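/- Let N ≥ 2 and M ≥ N + 1 be integers, let Ω be a domain in ℂ^M, and let ρ : Ω → ℝ be a smooth function with L_ρ(x;v) ≥ 3|v|² for every x ∈ Ω and v ∈ ℂ^M. Let D ⊂ ℂ^N be a bounded strongly pseudoconvex domain with smooth boundary, let z₀ ∈ bD, and let K₁ ⊆ Ω be a compact set such that dρ(x) ≠ 0 for every x ∈ K₁. Then there exist constants ε₀ ∈ (0,1), γ₀ ∈ (0,1), C > 1 and a relatively open neighborhood U ⊆ bD of z₀ such that the following holds. For every map f : cl(D) → Ω that is smooth on cl(D) and holomorphic on D, every compact set K ⊂ D, every ε > 0, and every continuous function γ : bD → (0, γ₀], there is a map g : cl(D) → ℂ^M, smooth on cl(D) and holomorphic on D, such that: (i) f(z) + g(z) ∈ Ω for all z ∈ cl(D); (ii) C|g(z)|² + ε > ρ(f(z) + g(z)) − ρ(f(z)) > |g(z)|² − ε for all z ∈ cl(D); (iii) |g(z)| > ε₀·γ(z) for all z ∈ U with f(z) ∈ K₁; (iv) |g(z)| < ε₀⁻¹·γ(z) for all z ∈ bD; and (v) |g(z)| < ε for all z ∈ K. -/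

import Mathlib

open Set Metric Complex Bornology

noncomputable section

/-- The Levi form of a C² function `ρ` at `x` in direction `v`:
`L_ρ(x;v) = (1/4)(D²ρ(x)[v,v] + D²ρ(x)[iv,iv])`. -/
def leviForm {E : Type*} [NormedAddCommGroup E] [NormedSpace ℂ E]
    (ρ : E → ℝ) (x v : E) : ℝ :=
  (1 / 4) * (iteratedFDeriv ℝ 2 ρ x ![v, v] +
    iteratedFDeriv ℝ 2 ρ x ![Complex.I • v, Complex.I • v])

/-- The Levi form of `ρ` at `x` has at least `r` positive eigenvalues: there is an
`r`-dimensional complex subspace on which it is positive on nonzero vectors. -/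
def LeviPosEigenAtLeast {E : Type*} [NormedAddCommGroup E] [NormedSpace ℂ E]
    (ρ : E → ℝ) (x : E) (r : ℕ) : Prop :=
  ∃ V : Submodule ℂ E, Module.finrank ℂ V = r ∧ ∀ v ∈ V, v ≠ 0 → 0 < leviForm ρ x v

/-- A bounded strongly pseudoconvex domain in `ℂ^d` with boundary of class `C^ℓ`. -/
def IsSPCDomain {d : ℕ} (D : Set (EuclideanSpace ℂ (Fin d))) (ℓ : ℕ∞) : Prop :=
  IsOpen D ∧ IsConnected D ∧ IsBounded D ∧
  ∃ (U : Set (EuclideanSpace ℂ (Fin d))) (rD : EuclideanSpace ℂ (Fin d) → ℝ),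
    IsOpen U ∧ frontier D ⊆ U ∧ ContDiffOn ℝ ℓ rD U ∧
    D ∩ U = {x ∈ U | rD x < 0} ∧
    (∀ x ∈ frontier D, fderiv ℝ rD x ≠ 0) ∧
    (∀ x ∈ frontier D, ∀ v : EuclideanSpace ℂ (Fin d), v ≠ 0 →
      fderiv ℝ rD x v = 0 → fderiv ℝ rD x (Complex.I • v) = 0 → 0 < leviForm rD x v)

set_option linter.unusedSectionVars false

section Packing

open MeasureTheory Module

variable {E : Type*} [NormedAddCommGroup E] [NormedSpace ℝ E] [FiniteDimensional ℝ E]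

/-- A `δ`-separated finite subset of a ball of radius `ρ` has at most `(1 + 2ρ/δ)^dim` points. -/
theorem card_le_of_separated_of_subset_closedBall (s : Finset E) {c : E} {ρ δ : ℝ} (hρ : 0 ≤ ρ)
    (hδ : 0 < δ) (hs : ∀ x ∈ s, dist x c ≤ ρ)
    (h : ∀ x ∈ s, ∀ y ∈ s, x ≠ y → δ ≤ dist x y) :
    (s.card : ℝ) ≤ (1 + 2 * ρ / δ) ^ finrank ℝ E := by
  borelize E
  let μ : Measure E := Measure.addHaar
  have hδ2 : 0 < δ / 2 := by positivity
  have hR : 0 < ρ + δ / 2 := by positivity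
  have D : Set.Pairwise (s : Set E) (Function.onFun Disjoint fun x => ball (x : E) (δ / 2)) := by
    rintro x hx y hy hxy
    apply ball_disjoint_ball
    have := h x hx y hy hxy
    linarith
  have A_subset : (⋃ x ∈ s, ball (x : E) (δ / 2)) ⊆ ball c (ρ + δ / 2) := by
    refine iUnion₂_subset fun x hx => ball_subset_ball' ?_
    have := hs x hx
    linarith
  have I : (s.card : ENNReal) * ENNReal.ofReal ((δ / 2) ^ finrank ℝ E) * μ (ball 0 1) ≤
      ENNReal.ofReal ((ρ + δ / 2) ^ finrank ℝ E) * μ (ball 0 1) :=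
    calc
      _ = μ (⋃ x ∈ s, ball (x : E) (δ / 2)) := by
        rw [measure_biUnion_finset D fun c _ => measurableSet_ball]
        simp only [μ.addHaar_ball_of_pos _ hδ2]
        simp only [Finset.sum_const, nsmul_eq_mul, mul_assoc]
      _ ≤ μ (ball c (ρ + δ / 2)) := measure_mono A_subset
      _ = _ := by simp only [μ.addHaar_ball_of_pos _ hR]
  have J := (ENNReal.mul_le_mul_iff_left (measure_ball_pos μ _ zero_lt_one).ne'
    measure_ball_lt_top.ne).1 I
  have K := ENNReal.toReal_le_of_le_ofReal (pow_nonneg hR.le _) J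
  rw [ENNReal.toReal_mul, ENNReal.toReal_natCast,
    ENNReal.toReal_ofReal (pow_nonneg hδ2.le _)] at K
  have : (1 + 2 * ρ / δ) = (ρ + δ / 2) / (δ / 2) := by field_simp; ring
  rw [this, div_pow, le_div_iff₀ (by positivity)]
  exact K

/-- A finite `δ`-net of the unit ball has at least `δ^(-dim)` points. -/
theorem one_le_card_mul_pow_of_cover (s : Finset E) {δ : ℝ} (hδ : 0 < δ)
    (h : ∀ x : E, ‖x‖ ≤ 1 → ∃ y ∈ s, dist x y < δ) :
    1 ≤ (s.card : ℝ) * δ ^ finrank ℝ E := by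
  borelize E
  let μ : Measure E := Measure.addHaar
  have hsub : ball (0 : E) 1 ⊆ ⋃ y ∈ s, ball y δ := by
    intro x hx
    obtain ⟨y, hy, hxy⟩ := h x (by simpa using (mem_ball_zero_iff.1 hx).le)
    exact mem_biUnion hy hxy
  have I : 1 * μ (ball 0 1) ≤
      (s.card : ENNReal) * ENNReal.ofReal (δ ^ finrank ℝ E) * μ (ball 0 1) :=
    calc
      1 * μ (ball 0 1) = μ (ball 0 1) := one_mul _
      _ ≤ μ (⋃ y ∈ s, ball y δ) := measure_mono hsub
      _ ≤ ∑ y ∈ s, μ (ball y δ) := measure_biUnion_finset_le _ _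
      _ = _ := by
        simp only [μ.addHaar_ball_of_pos _ hδ, Finset.sum_const, nsmul_eq_mul, mul_assoc]
  have J := (ENNReal.mul_le_mul_iff_left (measure_ball_pos μ _ zero_lt_one).ne'
    measure_ball_lt_top.ne).1 I
  have K := ENNReal.toReal_mono (ENNReal.mul_ne_top (by simp) (by simp)) J
  rwa [ENNReal.toReal_mul, ENNReal.toReal_natCast, ENNReal.toReal_one,
    ENNReal.toReal_ofReal (pow_nonneg hδ.le _)] at K

/-- Every bounded set has a finite `δ`-separated `δ`-net. -/
theorem exists_finset_separated_cover {X : Set E} (hX : IsBounded X) {δ : ℝ} (hδ : 0 < δ) :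
    ∃ s : Finset E, (↑s ⊆ X) ∧ (∀ x ∈ s, ∀ y ∈ s, x ≠ y → δ ≤ dist x y) ∧
      ∀ x ∈ X, ∃ y ∈ s, dist x y < δ := by
  classical
  obtain ⟨ρ, hρ0, hρ⟩ := hX.exists_pos_norm_le
  let P : ℕ → Prop := fun n => ∃ s : Finset E, s.card = n ∧ (↑s ⊆ X) ∧
    (∀ x ∈ s, ∀ y ∈ s, x ≠ y → δ ≤ dist x y)
  obtain ⟨b, hb⟩ := exists_nat_ge ((1 + 2 * ρ / δ) ^ finrank ℝ E)
  have hbd : ∀ n, P n → n ≤ b := by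
    rintro n ⟨s, rfl, hsX, hs⟩
    have := card_le_of_separated_of_subset_closedBall s (c := 0) hρ0.le hδ
      (fun x hx => by simpa using hρ x (hsX hx)) hs
    exact_mod_cast this.trans hb
  have h0 : P 0 := ⟨∅, by simp⟩
  obtain ⟨s, hcard, hsX, hs⟩ : P (Nat.findGreatest P b) :=
    Nat.findGreatest_spec (hbd 0 h0) h0
  refine ⟨s, hsX, hs, fun x hx => ?_⟩
  by_contra! hcon
  have hxs : x ∉ s := fun hxs => by simpa using (hcon x hxs).trans_lt' hδ
  have hP : P (Nat.findGreatest P b + 1) := by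
    refine ⟨insert x s, by rw [Finset.card_insert_of_notMem hxs, hcard], ?_, ?_⟩
    · rw [Finset.coe_insert]
      exact insert_subset hx hsX
    · intro y hy z hz hyz
      rw [Finset.mem_insert] at hy hz
      rcases hy with rfl | hy <;> rcases hz with rfl | hz
      · exact absurd rfl hyz
      · exact hcon z hz
      · rw [dist_comm]; exact hcon y hy
      · exact hs y hy z hz hyz
  have := Nat.le_findGreatest (hbd _ hP) hP
  omega

/-- Gaussian sums over separated sets are uniformly bounded. -/
theorem exists_gaussian_sum_le (E : Type*) [NormedAddCommGroup E] [NormedSpace ℝ E]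
    [FiniteDimensional ℝ E] {c : ℝ} (hc : 0 < c) :
    ∃ C : ℝ, 0 < C ∧ ∀ (t : ℝ), 0 < t → ∀ (S : Finset E) (z : E),
      (∀ x ∈ S, ∀ y ∈ S, x ≠ y → 1 ≤ t * dist x y) →
      ∑ x ∈ S, Real.exp (-c * (t * dist z x) ^ 2) ≤ C := by
  classical
  set d := finrank ℝ E
  let a : ℕ → ℝ := fun m => (2 * m + 3) ^ d * Real.exp (-c * m ^ 2)
  have ha0 : ∀ m, 0 ≤ a m := fun m => by positivity
  have hsum : Summable a := by
    have h1 := (Real.summable_pow_mul_exp_neg_nat_mul d hc).mul_left (5 ^ d)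
    have h2 := (Real.summable_pow_mul_exp_neg_nat_mul 0 hc).mul_left (5 ^ d)
    refine Summable.of_nonneg_of_le ha0 (fun m => ?_) (h1.add h2)
    have e1 : Real.exp (-c * (m : ℝ) ^ 2) ≤ Real.exp (-c * m) := by
      apply Real.exp_le_exp.2
      have : (m : ℝ) ≤ m ^ 2 := by exact_mod_cast Nat.le_self_pow two_ne_zero m
      nlinarith
    have e2 : ((2 : ℝ) * m + 3) ^ d ≤ 5 ^ d * m ^ d + 5 ^ d * 1 := by
      rcases Nat.eq_zero_or_pos m with rfl | hm
      · have : (3 : ℝ) ^ d ≤ 5 ^ d := by gcongr; norm_num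
        have h0 : (0 : ℝ) ≤ 5 ^ d * ((0 : ℕ) : ℝ) ^ d := by positivity
        simp only [Nat.cast_zero, mul_zero, zero_add, mul_one] at *
        linarith
      · have : ((1 : ℕ) : ℝ) ≤ m := by exact_mod_cast hm
        have h5 : ((2 : ℝ) * m + 3) ^ d ≤ (5 * m) ^ d := by
          gcongr; push_cast at this; linarith
        rw [mul_pow] at h5
        have : (0 : ℝ) ≤ 5 ^ d * 1 := by positivity
        linarith
    calc a m ≤ (5 ^ d * m ^ d + 5 ^ d * 1) * Real.exp (-c * m) := by
          simp only [a]; gcongr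
      _ = _ := by simp only [pow_zero]; ring
  refine ⟨∑' m, a m + 1, by have : (0:ℝ) ≤ ∑' m, a m := tsum_nonneg ha0; linarith, fun t ht S z hS => ?_⟩
  let m : E → ℕ := fun x => ⌊t * dist z x⌋₊
  have hm : ∀ x, (m x : ℝ) ≤ t * dist z x := fun x => Nat.floor_le (by positivity)
  calc ∑ x ∈ S, Real.exp (-c * (t * dist z x) ^ 2)
      ≤ ∑ x ∈ S, Real.exp (-c * (m x : ℝ) ^ 2) := by
        refine Finset.sum_le_sum fun x _ => Real.exp_le_exp.2 ?_
        have : (m x : ℝ) ^ 2 ≤ (t * dist z x) ^ 2 := by gcongr; exact hm x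
        nlinarith
    _ = ∑ k ∈ S.image m, ∑ x ∈ S with m x = k, Real.exp (-c * (m x : ℝ) ^ 2) :=
        (Finset.sum_fiberwise_of_maps_to (fun x hx => Finset.mem_image_of_mem m hx) _).symm
    _ ≤ ∑ k ∈ S.image m, a k := by
        refine Finset.sum_le_sum fun k _ => ?_
        have e : ∑ x ∈ S with m x = k, Real.exp (-c * (m x : ℝ) ^ 2) =
            ((S.filter fun x => m x = k).card : ℝ) * Real.exp (-c * (k : ℝ) ^ 2) := by
          rw [Finset.sum_congr rfl (g := fun _ => Real.exp (-c * (k : ℝ) ^ 2)), Finset.sum_const,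
            nsmul_eq_mul]
          intro x hx
          rw [(Finset.mem_filter.1 hx).2]
        rw [e]
        simp only [a]
        gcongr
        have hcard := card_le_of_separated_of_subset_closedBall (S.filter fun x => m x = k)
          (c := z) (ρ := (k + 1) / t) (δ := 1 / t) (by positivity) (by positivity)
          (fun x hx => by
            rw [dist_comm, le_div_iff₀ ht, mul_comm]
            have := (Finset.mem_filter.1 hx).2
            have h2 := (Nat.lt_floor_add_one (t * dist z x)).le
            rw [← this]; exact h2)
          (fun x hx y hy hxy => by
            rw [div_le_iff₀ ht, mul_comm]
            exact hS x (Finset.mem_filter.1 hx).1 y (Finset.mem_filter.1 hy).1 hxy)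
        refine hcard.trans (le_of_eq ?_)
        congr 1
        field_simp
        ring
    _ ≤ ∑' k, a k := hsum.sum_le_tsum _ (fun k _ => ha0 k)
    _ ≤ _ := by linarith

end Packing

section LocalLemma

/-- A counting form of the Lovász local lemma: if changing coordinate `i` does not affect the
events outside a set `nbr i` of at most `d` indices, and every event `Bad i` has conditional
density at most `1 / (4 (d + 1))` in the coordinate `i`, then some point avoids all the events. -/
theorem exists_forall_not_bad {I Q : Type*} [Fintype I] [DecidableEq I] [Fintype Q] [Nonempty Q]
    (Bad : I → (I → Q) → Prop) (nbr : I → Finset I) (d : ℕ)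
    (hcard : ∀ i, (nbr i).card ≤ d)
    (hinv : ∀ i j, j ∉ nbr i → ∀ p q, Bad j (Function.update p i q) ↔ Bad j p)
    (hdens : ∀ i p, 4 * (d + 1) * Nat.card {q // Bad i (Function.update p i q)} ≤
      Fintype.card Q) :
    ∃ p, ∀ i, ¬ Bad i p := by
  classical
  let G : Finset I → Finset (I → Q) := fun S => Finset.univ.filter fun p => ∀ i ∈ S, ¬ Bad i p
  have hGmono : ∀ {S T : Finset I}, S ⊆ T → G T ⊆ G S := fun {S T} h p hp => by
    simp only [G, Finset.mem_filter, Finset.mem_univ, true_and] at hp ⊢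
    exact fun i hi => hp i (h hi)
  -- density of one event inside events independent of its coordinate
  have hfib : ∀ (i : I) (S : Finset I), (∀ j ∈ S, j ∉ nbr i) →
      4 * (d + 1) * ((G S).filter fun p => Bad i p).card ≤ (G S).card := by
    intro i S hS
    have hGinv : ∀ p q, Function.update p i q ∈ G S ↔ p ∈ G S := by
      intro p q
      simp only [G, Finset.mem_filter, Finset.mem_univ, true_and]
      exact forall₂_congr fun j hj => not_congr (hinv i j (hS j hj) p q)
    -- double counting over pairs `(p, q)`
    let A : Finset ((I → Q) × Q) :=
      (G S ×ˢ Finset.univ).filter fun x => Bad i (Function.update x.1 i x.2)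
    have hA1 : A.card = ∑ p ∈ G S, Nat.card {q // Bad i (Function.update p i q)} := by
      simp only [A, Finset.card_filter, Finset.sum_product]
      refine Finset.sum_congr rfl fun p _ => ?_
      rw [Nat.card_eq_fintype_card, Fintype.card_subtype, Finset.card_filter]
    have hA2 : A.card = Fintype.card Q * ((G S).filter fun p => Bad i p).card := by
      have : A.card = (((G S).filter fun p => Bad i p) ×ˢ (Finset.univ : Finset Q)).card := by
        refine Finset.card_bij' (fun x _ => (Function.update x.1 i x.2, x.1 i))
          (fun x _ => (Function.update x.1 i x.2, x.1 i)) ?_ ?_ ?_ ?_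
        · rintro ⟨p, q⟩ hx
          simp only [A, Finset.mem_filter, Finset.mem_product, Finset.mem_univ, and_true] at hx ⊢
          exact ⟨(hGinv p q).2 hx.1, hx.2⟩
        · rintro ⟨p, q⟩ hx
          simp only [A, Finset.mem_filter, Finset.mem_product, Finset.mem_univ, and_true] at hx ⊢
          exact ⟨(hGinv p q).2 hx.1, by simpa using hx.2⟩
        · rintro ⟨p, q⟩ _; simp
        · rintro ⟨p, q⟩ _; simp
      rw [this, Finset.card_product, Finset.card_univ, mul_comm]
    have hQ : 0 < Fintype.card Q := Fintype.card_pos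
    refine Nat.le_of_mul_le_mul_left ?_ hQ
    calc Fintype.card Q * (4 * (d + 1) * ((G S).filter fun p => Bad i p).card)
        = 4 * (d + 1) * A.card := by rw [hA2]; ring
      _ = ∑ p ∈ G S, 4 * (d + 1) * Nat.card {q // Bad i (Function.update p i q)} := by
        rw [hA1, Finset.mul_sum]
      _ ≤ ∑ p ∈ G S, Fintype.card Q := Finset.sum_le_sum fun p _ => hdens i p
      _ = Fintype.card Q * (G S).card := by rw [Finset.sum_const, smul_eq_mul, mul_comm]
  set x : ℝ := 1 / (2 * (d + 1)) with hx
  have hx0 : 0 < x := by positivity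
  have hx1 : x ≤ 1 / 2 := by
    rw [hx]; apply one_div_le_one_div_of_le <;> norm_num
  have hpow : 1 / 2 ≤ (1 - x) ^ d := by
    have h1 := one_add_mul_le_pow (a := -x) (by linarith) d
    have h2 : (d : ℝ) * x ≤ 1 / 2 := by
      rw [hx]
      rw [mul_one_div, div_le_div_iff₀ (by positivity) (by norm_num)]
      linarith
    rw [← sub_eq_add_neg] at h1
    linarith
  have key : ∀ n : ℕ, ∀ S : Finset I, S.card = n → ∀ i, i ∉ S →
      (1 - x) * (G S).card ≤ (G (insert i S)).card := by
    intro n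
    induction n using Nat.strong_induction_on with
    | _ n ih =>
    intro S hSn i hi
    -- remove the neighbours of `i`
    let S₀ := S.filter fun j => j ∉ nbr i
    have hrem : ∀ T : Finset I, T ⊆ S → S₀ ⊆ T →
        (1 - x) ^ (T \ S₀).card * (G S₀).card ≤ (G T).card := by
      intro T
      induction T using Finset.strongInduction with
      | H T ihT =>
      intro hTS hST
      rcases Finset.eq_empty_or_nonempty (T \ S₀) with he | ⟨j, hj⟩
      · have : T = S₀ := Finset.Subset.antisymm (Finset.sdiff_eq_empty_iff_subset.1 he) hST
        rw [this]; simp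
      · have hjT := (Finset.mem_sdiff.1 hj).1
        have hss : T.erase j ⊂ T := Finset.erase_ssubset hjT
        have h1 := ihT (T.erase j) hss (hss.subset.trans hTS)
          (fun k hk => Finset.mem_erase.2 ⟨fun h => (Finset.mem_sdiff.1 hj).2 (h ▸ hk), hST hk⟩)
        have h2 := ih (T.erase j).card
          (hSn ▸ (Finset.card_lt_card hss).trans_le (Finset.card_le_card hTS)) (T.erase j) rfl j
          (Finset.notMem_erase j T)
        rw [Finset.insert_erase hjT] at h2
        have h3 : (T \ S₀).card = (T.erase j \ S₀).card + 1 := by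
          rw [Finset.erase_sdiff_comm, Finset.card_erase_add_one hj]
        rw [h3, pow_succ]
        calc _ = (1 - x) * ((1 - x) ^ (T.erase j \ S₀).card * (G S₀).card) := by ring
          _ ≤ (1 - x) * (G (T.erase j)).card := by
            apply mul_le_mul_of_nonneg_left h1; linarith
          _ ≤ _ := h2
    have h1 := hrem S subset_rfl (Finset.filter_subset _ _)
    have hcd : (S \ S₀).card ≤ d := by
      refine (Finset.card_le_card fun j hj => ?_).trans (hcard i)
      simp only [S₀, Finset.mem_sdiff, Finset.mem_filter, not_and, not_not] at hj
      exact hj.2 hj.1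
    have h2 : (1 / 2 : ℝ) * (G S₀).card ≤ (G S).card := by
      refine le_trans ?_ h1
      gcongr
      exact hpow.trans (pow_le_pow_of_le_one (by linarith) (by linarith) hcd)
    have h3 : ((4 * (d + 1) * ((G S₀).filter fun p => Bad i p).card : ℕ) : ℝ) ≤ (G S₀).card := by
      exact_mod_cast hfib i S₀ fun j hj => (Finset.mem_filter.1 hj).2
    have h4 : (((G S).filter fun p => Bad i p).card : ℝ) ≤ ((G S₀).filter fun p => Bad i p).card := by
      exact_mod_cast Finset.card_le_card
        (Finset.filter_subset_filter _ (hGmono (Finset.filter_subset _ _)))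
    have h5 : (G S).card = (G (insert i S)).card + ((G S).filter fun p => Bad i p).card := by
      rw [add_comm, ← Finset.card_filter_add_card_filter_not (s := G S) (fun p => Bad i p)]
      congr 2
      ext p
      simp only [G, Finset.mem_filter, Finset.mem_univ, true_and, Finset.mem_insert, forall_eq_or_imp]
      tauto
    have h5' : ((G S).card : ℝ) = (G (insert i S)).card + ((G S).filter fun p => Bad i p).card := by
      exact_mod_cast h5
    push_cast at h3
    have h6 : (((G S).filter fun p => Bad i p).card : ℝ) ≤ x * (G S).card := by
      rw [hx, one_div, ← div_eq_inv_mul, le_div_iff₀ (by positivity)]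
      nlinarith [h2, h3, h4]
    linarith
  have hpos : ∀ S : Finset I, 0 < (G S).card := by
    intro S
    induction S using Finset.induction_on with
    | empty => exact Finset.card_pos.2 ⟨fun _ => Classical.arbitrary Q, by simp [G]⟩
    | insert i S hi ih =>
      have := key _ S rfl i hi
      have h2 : (0 : ℝ) < (1 - x) * (G S).card :=
        mul_pos (by linarith) (by exact_mod_cast ih)
      exact_mod_cast h2.trans_le this
  obtain ⟨p, hp⟩ := Finset.card_pos.1 (hpos Finset.univ)
  exact ⟨p, fun i => (Finset.mem_filter.1 hp).2 i (Finset.mem_univ i)⟩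

end LocalLemma

section Wirtinger

open scoped ContDiff ComplexConjugate

variable {E : Type*} [NormedAddCommGroup E] [NormedSpace ℂ E]

/-- The antiholomorphic directional derivative. -/
def dbar (v : E) (f : E → ℂ) (z : E) : ℂ := (fderiv ℝ f z v + I * fderiv ℝ f z (I • v)) / 2

/-- The holomorphic directional derivative. -/
def del (v : E) (f : E → ℂ) (z : E) : ℂ := (fderiv ℝ f z v - I * fderiv ℝ f z (I • v)) / 2

theorem fderiv_conj_apply (f : E → ℂ) (z v : E) :
    fderiv ℝ (fun z => conj (f z)) z v = conj (fderiv ℝ f z v) := by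
  have := (conjCLE).comp_fderiv (f := f) (x := z)
  have h2 : (fun z => conj (f z)) = conjCLE ∘ f := by ext; simp
  rw [h2, this]; simp

theorem conj_dbar (v : E) (f : E → ℂ) (z : E) :
    conj (dbar v f z) = del v (fun z => conj (f z)) z := by
  simp only [dbar, del, fderiv_conj_apply]
  simp [sub_eq_add_neg, map_ofNat (starRingEnd ℂ) 2]

theorem conj_del (v : E) (f : E → ℂ) (z : E) :
    conj (del v f z) = dbar v (fun z => conj (f z)) z := by
  simp only [dbar, del, fderiv_conj_apply]
  simp [sub_eq_add_neg, map_ofNat (starRingEnd ℂ) 2]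

theorem dbar_mul {f g : E → ℂ} {z : E} (v : E) (hf : DifferentiableAt ℝ f z)
    (hg : DifferentiableAt ℝ g z) :
    dbar v (fun z => f z * g z) z = dbar v f z * g z + f z * dbar v g z := by
  simp only [dbar, fderiv_fun_mul hf hg]
  simp; ring

theorem del_mul {f g : E → ℂ} {z : E} (v : E) (hf : DifferentiableAt ℝ f z)
    (hg : DifferentiableAt ℝ g z) :
    del v (fun z => f z * g z) z = del v f z * g z + f z * del v g z := by
  simp only [del, fderiv_fun_mul hf hg]
  simp; ring

theorem dbar_sub {f g : E → ℂ} {z : E} (v : E) (hf : DifferentiableAt ℝ f z)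
    (hg : DifferentiableAt ℝ g z) :
    dbar v (fun z => f z - g z) z = dbar v f z - dbar v g z := by
  simp only [dbar, fderiv_fun_sub hf hg]
  simp; ring

theorem ContDiff.fderiv_apply_const {f : E → ℂ} (hf : ContDiff ℝ ∞ f) (v : E) :
    ContDiff ℝ ∞ (fun z => fderiv ℝ f z v) :=
  (hf.fderiv_right (m := ∞) (by simp)).clm_apply contDiff_const

theorem ContDiff.dbar {f : E → ℂ} (hf : ContDiff ℝ ∞ f) (v : E) : ContDiff ℝ ∞ (dbar v f) := by
  have h1 := hf.fderiv_apply_const v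
  have h2 := hf.fderiv_apply_const (I • v)
  exact (h1.add (contDiff_const.mul h2)).div_const 2

theorem ContDiff.del {f : E → ℂ} (hf : ContDiff ℝ ∞ f) (v : E) : ContDiff ℝ ∞ (del v f) := by
  have h1 := hf.fderiv_apply_const v
  have h2 := hf.fderiv_apply_const (I • v)
  exact (h1.sub (contDiff_const.mul h2)).div_const 2

theorem tsupport_dbar_subset (v : E) (f : E → ℂ) : tsupport (dbar v f) ⊆ tsupport f := by
  refine (closure_mono fun z hz => ?_).trans
    ((tsupport_fderiv_subset ℝ (f := f)))
  contrapose! hz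
  simp only [Function.mem_support, not_not] at hz ⊢
  simp [dbar, hz]

theorem tsupport_del_subset (v : E) (f : E → ℂ) : tsupport (del v f) ⊆ tsupport f := by
  refine (closure_mono fun z hz => ?_).trans
    ((tsupport_fderiv_subset ℝ (f := f)))
  contrapose! hz
  simp only [Function.mem_support, not_not] at hz ⊢
  simp [del, hz]

theorem HasCompactSupport.dbar {f : E → ℂ} (hf : HasCompactSupport f) (v : E) :
    HasCompactSupport (dbar v f) :=
  hf.of_isClosed_subset (isClosed_tsupport _) (tsupport_dbar_subset v f)

theorem HasCompactSupport.del {f : E → ℂ} (hf : HasCompactSupport f) (v : E) :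
    HasCompactSupport (del v f) :=
  hf.of_isClosed_subset (isClosed_tsupport _) (tsupport_del_subset v f)

theorem fderiv_fderiv_apply {F : Type*} [NormedAddCommGroup F] [NormedSpace ℝ F]
    {f : E → F} {z : E} (hf : ContDiffAt ℝ 2 f z) (v w : E) :
    fderiv ℝ (fun z => fderiv ℝ f z v) z w = fderiv ℝ (fderiv ℝ f) z w v := by
  have h : DifferentiableAt ℝ (fderiv ℝ f) z :=
    (hf.fderiv_right (m := 1) (by norm_num)).differentiableAt (by norm_num)
  rw [fderiv_clm_apply h (by fun_prop)]
  simp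

theorem differentiableAt_fderiv_apply {F : Type*} [NormedAddCommGroup F] [NormedSpace ℝ F]
    {f : E → F} {z : E} (hf : ContDiffAt ℝ 2 f z) (v : E) :
    DifferentiableAt ℝ (fun z => fderiv ℝ f z v) z := by
  have h : DifferentiableAt ℝ (fderiv ℝ f) z :=
    (hf.fderiv_right (m := 1) (by norm_num)).differentiableAt (by norm_num)
  fun_prop

theorem fderiv_dbar_apply {f : E → ℂ} {z : E} (hf : ContDiffAt ℝ 2 f z) (v w : E) :
    fderiv ℝ (dbar v f) z w = (fderiv ℝ (fderiv ℝ f) z w v +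
      I * fderiv ℝ (fderiv ℝ f) z w (I • v)) / 2 := by
  have h1 := differentiableAt_fderiv_apply hf v
  have h2 := differentiableAt_fderiv_apply hf (I • v)
  have : dbar v f = fun z => (2⁻¹ : ℂ) • (fderiv ℝ f z v + I • fderiv ℝ f z (I • v)) := by
    ext z; simp [dbar]; ring
  rw [this, fderiv_fun_const_smul (by fun_prop), fderiv_fun_add h1 (by fun_prop),
    fderiv_fun_const_smul h2]
  simp [fderiv_fderiv_apply hf]
  ring

theorem fderiv_del_apply {f : E → ℂ} {z : E} (hf : ContDiffAt ℝ 2 f z) (v w : E) :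
    fderiv ℝ (del v f) z w = (fderiv ℝ (fderiv ℝ f) z w v -
      I * fderiv ℝ (fderiv ℝ f) z w (I • v)) / 2 := by
  have h1 := differentiableAt_fderiv_apply hf v
  have h2 := differentiableAt_fderiv_apply hf (I • v)
  have : del v f = fun z => (2⁻¹ : ℂ) • (fderiv ℝ f z v - I • fderiv ℝ f z (I • v)) := by
    ext z; simp [del]; ring
  rw [this, fderiv_fun_const_smul (by fun_prop), fderiv_fun_sub h1 (by fun_prop),
    fderiv_fun_const_smul h2]
  simp [fderiv_fderiv_apply hf]
  ring

theorem isSymmSndFDerivAt_of_contDiffAt {F : Type*} [NormedAddCommGroup F] [NormedSpace ℝ F]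
    {f : E → F} {z : E} (hf : ContDiffAt ℝ 2 f z) (v w : E) :
    fderiv ℝ (fderiv ℝ f) z v w = fderiv ℝ (fderiv ℝ f) z w v :=
  (hf.isSymmSndFDerivAt (by simp)) v w

theorem dbar_dbar_comm {f : E → ℂ} {z : E} (hf : ContDiffAt ℝ 2 f z) (v w : E) :
    dbar v (dbar w f) z = dbar w (dbar v f) z := by
  rw [dbar, dbar, fderiv_dbar_apply hf, fderiv_dbar_apply hf, fderiv_dbar_apply hf,
    fderiv_dbar_apply hf, isSymmSndFDerivAt_of_contDiffAt hf w v,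
    isSymmSndFDerivAt_of_contDiffAt hf w (I • v), isSymmSndFDerivAt_of_contDiffAt hf (I • w) v,
    isSymmSndFDerivAt_of_contDiffAt hf (I • w) (I • v)]
  ring

theorem dbar_del_comm {f : E → ℂ} {z : E} (hf : ContDiffAt ℝ 2 f z) (v w : E) :
    dbar v (del w f) z = del w (dbar v f) z := by
  rw [dbar, del, fderiv_dbar_apply hf, fderiv_dbar_apply hf, fderiv_del_apply hf,
    fderiv_del_apply hf, isSymmSndFDerivAt_of_contDiffAt hf w v,
    isSymmSndFDerivAt_of_contDiffAt hf w (I • v), isSymmSndFDerivAt_of_contDiffAt hf (I • w) v,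
    isSymmSndFDerivAt_of_contDiffAt hf (I • w) (I • v)]
  ring

/-- A real-differentiable function all of whose antiholomorphic derivatives vanish is complex
differentiable. -/
theorem differentiableAt_complex_of_dbar_eq_zero {f : E → ℂ} {z : E}
    (hf : DifferentiableAt ℝ f z) (h : ∀ v, dbar v f z = 0) : DifferentiableAt ℂ f z := by
  rw [differentiableAt_iff_restrictScalars ℝ hf]
  have hI : ∀ v, fderiv ℝ f z (I • v) = I * fderiv ℝ f z v := fun v => by
    have := h v
    simp only [dbar] at this
    linear_combination (-2 * I) * this + (fderiv ℝ f z (I • v)) * I_mul_I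
  refine ⟨{ toFun := fderiv ℝ f z, map_add' := map_add _, map_smul' := fun c v => ?_,
            cont := (fderiv ℝ f z).continuous }, by ext; rfl⟩
  have : c • v = c.re • v + c.im • (I • v) := by
    conv_lhs => rw [← re_add_im c]
    rw [add_smul, mul_smul]; rfl
  rw [this, map_add, map_smul, map_smul, hI]
  simp only [real_smul, RingHom.id_apply, smul_eq_mul]
  conv_rhs => rw [← re_add_im c]
  ring

theorem dbar_eq_zero_of_differentiableAt {f : E → ℂ} {z : E}
    (hf : DifferentiableAt ℂ f z) (v : E) : dbar v f z = 0 := by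
  rw [dbar, hf.fderiv_restrictScalars ℝ]
  simp only [ContinuousLinearMap.coe_restrictScalars', map_smul, smul_eq_mul]
  linear_combination (fderiv ℂ f z v) / 2 * I_mul_I

theorem dbar_smul (c : ℂ) (v : E) (f : E → ℂ) (z : E) : dbar (c • v) f z = conj c * dbar v f z := by
  have : c • v = c.re • v + c.im • (I • v) := by
    conv_lhs => rw [← re_add_im c]
    rw [add_smul, mul_smul]; rfl
  have h2 : I • c • v = c.re • (I • v) - c.im • v := by
    rw [this, smul_add, smul_comm I c.re, smul_comm I c.im, ← mul_smul I I, I_mul_I]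
    simp [sub_eq_add_neg]
  rw [dbar, h2, this, dbar, map_add, map_sub, (fderiv ℝ f z).map_smul, (fderiv ℝ f z).map_smul,
    (fderiv ℝ f z).map_smul, (fderiv ℝ f z).map_smul]
  have hc : conj c = c.re - c.im * I := by
    apply Complex.ext <;> simp
  simp only [real_smul, hc]
  linear_combination ((c.im : ℂ) * fderiv ℝ f z (I • v)) / 2 * I_mul_I

theorem dbar_add_left (v w : E) (f : E → ℂ) (z : E) :
    dbar (v + w) f z = dbar v f z + dbar w f z := by
  simp only [dbar, smul_add, map_add]; ring

/-- The Levi form in coordinates. -/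
theorem sum_del_dbar_eq_leviForm {ι : Type*} [Fintype ι] (e : ι → E) (c : ι → ℂ) {φ : E → ℝ} {x : E}
    (hφ : ContDiffAt ℝ 2 φ x) :
    ∑ j, ∑ k, c j * conj (c k) * del (e j) (dbar (e k) (fun z => (φ z : ℂ))) x =
      leviForm φ x (∑ j, c j • e j) := by
  have hφc : ContDiffAt ℝ 2 (fun z => (φ z : ℂ)) x := ofRealCLM.contDiff.contDiffAt.comp x hφ
  set B := fderiv ℝ (fderiv ℝ φ) x with hB
  have hsymm : ∀ v w, B v w = B w v := isSymmSndFDerivAt_of_contDiffAt hφ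
  have hBc : ∀ v w, fderiv ℝ (fderiv ℝ (fun z => (φ z : ℂ))) x v w = (B v w : ℂ) := by
    intro v w
    have h1 : (fun z => fderiv ℝ (fun z => (φ z : ℂ)) z w) =ᶠ[nhds x]
        ofRealCLM ∘ (fun z => fderiv ℝ φ z w) := by
      filter_upwards [hφ.eventually (by simp)] with z hz
      have : HasFDerivAt (fun z => (φ z : ℂ)) (ofRealCLM.comp (fderiv ℝ φ z)) z :=
        ofRealCLM.hasFDerivAt.comp z (hz.differentiableAt (by simp)).hasFDerivAt
      rw [this.fderiv]; rfl
    rw [← fderiv_fderiv_apply hφc, h1.fderiv_eq,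
      (ofRealCLM.hasFDerivAt.comp x (differentiableAt_fderiv_apply hφ w).hasFDerivAt).fderiv]
    simp [fderiv_fderiv_apply hφ, hB]
  let H : E → E → ℂ := fun v w =>
    (B v w + I * B v (I • w) - I * (B (I • v) w + I * B (I • v) (I • w))) / 4
  have hH : ∀ v w, del v (dbar w (fun z => (φ z : ℂ))) x = H v w := fun v w => by
    rw [del, fderiv_dbar_apply hφc, fderiv_dbar_apply hφc]
    simp only [hBc, H]; ring
  have hd : ∀ (a : ℂ) (v : E), a • v = a.re • v + a.im • (I • v) := fun a v => by
    conv_lhs => rw [← re_add_im a]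
    rw [add_smul, mul_smul]; rfl
  have hd2 : ∀ (a : ℂ) (v : E), I • a • v = a.re • (I • v) - a.im • v := fun a v => by
    rw [hd a v, smul_add, smul_comm I a.re, smul_comm I a.im, ← mul_smul I I, I_mul_I]
    simp [sub_eq_add_neg]
  have hl1 : ∀ a v w, H (a • v) w = a * H v w := fun a v w => by
    simp only [H]
    rw [hd2, hd]
    simp only [map_add, map_sub, map_smul, add_apply,
      sub_apply, smul_apply, smul_eq_mul]
    conv_rhs => rw [← re_add_im a]
    push_cast
    linear_combination (a.im * (B (I • v) w + I * B (I • v) (I • w)) / 4 : ℂ) * I_mul_I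
  have hl2 : ∀ v w w', H v (w + w') = H v w + H v w' := fun v w w' => by
    simp only [H, smul_add, map_add]; push_cast; ring
  have hl3 : ∀ v v' w, H (v + v') w = H v w + H v' w := fun v w w' => by
    simp only [H, smul_add, map_add, add_apply]; push_cast; ring
  have hherm : ∀ v w, H w v = conj (H v w) := fun v w => by
    simp only [H, map_div₀, map_sub, map_add, map_mul, conj_ofReal, conj_I, map_ofNat]
    rw [hsymm w v, hsymm w (I • v), hsymm (I • w) v, hsymm (I • w) (I • v)]
    ring
  have hs1 : ∀ (s : Finset ι) (w : E) (a : ι → ℂ), H (∑ j ∈ s, a j • e j) w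
      = ∑ j ∈ s, a j * H (e j) w := fun s w a => by
    classical
    induction s using Finset.induction_on with
    | empty => simp [H]
    | insert i s hi ih => rw [Finset.sum_insert hi, Finset.sum_insert hi, hl3, ih, hl1]
  have hs2 : ∀ v : E, H v (∑ j, c j • e j) = ∑ k, conj (c k) * H v (e k) := fun v => by
    rw [hherm, hs1, map_sum]
    refine Finset.sum_congr rfl fun k _ => ?_
    rw [map_mul, ← hherm]
  have : (leviForm φ x (∑ j, c j • e j) : ℂ) = H (∑ j, c j • e j) (∑ j, c j • e j) := by
    rw [leviForm, iteratedFDeriv_two_apply, iteratedFDeriv_two_apply]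
    simp only [H, ← hB, Matrix.cons_val_zero, Matrix.cons_val_one]
    rw [hsymm (I • _) (∑ j, c j • e j)]
    push_cast
    linear_combination (B (I • (∑ j, c j • e j)) (I • (∑ j, c j • e j)) / 4 : ℂ) * I_mul_I
  rw [this, hs1]
  refine Finset.sum_congr rfl fun j _ => ?_
  rw [hs2, Finset.mul_sum]
  refine Finset.sum_congr rfl fun k _ => ?_
  rw [hH]; ring

end Wirtinger

section BasicEstimate

open MeasureTheory
open scoped ContDiff ComplexConjugate

variable {E : Type*} [NormedAddCommGroup E] [NormedSpace ℂ E] [FiniteDimensional ℂ E]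
  [MeasurableSpace E] [BorelSpace E] {μ : Measure E} [μ.IsAddHaarMeasure]

theorem ContDiff.contDiffAt_two {V F : Type*} [NormedAddCommGroup V] [NormedSpace ℝ V]
    [NormedAddCommGroup F] [NormedSpace ℝ F] {f : V → F} (hf : ContDiff ℝ ∞ f) (x : V) :
    ContDiffAt ℝ 2 f x :=
  hf.contDiffAt.of_le (WithTop.coe_le_coe.2 le_top)

theorem integral_dbar_mul {f g : E → ℂ} (hf : ContDiff ℝ ∞ f) (hg : ContDiff ℝ ∞ g)
    (hfc : HasCompactSupport f) (v : E) :
    ∫ x, dbar v f x * g x ∂μ = - ∫ x, f x * dbar v g x ∂μ := by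
  have key : ∀ w : E, ∫ x, f x * fderiv ℝ g x w ∂μ = - ∫ x, fderiv ℝ f x w * g x ∂μ := fun w =>
    integral_mul_fderiv_eq_neg_fderiv_mul_of_integrable
      (((hf.fderiv_apply_const w).continuous.mul hg.continuous).integrable_of_hasCompactSupport
        ((hfc.fderiv_apply ℝ w).mul_right))
      ((hf.continuous.mul (hg.fderiv_apply_const w).continuous).integrable_of_hasCompactSupport
        hfc.mul_right)
      ((hf.continuous.mul hg.continuous).integrable_of_hasCompactSupport hfc.mul_right)
      (fun x _ => (hf.differentiable (by simp)).differentiableAt)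
      (fun x _ => (hg.differentiable (by simp)).differentiableAt)
  have i1 : ∀ w : E, Integrable (fun x => fderiv ℝ f x w * g x) μ := fun w =>
    ((hf.fderiv_apply_const w).continuous.mul hg.continuous).integrable_of_hasCompactSupport
        ((hfc.fderiv_apply ℝ w).mul_right)
  have i2 : ∀ w : E, Integrable (fun x => f x * fderiv ℝ g x w) μ := fun w =>
    (hf.continuous.mul (hg.fderiv_apply_const w).continuous).integrable_of_hasCompactSupport
        hfc.mul_right
  have e1 : ∀ x, dbar v f x * g x = (2⁻¹ : ℂ) * (fderiv ℝ f x v * g x) +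
      (I / 2) * (fderiv ℝ f x (I • v) * g x) := fun x => by simp only [dbar]; ring
  have e2 : ∀ x, f x * dbar v g x = (2⁻¹ : ℂ) * (f x * fderiv ℝ g x v) +
      (I / 2) * (f x * fderiv ℝ g x (I • v)) := fun x => by simp only [dbar]; ring
  simp_rw [e1, e2]
  rw [integral_add ((i1 v).const_mul _) ((i1 _).const_mul _),
    integral_add ((i2 v).const_mul _) ((i2 _).const_mul _), integral_const_mul, integral_const_mul,
    integral_const_mul, integral_const_mul, key, key]
  ring

theorem integral_del_mul {f g : E → ℂ} (hf : ContDiff ℝ ∞ f) (hg : ContDiff ℝ ∞ g)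
    (hfc : HasCompactSupport f) (v : E) :
    ∫ x, del v f x * g x ∂μ = - ∫ x, f x * del v g x ∂μ := by
  have hconj : ∀ {h : E → ℂ}, ContDiff ℝ ∞ h → ContDiff ℝ ∞ (fun x => conj (h x)) :=
    fun hh => conjCLE.contDiff.comp hh
  have h := integral_dbar_mul (μ := μ) (hconj hf) (hconj hg) (hfc.comp_left (map_zero conj)) v
  have h2 := congrArg conj h
  rw [map_neg, ← integral_conj, ← integral_conj] at h2
  simpa only [map_mul, conj_dbar, conj_conj] using h2

/-- Polarized Kohn--Morrey identity for a pair of test functions. -/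
theorem integral_kohn {φ : E → ℝ} (hφ : ContDiff ℝ ∞ φ) {f g : E → ℂ} (hf : ContDiff ℝ ∞ f)
    (hg : ContDiff ℝ ∞ g) (hfc : HasCompactSupport f) (v w : E) :
    ∫ x, ((del v f x - f x * del v (fun z => (φ z : ℂ)) x) *
        conj (del w g x - g x * del w (fun z => (φ z : ℂ)) x) * (Real.exp (-φ x) : ℂ) -
      dbar w f x * conj (dbar v g x) * (Real.exp (-φ x) : ℂ) -
      f x * conj (g x) * del v (dbar w (fun z => (φ z : ℂ))) x * (Real.exp (-φ x) : ℂ)) ∂μ = 0 := by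
  have hconj : ∀ {h : E → ℂ}, ContDiff ℝ ∞ h → ContDiff ℝ ∞ (fun x => conj (h x)) :=
    fun hh => conjCLE.contDiff.comp hh
  have hφc : ContDiff ℝ ∞ (fun z => (φ z : ℂ)) := ofRealCLM.contDiff.comp hφ
  let P : E → ℂ := fun x => (Real.exp (-φ x) : ℂ)
  have hP : ContDiff ℝ ∞ P := ofRealCLM.contDiff.comp (Real.contDiff_exp.comp hφ.neg)
  have hPconj : ∀ x, conj (P x) = P x := fun x => conj_ofReal _
  have hdP : ∀ u x, fderiv ℝ P x u = - (P x * fderiv ℝ (fun z => (φ z : ℂ)) x u) := fun u x => by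
    have h0 : DifferentiableAt ℝ φ x := (hφ.differentiable (by simp)).differentiableAt
    have h1 : HasFDerivAt P (ofRealCLM.comp (Real.exp (-φ x) • (-(fderiv ℝ φ x)))) x :=
      ofRealCLM.hasFDerivAt.comp x (h0.hasFDerivAt.neg.exp)
    have h2 : HasFDerivAt (fun z => (φ z : ℂ)) (ofRealCLM.comp (fderiv ℝ φ x)) x :=
      ofRealCLM.hasFDerivAt.comp x h0.hasFDerivAt
    rw [h1.fderiv, h2.fderiv]; simp [P]
  have hdelP : ∀ u x, del u P x = - (P x * del u (fun z => (φ z : ℂ)) x) := fun u x => by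
    simp only [del, hdP]; ring
  have dif : ∀ {h : E → ℂ}, ContDiff ℝ ∞ h → ∀ x, DifferentiableAt ℝ h x := fun hh x =>
    (hh.differentiable (by simp)).differentiableAt
  -- the two adjoint derivatives
  let δg : E → ℂ := fun x => del w g x - g x * del w (fun z => (φ z : ℂ)) x
  have hδg : ContDiff ℝ ∞ δg := (hg.del w).sub (hg.mul (hφc.del w))
  have A : ∫ x, del v (fun x => f x * P x) x * conj (δg x) ∂μ =
      - ∫ x, f x * P x * conj (dbar v δg x) ∂μ := by
    rw [integral_del_mul (hf.mul hP) (hconj hδg) hfc.mul_right]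
    simp only [conj_dbar]
  have B : ∫ x, dbar w f x * conj (dbar v g x * P x) ∂μ =
      - ∫ x, f x * conj (del w (fun x => dbar v g x * P x) x) ∂μ := by
    rw [integral_dbar_mul hf (hconj ((hg.dbar v).mul hP)) hfc]
    simp only [conj_del]
  have pA : ∀ x, del v (fun x => f x * P x) x =
      (del v f x - f x * del v (fun z => (φ z : ℂ)) x) * P x := fun x => by
    rw [del_mul v (dif hf x) (dif hP x), hdelP]; ring
  have pB : ∀ x, del w (fun x => dbar v g x * P x) x =
      (del w (dbar v g) x - dbar v g x * del w (fun z => (φ z : ℂ)) x) * P x := fun x => by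
    rw [del_mul w (dif (hg.dbar v) x) (dif hP x), hdelP]; ring
  have pC : ∀ x, dbar v δg x = del w (dbar v g) x - dbar v g x * del w (fun z => (φ z : ℂ)) x
      - g x * dbar v (del w (fun z => (φ z : ℂ))) x := fun x => by
    simp only [δg]
    rw [dbar_sub v (dif (hg.del w) x) (dif (hg.mul (hφc.del w)) x),
      dbar_mul v (dif hg x) (dif (hφc.del w) x), dbar_del_comm (hg.contDiffAt_two x)]
    ring
  have pD : ∀ x, conj (dbar v (del w (fun z => (φ z : ℂ))) x) =
      del v (dbar w (fun z => (φ z : ℂ))) x := fun x => by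
    rw [conj_dbar]; congr 1; ext z; rw [conj_del]; simp
  have ci : ∀ {h : E → ℂ}, ContDiff ℝ ∞ h → HasCompactSupport h → Integrable h μ :=
    fun hh hc => hh.continuous.integrable_of_hasCompactSupport hc
  have iA : Integrable (fun x => del v (fun x => f x * P x) x * conj (δg x)) μ :=
    ci (((hf.mul hP).del v).mul (hconj hδg)) ((hfc.mul_right.del v).mul_right)
  have iA' : Integrable (fun x => f x * P x * conj (dbar v δg x)) μ :=
    ci ((hf.mul hP).mul (hconj (hδg.dbar v))) hfc.mul_right.mul_right
  have iB : Integrable (fun x => dbar w f x * conj (dbar v g x * P x)) μ :=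
    ci ((hf.dbar w).mul (hconj ((hg.dbar v).mul hP))) (hfc.dbar w).mul_right
  have iB' : Integrable (fun x => f x * conj (del w (fun x => dbar v g x * P x) x)) μ :=
    ci (hf.mul (hconj (((hg.dbar v).mul hP).del w))) hfc.mul_right
  have pt : ∀ x, ((del v f x - f x * del v (fun z => (φ z : ℂ)) x) *
        conj (del w g x - g x * del w (fun z => (φ z : ℂ)) x) * (Real.exp (-φ x) : ℂ) -
      dbar w f x * conj (dbar v g x) * (Real.exp (-φ x) : ℂ) -
      f x * conj (g x) * del v (dbar w (fun z => (φ z : ℂ))) x * (Real.exp (-φ x) : ℂ)) =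
      (del v (fun x => f x * P x) x * conj (δg x) + f x * P x * conj (dbar v δg x)) -
      (dbar w f x * conj (dbar v g x * P x) + f x * conj (del w (fun x => dbar v g x * P x) x)) := by
    intro x
    rw [pA, pB, pC, ← pD]
    simp only [map_mul, map_sub, hPconj]
    simp only [δg, P, map_sub, map_mul]
    ring
  simp_rw [pt]
  refine (integral_sub (iA.add iA') (iB.add iB')).trans ?_
  rw [integral_add' iA iA', integral_add' iB iB', A, B]
  ring

/-- The basic `L²` estimate for test forms. -/
theorem integral_leviForm_le {ι : Type*} [Fintype ι] (e : ι → E) {φ : E → ℝ}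
    (hφ : ContDiff ℝ ∞ φ) (b : ι → E → ℂ) (hb : ∀ j, ContDiff ℝ ∞ (b j))
    (hbc : ∀ j, HasCompactSupport (b j)) :
    Integrable (fun x => leviForm φ x (∑ j, b j x • e j) * Real.exp (-φ x)) μ ∧
    ∫ x, leviForm φ x (∑ j, b j x • e j) * Real.exp (-φ x) ∂μ ≤
      ∫ x, (‖∑ j, (del (e j) (b j) x - b j x * del (e j) (fun z => (φ z : ℂ)) x)‖ ^ 2 +
        (∑ j, ∑ k, ‖dbar (e j) (b k) x - dbar (e k) (b j) x‖ ^ 2) / 2) * Real.exp (-φ x) ∂μ := by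
  have hφc : ContDiff ℝ ∞ (fun z => (φ z : ℂ)) := ofRealCLM.contDiff.comp hφ
  have hconj : ∀ {h : E → ℂ}, ContDiff ℝ ∞ h → ContDiff ℝ ∞ (fun x => conj (h x)) :=
    fun hh => conjCLE.contDiff.comp hh
  have hP : ContDiff ℝ ∞ (fun x => (Real.exp (-φ x) : ℂ)) :=
    ofRealCLM.contDiff.comp (Real.contDiff_exp.comp hφ.neg)
  have hPr : ContDiff ℝ ∞ (fun x => Real.exp (-φ x)) := Real.contDiff_exp.comp hφ.neg
  let δ : ι → E → ℂ := fun j x => del (e j) (b j) x - b j x * del (e j) (fun z => (φ z : ℂ)) x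
  have hδ : ∀ j, ContDiff ℝ ∞ (δ j) := fun j => ((hb j).del _).sub ((hb j).mul (hφc.del _))
  have hδc : ∀ j, HasCompactSupport (δ j) := fun j => ((hbc j).del _).sub (hbc j).mul_right
  let G : ι → ι → E → ℂ := fun j k x => δ j x * conj (δ k x) * (Real.exp (-φ x) : ℂ) -
      dbar (e k) (b j) x * conj (dbar (e j) (b k) x) * (Real.exp (-φ x) : ℂ) -
      b j x * conj (b k x) * del (e j) (dbar (e k) (fun z => (φ z : ℂ))) x *
        (Real.exp (-φ x) : ℂ)
  have hG0 : ∀ j k, ∫ x, G j k x ∂μ = 0 := fun j k =>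
    integral_kohn hφ (hb j) (hb k) (hbc j) (e j) (e k)
  have hGi : ∀ j k, Integrable (G j k) μ := fun j k => by
    refine Continuous.integrable_of_hasCompactSupport ?_ ?_
    · exact (((((hδ j).mul (hconj (hδ k))).mul hP).sub ((((hb j).dbar _).mul
        (hconj ((hb k).dbar _))).mul hP)).sub ((((hb j).mul (hconj (hb k))).mul
        ((hφc.dbar _).del _)).mul hP)).continuous
    · exact ((((hδc j).mul_right).mul_right).sub (((hbc j).dbar _).mul_right.mul_right)).sub
        (((hbc j).mul_right).mul_right.mul_right)
  have hsum : ∫ x, ∑ j, ∑ k, G j k x ∂μ = 0 := by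
    rw [integral_finsetSum _ fun j _ => integrable_finsetSum _ fun k _ => hGi j k]
    refine Finset.sum_eq_zero fun j _ => ?_
    rw [integral_finsetSum _ fun k _ => hGi j k]
    exact Finset.sum_eq_zero fun k _ => hG0 j k
  have hre : ∫ x, (∑ j, ∑ k, G j k x).re ∂μ = 0 := by
    have hi : Integrable (fun x => ∑ j, ∑ k, G j k x) μ :=
      integrable_finsetSum _ fun j _ => integrable_finsetSum _ fun k _ => hGi j k
    have := integral_re hi
    simp only [RCLike.re_to_complex] at this
    rw [this, hsum]; simp
  have i1 : Integrable (fun x => leviForm φ x (∑ j, b j x • e j) * Real.exp (-φ x)) μ := by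
    have : ∀ x, leviForm φ x (∑ j, b j x • e j) =
        (∑ j, ∑ k, b j x * conj (b k x) * del (e j) (dbar (e k) (fun z => (φ z : ℂ))) x).re :=
      fun x => by
        rw [sum_del_dbar_eq_leviForm e (fun j => b j x) (hφ.contDiffAt_two x)]; simp
    simp_rw [this]
    have hF : ContDiff ℝ ∞ (fun x => ∑ j, ∑ k, b j x * conj (b k x) *
        del (e j) (dbar (e k) (fun z => (φ z : ℂ))) x) :=
      ContDiff.sum fun j _ => ContDiff.sum fun k _ =>
        ((hb j).mul (hconj (hb k))).mul ((hφc.dbar _).del _)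
    refine ((continuous_re.comp hF.continuous).mul hPr.continuous).integrable_of_hasCompactSupport ?_
    refine HasCompactSupport.mul_right ?_
    refine HasCompactSupport.comp_left (g := Complex.re) ?_ Complex.zero_re
    refine HasCompactSupport.of_support_subset_isCompact
      (isCompact_iUnion fun j => (hbc j)) fun x hx => ?_
    by_contra hcon
    refine hx (Finset.sum_eq_zero fun j _ => Finset.sum_eq_zero fun k _ => ?_)
    rw [image_eq_zero_of_notMem_tsupport (f := b j) (fun h => hcon (mem_iUnion.2 ⟨j, h⟩))]
    simp
  have i2 : Integrable (fun x =>
      (‖∑ j, δ j x‖ ^ 2 + (∑ j, ∑ k, ‖dbar (e j) (b k) x - dbar (e k) (b j) x‖ ^ 2) / 2) *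
        Real.exp (-φ x)) μ := by
    refine Continuous.integrable_of_hasCompactSupport ?_ ?_
    · refine Continuous.mul (Continuous.add ?_ ?_) hPr.continuous
      · exact (continuous_finsetSum _ fun j _ => (hδ j).continuous).norm.pow 2
      · refine Continuous.div_const (continuous_finsetSum _ fun j _ =>
          continuous_finsetSum _ fun k _ => ?_) _
        exact (((hb k).dbar _).sub ((hb j).dbar _)).continuous.norm.pow 2
    · refine HasCompactSupport.mul_right (HasCompactSupport.of_support_subset_isCompact
        (isCompact_iUnion fun j => (hbc j)) fun x hx => ?_)
      by_contra hcon
      have hz : ∀ j, x ∉ tsupport (b j) := fun j h => hcon (mem_iUnion.2 ⟨j, h⟩)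
      refine hx ?_
      have e1 : ∀ j v, dbar v (b j) x = 0 := fun j v =>
        image_eq_zero_of_notMem_tsupport fun h => hz j (tsupport_dbar_subset _ _ h)
      have e2 : ∀ j v, del v (b j) x = 0 := fun j v =>
        image_eq_zero_of_notMem_tsupport fun h => hz j (tsupport_del_subset _ _ h)
      have e3 : ∀ j, b j x = 0 := fun j => image_eq_zero_of_notMem_tsupport (hz j)
      simp [δ, e1, e2, e3]
  refine ⟨i1, ?_⟩
  rw [← sub_nonneg, ← integral_sub i2 i1, ← hre]
  refine integral_mono ?_ (i2.sub i1) fun x => ?_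
  · exact (integrable_finsetSum _ fun j _ => integrable_finsetSum _ fun k _ => hGi j k).re
  · have hP0 : 0 ≤ Real.exp (-φ x) := (Real.exp_pos _).le
    have h1 : ∑ j, ∑ k, G j k x = (((‖∑ j, δ j x‖ ^ 2 : ℝ) : ℂ) -
        ∑ j, ∑ k, dbar (e k) (b j) x * conj (dbar (e j) (b k) x) -
        (leviForm φ x (∑ j, b j x • e j) : ℂ)) * (Real.exp (-φ x) : ℂ) := by
      rw [← sum_del_dbar_eq_leviForm e (fun j => b j x) (hφ.contDiffAt_two x)]
      have : ((‖∑ j, δ j x‖ ^ 2 : ℝ) : ℂ) = ∑ j, ∑ k, δ j x * conj (δ k x) := by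
        push_cast
        rw [← mul_conj', map_sum, Finset.sum_mul_sum]
      rw [this, sub_mul, sub_mul]
      simp only [G, Finset.sum_sub_distrib, Finset.sum_mul]
    have h2 : (∑ j, ∑ k, dbar (e k) (b j) x * conj (dbar (e j) (b k) x)).re =
        ∑ j, ∑ k, ‖dbar (e j) (b k) x‖ ^ 2 -
          (∑ j, ∑ k, ‖dbar (e j) (b k) x - dbar (e k) (b j) x‖ ^ 2) / 2 := by
      have : ∀ j k, ‖dbar (e j) (b k) x - dbar (e k) (b j) x‖ ^ 2 =
          ‖dbar (e j) (b k) x‖ ^ 2 + ‖dbar (e k) (b j) x‖ ^ 2 -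
            2 * (dbar (e k) (b j) x * conj (dbar (e j) (b k) x)).re := fun j k => by
        simp only [← normSq_eq_norm_sq, normSq_apply, mul_re, conj_re, conj_im, sub_re, sub_im]
        ring
      simp_rw [this, Finset.sum_sub_distrib, Finset.sum_add_distrib, ← Finset.mul_sum]
      rw [Finset.sum_comm (f := fun j k => ‖dbar (e k) (b j) x‖ ^ 2)]
      simp only [re_sum]
      ring
    have h3 : 0 ≤ ∑ j, ∑ k, ‖dbar (e j) (b k) x‖ ^ 2 := by positivity
    have h4 : (∑ j, ∑ k, G j k x).re = (‖∑ j, δ j x‖ ^ 2 -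
        (∑ j, ∑ k, dbar (e k) (b j) x * conj (dbar (e j) (b k) x)).re -
        leviForm φ x (∑ j, b j x • e j)) * Real.exp (-φ x) := by
      rw [h1, re_mul_ofReal, sub_re, sub_re, ofReal_re, ofReal_re]
    simp only [h4]
    rw [h2, ← sub_mul]
    refine mul_le_mul_of_nonneg_right ?_ hP0
    simp only [δ]
    linarith

end BasicEstimate

section Mollify

open MeasureTheory Filter Topology
open scoped ContDiff ComplexConjugate

variable {E : Type*} [NormedAddCommGroup E] [NormedSpace ℂ E] [FiniteDimensional ℂ E]
  [MeasurableSpace E] [BorelSpace E] {μ : Measure E} [μ.IsAddHaarMeasure]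

/-- A smooth probability density supported in the ball of radius `ε`. -/
structure IsMollifier (μ : Measure E) (k : E → ℝ) (ε : ℝ) : Prop where
  contDiff : ContDiff ℝ ∞ k
  nonneg : ∀ x, 0 ≤ k x
  support_subset : Function.support k ⊆ ball 0 ε
  integral_eq_one : ∫ x, k x ∂μ = 1

/-- Convolution of a function with a real kernel. -/
def mollify (μ : Measure E) (k : E → ℝ) (g : E → ℂ) (x : E) : ℂ := ∫ t, g t * (k (x - t) : ℂ) ∂μ

theorem exists_isMollifier (μ : Measure E) [μ.IsAddHaarMeasure] {ε : ℝ} (hε : 0 < ε) :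
    ∃ k, IsMollifier μ k ε := by
  let f : ContDiffBump (0 : E) := ⟨ε / 2, ε, by positivity, by linarith⟩
  exact ⟨f.normed μ, f.contDiff_normed, fun x => f.nonneg_normed x,
    by rw [f.support_normed_eq], f.integral_normed⟩

namespace IsMollifier

variable {k : E → ℝ} {ε : ℝ}

theorem hasCompactSupport (hk : IsMollifier μ k ε) : HasCompactSupport k :=
  HasCompactSupport.of_support_subset_isCompact (isCompact_closedBall 0 ε)
    (hk.support_subset.trans ball_subset_closedBall)

theorem contDiff_ofReal (hk : IsMollifier μ k ε) : ContDiff ℝ ∞ (fun x => (k x : ℂ)) :=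
  ofRealCLM.contDiff.comp hk.contDiff

theorem hasCompactSupport_ofReal (hk : IsMollifier μ k ε) :
    HasCompactSupport (fun x => (k x : ℂ)) :=
  hk.hasCompactSupport.comp_left (g := ((↑) : ℝ → ℂ)) (by simp)

theorem hasCompactSupport_sub (hk : IsMollifier μ k ε) (x : E) :
    HasCompactSupport (fun t => (k (x - t) : ℂ)) := by
  refine HasCompactSupport.of_support_subset_isCompact (isCompact_closedBall x ε) fun t ht => ?_
  have h1 : k (x - t) ≠ 0 := fun h => ht (by simp [h])
  have := hk.support_subset h1
  rw [mem_ball_zero_iff] at this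
  rw [mem_closedBall, dist_comm, dist_eq_norm]; exact this.le

theorem contDiff_sub (hk : IsMollifier μ k ε) (x : E) :
    ContDiff ℝ ∞ (fun t => (k (x - t) : ℂ)) :=
  hk.contDiff_ofReal.comp (contDiff_const.sub contDiff_id)

theorem eq_zero (hk : IsMollifier μ k ε) {x : E} (hx : ε ≤ ‖x‖) : k x = 0 := by
  by_contra h
  have := hk.support_subset h
  rw [mem_ball_zero_iff] at this
  linarith

theorem contDiff_mollify (hk : IsMollifier μ k ε) {g : E → ℂ} (hg : LocallyIntegrable g μ) :
    ContDiff ℝ ∞ (mollify μ k g) :=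
  hk.hasCompactSupport_ofReal.contDiff_convolution_right (ContinuousLinearMap.mul ℝ ℂ) hg
    hk.contDiff_ofReal

theorem integrable_mul (hk : IsMollifier μ k ε) {g : E → ℂ} (hg : LocallyIntegrable g μ) (x : E) :
    Integrable (fun t => g t * (k (x - t) : ℂ)) μ := by
  have := hg.integrable_smul_left_of_hasCompactSupport (hk.contDiff_sub x).continuous
    (hk.hasCompactSupport_sub x)
  simpa [mul_comm] using this

theorem fderiv_mollify (hk : IsMollifier μ k ε) {g : E → ℂ} (hg : LocallyIntegrable g μ) (x v : E) :
    fderiv ℝ (mollify μ k g) x v = - ∫ t, g t * fderiv ℝ (fun t => (k (x - t) : ℂ)) t v ∂μ := by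
  have h := hk.hasCompactSupport_ofReal.hasFDerivAt_convolution_right
    (ContinuousLinearMap.mul ℝ ℂ) hg (hk.contDiff_ofReal.of_le (by simp)) x
  have h' : HasFDerivAt (mollify μ k g) _ x := h
  have hfc : Continuous (fderiv ℝ (fun x => (k x : ℂ))) :=
    (hk.contDiff_ofReal.continuous_fderiv (by simp))
  have hce := (hk.hasCompactSupport_ofReal.fderiv ℝ).convolutionExists_right
    ((ContinuousLinearMap.mul ℝ ℂ).precompR E) hg hfc x
  rw [h'.fderiv, convolution_def, ContinuousLinearMap.integral_apply hce, ← integral_neg]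
  refine integral_congr_ae (Eventually.of_forall fun t => ?_)
  have h2 : HasFDerivAt (fun t => (k (x - t) : ℂ))
      ((fderiv ℝ (fun x => (k x : ℂ)) (x - t)).comp (-(ContinuousLinearMap.id ℝ E))) t :=
    ((hk.contDiff_ofReal.differentiable (by simp)).differentiableAt.hasFDerivAt).comp t
      ((hasFDerivAt_id t).const_sub x)
  simp only [h2.fderiv]
  simp [ContinuousLinearMap.precompR]

theorem integrable_mul_fderiv (hk : IsMollifier μ k ε) {g : E → ℂ} (hg : LocallyIntegrable g μ)
    (x v : E) : Integrable (fun t => g t * fderiv ℝ (fun t => (k (x - t) : ℂ)) t v) μ := by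
  have := hg.integrable_smul_left_of_hasCompactSupport
    ((hk.contDiff_sub x).fderiv_apply_const v).continuous
    ((hk.hasCompactSupport_sub x).fderiv_apply ℝ v)
  simpa [mul_comm] using this

theorem dbar_mollify (hk : IsMollifier μ k ε) {g : E → ℂ} (hg : LocallyIntegrable g μ) (x v : E) :
    dbar v (mollify μ k g) x = - ∫ t, g t * dbar v (fun t => (k (x - t) : ℂ)) t ∂μ := by
  have e : ∀ t, g t * dbar v (fun t => (k (x - t) : ℂ)) t =
      (2⁻¹ : ℂ) * (g t * fderiv ℝ (fun t => (k (x - t) : ℂ)) t v) +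
      (I / 2) * (g t * fderiv ℝ (fun t => (k (x - t) : ℂ)) t (I • v)) := fun t => by
    simp only [dbar]; ring
  simp_rw [e]
  rw [integral_add ((hk.integrable_mul_fderiv hg x v).const_mul _)
    ((hk.integrable_mul_fderiv hg x _).const_mul _), integral_const_mul, integral_const_mul,
    dbar, hk.fderiv_mollify hg, hk.fderiv_mollify hg]
  ring

theorem del_mollify (hk : IsMollifier μ k ε) {g : E → ℂ} (hg : LocallyIntegrable g μ) (x v : E) :
    del v (mollify μ k g) x = - ∫ t, g t * del v (fun t => (k (x - t) : ℂ)) t ∂μ := by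
  have e : ∀ t, g t * del v (fun t => (k (x - t) : ℂ)) t =
      (2⁻¹ : ℂ) * (g t * fderiv ℝ (fun t => (k (x - t) : ℂ)) t v) -
      (I / 2) * (g t * fderiv ℝ (fun t => (k (x - t) : ℂ)) t (I • v)) := fun t => by
    simp only [del]; ring
  simp_rw [e]
  rw [integral_sub ((hk.integrable_mul_fderiv hg x v).const_mul _)
    ((hk.integrable_mul_fderiv hg x _).const_mul _), integral_const_mul, integral_const_mul,
    del, hk.fderiv_mollify hg, hk.fderiv_mollify hg]
  ring

theorem support_mollify_subset (hk : IsMollifier μ k ε) {g : E → ℂ} {L : Set E}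
    (hL : ∀ x, x ∉ L → g x = 0) : ∀ x, x ∉ cthickening ε L → mollify μ k g x = 0 := by
  intro x hx
  refine integral_eq_zero_of_ae (Eventually.of_forall fun t => ?_)
  by_cases ht : t ∈ L
  · have : ε ≤ ‖x - t‖ := by
      by_contra h
      push Not at h
      exact hx (mem_cthickening_of_dist_le x t ε L ht (by rw [dist_eq_norm]; exact h.le))
    simp [hk.eq_zero this]
  · simp [hL t ht]

theorem lintegral_eq_one (hk : IsMollifier μ k ε) : ∫⁻ x, ENNReal.ofReal (k x) ∂μ = 1 := by
  rw [← ofReal_integral_eq_lintegral_ofReal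
    (hk.contDiff.continuous.integrable_of_hasCompactSupport hk.hasCompactSupport)
    (Eventually.of_forall hk.nonneg), hk.integral_eq_one]
  simp

theorem mollify_eq (g : E → ℂ) (x : E) :
    mollify μ k g x = ∫ y, g (x - y) * (k y : ℂ) ∂μ := by
  rw [mollify, ← integral_sub_left_eq_self _ μ x]
  simp

end IsMollifier

theorem eLpNorm_two_sq {F : Type*} [NormedAddCommGroup F] {X : Type*} [MeasurableSpace X]
    {ν : Measure X} (f : X → F) :
    eLpNorm f 2 ν ^ 2 = ∫⁻ x, ‖f x‖ₑ ^ 2 ∂ν := by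
  have h := eLpNorm_nnreal_pow_eq_lintegral (f := f) (μ := ν) (p := 2) (by norm_num)
  simpa using h

theorem IsMollifier.eLpNorm_sub_le {k : E → ℝ} {ε : ℝ} (hk : IsMollifier μ k ε) {g : E → ℂ}
    (hgm : StronglyMeasurable g) (hg : LocallyIntegrable g μ) {c : ENNReal}
    (hc : ∀ y ∈ ball (0 : E) ε, eLpNorm (fun x => g (x - y) - g x) 2 μ ≤ c) :
    eLpNorm (fun x => mollify μ k g x - g x) 2 μ ≤ c := by
  let K : E → ENNReal := fun y => ENNReal.ofReal (k y)
  have hK : Measurable K := hk.contDiff.continuous.measurable.ennreal_ofReal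
  let ν := μ.withDensity K
  have hν : IsProbabilityMeasure ν := ⟨by simp [ν, K, hk.lintegral_eq_one]⟩
  have hjm : Measurable (fun p : E × E => ‖g (p.1 - p.2) - g p.1‖ₑ ^ 2) := by
    have := hgm.measurable
    fun_prop
  have pt : ∀ x, ‖mollify μ k g x - g x‖ₑ ^ 2 ≤ ∫⁻ y, K y * ‖g (x - y) - g x‖ₑ ^ 2 ∂μ := by
    intro x
    have h1 : mollify μ k g x - g x = ∫ y, (g (x - y) - g x) * (k y : ℂ) ∂μ := by
      rw [IsMollifier.mollify_eq]
      simp only [sub_mul]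
      have i1 : Integrable (fun y => g (x - y) * (k y : ℂ)) μ := by
        have := (hk.integrable_mul hg x).comp_sub_left x
        simpa using this
      have i2 : Integrable (fun y => g x * (k y : ℂ)) μ :=
        (hk.contDiff_ofReal.continuous.integrable_of_hasCompactSupport
          hk.hasCompactSupport_ofReal).const_mul _
      have i3 : ∫ y, (k y : ℂ) ∂μ = 1 := by
        rw [integral_complex_ofReal, hk.integral_eq_one]; simp
      rw [integral_sub i1 i2, integral_const_mul, i3, mul_one]
    have hm : Measurable (fun y => ‖g (x - y) - g x‖ₑ) := by
      have := hgm.measurable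
      fun_prop
    have h2 : ‖mollify μ k g x - g x‖ₑ ≤ eLpNorm (fun y => g (x - y) - g x) 1 ν := by
      rw [h1, eLpNorm_one_eq_lintegral_enorm, lintegral_withDensity_eq_lintegral_mul μ hK hm]
      refine (enorm_integral_le_lintegral_enorm _).trans (lintegral_mono fun y => ?_)
      rw [enorm_mul, mul_comm]
      simp only [Pi.mul_apply, K]
      gcongr
      rw [← ofReal_norm, norm_real, Real.norm_of_nonneg (hk.nonneg y)]
    have h3 := h2.trans (eLpNorm_le_eLpNorm_of_exponent_le (q := 2) (by norm_num)
      (hgm.comp_measurable (measurable_const.sub measurable_id) |>.sub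
        stronglyMeasurable_const).aestronglyMeasurable)
    calc _ ≤ (eLpNorm (fun y => g (x - y) - g x) 2 ν) ^ 2 := by gcongr
      _ = _ := by
        rw [eLpNorm_two_sq, lintegral_withDensity_eq_lintegral_mul μ hK (hm.pow_const 2)]
        rfl
  have hsq : eLpNorm (fun x => mollify μ k g x - g x) 2 μ ^ 2 ≤ c ^ 2 := by
    rw [eLpNorm_two_sq]
    calc _ ≤ ∫⁻ x, ∫⁻ y, K y * ‖g (x - y) - g x‖ₑ ^ 2 ∂μ ∂μ := lintegral_mono pt
      _ = ∫⁻ y, ∫⁻ x, K y * ‖g (x - y) - g x‖ₑ ^ 2 ∂μ ∂μ := by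
        refine lintegral_lintegral_swap ?_
        exact ((hK.comp measurable_snd).mul hjm).aemeasurable
      _ ≤ ∫⁻ y, K y * c ^ 2 ∂μ := by
        refine lintegral_mono fun y => ?_
        simp only
        have hm : Measurable (fun x => ‖g (x - y) - g x‖ₑ ^ 2) := by
          have := hgm.measurable
          fun_prop
        rw [lintegral_const_mul _ hm]
        by_cases hy : y ∈ ball (0 : E) ε
        · gcongr
          rw [← eLpNorm_two_sq (fun x => g (x - y) - g x)]
          gcongr
          exact hc y hy
        · have : K y = 0 := by
            have : k y = 0 := by
              by_contra h; exact hy (hk.support_subset h)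
            simp [K, this]
          simp [this]
      _ = c ^ 2 := by
        rw [lintegral_mul_const _ hK, hk.lintegral_eq_one, one_mul]
  exact (ENNReal.pow_le_pow_left_iff two_ne_zero).1 hsq

theorem eventually_eLpNorm_translate_sub_le {g : E → ℂ} (hg : MemLp g 2 μ) {c : ENNReal}
    (hc : 0 < c) : ∀ᶠ y in 𝓝 (0 : E), eLpNorm (fun x => g (x - y) - g x) 2 μ ≤ c := by
  let G : C(E, C(E, E)) := ContinuousMap.curry ⟨fun p : E × E => p.2 - p.1, by fun_prop⟩
  have hmp : ∀ y, MeasurePreserving (G y) μ μ := fun y => measurePreserving_sub_right μ y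
  have h := Filter.Tendsto.compMeasurePreservingLp (p := 2) (μ := μ) (ν := μ) (l := 𝓝 (0 : E))
    (tendsto_const_nhds (x := hg.toLp g)) (G.continuous.tendsto 0) hmp (hmp 0) (by simp)
  simp only [Lp.toLp_compMeasurePreserving] at h
  rw [Lp.tendsto_Lp_iff_tendsto_eLpNorm''] at h
  filter_upwards [h.eventually (ge_mem_nhds hc)] with y hy
  have : (fun x => g (x - y) - g x) = g ∘ (G y) - g ∘ (G 0) := by
    ext x
    simp [G]
  rw [this]
  exact hy

/-- Mollifications converge in `L²`. -/
theorem exists_eLpNorm_mollify_sub_le {g : E → ℂ} (hg : MemLp g 2 μ) {c : ENNReal} (hc : 0 < c) :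
    ∃ δ > 0, ∀ ε ≤ δ, ∀ k, IsMollifier μ k ε → eLpNorm (fun x => mollify μ k g x - g x) 2 μ ≤ c := by
  obtain ⟨g', hg'm, hgg'⟩ := hg.1
  have hg' : MemLp g' 2 μ := (memLp_congr_ae hgg').1 hg
  obtain ⟨δ, hδ, h⟩ := Metric.eventually_nhds_iff_ball.1
    (eventually_eLpNorm_translate_sub_le hg' hc)
  refine ⟨δ, hδ, fun ε hε k hk => ?_⟩
  have h2 := hk.eLpNorm_sub_le hg'm (hg'.locallyIntegrable (by norm_num))
    (fun y hy => h y (ball_subset_ball hε hy))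
  have h3 : ∀ x, mollify μ k g x = mollify μ k g' x := fun x => by
    refine integral_congr_ae ?_
    filter_upwards [hgg'] with t ht
    simp [ht]
  refine (eLpNorm_congr_ae ?_).trans_le h2
  filter_upwards [hgg'] with t ht
  simp [h3, ht]

end Mollify

section WeakEstimate

open MeasureTheory Filter Topology
open scoped ContDiff ComplexConjugate

variable {E : Type*} [NormedAddCommGroup E] [NormedSpace ℂ E] [FiniteDimensional ℂ E]
  [MeasurableSpace E] [BorelSpace E] {μ : Measure E} [μ.IsAddHaarMeasure]

/-- `L²` convergence of functions supported in a common set. -/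
structure TendstoL2 (μ : Measure E) (L : Set E) (F : ℕ → E → ℂ) (f : E → ℂ) : Prop where
  memLp : ∀ n, MemLp (F n) 2 μ
  memLp_lim : MemLp f 2 μ
  eq_zero : ∀ n x, x ∉ L → F n x = 0
  eq_zero_lim : ∀ x, x ∉ L → f x = 0
  tendsto : Tendsto (fun n => eLpNorm (F n - f) 2 μ) atTop (𝓝 0)

theorem MeasureTheory.MemLp.continuous_mul {L : Set E} (hL : IsCompact L) {c : E → ℂ}
    (hc : Continuous c) {f : E → ℂ} (hf : MemLp f 2 μ) (hz : ∀ x, x ∉ L → f x = 0) :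
    MemLp (fun x => c x * f x) 2 μ := by
  obtain ⟨M, hM⟩ := hL.exists_bound_of_continuousOn hc.continuousOn
  refine MemLp.of_le_mul (c := M) hf (hc.aestronglyMeasurable.mul hf.1)
    (Eventually.of_forall fun x => ?_)
  by_cases hx : x ∈ L
  · rw [norm_mul]; gcongr; exact hM x hx
  · simp [hz x hx]

theorem integrable_sq_norm {X : Type*} [MeasurableSpace X] {ν : Measure X} {f : X → ℂ}
    (hf : MemLp f 2 ν) : Integrable (fun x => ‖f x‖ ^ 2) ν :=
  (memLp_two_iff_integrable_sq_norm hf.1).1 hf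

namespace TendstoL2

variable {L : Set E} {F G : ℕ → E → ℂ} {f g : E → ℂ}

theorem mul_left (h : TendstoL2 μ L F f) (hL : IsCompact L) {c : E → ℂ} (hc : Continuous c) :
    TendstoL2 μ L (fun n x => c x * F n x) (fun x => c x * f x) where
  memLp n := (h.memLp n).continuous_mul hL hc (h.eq_zero n)
  memLp_lim := h.memLp_lim.continuous_mul hL hc h.eq_zero_lim
  eq_zero n x hx := by simp [h.eq_zero n x hx]
  eq_zero_lim x hx := by simp [h.eq_zero_lim x hx]
  tendsto := by
    obtain ⟨M, hM⟩ := hL.exists_bound_of_continuousOn hc.continuousOn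
    have h1 : Tendsto (fun n => ENNReal.ofReal M * eLpNorm (F n - f) 2 μ) atTop (𝓝 0) := by
      have := ENNReal.Tendsto.const_mul (a := ENNReal.ofReal M) h.tendsto (Or.inr (by simp))
      simpa using this
    refine tendsto_of_tendsto_of_tendsto_of_le_of_le tendsto_const_nhds h1
      (fun n => zero_le) fun n => ?_
    refine eLpNorm_le_mul_eLpNorm_of_ae_le_mul (Eventually.of_forall fun x => ?_) 2
    by_cases hx : x ∈ L
    · simp only [Pi.sub_apply]
      rw [← mul_sub, norm_mul]
      gcongr
      exact hM x hx
    · simp [h.eq_zero n x hx, h.eq_zero_lim x hx]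

theorem add (h : TendstoL2 μ L F f) (h' : TendstoL2 μ L G g) :
    TendstoL2 μ L (fun n x => F n x + G n x) (fun x => f x + g x) where
  memLp n := (h.memLp n).add (h'.memLp n)
  memLp_lim := h.memLp_lim.add h'.memLp_lim
  eq_zero n x hx := by simp [h.eq_zero n x hx, h'.eq_zero n x hx]
  eq_zero_lim x hx := by simp [h.eq_zero_lim x hx, h'.eq_zero_lim x hx]
  tendsto := by
    have h1 := h.tendsto.add h'.tendsto
    rw [add_zero] at h1
    refine tendsto_of_tendsto_of_tendsto_of_le_of_le tendsto_const_nhds h1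
      (fun n => zero_le) fun n => ?_
    have e : (fun x => F n x + G n x) - (fun x => f x + g x) = (F n - f) + (G n - g) := by
      ext x; simp; ring
    simp only [e]
    exact eLpNorm_add_le ((h.memLp n).sub h.memLp_lim).1 ((h'.memLp n).sub h'.memLp_lim).1
      (by norm_num)

theorem sum {ι : Type*} (s : Finset ι) {F : ι → ℕ → E → ℂ} {f : ι → E → ℂ}
    (h : ∀ j, TendstoL2 μ L (F j) (f j)) :
    TendstoL2 μ L (fun n x => ∑ j ∈ s, F j n x) (fun x => ∑ j ∈ s, f j x) := by
  classical
  induction s using Finset.induction_on with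
  | empty =>
    simp only [Finset.sum_empty]
    exact ⟨fun _ => MemLp.zero, MemLp.zero, by simp, by simp, by
      simp⟩
  | insert i s hi ih =>
    simp only [Finset.sum_insert hi]
    exact (h i).add ih

theorem tendsto_integral (h : TendstoL2 μ L F f) :
    Tendsto (fun n => ∫ x, ‖F n x‖ ^ 2 ∂μ) atTop (𝓝 (∫ x, ‖f x‖ ^ 2 ∂μ)) := by
  have key : ∀ {u : E → ℂ} (hu : MemLp u 2 μ), ∫ x, ‖u x‖ ^ 2 ∂μ = ‖hu.toLp u‖ ^ 2 := by
    intro u hu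
    rw [Lp.norm_toLp, hu.eLpNorm_eq_integral_rpow_norm (by simp) (by simp),
      ENNReal.toReal_ofReal (by positivity)]
    simp only [ENNReal.toReal_ofNat, Real.rpow_ofNat]
    rw [← Real.rpow_natCast, ← Real.rpow_mul (by positivity)]
    norm_num
  have h1 := (Lp.tendsto_Lp_iff_tendsto_eLpNorm'' F h.memLp f h.memLp_lim).2 h.tendsto
  simp_rw [key h.memLp_lim, fun n => key (h.memLp n)]
  exact (h1.norm).pow 2

end TendstoL2

/-- The basic estimate for forms in the domain of the weak operators. -/
theorem integral_weighted_le_of_weak {ι : Type*} [Fintype ι] (e : ι → E) {φ m : E → ℝ}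
    (hφ : ContDiff ℝ ∞ φ) (hm : Continuous m) (hm0 : ∀ x, 0 ≤ m x) {L W : Set E}
    (hL : IsCompact L) (hW : IsOpen W) (hLW : L ⊆ W)
    (hlevi : ∀ x ∈ W, ∀ c : ι → ℂ, m x * ∑ j, ‖c j‖ ^ 2 ≤ leviForm φ x (∑ j, c j • e j))
    {b : ι → E → ℂ} {σ : E → ℂ} {θ : ι → ι → E → ℂ}
    (hb : ∀ j, MemLp (b j) 2 μ) (hσ : MemLp σ 2 μ) (hθ : ∀ j k, MemLp (θ j k) 2 μ)
    (hbz : ∀ j x, x ∉ L → b j x = 0) (hσz : ∀ x, x ∉ L → σ x = 0)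
    (hθz : ∀ j k x, x ∉ L → θ j k x = 0)
    (hdiv : ∀ f : E → ℂ, ContDiff ℝ ∞ f → HasCompactSupport f →
      ∫ t, ∑ j, b j t * del (e j) f t ∂μ = - ∫ t, σ t * f t ∂μ)
    (hcurl : ∀ f : E → ℂ, ContDiff ℝ ∞ f → HasCompactSupport f → ∀ j k,
      ∫ t, (b k t * dbar (e j) f t - b j t * dbar (e k) f t) ∂μ = - ∫ t, θ j k t * f t ∂μ) :
    ∫ x, m x * (∑ j, ‖b j x‖ ^ 2) * Real.exp (-φ x) ∂μ ≤
      ∫ x, (‖σ x - ∑ j, b j x * del (e j) (fun z => (φ z : ℂ)) x‖ ^ 2 +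
        (∑ j, ∑ k, ‖θ j k x‖ ^ 2) / 2) * Real.exp (-φ x) ∂μ := by
  obtain ⟨δ, hδ, hδW⟩ := hL.exists_cthickening_subset_open hW hLW
  set L' := cthickening δ L with hL'
  have hL'c : IsCompact L' := hL.cthickening
  have hε : ∀ n : ℕ, 0 < δ / (n + 1) := fun n => by positivity
  choose k hk using fun n : ℕ => exists_isMollifier μ (hε n)
  have hεδ : ∀ n : ℕ, δ / (n + 1) ≤ δ := fun n => div_le_self hδ.le (by linarith [n.cast_nonneg (α := ℝ)])
  have hLL' : L ⊆ L' := self_subset_cthickening L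
  have zero_off : ∀ {g : E → ℂ}, (∀ x, x ∉ L → g x = 0) → ∀ n x, x ∉ L' →
      mollify μ (k n) g x = 0 := fun hg n x hx =>
    (hk n).support_mollify_subset hg x fun h => hx (cthickening_mono (hεδ n) L h)
  have loc : ∀ {g : E → ℂ}, MemLp g 2 μ → LocallyIntegrable g μ := fun hg =>
    hg.locallyIntegrable (by norm_num)
  have cs : ∀ {g : E → ℂ}, (∀ x, x ∉ L → g x = 0) → ∀ n, HasCompactSupport (mollify μ (k n) g) :=
    fun hg n => HasCompactSupport.of_support_subset_isCompact hL'c fun x hx => by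
      by_contra h; exact hx (zero_off hg n x h)
  have tl : ∀ {g : E → ℂ}, MemLp g 2 μ → (∀ x, x ∉ L → g x = 0) →
      TendstoL2 μ L' (fun n => mollify μ (k n) g) g := fun {g} hg hz =>
    { memLp := fun n =>
        ((hk n).contDiff_mollify (loc hg)).continuous.memLp_of_hasCompactSupport (cs hz n)
      memLp_lim := hg
      eq_zero := zero_off hz
      eq_zero_lim := fun x hx => hz x fun h => hx (hLL' h)
      tendsto := by
        rw [ENNReal.tendsto_nhds_zero]
        intro c hc
        obtain ⟨d, hd, h⟩ := exists_eLpNorm_mollify_sub_le hg hc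
        have ht : Tendsto (fun n : ℕ => δ / ((n : ℝ) + 1)) atTop (𝓝 0) :=
          tendsto_const_div_atTop_nhds_zero_nat δ |>.comp (tendsto_add_atTop_nat 1) |>.congr
            fun n => by simp
        filter_upwards [ht.eventually (ge_mem_nhds hd)] with n hn
        exact h _ hn _ (hk n) }
  let φc : E → ℂ := fun z => (φ z : ℂ)
  have hφc : ContDiff ℝ ∞ φc := ofRealCLM.contDiff.comp hφ
  let p : E → ℂ := fun x => (Real.sqrt (Real.exp (-φ x)) : ℂ)
  have hp : Continuous p := continuous_ofReal.comp
    (Real.continuous_sqrt.comp (Real.continuous_exp.comp hφ.continuous.neg))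
  have hpn : ∀ x, ‖p x‖ ^ 2 = Real.exp (-φ x) := fun x => by
    simp only [p, norm_real, Real.norm_eq_abs, sq_abs]
    exact Real.sq_sqrt (Real.exp_pos _).le
  let q : E → ℂ := fun x => (Real.sqrt (m x) : ℂ) * p x
  have hq : Continuous q := (continuous_ofReal.comp (Real.continuous_sqrt.comp hm)).mul hp
  have hqn : ∀ x, ‖q x‖ ^ 2 = m x * Real.exp (-φ x) := fun x => by
    simp only [q, norm_mul, mul_pow, hpn, norm_real, Real.norm_eq_abs, sq_abs]
    rw [Real.sq_sqrt (hm0 x)]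
  -- convergence of all terms
  have tb : ∀ j, TendstoL2 μ L' (fun n => mollify μ (k n) (b j)) (b j) := fun j =>
    tl (hb j) (hbz j)
  have t1 : ∀ j, TendstoL2 μ L' (fun n x => q x * mollify μ (k n) (b j) x)
      (fun x => q x * b j x) := fun j => (tb j).mul_left hL'c hq
  have t2 : TendstoL2 μ L' (fun n x => p x * (mollify μ (k n) σ x +
        ∑ j, (-del (e j) φc x) * mollify μ (k n) (b j) x))
      (fun x => p x * (σ x + ∑ j, (-del (e j) φc x) * b j x)) :=
    ((tl hσ hσz).add (TendstoL2.sum _ fun j => (tb j).mul_left hL'c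
      (hφc.del (e j)).continuous.neg)).mul_left hL'c hp
  have t3 : ∀ j l, TendstoL2 μ L' (fun n x => p x * mollify μ (k n) (θ j l) x)
      (fun x => p x * θ j l x) := fun j l => (tl (hθ j l) (hθz j l)).mul_left hL'c hp
  -- rewriting the two sides
  have eL : ∀ (B : ι → E → ℂ), (∀ j, MemLp (fun x => q x * B j x) 2 μ) →
      Integrable (fun x => m x * (∑ j, ‖B j x‖ ^ 2) * Real.exp (-φ x)) μ ∧
      ∫ x, m x * (∑ j, ‖B j x‖ ^ 2) * Real.exp (-φ x) ∂μ = ∑ j, ∫ x, ‖q x * B j x‖ ^ 2 ∂μ := by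
    intro B hB
    have e1 : ∀ x, m x * (∑ j, ‖B j x‖ ^ 2) * Real.exp (-φ x) = ∑ j, ‖q x * B j x‖ ^ 2 :=
      fun x => by
        simp only [norm_mul, mul_pow, hqn, ← Finset.mul_sum]; ring
    simp_rw [e1]
    exact ⟨integrable_finsetSum _ fun j _ => integrable_sq_norm (hB j),
      integral_finsetSum _ fun j _ => integrable_sq_norm (hB j)⟩
  have eR : ∀ (S : E → ℂ) (B : ι → E → ℂ) (T : ι → ι → E → ℂ),
      MemLp (fun x => p x * (S x + ∑ j, (-del (e j) φc x) * B j x)) 2 μ →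
      (∀ j l, MemLp (fun x => p x * T j l x) 2 μ) →
      ∫ x, (‖S x - ∑ j, B j x * del (e j) φc x‖ ^ 2 +
        (∑ j, ∑ l, ‖T j l x‖ ^ 2) / 2) * Real.exp (-φ x) ∂μ =
      ∫ x, ‖p x * (S x + ∑ j, (-del (e j) φc x) * B j x)‖ ^ 2 ∂μ +
        (∑ j, ∑ l, ∫ x, ‖p x * T j l x‖ ^ 2 ∂μ) / 2 := by
    intro S B T hS hT
    have e1 : ∀ x, (‖S x - ∑ j, B j x * del (e j) φc x‖ ^ 2 +
        (∑ j, ∑ l, ‖T j l x‖ ^ 2) / 2) * Real.exp (-φ x) =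
        ‖p x * (S x + ∑ j, (-del (e j) φc x) * B j x)‖ ^ 2 +
        (∑ j, ∑ l, ‖p x * T j l x‖ ^ 2) / 2 := fun x => by
      have : S x - ∑ j, B j x * del (e j) φc x = S x + ∑ j, (-del (e j) φc x) * B j x := by
        simp [sub_eq_add_neg, mul_comm]
      rw [this]
      simp only [norm_mul, mul_pow, hpn, ← Finset.mul_sum]; ring
    simp_rw [e1]
    have i3 : Integrable (fun x => ∑ j, ∑ l, ‖p x * T j l x‖ ^ 2) μ :=
      integrable_finsetSum _ fun j _ => integrable_finsetSum _ fun l _ => integrable_sq_norm (hT j l)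
    rw [integral_add (integrable_sq_norm hS) (i3.div_const 2), integral_div,
      integral_finsetSum _ fun j _ => integrable_finsetSum _ fun l _ => integrable_sq_norm (hT j l)]
    congr 2
    exact Finset.sum_congr rfl fun j _ =>
      integral_finsetSum _ fun l _ => integrable_sq_norm (hT j l)
  rw [(eL b fun j => (t1 j).memLp_lim).2, eR σ b θ t2.memLp_lim fun j l => (t3 j l).memLp_lim]
  refine le_of_tendsto_of_tendsto
    (tendsto_finsetSum _ fun j _ => (t1 j).tendsto_integral)
    (t2.tendsto_integral.add ((tendsto_finsetSum _ fun j _ => tendsto_finsetSum _ fun l _ =>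
      (t3 j l).tendsto_integral).div_const 2)) (Eventually.of_forall fun n => ?_)
  simp only
  rw [← (eL (fun j => mollify μ (k n) (b j)) fun j => (t1 j).memLp n).2,
    ← eR (mollify μ (k n) σ) (fun j => mollify μ (k n) (b j)) (fun j l => mollify μ (k n) (θ j l))
      (t2.memLp n) fun j l => (t3 j l).memLp n]
  have key := integral_leviForm_le (μ := μ) e hφ (fun j => mollify μ (k n) (b j))
    (fun j => (hk n).contDiff_mollify (loc (hb j))) (fun j => cs (hbz j) n)
  refine ((integral_mono (eL (fun j => mollify μ (k n) (b j)) fun j => (t1 j).memLp n).1 key.1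
    fun x => ?_).trans key.2).trans_eq ?_
  · refine mul_le_mul_of_nonneg_right ?_ (Real.exp_pos _).le
    by_cases hx : x ∈ L'
    · exact hlevi x (hδW hx) _
    · have : ∀ j, mollify μ (k n) (b j) x = 0 := fun j => zero_off (hbz j) n x hx
      simp [this, leviForm, iteratedFDeriv_two_apply]
  · have d1 : ∀ x, ∑ j, del (e j) (mollify μ (k n) (b j)) x = mollify μ (k n) σ x := fun x => by
      have := hdiv _ ((hk n).contDiff_sub x) ((hk n).hasCompactSupport_sub x)
      rw [integral_finsetSum] at this
      · simp_rw [fun j => (hk n).del_mollify (loc (hb j)) x (e j)]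
        rw [Finset.sum_neg_distrib, this, neg_neg]; rfl
      · intro j _
        have := (loc (hb j)).integrable_smul_left_of_hasCompactSupport
          (((hk n).contDiff_sub x).del (e j)).continuous (((hk n).hasCompactSupport_sub x).del (e j))
        simpa [mul_comm] using this
    have d2 : ∀ x j l, dbar (e j) (mollify μ (k n) (b l)) x - dbar (e l) (mollify μ (k n) (b j)) x =
        mollify μ (k n) (θ j l) x := fun x j l => by
      have := hcurl _ ((hk n).contDiff_sub x) ((hk n).hasCompactSupport_sub x) j l
      have ii : ∀ j l, Integrable (fun t => b j t * dbar (e l) (fun t => (k n (x - t) : ℂ)) t) μ :=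
        fun j l => by
          have := (loc (hb j)).integrable_smul_left_of_hasCompactSupport
            (((hk n).contDiff_sub x).dbar (e l)).continuous
            (((hk n).hasCompactSupport_sub x).dbar (e l))
          simpa [mul_comm] using this
      rw [integral_sub (ii _ _) (ii _ _)] at this
      rw [(hk n).dbar_mollify (loc (hb l)), (hk n).dbar_mollify (loc (hb j)), mollify]
      linear_combination -this
    refine integral_congr_ae (Eventually.of_forall fun x => ?_)
    simp only [Finset.sum_sub_distrib, d1, d2, φc]

end WeakEstimate

section Hilbert

open MeasureTheory
open scoped ComplexConjugate

/-- A functional bounded by `B * ‖T a‖` is represented by a vector of norm at most `B`. -/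
theorem exists_inner_eq_of_norm_le {V H : Type*} [AddCommGroup V] [Module ℂ V]
    [NormedAddCommGroup H] [InnerProductSpace ℂ H] [CompleteSpace H] (T : V →ₗ[ℂ] H)
    (Λ : V →ₗ[ℂ] ℂ) {B : ℝ} (hB : 0 ≤ B) (h : ∀ a, ‖Λ a‖ ≤ B * ‖T a‖) :
    ∃ w : H, ‖w‖ ≤ B ∧ ∀ a, Λ a = inner ℂ w (T a) := by
  have hker : LinearMap.ker T.rangeRestrict ≤ LinearMap.ker Λ := by
    intro a ha
    have h1 : T a = 0 := by simpa [Subtype.ext_iff] using ha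
    have h2 := h a
    rw [h1, norm_zero, mul_zero] at h2
    simpa using h2
  obtain ⟨S, hS⟩ := (LinearMap.exists_rightInverse_of_surjective T.rangeRestrict
    T.range_rangeRestrict)
  have key : ∀ a, Λ (S (T.rangeRestrict a)) = Λ a := by
    intro a
    have h1 : S (T.rangeRestrict a) - a ∈ LinearMap.ker T.rangeRestrict := by
      have : T.rangeRestrict (S (T.rangeRestrict a)) = T.rangeRestrict a :=
        LinearMap.congr_fun hS _
      rw [LinearMap.mem_ker, map_sub, this, sub_self]
    have h2 := hker h1
    rwa [LinearMap.mem_ker, map_sub, sub_eq_zero] at h2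
  let F : StrongDual ℂ (LinearMap.range T) := (Λ.comp S).mkContinuous B (by
    rintro ⟨x, a, rfl⟩
    have := key a
    simp only [LinearMap.coe_comp, Function.comp_apply]
    change ‖Λ (S (T.rangeRestrict a))‖ ≤ _
    rw [this]
    exact h a)
  obtain ⟨G, hG, hGn⟩ := exists_extension_norm_eq (LinearMap.range T) F
  refine ⟨(InnerProductSpace.toDual ℂ H).symm G, ?_, fun a => ?_⟩
  · rw [LinearIsometryEquiv.norm_map, hGn]
    exact LinearMap.mkContinuous_norm_le _ hB _
  · rw [InnerProductSpace.toDual_symm_apply]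
    exact (key a).symm.trans (hG (T.rangeRestrict a)).symm

/-- Orthogonal projection onto the complement of a set of vectors. -/
theorem exists_orthogonal_of_set {H : Type*} [NormedAddCommGroup H] [InnerProductSpace ℂ H]
    [CompleteSpace H] (S : Set H) (α : H) :
    ∃ β : H, (∀ k ∈ S, inner ℂ k β = 0) ∧
      ∀ u, (∀ k ∈ S, inner ℂ k u = 0) → inner ℂ u α = inner ℂ u β := by
  have hmem : ∀ u : H, (∀ k ∈ S, inner ℂ k u = 0) → u ∈ (Submodule.span ℂ S)ᗮ := by
    intro u hu
    rw [Submodule.mem_orthogonal]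
    intro k hk
    induction hk using Submodule.span_induction with
    | mem x hx => exact hu x hx
    | zero => simp
    | add x y _ _ hx hy => rw [inner_add_left, hx, hy, add_zero]
    | smul c x _ hx => rw [inner_smul_left, hx, mul_zero]
  refine ⟨(Submodule.span ℂ S)ᗮ.starProjection α, fun k hk => ?_, fun u hu => ?_⟩
  · have := (Submodule.span ℂ S)ᗮ.starProjection_apply_mem α
    rw [Submodule.mem_orthogonal] at this
    exact this k (Submodule.subset_span hk)
  · have := (Submodule.span ℂ S)ᗮ.starProjection_inner_eq_zero α u (hmem u hu)
    rw [inner_sub_left, sub_eq_zero] at this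
    rw [← inner_conj_symm, this, inner_conj_symm]

variable {X ι : Type*} [MeasurableSpace X] {μ : Measure X} [Fintype ι]

/-- A tuple of square integrable functions as a Hilbert space vector. -/
def l2vec {u : ι → X → ℂ} (hu : ∀ j, MemLp (u j) 2 μ) : PiLp 2 (fun _ : ι => Lp ℂ 2 μ) :=
  WithLp.toLp 2 fun j => (hu j).toLp

theorem integrable_conj_mul {u v : X → ℂ} (hu : MemLp u 2 μ) (hv : MemLp v 2 μ) :
    Integrable (fun x => conj (u x) * v x) μ :=
  (hu.star).integrable_mul hv

theorem inner_toLp {u v : X → ℂ} (hu : MemLp u 2 μ) (hv : MemLp v 2 μ) :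
    inner ℂ (hu.toLp u) (hv.toLp v) = ∫ x, conj (u x) * v x ∂μ := by
  rw [L2.inner_def]
  refine integral_congr_ae ?_
  filter_upwards [hu.coeFn_toLp, hv.coeFn_toLp] with x h1 h2
  rw [h1, h2, RCLike.inner_apply', starRingEnd_apply]

theorem inner_l2vec {u v : ι → X → ℂ} (hu : ∀ j, MemLp (u j) 2 μ) (hv : ∀ j, MemLp (v j) 2 μ) :
    inner ℂ (l2vec hu) (l2vec hv) = ∫ x, ∑ j, conj (u j x) * v j x ∂μ := by
  rw [integral_finsetSum _ fun j _ => integrable_conj_mul (hu j) (hv j), PiLp.inner_apply]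
  exact Finset.sum_congr rfl fun j _ => inner_toLp (hu j) (hv j)

theorem norm_l2vec_sq {u : ι → X → ℂ} (hu : ∀ j, MemLp (u j) 2 μ) :
    ‖l2vec hu‖ ^ 2 = ∫ x, ∑ j, ‖u j x‖ ^ 2 ∂μ := by
  have h : ((‖l2vec hu‖ ^ 2 : ℝ) : ℂ) = ((∫ x, ∑ j, ‖u j x‖ ^ 2 ∂μ : ℝ) : ℂ) := by
    rw [← integral_complex_ofReal]
    have := inner_self_eq_norm_sq_to_K (𝕜 := ℂ) (l2vec hu)
    rw [inner_l2vec] at this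
    push_cast
    refine this.symm.trans (integral_congr_ae (Filter.Eventually.of_forall fun x => ?_))
    simp [Complex.conj_mul']
  exact_mod_cast h

theorem exists_l2vec (h : PiLp 2 (fun _ : ι => Lp ℂ 2 μ)) :
    ∃ (u : ι → X → ℂ) (hu : ∀ j, MemLp (u j) 2 μ), h = l2vec hu := by
  refine ⟨fun j => (h j : X → ℂ), fun j => Lp.memLp (h j), ?_⟩
  ext1 j
  simp [l2vec]

/-- Functional form of the orthogonal projection, for tuples vanishing off a measurable set. -/
theorem exists_memLp_orthogonal {I : Type*} {W : Set X} (hW : MeasurableSet W)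
    {κ : I → ι → X → ℂ} (hκ : ∀ i j, MemLp (κ i j) 2 μ) (hκW : ∀ i j x, x ∉ W → κ i j x = 0)
    {α : ι → X → ℂ} (hα : ∀ j, MemLp (α j) 2 μ) :
    ∃ β : ι → X → ℂ, (∀ j, MemLp (β j) 2 μ) ∧ (∀ j x, x ∉ W → β j x = 0) ∧
      (∀ i, ∫ x, ∑ j, conj (κ i j x) * β j x ∂μ = 0) ∧
      ∀ u : ι → X → ℂ, (∀ j, MemLp (u j) 2 μ) → (∀ j x, x ∉ W → u j x = 0) →
        (∀ i, ∫ x, ∑ j, conj (κ i j x) * u j x ∂μ = 0) →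
        ∫ x, ∑ j, conj (u j x) * α j x ∂μ = ∫ x, ∑ j, conj (u j x) * β j x ∂μ := by
  obtain ⟨b, hb1, hb2⟩ := exists_orthogonal_of_set (Set.range fun i => l2vec (hκ i)) (l2vec hα)
  obtain ⟨β, hβ, rfl⟩ := exists_l2vec b
  have hind : ∀ (u : ι → X → ℂ), (∀ j x, x ∉ W → u j x = 0) → ∀ x,
      ∑ j, conj (u j x) * W.indicator (β j) x = ∑ j, conj (u j x) * β j x := by
    intro u hu x
    by_cases hx : x ∈ W
    · simp [hx]
    · simp [hu _ x hx]
  refine ⟨fun j => W.indicator (β j), fun j => (hβ j).indicator hW,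
    fun j x hx => indicator_of_notMem hx _, fun i => ?_, fun u hu huW huκ => ?_⟩
  · simp_rw [hind (κ i) (hκW i)]
    rw [← inner_l2vec (hκ i) hβ]
    exact hb1 _ ⟨i, rfl⟩
  · simp_rw [hind u huW]
    rw [← inner_l2vec hu hα, ← inner_l2vec hu hβ]
    refine hb2 _ ?_
    rintro _ ⟨i, rfl⟩
    exact (inner_l2vec (hκ i) hu).trans (huκ i)

end Hilbert

section TestFunction

open scoped ContDiff ComplexConjugate Topology Manifold

variable {E : Type*} [NormedAddCommGroup E] [NormedSpace ℂ E]

/-- Compactly supported smooth functions in an open set. -/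
structure IsTest (W : Set E) (f : E → ℂ) : Prop where
  contDiff : ContDiff ℝ ∞ f
  hasCompactSupport : HasCompactSupport f
  tsupport_subset : tsupport f ⊆ W

theorem contDiff_of_contDiffOn_of_tsupport {F : Type*} [NormedAddCommGroup F] [NormedSpace ℝ F]
    {W : Set E} (hW : IsOpen W) {f : E → F}
    (hf : ContDiffOn ℝ ∞ f W) (h : tsupport f ⊆ W) : ContDiff ℝ ∞ f := by
  rw [contDiff_iff_contDiffAt]
  intro x
  by_cases hx : x ∈ tsupport f
  · exact hf.contDiffAt (hW.mem_nhds (h hx))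
  · have : f =ᶠ[𝓝 x] fun _ => 0 := notMem_tsupport_iff_eventuallyEq.1 hx
    exact contDiffAt_const.congr_of_eventuallyEq this

namespace IsTest

variable {W : Set E} {f g : E → ℂ}

theorem eq_zero (hf : IsTest W f) {x : E} (hx : x ∉ W) : f x = 0 :=
  image_eq_zero_of_notMem_tsupport fun h => hx (hf.tsupport_subset h)

theorem continuous (hf : IsTest W f) : Continuous f := hf.contDiff.continuous

theorem differentiableAt (hf : IsTest W f) {x : E} : DifferentiableAt ℝ f x :=
  (hf.contDiff.differentiable (by simp)).differentiableAt

theorem mul_of_contDiffOn (hW : IsOpen W) {c : E → ℂ} (hc : ContDiffOn ℝ ∞ c W) (hf : IsTest W f) :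
    IsTest W (fun x => c x * f x) := by
  have hs : tsupport (fun x => c x * f x) ⊆ tsupport f :=
    closure_mono fun x hx => by
      simp only [Function.mem_support] at hx ⊢
      exact right_ne_zero_of_mul hx
  exact ⟨contDiff_of_contDiffOn_of_tsupport hW (hc.mul hf.contDiff.contDiffOn)
    (hs.trans hf.tsupport_subset), hf.hasCompactSupport.of_isClosed_subset
      (isClosed_tsupport _) hs, hs.trans hf.tsupport_subset⟩

theorem mul (hf : IsTest W f) {c : E → ℂ} (hc : ContDiff ℝ ∞ c) :
    IsTest W (fun x => f x * c x) := by
  have hs : tsupport (fun x => f x * c x) ⊆ tsupport f :=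
    closure_mono fun x hx => by
      simp only [Function.mem_support] at hx ⊢
      exact left_ne_zero_of_mul hx
  exact ⟨hf.contDiff.mul hc, hf.hasCompactSupport.of_isClosed_subset
      (isClosed_tsupport _) hs, hs.trans hf.tsupport_subset⟩

theorem add (hf : IsTest W f) (hg : IsTest W g) : IsTest W (f + g) :=
  ⟨hf.contDiff.add hg.contDiff, hf.hasCompactSupport.add hg.hasCompactSupport,
    (tsupport_add f g).trans (union_subset hf.tsupport_subset hg.tsupport_subset)⟩

theorem zero : IsTest W (0 : E → ℂ) :=
  ⟨contDiff_const, HasCompactSupport.zero, by simp⟩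

theorem conj_comp (hf : IsTest W f) : IsTest W (fun x => conj (f x)) := by
  have hs : tsupport (fun x => (starRingEnd ℂ) (f x)) ⊆ tsupport f :=
    closure_mono fun x hx => by simpa using hx
  exact ⟨conjCLE.contDiff.comp hf.contDiff, hf.hasCompactSupport.of_isClosed_subset
      (isClosed_tsupport _) hs, hs.trans hf.tsupport_subset⟩

theorem dbar (hf : IsTest W f) (v : E) : IsTest W (dbar v f) :=
  ⟨hf.contDiff.dbar v, hf.hasCompactSupport.dbar v,
    (tsupport_dbar_subset v f).trans hf.tsupport_subset⟩

theorem del (hf : IsTest W f) (v : E) : IsTest W (del v f) :=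
  ⟨hf.contDiff.del v, hf.hasCompactSupport.del v,
    (tsupport_del_subset v f).trans hf.tsupport_subset⟩

theorem memLp [MeasurableSpace E] [BorelSpace E] {μ : MeasureTheory.Measure E}
    [MeasureTheory.IsFiniteMeasureOnCompacts μ] (hf : IsTest W f) :
    MeasureTheory.MemLp f 2 μ :=
  hf.continuous.memLp_of_hasCompactSupport hf.hasCompactSupport

theorem mul_memLp [MeasurableSpace E] [BorelSpace E] {μ : MeasureTheory.Measure E}
    (hf : IsTest W f) {β : E → ℂ} (hβ : MeasureTheory.MemLp β 2 μ) :
    MeasureTheory.MemLp (fun x => f x * β x) 2 μ := by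
  obtain ⟨M, hM⟩ := hf.continuous.bounded_above_of_compact_support hf.hasCompactSupport
  refine MeasureTheory.MemLp.of_le_mul (c := M) hβ
    (hf.continuous.aestronglyMeasurable.mul hβ.1) (Filter.Eventually.of_forall fun x => ?_)
  rw [norm_mul]; gcongr; exact hM x

end IsTest

theorem exists_cutoff [FiniteDimensional ℂ E] {L W : Set E} (hL : IsCompact L) (hW : IsOpen W)
    (hLW : L ⊆ W) : ∃ χ : E → ℝ, ContDiff ℝ ∞ χ ∧ HasCompactSupport χ ∧ tsupport χ ⊆ W ∧
      (∀ᶠ x in 𝓝ˢ L, χ x = 1) ∧ ∀ x, χ x ∈ Icc (0 : ℝ) 1 := by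
  have : FiniteDimensional ℝ E := FiniteDimensional.complexToReal E
  obtain ⟨δ, hδ, hδW⟩ := hL.exists_cthickening_subset_open hW hLW
  obtain ⟨f, h1, h0, hf⟩ := exists_contMDiffMap_one_nhds_of_subset_interior 𝓘(ℝ, E)
    (n := ⊤) (s := L) (t := cthickening δ L) hL.isClosed
    ((self_subset_thickening hδ L).trans
      (interior_maximal (thickening_subset_cthickening δ L) isOpen_thickening))
  have hs : tsupport f ⊆ cthickening δ L :=
    closure_minimal (fun x hx => by by_contra h; exact hx (h0 x h)) isClosed_cthickening
  have : ProperSpace E := FiniteDimensional.proper_rclike ℂ E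
  exact ⟨f, f.contMDiff.contDiff, hL.cthickening.of_isClosed_subset (isClosed_tsupport _) hs,
    hs.trans hδW, h1, hf⟩

end TestFunction

section Hormander

open MeasureTheory Filter Topology
open scoped ContDiff ComplexConjugate

variable {E : Type*} [NormedAddCommGroup E] [NormedSpace ℂ E]

theorem fderiv_ofReal_comp {w : E → ℝ} {x : E} (hw : DifferentiableAt ℝ w x) (v : E) :
    fderiv ℝ (fun z => (w z : ℂ)) x v = (fderiv ℝ w x v : ℂ) := by
  have := (ofRealCLM.hasFDerivAt.comp x hw.hasFDerivAt).fderiv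
  change fderiv ℝ (ofRealCLM ∘ w) x v = _
  rw [this]; simp

theorem norm_dbar_ofReal (η : E → ℝ) (v x : E) :
    ‖dbar v (fun z => (η z : ℂ)) x‖ = ‖del v (fun z => (η z : ℂ)) x‖ := by
  rw [← Complex.norm_conj, conj_dbar]; simp

theorem del_exp_ofReal {w : E → ℝ} {x : E} (hw : DifferentiableAt ℝ w x) (v : E) :
    del v (fun z => (Real.exp (w z) : ℂ)) x = Real.exp (w x) * del v (fun z => (w z : ℂ)) x := by
  simp only [del, fderiv_ofReal_comp hw, fderiv_ofReal_comp hw.exp, fderiv_exp hw]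
  simp; ring

theorem norm_sum_mul_sq_le {ι : Type*} [Fintype ι] (a b : ι → ℂ) :
    ‖∑ j, a j * b j‖ ^ 2 ≤ (∑ j, ‖a j‖ ^ 2) * ∑ j, ‖b j‖ ^ 2 := by
  calc ‖∑ j, a j * b j‖ ^ 2 ≤ (∑ j, ‖a j‖ * ‖b j‖) ^ 2 := by
        gcongr
        exact (norm_sum_le _ _).trans_eq (by simp)
    _ ≤ _ := Finset.sum_mul_sq_le_sq_mul_sq _ _ _

theorem norm_add_add_sq_le (a b c : ℂ) : ‖a + b + c‖ ^ 2 ≤ 3 * (‖a‖ ^ 2 + ‖b‖ ^ 2 + ‖c‖ ^ 2) := by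
  have h1 : ‖a + b + c‖ ^ 2 ≤ (‖a‖ + ‖b‖ + ‖c‖) ^ 2 := by gcongr; exact norm_add₃_le
  nlinarith [sq_nonneg (‖a‖ - ‖b‖), sq_nonneg (‖b‖ - ‖c‖), sq_nonneg (‖a‖ - ‖c‖)]

theorem sum_sum_norm_sub_sq_le {ι : Type*} [Fintype ι] (a b : ι → ℂ) :
    (∑ j, ∑ k, ‖a k * b j - a j * b k‖ ^ 2) / 2 ≤ 2 * ((∑ j, ‖a j‖ ^ 2) * ∑ j, ‖b j‖ ^ 2) := by
  have h1 : ∀ j k, ‖a k * b j - a j * b k‖ ^ 2 ≤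
      2 * (‖a k‖ ^ 2 * ‖b j‖ ^ 2) + 2 * (‖a j‖ ^ 2 * ‖b k‖ ^ 2) := fun j k => by
    have := norm_sub_le (a k * b j) (a j * b k)
    simp only [norm_mul] at this
    have h2 : ‖a k * b j - a j * b k‖ ^ 2 ≤ (‖a k‖ * ‖b j‖ + ‖a j‖ * ‖b k‖) ^ 2 := by gcongr
    nlinarith [sq_nonneg (‖a k‖ * ‖b j‖ - ‖a j‖ * ‖b k‖)]
  have h2 : ∑ j, ∑ k, ‖a k * b j - a j * b k‖ ^ 2 ≤
      ∑ j, ∑ k, (2 * (‖a k‖ ^ 2 * ‖b j‖ ^ 2) + 2 * (‖a j‖ ^ 2 * ‖b k‖ ^ 2)) :=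
    Finset.sum_le_sum fun j _ => Finset.sum_le_sum fun k _ => h1 j k
  have h3 : ∑ j, ∑ k, (2 * (‖a k‖ ^ 2 * ‖b j‖ ^ 2) + 2 * (‖a j‖ ^ 2 * ‖b k‖ ^ 2)) =
      4 * ((∑ j, ‖a j‖ ^ 2) * ∑ j, ‖b j‖ ^ 2) := by
    simp only [Finset.sum_add_distrib, ← Finset.mul_sum, ← Finset.sum_mul]
    ring
  linarith

variable [FiniteDimensional ℂ E]
  [MeasurableSpace E] [BorelSpace E] {μ : Measure E} [μ.IsAddHaarMeasure]

theorem integral_dbar_dbar_sub {f u : E → ℂ} (hf : ContDiff ℝ ∞ f) (hfc : HasCompactSupport f)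
    (hu : ContDiff ℝ ∞ u) (v w : E) :
    ∫ x, (dbar w u x * dbar v f x - dbar v u x * dbar w f x) ∂μ = 0 := by
  have i : ∀ v w, Integrable (fun x => dbar w u x * dbar v f x) μ := fun v w =>
    ((hu.dbar w).continuous.mul (hf.dbar v).continuous).integrable_of_hasCompactSupport
      (hfc.dbar v).mul_left
  have key : ∀ v w, ∫ x, dbar w u x * dbar v f x ∂μ = - ∫ x, f x * dbar v (dbar w u) x ∂μ :=
    fun v w => by
      rw [← integral_dbar_mul hf (hu.dbar w) hfc]
      exact integral_congr_ae (Eventually.of_forall fun x => mul_comm _ _)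
  rw [integral_sub (i _ _) (i _ _), key, key]
  simp_rw [dbar_dbar_comm (hu.contDiffAt_two _) v w]
  ring

/-- The a priori estimate for one cut-off function, with globally smooth weights. -/
theorem hormander_cutoff_aux {ι : Type*} [Fintype ι] (e : ι → E) {φ ψ η : E → ℝ} {V : Set E}
    (hφ : ContDiff ℝ ∞ φ) (hψ : ContDiff ℝ ∞ ψ) (hη : ContDiff ℝ ∞ η) (hηc : HasCompactSupport η)
    (hη01 : ∀ x, η x ∈ Icc (0 : ℝ) 1) (hV : IsOpen V) (hηV : tsupport η ⊆ V)
    (hlevi : ∀ x ∈ V, ∀ c : ι → ℂ,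
      (3 * ∑ j, ‖del (e j) (fun z => (ψ z : ℂ)) x‖ ^ 2 + 3 * Real.exp (ψ x)) * ∑ j, ‖c j‖ ^ 2 ≤
        leviForm φ x (∑ j, c j • e j))
    {a β : ι → E → ℂ} (ha : ∀ j, IsTest univ (a j)) (hβ : ∀ j, MemLp (β j) 2 μ)
    (hK : ∀ f, IsTest univ f → tsupport f ⊆ tsupport η → ∀ j k,
      ∫ x, (Real.exp ((φ x - ψ x) / 2) : ℂ) * (β k x * dbar (e j) f x - β j x * dbar (e k) f x) ∂μ
        = 0)
    (hU : ∀ h, IsTest univ h → tsupport h ⊆ tsupport η →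
      ∫ x, ∑ j, del (e j) h x * a j x ∂μ =
        ∫ x, ∑ j, (Real.exp (-((φ x - ψ x) / 2)) : ℂ) * del (e j) h x * β j x ∂μ)
    {ε : ℝ} (hε0 : 0 ≤ ε) (hε : ∀ x ∈ tsupport η,
      (∑ j, ‖del (e j) (fun z => (η z : ℂ)) x‖ ^ 2) * Real.exp (-ψ x) ≤ ε) :
    3 * ∫ x, η x ^ 2 * ∑ j, ‖β j x‖ ^ 2 ∂μ ≤
      3 * ∫ x, Real.exp (φ x - 2 * ψ x) * ‖∑ j, del (e j) (a j) x‖ ^ 2 ∂μ +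
        5 * ε * ∫ x, ∑ j, ‖β j x‖ ^ 2 ∂μ := by
  let ηc : E → ℂ := fun x => (η x : ℂ)
  have hηcs : ContDiff ℝ ∞ ηc := ofRealCLM.contDiff.comp hη
  have hsupp : tsupport ηc = tsupport η := by
    simp only [tsupport, ηc]; congr 1; ext x; simp
  have hηt : IsTest univ ηc := ⟨hηcs, by rw [HasCompactSupport, hsupp]; exact hηc, subset_univ _⟩
  let w : E → ℝ := fun x => (φ x - ψ x) / 2
  have hw : ContDiff ℝ ∞ w := (hφ.sub hψ).div_const 2
  let ew : E → ℂ := fun x => (Real.exp (w x) : ℂ)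
  let ewi : E → ℂ := fun x => (Real.exp (-w x) : ℂ)
  have hew : ContDiff ℝ ∞ ew := ofRealCLM.contDiff.comp hw.exp
  have hewi : ContDiff ℝ ∞ ewi := ofRealCLM.contDiff.comp hw.neg.exp
  have hinv : ∀ x, ewi x * ew x = 1 := fun x => by
    simp only [ew, ewi]; rw [← ofReal_mul, ← Real.exp_add]; simp
  let τ : E → ℂ := fun x => ηc x * (ew x * ew x)
  have hτ : IsTest univ τ := hηt.mul (hew.mul hew)
  have hτs : tsupport τ ⊆ tsupport η := by
    rw [← hsupp]; exact closure_mono fun x hx => left_ne_zero_of_mul hx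
  let dv : E → ℂ := fun x => ∑ j, del (e j) (a j) x
  have hdv : ContDiff ℝ ∞ dv := ContDiff.sum fun j _ => (ha j).contDiff.del (e j)
  let b : ι → E → ℂ := fun j x => ηc x * ew x * β j x
  let σ : E → ℂ := fun x => τ x * dv x + ∑ j, del (e j) τ x * ewi x * β j x
  let θ : ι → ι → E → ℂ := fun j k x =>
    ew x * (β k x * dbar (e j) ηc x - β j x * dbar (e k) ηc x)
  have hb : ∀ j, MemLp (b j) 2 μ := fun j => (hηt.mul hew).mul_memLp (hβ j)
  have hσ : MemLp σ 2 μ := ((hτ.mul hdv).memLp).add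
    (memLp_finsetSum _ fun j _ => ((hτ.del (e j)).mul hewi).mul_memLp (hβ j))
  have hθ : ∀ j k, MemLp (θ j k) 2 μ := fun j k => by
    have h1 := (((hηt.dbar (e j)).mul hew).mul_memLp (hβ k)).sub
      (((hηt.dbar (e k)).mul hew).mul_memLp (hβ j))
    refine h1.ae_eq (Eventually.of_forall fun x => ?_)
    simp only [θ, Pi.sub_apply]; ring
  have zη : ∀ x, x ∉ tsupport η → ηc x = 0 := fun x hx =>
    image_eq_zero_of_notMem_tsupport (by rwa [hsupp])
  have zd : ∀ v x, x ∉ tsupport η → dbar v ηc x = 0 := fun v x hx =>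
    image_eq_zero_of_notMem_tsupport fun h => hx (hsupp ▸ tsupport_dbar_subset v ηc h)
  have zdl : ∀ v x, x ∉ tsupport η → del v ηc x = 0 := fun v x hx =>
    image_eq_zero_of_notMem_tsupport fun h => hx (hsupp ▸ tsupport_del_subset v ηc h)
  have zτ : ∀ v x, x ∉ tsupport η → del v τ x = 0 := fun v x hx =>
    image_eq_zero_of_notMem_tsupport fun h => hx (hτs (tsupport_del_subset v τ h))
  have hψc : ContDiff ℝ ∞ (fun z => (ψ z : ℂ)) := ofRealCLM.contDiff.comp hψ
  have key := integral_weighted_le_of_weak (μ := μ) e (φ := φ)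
    (m := fun x => 3 * ∑ j, ‖del (e j) (fun z => (ψ z : ℂ)) x‖ ^ 2 + 3 * Real.exp (ψ x))
    hφ ((continuous_const.mul (continuous_finsetSum _ fun j _ =>
        ((hψc.del (e j)).continuous.norm.pow 2))).add
      (continuous_const.mul hψ.exp.continuous))
    (fun x => by positivity) hηc hV hηV hlevi hb hσ hθ
    (fun j x hx => by simp [b, zη x hx]) (fun x hx => by simp [σ, τ, zη x hx, zτ _ x hx])
    (fun j k x hx => by simp [θ, zd _ x hx]) ?_ ?_
  · -- pointwise analysis
    have hσe : ∀ x, σ x - ∑ j, b j x * del (e j) (fun z => (φ z : ℂ)) x =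
        ew x * (ηc x * ew x * dv x + ∑ j, β j x * del (e j) ηc x +
          -(ηc x * ∑ j, β j x * del (e j) (fun z => (ψ z : ℂ)) x)) := fun x => by
      have dφ : DifferentiableAt ℝ φ x := hφ.differentiable (by simp) x
      have dψ : DifferentiableAt ℝ ψ x := hψ.differentiable (by simp) x
      have dw : DifferentiableAt ℝ w x := hw.differentiable (by simp) x
      have dew : DifferentiableAt ℝ ew x := hew.differentiable (by simp) x
      have hdw : ∀ v, del v (fun z => (w z : ℂ)) x =
          (del v (fun z => (φ z : ℂ)) x - del v (fun z => (ψ z : ℂ)) x) / 2 := fun v => by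
        simp only [del, fderiv_ofReal_comp dw, fderiv_ofReal_comp dφ, fderiv_ofReal_comp dψ]
        have h1 : ∀ v, fderiv ℝ w x v = (fderiv ℝ φ x v - fderiv ℝ ψ x v) * 2⁻¹ := fun v => by
          have := ((dφ.hasFDerivAt.sub dψ.hasFDerivAt).mul_const (2⁻¹ : ℝ)).fderiv
          have h2 : w = fun x => (φ x - ψ x) * 2⁻¹ := funext fun y => div_eq_mul_inv _ _
          rw [h2]
          erw [this]
          simp [mul_comm]
        simp only [h1]
        push_cast; ring
      have hdτ : ∀ v, del v τ x * ewi x = ew x * (del v ηc x + ηc x *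
          (del v (fun z => (φ z : ℂ)) x - del v (fun z => (ψ z : ℂ)) x)) := fun v => by
        have h1 : del v τ x = del v ηc x * (ew x * ew x) + ηc x * (del v ew x * ew x +
            ew x * del v ew x) := by
          rw [← del_mul v dew dew]
          exact del_mul v hηt.differentiableAt (dew.mul dew)
        have h2 : del v ew x = ew x * del v (fun z => (w z : ℂ)) x := del_exp_ofReal dw v
        rw [h1, h2, hdw]
        linear_combination (ew x * (del v ηc x + ηc x *
          (del v (fun z => (φ z : ℂ)) x - del v (fun z => (ψ z : ℂ)) x))) * hinv x
      simp only [σ, hdτ, b, τ, Finset.mul_sum, mul_add, ← Finset.sum_neg_distrib,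
        add_sub_assoc, add_assoc]
      rw [← Finset.sum_sub_distrib, ← Finset.sum_add_distrib]
      congr 1
      · ring
      · exact Finset.sum_congr rfl fun j _ => by ring
    have hewn : ∀ x, ‖ew x‖ ^ 2 = Real.exp (φ x - ψ x) := fun x => by
      simp only [ew, norm_real, Real.norm_eq_abs, abs_of_pos (Real.exp_pos _)]
      rw [← Real.exp_nat_mul]; congr 1; simp only [w]; push_cast; ring
    have hηn : ∀ x, ‖ηc x‖ = η x := fun x => by
      simp [ηc, abs_of_nonneg (hη01 x).1]
    let Q : E → ℝ := fun x => η x ^ 2 * ∑ j, ‖β j x‖ ^ 2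
    let P : E → ℝ := fun x => η x ^ 2 * (∑ j, ‖β j x‖ ^ 2) *
      (∑ j, ‖del (e j) (fun z => (ψ z : ℂ)) x‖ ^ 2) * Real.exp (-ψ x)
    let R : E → ℝ := fun x => Real.exp (φ x - 2 * ψ x) * ‖dv x‖ ^ 2
    let S : E → ℝ := fun x => ∑ j, ‖β j x‖ ^ 2
    have iS : Integrable S μ := integrable_finsetSum _ fun j _ => integrable_sq_norm (hβ j)
    have iQ : Integrable Q μ := by
      have : ∀ x, Q x = ∑ j, ‖ηc x * β j x‖ ^ 2 := fun x => by
        simp [Q, Finset.mul_sum, mul_pow, hηn]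
      simp_rw [show Q = fun x => ∑ j, ‖ηc x * β j x‖ ^ 2 from funext this]
      exact integrable_finsetSum _ fun j _ => integrable_sq_norm (hηt.mul_memLp (hβ j))
    have iP : Integrable P μ := by
      have : P = fun x => ∑ k, ∑ j, ‖(ηc x * (del (e k) (fun z => (ψ z : ℂ)) x *
          (Real.exp (-ψ x / 2) : ℂ))) * β j x‖ ^ 2 := funext fun x => by
        have h1 : Real.exp (-ψ x / 2) ^ 2 = Real.exp (-ψ x) := by
          rw [← Real.exp_nat_mul]; congr 1; push_cast; ring
        simp only [norm_mul, mul_pow, hηn, ← Finset.mul_sum, ← Finset.sum_mul, norm_real,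
          Real.norm_eq_abs, sq_abs, h1, P]
        ring
      rw [this]
      exact integrable_finsetSum _ fun k _ => integrable_finsetSum _ fun j _ =>
        integrable_sq_norm ((hηt.mul ((hψc.del (e k)).mul
          (ofRealCLM.contDiff.comp (hψ.neg.div_const 2).exp))).mul_memLp (hβ j))
    have iR : Integrable R μ := by
      refine Continuous.integrable_of_hasCompactSupport ?_ ?_
      · exact (hφ.sub (contDiff_const.mul hψ)).exp.continuous.mul (hdv.continuous.norm.pow 2)
      · have : HasCompactSupport dv := by
          have h2 : IsTest univ dv := by
            have : dv = ∑ j, del (e j) (a j) := by ext x; simp [dv]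
            rw [this]
            exact Finset.sum_induction _ (IsTest univ) (fun _ _ h h' => h.add h') IsTest.zero
              fun j _ => (ha j).del (e j)
          exact h2.hasCompactSupport
        exact (this.comp_left (g := fun z : ℂ => ‖z‖ ^ 2) (by simp)).mul_left
    have hl : ∀ x, (3 * ∑ j, ‖del (e j) (fun z => (ψ z : ℂ)) x‖ ^ 2 + 3 * Real.exp (ψ x)) *
        (∑ j, ‖b j x‖ ^ 2) * Real.exp (-φ x) = 3 * P x + 3 * Q x := fun x => by
      simp only [b, norm_mul, mul_pow, hηn, hewn, ← Finset.mul_sum, P, Q]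
      have h1 : Real.exp (φ x - ψ x) * Real.exp (-φ x) = Real.exp (-ψ x) := by
        rw [← Real.exp_add]; congr 1; ring
      have h2 : Real.exp (ψ x) * Real.exp (-ψ x) = 1 := by rw [← Real.exp_add]; simp
      linear_combination ((3 * ∑ j, ‖del (e j) (fun z => (ψ z : ℂ)) x‖ ^ 2 + 3 * Real.exp (ψ x)) *
        η x ^ 2 * ∑ j, ‖β j x‖ ^ 2) * h1 + (3 * η x ^ 2 * ∑ j, ‖β j x‖ ^ 2) * h2
    have hr : ∀ x, (‖σ x - ∑ j, b j x * del (e j) (fun z => (φ z : ℂ)) x‖ ^ 2 +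
        (∑ j, ∑ k, ‖θ j k x‖ ^ 2) / 2) * Real.exp (-φ x) ≤
        3 * R x + 5 * ε * S x + 3 * P x := fun x => by
      set dη := ∑ j, ‖del (e j) ηc x‖ ^ 2 with hdη
      set dψ := ∑ j, ‖del (e j) (fun z => (ψ z : ℂ)) x‖ ^ 2 with hdψ
      have h1 : Real.exp (φ x - ψ x) * Real.exp (-φ x) = Real.exp (-ψ x) := by
        rw [← Real.exp_add]; congr 1; ring
      have h2 : Real.exp (φ x - ψ x) * Real.exp (-ψ x) = Real.exp (φ x - 2 * ψ x) := by
        rw [← Real.exp_add]; congr 1; ring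
      have hSn : 0 ≤ S x := by positivity
      have a1 : ‖σ x - ∑ j, b j x * del (e j) (fun z => (φ z : ℂ)) x‖ ^ 2 ≤
          Real.exp (φ x - ψ x) * (3 * (η x ^ 2 * Real.exp (φ x - ψ x) * ‖dv x‖ ^ 2 +
            S x * dη + η x ^ 2 * (S x * dψ))) := by
        rw [hσe, norm_mul, mul_pow, hewn]
        refine mul_le_mul_of_nonneg_left ((norm_add_add_sq_le _ _ _).trans ?_) (Real.exp_pos _).le
        gcongr
        · simp only [norm_mul, mul_pow, hηn, hewn]; exact le_rfl
        · exact norm_sum_mul_sq_le _ _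
        · rw [norm_neg, norm_mul, mul_pow, hηn]
          gcongr
          exact norm_sum_mul_sq_le _ _
      have a2 : (∑ j, ∑ k, ‖θ j k x‖ ^ 2) / 2 ≤ Real.exp (φ x - ψ x) * (2 * (S x * dη)) := by
        have e1 : ∑ j, ‖dbar (e j) ηc x‖ ^ 2 = dη :=
          Finset.sum_congr rfl fun j _ => by rw [norm_dbar_ofReal]
        have := sum_sum_norm_sub_sq_le (fun j => β j x) (fun j => dbar (e j) ηc x)
        rw [e1] at this
        simp only [θ, norm_mul, mul_pow, hewn, ← Finset.mul_sum]
        rw [mul_div_assoc]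
        exact mul_le_mul_of_nonneg_left this (Real.exp_pos _).le
      have a3 : dη * Real.exp (-ψ x) ≤ ε ∨ dη = 0 := by
        by_cases hx : x ∈ tsupport η
        · exact Or.inl (hε x hx)
        · right; simp [hdη, zdl _ x hx]
      have a4 : S x * (dη * Real.exp (-ψ x)) ≤ S x * ε := by
        rcases a3 with h | h
        · gcongr
        · rw [h, zero_mul, mul_zero]; positivity
      have a5 : η x ^ 2 ≤ 1 := pow_le_one₀ (hη01 x).1 (hη01 x).2
      calc _ ≤ (Real.exp (φ x - ψ x) * (3 * (η x ^ 2 * Real.exp (φ x - ψ x) * ‖dv x‖ ^ 2 +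
            S x * dη + η x ^ 2 * (S x * dψ))) + Real.exp (φ x - ψ x) * (2 * (S x * dη))) *
            Real.exp (-φ x) := by gcongr
        _ = 3 * (η x ^ 2 * R x) + 5 * (S x * (dη * Real.exp (-ψ x))) + 3 * P x := by
          simp only [R, P, ← h2, ← h1, S]; ring
        _ ≤ 3 * (1 * R x) + 5 * (S x * ε) + 3 * P x := by gcongr
        _ = _ := by ring
    have l1 := integral_mono_of_nonneg (μ := μ) (Eventually.of_forall fun x => by positivity)
      (((iR.const_mul 3).add (iS.const_mul (5 * ε))).add (iP.const_mul 3))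
      (Eventually.of_forall hr)
    simp_rw [hl] at key
    have l2 := key.trans l1
    simp only [Pi.add_apply] at l2
    rw [integral_add (iP.const_mul 3) (iQ.const_mul 3),
      integral_add (show Integrable (fun x => 3 * R x + 5 * ε * S x) μ from
        (iR.const_mul 3).add (iS.const_mul (5 * ε))) (iP.const_mul 3),
      integral_add (iR.const_mul 3) (iS.const_mul (5 * ε))] at l2
    simp only [integral_const_mul] at l2
    linarith
  · -- the divergence equation
    intro f hf hfc
    have hh : IsTest univ (fun x => τ x * f x) := hτ.mul hf
    have h1 := hU _ hh ((closure_mono fun x hx => left_ne_zero_of_mul hx).trans hτs)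
    have h2 : ∀ j, ∫ x, del (e j) (fun x => τ x * f x) x * a j x ∂μ =
        - ∫ x, τ x * f x * del (e j) (a j) x ∂μ := fun j =>
      integral_del_mul hh.contDiff (ha j).contDiff hh.hasCompactSupport (e j)
    rw [integral_finsetSum _ fun j _ => ((((hh.del (e j)).mul (ha j).contDiff)).continuous
      |>.integrable_of_hasCompactSupport (((hh.del (e j)).mul (ha j).contDiff)).hasCompactSupport)] at h1
    simp_rw [h2] at h1
    rw [Finset.sum_neg_distrib, ← integral_finsetSum _ fun j _ =>
      (((hh.mul ((ha j).contDiff.del (e j))).continuous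
      |>.integrable_of_hasCompactSupport (hh.mul ((ha j).contDiff.del (e j))).hasCompactSupport))]
      at h1
    have hft : IsTest univ f := ⟨hf, hfc, subset_univ _⟩
    have im : ∀ {u v : E → ℂ}, MemLp u 2 μ → MemLp v 2 μ → Integrable (fun x => u x * v x) μ :=
      fun hu hv => hu.integrable_mul hv
    have i1 : Integrable (fun t => ∑ j, b j t * del (e j) f t) μ :=
      integrable_finsetSum _ fun j _ => im (hb j) (hft.del (e j)).memLp
    have i2 : Integrable (fun t => σ t * f t) μ := im hσ hft.memLp
    have i3 : Integrable (fun x => ∑ j, τ x * f x * del (e j) (a j) x) μ :=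
      integrable_finsetSum _ fun j _ => im hh.memLp ((ha j).del (e j)).memLp
    have e1 : ∀ x, ∑ j, (Real.exp (-((φ x - ψ x) / 2)) : ℂ) * del (e j) (fun x => τ x * f x) x *
        β j x = (∑ j, b j x * del (e j) f x + σ x * f x) -
          ∑ j, τ x * f x * del (e j) (a j) x := fun x => by
      have d1 : ∀ j, del (e j) (fun x => τ x * f x) x = del (e j) τ x * f x + τ x * del (e j) f x :=
        fun j => del_mul _ hτ.differentiableAt hft.differentiableAt
      simp only [d1, σ, b, dv, add_mul, Finset.sum_mul, Finset.mul_sum]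
      rw [← Finset.sum_add_distrib, ← Finset.sum_add_distrib, ← Finset.sum_sub_distrib]
      refine Finset.sum_congr rfl fun j _ => ?_
      change ewi x * _ * β j x = _
      simp only [τ]
      linear_combination (ηc x * ew x * del (e j) f x * β j x) * hinv x
    simp_rw [e1] at h1
    rw [integral_sub (show Integrable (fun x => ∑ j, b j x * del (e j) f x + σ x * f x) μ from
      i1.add i2) i3, integral_add i1 i2] at h1
    linear_combination -h1
  · -- the curl equation
    intro f hf hfc j k
    have hft : IsTest univ f := ⟨hf, hfc, subset_univ _⟩
    have hh : IsTest univ (fun x => ηc x * f x) := hηt.mul hf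
    have h1 := hK _ hh ((closure_mono fun x hx => left_ne_zero_of_mul hx).trans hsupp.le) j k
    have im : ∀ {u v : E → ℂ}, MemLp u 2 μ → MemLp v 2 μ → Integrable (fun x => u x * v x) μ :=
      fun hu hv => hu.integrable_mul hv
    have e1 : ∀ x, (Real.exp ((φ x - ψ x) / 2) : ℂ) *
        (β k x * dbar (e j) (fun x => ηc x * f x) x - β j x * dbar (e k) (fun x => ηc x * f x) x) =
        (b k x * dbar (e j) f x - b j x * dbar (e k) f x) + θ j k x * f x := fun x => by
      simp only [dbar_mul _ hηt.differentiableAt hft.differentiableAt]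
      change ew x * _ = _
      simp only [b, θ]; ring
    simp_rw [e1] at h1
    rw [integral_add (show Integrable (fun x => b k x * dbar (e j) f x - b j x * dbar (e k) f x) μ
      from (im (hb k) (hft.dbar (e j)).memLp).sub (im (hb j) (hft.dbar (e k)).memLp))
      (im (hθ j k) hft.memLp)] at h1
    linear_combination h1

end Hormander

section HormanderSolution

open MeasureTheory Filter Topology
open scoped ContDiff ComplexConjugate

variable {E : Type*} [NormedAddCommGroup E] [NormedSpace ℂ E]

theorem dbar_congr_of_eventuallyEq {f g : E → ℂ} {x : E} (h : f =ᶠ[𝓝 x] g) (v : E) :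
    dbar v f x = dbar v g x := by simp only [dbar, h.fderiv_eq]

theorem del_congr_of_eventuallyEq {f g : E → ℂ} {x : E} (h : f =ᶠ[𝓝 x] g) (v : E) :
    del v f x = del v g x := by simp only [del, h.fderiv_eq]

theorem leviForm_congr_of_eventuallyEq {f g : E → ℝ} {x : E} (h : f =ᶠ[𝓝 x] g) (v : E) :
    leviForm f x v = leviForm g x v := by
  simp only [leviForm, (h.iteratedFDeriv ℝ 2).eq_of_nhds]

/-- Weights and cut-off functions suitable for the twisted `L²` method on an open set. -/
structure HormanderData {ι : Type*} [Fintype ι] (e : ι → E) (W : Set E) (φ ψ : E → ℝ)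
    (η : ℕ → E → ℝ) (ε : ℕ → ℝ) : Prop where
  isOpen : IsOpen W
  contDiffOn_left : ContDiffOn ℝ ∞ φ W
  contDiffOn_right : ContDiffOn ℝ ∞ ψ W
  levi : ∀ x ∈ W, ∀ c : ι → ℂ,
      (3 * ∑ j, ‖del (e j) (fun z => (ψ z : ℂ)) x‖ ^ 2 + 3 * Real.exp (ψ x)) * ∑ j, ‖c j‖ ^ 2 ≤
        leviForm φ x (∑ j, c j • e j)
  contDiff : ∀ n, ContDiff ℝ ∞ (η n)
  compact : ∀ n, HasCompactSupport (η n)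
  tsupport_subset : ∀ n, tsupport (η n) ⊆ W
  mem_Icc : ∀ n x, η n x ∈ Icc (0 : ℝ) 1
  tendsto : ∀ x ∈ W, Tendsto (fun n => η n x) atTop (𝓝 1)
  eps_nonneg : ∀ n, 0 ≤ ε n
  eps_tendsto : Tendsto ε atTop (𝓝 0)
  gradient_le : ∀ n, ∀ x ∈ W,
    (∑ j, ‖del (e j) (fun z => (η n z : ℂ)) x‖ ^ 2) * Real.exp (-ψ x) ≤ ε n

variable [FiniteDimensional ℂ E]
  [MeasurableSpace E] [BorelSpace E] {μ : Measure E} [μ.IsAddHaarMeasure]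
  {ι : Type*} [Fintype ι] {e : ι → E} {W : Set E} {φ ψ : E → ℝ} {η : ℕ → E → ℝ} {ε : ℕ → ℝ}

namespace HormanderData

theorem contDiffOn_exp (h : HormanderData e W φ ψ η ε) (a b : ℝ) :
    ContDiffOn ℝ ∞ (fun x => (Real.exp (a * φ x + b * ψ x) : ℂ)) W :=
  ofRealCLM.contDiff.comp_contDiffOn
    ((contDiffOn_const.mul h.contDiffOn_left).add (contDiffOn_const.mul h.contDiffOn_right)).exp

/-- The a priori estimate. -/
theorem integral_le (h : HormanderData e W φ ψ η ε) {a β : ι → E → ℂ}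
    (ha : ∀ j, IsTest W (a j)) (hβ : ∀ j, MemLp (β j) 2 μ) (hβW : ∀ j x, x ∉ W → β j x = 0)
    (hK : ∀ f, IsTest W f → ∀ j k,
      ∫ x, (Real.exp ((φ x - ψ x) / 2) : ℂ) * (β k x * dbar (e j) f x - β j x * dbar (e k) f x) ∂μ
        = 0)
    (hU : ∀ f, IsTest W f → ∫ x, ∑ j, del (e j) f x * a j x ∂μ =
        ∫ x, ∑ j, (Real.exp (-((φ x - ψ x) / 2)) : ℂ) * del (e j) f x * β j x ∂μ) :
    ∫ x, ∑ j, ‖β j x‖ ^ 2 ∂μ ≤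
      ∫ x, Real.exp (φ x - 2 * ψ x) * ‖∑ j, del (e j) (a j) x‖ ^ 2 ∂μ := by
  have iS : Integrable (fun x => ∑ j, ‖β j x‖ ^ 2) μ :=
    integrable_finsetSum _ fun j _ => integrable_sq_norm (hβ j)
  have key : ∀ n, 3 * ∫ x, η n x ^ 2 * ∑ j, ‖β j x‖ ^ 2 ∂μ ≤
      3 * ∫ x, Real.exp (φ x - 2 * ψ x) * ‖∑ j, del (e j) (a j) x‖ ^ 2 ∂μ +
        5 * ε n * ∫ x, ∑ j, ‖β j x‖ ^ 2 ∂μ := by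
    intro n
    have hL : IsCompact (tsupport (η n) ∪ ⋃ j, tsupport (a j)) :=
      (h.compact n).isCompact.union (isCompact_iUnion fun j => (ha j).hasCompactSupport)
    obtain ⟨χ, hχ, hχc, hχW, hχ1, -⟩ := exists_cutoff hL h.isOpen
      (union_subset (h.tsupport_subset n) (iUnion_subset fun j => (ha j).tsupport_subset))
    obtain ⟨V, hV, hLV, hVχ⟩ := mem_nhdsSet_iff_exists.1 hχ1
    have hVW : V ⊆ W := fun x hx => hχW (subset_tsupport χ (by
      have : χ x = 1 := hVχ hx
      simp [this]))
    have sm : ∀ {w : E → ℝ}, ContDiffOn ℝ ∞ w W → ContDiff ℝ ∞ (fun x => χ x * w x) := fun hw =>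
      contDiff_of_contDiffOn_of_tsupport h.isOpen (hχ.contDiffOn.mul hw)
        ((closure_mono fun x hx => left_ne_zero_of_mul hx).trans hχW)
    have hev : ∀ (w : E → ℝ), ∀ x ∈ V, χ x * w x = w x := fun w x hx => by
      have : χ x = 1 := hVχ hx
      rw [this, one_mul]
    have hevn : ∀ (w : E → ℝ), ∀ x ∈ V, (fun x => χ x * w x) =ᶠ[𝓝 x] w := fun w x hx =>
      (hV.eventually_mem hx).mono fun y hy => hev w y hy
    have hηV : tsupport (η n) ⊆ V := subset_union_left.trans hLV
    have main := hormander_cutoff_aux (μ := μ) e (sm h.contDiffOn_left) (sm h.contDiffOn_right)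
      (h.contDiff n) (h.compact n) (h.mem_Icc n) hV hηV (a := a) (β := β) ?_
      (fun j => ⟨(ha j).contDiff, (ha j).hasCompactSupport, subset_univ _⟩) hβ ?_ ?_
      (h.eps_nonneg n) ?_
    · refine main.trans_eq ?_
      congr 2
      refine integral_congr_ae (Eventually.of_forall fun x => ?_)
      by_cases hx : x ∈ V
      · simp only [hev _ x hx]
      · have : ∀ j, del (e j) (a j) x = 0 := fun j => image_eq_zero_of_notMem_tsupport fun hh =>
          hx (hLV (Or.inr (mem_iUnion.2 ⟨j, tsupport_del_subset _ _ hh⟩)))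
        simp [this]
    · intro x hx c
      have e1 : ∀ j, del (e j) (fun z => ((χ z * ψ z : ℝ) : ℂ)) x =
          del (e j) (fun z => (ψ z : ℂ)) x := fun j =>
        del_congr_of_eventuallyEq ((hevn ψ x hx).mono fun y hy => congrArg ofReal hy) _
      rw [leviForm_congr_of_eventuallyEq (hevn φ x hx)]
      simp only [e1, hev _ x hx]
      exact h.levi x (hVW hx) c
    · intro f hf hfs j k
      rw [← hK f ⟨hf.contDiff, hf.hasCompactSupport, hfs.trans (h.tsupport_subset n)⟩ j k]
      refine integral_congr_ae (Eventually.of_forall fun x => ?_)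
      by_cases hx : x ∈ V
      · simp only [hev _ x hx]
      · have : ∀ j, dbar (e j) f x = 0 := fun j => image_eq_zero_of_notMem_tsupport fun hh =>
          hx (hηV (hfs (tsupport_dbar_subset _ _ hh)))
        simp [this]
    · intro f hf hfs
      rw [hU f ⟨hf.contDiff, hf.hasCompactSupport, hfs.trans (h.tsupport_subset n)⟩]
      refine integral_congr_ae (Eventually.of_forall fun x => ?_)
      by_cases hx : x ∈ V
      · simp only [hev _ x hx]
      · have : ∀ j, del (e j) f x = 0 := fun j => image_eq_zero_of_notMem_tsupport fun hh =>
          hx (hηV (hfs (tsupport_del_subset _ _ hh)))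
        simp [this]
    · intro x hx
      rw [hev _ x (hηV hx)]
      exact h.gradient_le n x (h.tsupport_subset n hx)
  have lim1 : Tendsto (fun n => ∫ x, η n x ^ 2 * ∑ j, ‖β j x‖ ^ 2 ∂μ) atTop
      (𝓝 (∫ x, ∑ j, ‖β j x‖ ^ 2 ∂μ)) := by
    refine tendsto_integral_of_dominated_convergence (fun x => ∑ j, ‖β j x‖ ^ 2)
      (fun n => ((h.contDiff n).continuous.pow 2).aestronglyMeasurable.mul iS.1) iS
      (fun n => Eventually.of_forall fun x => ?_) (Eventually.of_forall fun x => ?_)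
    · have h0 : 0 ≤ ∑ j, ‖β j x‖ ^ 2 := by positivity
      rw [Real.norm_of_nonneg (mul_nonneg (sq_nonneg _) h0)]
      exact mul_le_of_le_one_left h0 (pow_le_one₀ (h.mem_Icc n x).1 (h.mem_Icc n x).2)
    · by_cases hx : x ∈ W
      · have := ((h.tendsto x hx).pow 2).mul_const (∑ j, ‖β j x‖ ^ 2)
        simpa using this
      · simp [hβW _ x hx]
  have lim2 := ((h.eps_tendsto.const_mul 5).mul_const (∫ x, ∑ j, ‖β j x‖ ^ 2 ∂μ)).const_add
    (3 * ∫ x, Real.exp (φ x - 2 * ψ x) * ‖∑ j, del (e j) (a j) x‖ ^ 2 ∂μ)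
  have := le_of_tendsto_of_tendsto (lim1.const_mul 3) lim2 (Eventually.of_forall key)
  simp only [mul_zero, zero_mul, add_zero] at this
  linarith

/-- Solution of the weak `∂̄`-equation with estimates. -/
theorem exists_solution (h : HormanderData e W φ ψ η ε) {u : E → ℂ} (hu : ContDiff ℝ ∞ u)
    (huL : ∀ j, MemLp (W.indicator fun x => (Real.exp ((ψ x - φ x) / 2) : ℂ) * dbar (e j) u x) 2 μ) :
    ∃ v : E → ℂ, MemLp v 2 μ ∧
      ∫ x, ‖v x‖ ^ 2 ∂μ ≤ ∫ x, ∑ j, ‖W.indicator (fun x => (Real.exp ((ψ x - φ x) / 2) : ℂ) *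
        dbar (e j) u x) x‖ ^ 2 ∂μ ∧
      ∀ f, IsTest W f → ∀ j,
        ∫ x, (u x - (Real.exp (φ x / 2 - ψ x) : ℂ) * v x) * dbar (e j) f x ∂μ = 0 := by
  classical
  set û : ι → E → ℂ := fun j => W.indicator fun x => (Real.exp ((ψ x - φ x) / 2) : ℂ) *
    dbar (e j) u x with hû
  have hs : ContDiffOn ℝ ∞ (fun x => (Real.exp ((ψ x - φ x) / 2) : ℂ)) W :=
    (h.contDiffOn_exp (-(1 / 2)) (1 / 2)).congr fun x _ => by congr 2; ring
  have hsi : ContDiffOn ℝ ∞ (fun x => (Real.exp ((φ x - ψ x) / 2) : ℂ)) W :=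
    (h.contDiffOn_exp (1 / 2) (-(1 / 2))).congr fun x _ => by congr 2; ring
  have hg : ContDiffOn ℝ ∞ (fun x => (Real.exp (φ x / 2 - ψ x) : ℂ)) W :=
    (h.contDiffOn_exp (1 / 2) (-1)).congr fun x _ => by congr 2; ring
  have hinv : ∀ x, (Real.exp ((φ x - ψ x) / 2) : ℂ) * Real.exp ((ψ x - φ x) / 2) = 1 := fun x => by
    rw [← ofReal_mul, ← Real.exp_add]
    simp only [ofReal_eq_one, Real.exp_eq_one_iff]
    ring
  -- elements orthogonal to the curl conditions
  let I := {f : E → ℂ // IsTest W f} × ι × ι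
  let κ : I → ι → E → ℂ := fun i l x => (Real.exp ((φ x - ψ x) / 2) : ℂ) *
    ((if l = i.2.2 then conj (dbar (e i.2.1) i.1.1 x) else 0) -
      (if l = i.2.1 then conj (dbar (e i.2.2) i.1.1 x) else 0))
  have hκt : ∀ i l, IsTest W (κ i l) := fun i l => by
    refine IsTest.mul_of_contDiffOn h.isOpen hsi ?_
    have t : ∀ v, IsTest W (fun x => conj (dbar v i.1.1 x)) := fun v => (i.1.2.dbar v).conj_comp
    have t' : ∀ v, IsTest W (fun x => -conj (dbar v i.1.1 x)) := fun v => by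
      simpa using (t v).mul (contDiff_const (c := (-1 : ℂ)))
    have t1 : IsTest W (fun x => if l = i.2.2 then conj (dbar (e i.2.1) i.1.1 x) else 0) := by
      by_cases h1 : l = i.2.2
      · simpa only [h1, if_true] using t _
      · simp only [h1, if_false]; exact IsTest.zero
    have t2 : IsTest W (fun x => -if l = i.2.1 then conj (dbar (e i.2.2) i.1.1 x) else 0) := by
      by_cases h1 : l = i.2.1
      · simpa only [h1, if_true] using t' _
      · simp only [h1, if_false, neg_zero]; exact IsTest.zero
    simp only [sub_eq_add_neg]
    exact t1.add t2
  have hκsum : ∀ (i : I) (γ : ι → E → ℂ) x, ∑ l, conj (κ i l x) * γ l x =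
      (Real.exp ((φ x - ψ x) / 2) : ℂ) * (γ i.2.2 x * dbar (e i.2.1) i.1.1 x -
        γ i.2.1 x * dbar (e i.2.2) i.1.1 x) := fun i γ x => by
    simp only [κ, map_mul, map_sub, conj_ofReal, apply_ite conj, conj_conj, map_zero, mul_sub,
      sub_mul, Finset.sum_sub_distrib, mul_ite, ite_mul, mul_zero, zero_mul, Finset.sum_ite_eq',
      Finset.mem_univ, if_true]
    ring
  have horth : ∀ (w : E → ℂ), ContDiff ℝ ∞ w → ∀ i : I, ∫ x, ∑ l, conj (κ i l x) *
      W.indicator (fun x => (Real.exp ((ψ x - φ x) / 2) : ℂ) * dbar (e l) w x) x ∂μ = 0 := by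
    intro w hw i
    simp_rw [hκsum]
    rw [← integral_dbar_dbar_sub (μ := μ) i.1.2.contDiff i.1.2.hasCompactSupport hw (e i.2.1)
      (e i.2.2)]
    refine integral_congr_ae (Eventually.of_forall fun x => ?_)
    by_cases hx : x ∈ W
    · simp only [indicator_of_mem hx]
      linear_combination (dbar (e i.2.2) w x * dbar (e i.2.1) i.1.1 x -
        dbar (e i.2.1) w x * dbar (e i.2.2) i.1.1 x) * hinv x
    · simp [hx, (i.1.2.dbar _).eq_zero hx]
  have hdiv : ∀ {a : ι → E → ℂ}, (∀ j, IsTest W (a j)) →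
      IsTest W (fun x => (Real.exp (φ x / 2 - ψ x) : ℂ) * ∑ j, del (e j) (a j) x) := fun {a} ha => by
    refine IsTest.mul_of_contDiffOn h.isOpen hg ?_
    have : (fun x => ∑ j, del (e j) (a j) x) = ∑ j, del (e j) (a j) := by ext x; simp
    rw [this]
    exact Finset.sum_induction _ (IsTest W) (fun _ _ h h' => h.add h') IsTest.zero
      fun j _ => (ha j).del (e j)
  have hiL : ∀ {f : E → ℂ}, IsTest W f → Integrable f μ := fun hf =>
    hf.continuous.integrable_of_hasCompactSupport hf.hasCompactSupport
  -- the bound for the functional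
  have bound : ∀ {a : ι → E → ℂ} (ha : ∀ j, IsTest W (a j)),
      ‖∫ x, ∑ j, conj (dbar (e j) u x) * a j x ∂μ‖ ≤ ‖l2vec huL‖ * ‖((hdiv ha).memLp (μ := μ)).toLp (_)‖ := by
    intro a ha
    let α : ι → E → ℂ := fun j x => (Real.exp ((φ x - ψ x) / 2) : ℂ) * a j x
    have hα : ∀ j, IsTest W (α j) := fun j => (ha j).mul_of_contDiffOn h.isOpen hsi
    obtain ⟨β, hβ, hβW, hβκ, hβα⟩ := exists_memLp_orthogonal (μ := μ) h.isOpen.measurableSet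
      (fun i j => (hκt i j).memLp) (fun i j x hx => (hκt i j).eq_zero hx)
      (fun j => (hα j).memLp)
    have est := h.integral_le (μ := μ) ha hβ hβW (fun f hf j k => by
      have := hβκ (⟨f, hf⟩, j, k)
      simp_rw [hκsum] at this
      exact this) (fun f hf => by
      have h1 := hβα (fun j => W.indicator fun x => (Real.exp ((ψ x - φ x) / 2) : ℂ) *
          dbar (e j) (fun x => conj (f x)) x) ?_ (fun j x hx => indicator_of_notMem hx _)
          (horth _ hf.conj_comp.contDiff)
      · have c1 : ∀ j x, conj (dbar (e j) (fun x => conj (f x)) x) = del (e j) f x := fun j x => by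
          rw [conj_dbar]; simp
        refine (integral_congr_ae (Eventually.of_forall fun x => ?_)).trans
          (h1.trans (integral_congr_ae (Eventually.of_forall fun x => ?_)))
        · refine Finset.sum_congr rfl fun j _ => ?_
          by_cases hx : x ∈ W
          · simp only [indicator_of_mem hx, map_mul, conj_ofReal, c1, α]
            linear_combination -(del (e j) f x * a j x) * hinv x
          · simp [hx, (hf.del _).eq_zero hx]
        · refine Finset.sum_congr rfl fun j _ => ?_
          by_cases hx : x ∈ W
          · simp only [indicator_of_mem hx, map_mul, conj_ofReal, c1]
            congr 4; ring
          · simp [hx, (hf.del _).eq_zero hx]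
      · intro j
        have t := ((hf.conj_comp.dbar (e j)).mul_of_contDiffOn h.isOpen hs)
        refine t.memLp.ae_eq (Eventually.of_forall fun x => ?_)
        by_cases hx : x ∈ W
        · simp [hx]
        · simp only [indicator_of_notMem hx]; exact t.eq_zero hx)
    have h2 := hβα û huL (fun j x hx => indicator_of_notMem hx _) (horth u hu)
    have h3 : ∫ x, ∑ j, conj (dbar (e j) u x) * a j x ∂μ = ∫ x, ∑ j, conj (û j x) * β j x ∂μ := by
      rw [← h2]
      refine integral_congr_ae (Eventually.of_forall fun x => Finset.sum_congr rfl fun j _ => ?_)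
      by_cases hx : x ∈ W
      · simp only [û, indicator_of_mem hx, map_mul, conj_ofReal, α]
        linear_combination -(conj (dbar (e j) u x) * a j x) * hinv x
      · simp [û, hx, (ha j).eq_zero hx]
    rw [h3, ← inner_l2vec huL hβ]
    refine (norm_inner_le_norm _ _).trans (mul_le_mul_of_nonneg_left ?_ (norm_nonneg _))
    refine le_of_sq_le_sq ?_ (norm_nonneg _)
    rw [norm_l2vec_sq hβ]
    refine est.trans_eq ?_
    have h4 := norm_l2vec_sq (ι := Unit) (u := fun _ => _) (fun _ => (hdiv ha).memLp (μ := μ))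
    have h5 : ‖l2vec (ι := Unit) (u := fun _ => _) (fun _ => (hdiv ha).memLp (μ := μ))‖ =
        ‖((hdiv ha).memLp (μ := μ)).toLp (_)‖ := by
      rw [PiLp.norm_eq_of_L2]
      simp [l2vec]
    rw [← h5, h4]
    refine integral_congr_ae (Eventually.of_forall fun x => ?_)
    simp only [Finset.univ_unique, Finset.sum_const, Finset.card_singleton, one_smul, norm_mul,
      mul_pow, norm_real, Real.norm_eq_abs, sq_abs]
    rw [← Real.exp_nat_mul]
    congr 2; push_cast; ring
  -- the functional
  let T₀ : Submodule ℂ (ι → E → ℂ) :=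
    { carrier := {a | ∀ j, IsTest W (a j)}
      add_mem' := fun ha hb j => (ha j).add (hb j)
      zero_mem' := fun j => IsTest.zero
      smul_mem' := fun c a ha j => by
        have := (ha j).mul (contDiff_const (c := c))
        refine (?_ : IsTest W _)
        convert this using 1
        ext x; simp [mul_comm] }
  have dadd : ∀ {a b : ι → E → ℂ}, (∀ j, IsTest W (a j)) → (∀ j, IsTest W (b j)) → ∀ j x,
      del (e j) ((a + b) j) x = del (e j) (a j) x + del (e j) (b j) x := fun ha hb j x => by
    simp only [del, Pi.add_apply, fderiv_add (ha j).differentiableAt (hb j).differentiableAt]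
    simp; ring
  have dsmul : ∀ {a : ι → E → ℂ} (c : ℂ), (∀ j, IsTest W (a j)) → ∀ j x,
      del (e j) ((c • a) j) x = c * del (e j) (a j) x := fun c ha j x => by
    simp only [del, Pi.smul_apply, fderiv_const_smul (ha j).differentiableAt]
    simp; ring
  let T : T₀ →ₗ[ℂ] Lp ℂ 2 μ :=
    { toFun := fun a => ((hdiv a.2).memLp (μ := μ)).toLp _
      map_add' := fun a b => by
        rw [← MemLp.toLp_add]
        congr 1
        ext x
        have := fun j => dadd a.2 b.2 j x
        simp only [Submodule.coe_add, this, Finset.sum_add_distrib]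
        exact mul_add (_ : ℂ) _ _
      map_smul' := fun c a => by
        rw [RingHom.id_apply, ← MemLp.toLp_const_smul]
        congr 1
        ext x
        have := fun j => dsmul c a.2 j x
        simp only [Submodule.coe_smul, this, ← Finset.mul_sum]
        exact mul_left_comm _ _ _ }
  have hintg : ∀ {a : ι → E → ℂ}, (∀ j, IsTest W (a j)) → ∀ j,
      IsTest W (fun x => conj (dbar (e j) u x) * a j x) := fun ha j => by
    have := (ha j).mul (conjCLE.contDiff.comp (hu.dbar (e j)))
    convert this using 2
    exact mul_comm _ _
  let Λ : T₀ →ₗ[ℂ] ℂ :=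
    { toFun := fun a => ∫ x, ∑ j, conj (dbar (e j) u x) * a.1 j x ∂μ
      map_add' := fun a b => by
        rw [← integral_add (integrable_finsetSum _ fun j _ => hiL (hintg a.2 j))
          (integrable_finsetSum _ fun j _ => hiL (hintg b.2 j))]
        refine integral_congr_ae (Eventually.of_forall fun x => ?_)
        simp [mul_add, Finset.sum_add_distrib]
      map_smul' := fun c a => by
        rw [RingHom.id_apply, smul_eq_mul, ← integral_const_mul]
        refine integral_congr_ae (Eventually.of_forall fun x => ?_)
        simp only [Submodule.coe_smul, Pi.smul_apply, smul_eq_mul, Finset.mul_sum]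
        exact Finset.sum_congr rfl fun j _ => by ring }
  obtain ⟨w, hwn, hw⟩ := exists_inner_eq_of_norm_le T Λ (norm_nonneg (l2vec huL))
    fun a => bound a.2
  have hwL : MemLp (fun x => (w : E → ℂ) x) 2 μ := Lp.memLp w
  refine ⟨fun x => -w x, hwL.neg, ?_, fun f hf j => ?_⟩
  · have h4 := norm_l2vec_sq (ι := Unit) (u := fun _ => _) (fun _ => hwL)
    have h5 : ‖l2vec (ι := Unit) (u := fun _ => _) (fun _ => hwL)‖ = ‖w‖ := by
      rw [PiLp.norm_eq_of_L2]
      simp [l2vec]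
    rw [h5] at h4
    simp only [Finset.univ_unique, Finset.sum_const, Finset.card_singleton, one_smul] at h4
    simp only [norm_neg]
    rw [← h4, ← norm_l2vec_sq huL]
    exact pow_le_pow_left₀ (norm_nonneg _) hwn 2
  · let a : ι → E → ℂ := fun l => if l = j then (fun x => conj (f x)) else 0
    have ha : ∀ l, IsTest W (a l) := fun l => by
      by_cases hl : l = j
      · simpa [a, hl] using hf.conj_comp
      · simpa [a, hl] using IsTest.zero
    have hwa : ∫ x, ∑ j, conj (dbar (e j) u x) * a j x ∂μ =
        inner ℂ w ((hdiv ha).memLp.toLp _) := hw ⟨a, ha⟩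
    have hL : ∫ x, ∑ l, conj (dbar (e l) u x) * a l x ∂μ =
        conj (∫ x, dbar (e j) u x * f x ∂μ) := by
      rw [← integral_conj]
      refine integral_congr_ae (Eventually.of_forall fun x => ?_)
      dsimp only
      rw [Finset.sum_eq_single j]
      · simp [a]
      · intro l _ hl; simp [a, hl]
      · simp
    have hda : ∀ x, ∑ l, del (e l) (a l) x = conj (dbar (e j) f x) := fun x => by
      rw [Finset.sum_eq_single j, conj_dbar]
      · simp [a]
      · intro l _ hl
        simp [a, hl, del]
      · simp
    have hR : inner ℂ w ((hdiv ha).memLp.toLp _) =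
        conj (∫ x, (Real.exp (φ x / 2 - ψ x) : ℂ) * w x * dbar (e j) f x ∂μ) := by
      have : w = hwL.toLp _ := by simp
      conv_lhs => rw [this]
      rw [inner_toLp, ← integral_conj]
      refine integral_congr_ae (Eventually.of_forall fun x => ?_)
      simp only [hda, map_mul, conj_ofReal]
      ring
    have hE := hL.symm.trans (hwa.trans hR)
    have hE2 := (starRingEnd ℂ).injective hE
    have hI : ∫ x, dbar (e j) u x * f x ∂μ = - ∫ x, u x * dbar (e j) f x ∂μ := by
      have := integral_dbar_mul (μ := μ) hf.contDiff hu hf.hasCompactSupport (e j)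
      have e1 : ∫ x, dbar (e j) u x * f x ∂μ = ∫ x, f x * dbar (e j) u x ∂μ :=
        integral_congr_ae (Eventually.of_forall fun x => mul_comm _ _)
      have e2 : ∫ x, u x * dbar (e j) f x ∂μ = ∫ x, dbar (e j) f x * u x ∂μ :=
        integral_congr_ae (Eventually.of_forall fun x => mul_comm _ _)
      rw [e1, e2, this, neg_neg]
    have i1 : Integrable (fun x => u x * dbar (e j) f x) μ := by
      have := hiL ((hf.dbar (e j)).mul hu)
      simpa only [mul_comm] using this
    have i2 : Integrable (fun x => (Real.exp (φ x / 2 - ψ x) : ℂ) * w x * dbar (e j) f x) μ := by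
      have t := (hf.dbar (e j)).mul_of_contDiffOn h.isOpen hg
      have := t.memLp.integrable_mul hwL (μ := μ)
      refine this.congr (Eventually.of_forall fun x => ?_)
      simp only [Pi.mul_apply]; ring
    have e3 : ∀ x, (u x - (Real.exp (φ x / 2 - ψ x) : ℂ) * -w x) * dbar (e j) f x =
        u x * dbar (e j) f x + (Real.exp (φ x / 2 - ψ x) : ℂ) * w x * dbar (e j) f x :=
      fun x => by ring
    simp_rw [e3]
    rw [integral_add i1 i2, ← hE2, hI]
    ring

end HormanderData

end HormanderSolution

section HolomorphicApproximation

open MeasureTheory Filter Topology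
open scoped ContDiff ComplexConjugate

theorem measurePreserving_unit_smul {E : Type*} [NormedAddCommGroup E] [NormedSpace ℂ E]
    [FiniteDimensional ℂ E] [MeasurableSpace E] [BorelSpace E] (μ : Measure E) [μ.IsAddHaarMeasure]
    {c : ℂ} (hc : ‖c‖ = 1) : MeasurePreserving (fun x : E => c • x) μ μ := by
  have : FiniteDimensional ℝ E := FiniteDimensional.complexToReal E
  have hc0 : c ≠ 0 := by rintro rfl; simp at hc
  let f : E ≃L[ℝ] E := (ContinuousLinearEquiv.smulLeft (R₁ := ℂ) (M₁ := E) (Units.mk0 c hc0)).restrictScalars ℝ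
  have hf : ⇑f = fun x : E => c • x := rfl
  rw [← hf]
  refine ⟨f.continuous.measurable, ?_⟩
  have hH : (μ.map f).IsAddHaarMeasure := f.isAddHaarMeasure_map μ
  have h1 := Measure.isAddLeftInvariant_eq_smul (μ.map f) μ
  have hb : (μ.map f) (ball 0 1) = μ (ball 0 1) := by
    rw [Measure.map_apply f.continuous.measurable measurableSet_ball]
    congr 1
    ext x
    simp [hf, norm_smul, hc]
  rw [h1] at hb ⊢
  have h0 : μ (ball 0 1) ≠ 0 := (measure_ball_pos μ 0 one_pos).ne'
  have ht : μ (ball 0 1) ≠ ⊤ := measure_ball_lt_top.ne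
  rw [Measure.smul_apply, ENNReal.smul_def, smul_eq_mul] at hb
  have h2 := (ENNReal.mul_eq_right h0 ht).1 hb
  have h3 : Measure.addHaarScalarFactor (μ.map f) μ = 1 := by exact_mod_cast h2
  rw [h3, one_smul]

variable {E : Type*} [NormedAddCommGroup E] [InnerProductSpace ℂ E] [FiniteDimensional ℂ E]
  [MeasurableSpace E] [BorelSpace E] {μ : Measure E} [μ.IsAddHaarMeasure]

theorem exists_circular_isMollifier (μ : Measure E) [μ.IsAddHaarMeasure] {ε : ℝ} (hε : 0 < ε) :
    ∃ k, IsMollifier μ k ε ∧ ∀ (c : ℂ) (x : E), ‖c‖ = 1 → k (c • x) = k x := by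
  have : FiniteDimensional ℝ E := FiniteDimensional.complexToReal E
  let k₀ : E → ℝ := fun x => Real.smoothTransition (ε ^ 2 - ‖x‖ ^ 2)
  have h1 : ContDiff ℝ ∞ k₀ :=
    Real.smoothTransition.contDiff.comp (contDiff_const.sub (contDiff_norm_sq ℂ))
  have h2 : ∀ x, 0 ≤ k₀ x := fun x => Real.smoothTransition.nonneg _
  have h3 : Function.support k₀ ⊆ ball 0 ε := fun x hx => by
    rw [mem_ball_zero_iff]
    by_contra hh
    exact hx (Real.smoothTransition.zero_of_nonpos (by nlinarith [norm_nonneg x]))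
  have hcs : HasCompactSupport k₀ := HasCompactSupport.of_support_subset_isCompact
    (isCompact_closedBall 0 ε) (h3.trans ball_subset_closedBall)
  have hpos : 0 < ∫ x, k₀ x ∂μ :=
    h1.continuous.integral_pos_of_hasCompactSupport_nonneg_nonzero hcs h2 (x := 0)
      (Real.smoothTransition.pos_of_pos (by simpa using pow_pos hε 2)).ne'
  refine ⟨fun x => k₀ x / ∫ x, k₀ x ∂μ, ⟨h1.div_const _, fun x => div_nonneg (h2 x) hpos.le,
    fun x hx => h3 fun h => hx (by simp [h]), ?_⟩, fun c x hc => by simp [k₀, norm_smul, hc]⟩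
  rw [integral_div, div_self hpos.ne']

theorem IsMollifier.mollify_eq_self {k : E → ℝ} {ε : ℝ} (hk : IsMollifier μ k ε)
    (hkc : ∀ (c : ℂ) (x : E), ‖c‖ = 1 → k (c • x) = k x) {u : E → ℂ} (hu : Continuous u) {x : E}
    (hd : ∀ y ∈ ball x ε, DifferentiableAt ℂ u y) : mollify μ k u x = u x := by
  have : FiniteDimensional ℝ E := FiniteDimensional.complexToReal E
  have : ProperSpace E := FiniteDimensional.proper ℝ E
  have hrot : ∀ θ : ℝ, ∫ y, u (x - circleMap 0 1 θ • y) * (k y : ℂ) ∂μ = mollify μ k u x := by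
    intro θ
    have hθ : ‖circleMap 0 1 θ‖ = 1 := by simp
    rw [IsMollifier.mollify_eq]
    have hc0 : circleMap 0 1 θ ≠ 0 := by intro h; simp [h] at hθ
    rw [← (measurePreserving_unit_smul μ hθ).integral_comp
      ((Homeomorph.smulOfNeZero _ hc0).measurableEmbedding) (fun y => u (x - y) * (k y : ℂ))]
    refine integral_congr_ae (Eventually.of_forall fun y => ?_)
    simp only [hkc _ y hθ]
  have hcirc : ∀ y, ∫ θ in (0 : ℝ)..2 * Real.pi, u (x - circleMap 0 1 θ • y) * (k y : ℂ) =
      (2 * Real.pi : ℝ) * (u x * k y) := by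
    intro y
    by_cases hy : ‖y‖ < ε
    · have hdf : DiffContOnCl ℂ (fun s : ℂ => u (x - s • y)) (ball 0 |1|) := by
        refine DifferentiableOn.diffContOnCl fun s hs => ?_
        have hs' : ‖s‖ ≤ 1 := by
          have := closure_ball_subset_closedBall hs
          simpa using this
        refine (DifferentiableAt.comp s (f := fun s : ℂ => x - s • y) (hd _ ?_)
          (by fun_prop)).differentiableWithinAt
        rw [mem_ball, dist_eq_norm, sub_sub_cancel_left, norm_neg, norm_smul]
        nlinarith [norm_nonneg y]
      have := hdf.circleAverage
      rw [Real.circleAverage_def] at this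
      simp only [zero_smul, sub_zero] at this
      rw [intervalIntegral.integral_mul_const]
      rw [inv_smul_eq_iff₀ (by positivity)] at this
      rw [this]
      simp; ring
    · simp [hk.eq_zero (not_lt.1 hy)]
  have hswap : ∫ θ in (0 : ℝ)..2 * Real.pi, ∫ y, u (x - circleMap 0 1 θ • y) * (k y : ℂ) ∂μ =
      ∫ y, (∫ θ in (0 : ℝ)..2 * Real.pi, u (x - circleMap 0 1 θ • y) * (k y : ℂ)) ∂μ := by
    rw [intervalIntegral.integral_of_le (by positivity)]
    simp_rw [intervalIntegral.integral_of_le (show (0 : ℝ) ≤ 2 * Real.pi by positivity)]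
    refine integral_integral_swap ?_
    let F : ℝ × E → ℂ := fun p => u (x - circleMap 0 1 p.1 • p.2) * (k p.2 : ℂ)
    have hF : Continuous F := by
      have := hk.contDiff.continuous
      fun_prop
    have hcpt : IsCompact (Icc (0 : ℝ) (2 * Real.pi) ×ˢ closedBall (0 : E) ε) :=
      isCompact_Icc.prod (isCompact_closedBall _ _)
    have h1 : IntegrableOn F (Icc (0 : ℝ) (2 * Real.pi) ×ˢ closedBall (0 : E) ε)
      (volume.prod μ) := hF.continuousOn.integrableOn_compact hcpt
    have h2 : IntegrableOn F (Ioc (0 : ℝ) (2 * Real.pi) ×ˢ (univ : Set E)) (volume.prod μ) := by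
      refine (h1.mono_set (prod_mono_left Ioc_subset_Icc_self)).of_forall_sdiff_eq_zero
        (measurableSet_Ioc.prod MeasurableSet.univ) fun p hp => ?_
      have : p.2 ∉ closedBall (0 : E) ε := fun h => hp.2 ⟨hp.1.1, h⟩
      simp only [F, hk.eq_zero (by simpa using (not_le.1 (by simpa using this)).le)]
      simp
    rw [IntegrableOn, ← Measure.prod_restrict, Measure.restrict_univ] at h2
    exact h2
  simp_rw [hrot, hcirc] at hswap
  rw [intervalIntegral.integral_const, integral_const_mul, integral_const_mul,
    integral_complex_ofReal, hk.integral_eq_one] at hswap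
  have hpi : ((2 * Real.pi : ℝ) : ℂ) ≠ 0 := by exact_mod_cast (by positivity : 2 * Real.pi ≠ 0)
  simp only [sub_zero, real_smul, ofReal_one, mul_one] at hswap
  exact mul_left_cancel₀ hpi hswap

variable {ι : Type*} [Fintype ι] {e : ι → E} {W : Set E} {φ ψ : E → ℝ} {η : ℕ → E → ℝ} {ε : ℕ → ℝ}

theorem dbar_eq_zero_of_span {h : E → ℂ} {x : E} (he : Submodule.span ℂ (range e) = ⊤)
    (h0 : ∀ j, dbar (e j) h x = 0) (v : E) : dbar v h x = 0 := by
  have hv : v ∈ Submodule.span ℂ (range e) := he ▸ Submodule.mem_top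
  induction hv using Submodule.span_induction with
  | mem v hv => obtain ⟨j, rfl⟩ := hv; exact h0 j
  | zero => simp [dbar]
  | add v w _ _ hv hw => rw [dbar_add_left, hv, hw, add_zero]
  | smul c v _ hv => rw [dbar_smul, hv, mul_zero]

/-- Smooth functions with small `∂̄` are close to holomorphic ones, uniformly on compacts. -/
theorem HormanderData.exists_holomorphic (h : HormanderData e W φ ψ η ε)
    (he : Submodule.span ℂ (range e) = ⊤) (hWb : IsBounded W) {B : ℝ}
    (hB : ∀ x ∈ W, Real.exp ((ψ x - φ x) / 2) ≤ B) {K L : Set E} (hL : IsCompact L) (hLW : L ⊆ W)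
    {δ : ℝ} {k : E → ℝ} (hk : IsMollifier μ k δ) (hKL : ∀ x ∈ K, closedBall x δ ⊆ L) :
    ∃ C : ℝ, 0 ≤ C ∧ ∀ (u : E → ℂ) (m : ℝ), ContDiff ℝ ∞ u → 0 < m →
      (∀ x ∈ W, ∀ j, ‖dbar (e j) u x‖ ≤ m) →
      ∃ g : E → ℂ, ContDiff ℝ ∞ g ∧ (∀ x ∈ K, DifferentiableAt ℂ g x) ∧
        ∀ x ∈ K, ‖g x - mollify μ k u x‖ ≤ C * m := by
  have : FiniteDimensional ℝ E := FiniteDimensional.complexToReal E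
  have : ProperSpace E := FiniteDimensional.proper ℝ E
  have hgc : ContinuousOn (fun x => (Real.exp (φ x / 2 - ψ x) : ℂ)) L :=
    ((h.contDiffOn_exp (1 / 2) (-1)).continuousOn.mono hLW).congr fun x _ => by congr 2; ring
  obtain ⟨G, hG⟩ := hL.exists_bound_of_continuousOn hgc
  obtain ⟨k₁, hk₁⟩ := hk.contDiff.continuous.bounded_above_of_compact_support hk.hasCompactSupport
  have hWfin : μ W ≠ ⊤ := hWb.measure_lt_top.ne
  have hLfin : μ L ≠ ⊤ := hL.measure_lt_top.ne
  let A : ℝ := Fintype.card ι * B ^ 2 * μ.real W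
  have hA : 0 ≤ A := by positivity
  refine ⟨|G| * |k₁| * ((μ.real L + A) / 2), by positivity, fun u m hu hm hum => ?_⟩
  have hb : ∀ j, ∀ x ∈ W, ‖(Real.exp ((ψ x - φ x) / 2) : ℂ) * dbar (e j) u x‖ ≤ B * m := by
    intro j x hx
    rw [norm_mul, norm_real, Real.norm_of_nonneg (Real.exp_nonneg _)]
    exact mul_le_mul (hB x hx) (hum x hx j) (norm_nonneg _) ((Real.exp_nonneg _).trans (hB x hx))
  have huL : ∀ j, MemLp (W.indicator fun x => (Real.exp ((ψ x - φ x) / 2) : ℂ) *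
      dbar (e j) u x) 2 μ := by
    intro j
    rw [memLp_indicator_iff_restrict h.isOpen.measurableSet]
    have : IsFiniteMeasure (μ.restrict W) := ⟨by simpa using hWfin.lt_top⟩
    refine MemLp.of_bound ?_ (B * m) ((ae_restrict_iff' h.isOpen.measurableSet).2
      (Eventually.of_forall (hb j)))
    refine ContinuousOn.aestronglyMeasurable (ContinuousOn.mul ?_
      (hu.dbar (e j)).continuous.continuousOn) h.isOpen.measurableSet
    exact (h.contDiffOn_exp (-(1 / 2)) (1 / 2)).continuousOn.congr fun x _ => by congr 2; ring
  obtain ⟨v, hv, hvn, hvw⟩ := h.exists_solution hu huL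
  have hvn' : ∫ x, ‖v x‖ ^ 2 ∂μ ≤ A * m ^ 2 := by
    refine hvn.trans ?_
    have : ∫ x, W.indicator (fun _ => Fintype.card ι * (B * m) ^ 2) x ∂μ = A * m ^ 2 := by
      rw [integral_indicator_const _ h.isOpen.measurableSet]
      simp only [A, smul_eq_mul]; ring
    rw [← this]
    refine integral_mono_of_nonneg (Eventually.of_forall fun x => by positivity)
      ((integrable_indicator_iff h.isOpen.measurableSet).2 (integrableOn_const hWfin))
      (Eventually.of_forall fun x => ?_)
    by_cases hx : x ∈ W
    · simp only [indicator_of_mem hx]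
      refine (Finset.sum_le_card_nsmul _ _ ((B * m) ^ 2) fun j _ =>
        pow_le_pow_left₀ (norm_nonneg _) (hb j x hx) 2).trans_eq ?_
      simp
    · simp [hx]
  have hvL : IntegrableOn v L μ := by
    have : IsFiniteMeasure (μ.restrict L) := ⟨by simpa using hLfin.lt_top⟩
    exact (hv.restrict L).integrable (by norm_num)
  have hgv : IntegrableOn (fun x => (Real.exp (φ x / 2 - ψ x) : ℂ) * v x) L μ :=
    hvL.continuousOn_mul hgc hL
  let w : E → ℂ := fun x => u x - (Real.exp (φ x / 2 - ψ x) : ℂ) * v x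
  have hw : IntegrableOn w L μ := (hu.continuous.continuousOn.integrableOn_compact hL).sub hgv
  have hwi : Integrable (L.indicator w) μ := (integrable_indicator_iff hL.measurableSet).2 hw
  have hkz : ∀ x ∈ K, ∀ t, t ∉ L → k (x - t) = 0 := fun x hx t ht => hk.eq_zero (by
    by_contra hlt
    exact ht (hKL x hx (by rw [mem_closedBall, dist_comm, dist_eq_norm]; exact (not_le.1 hlt).le)))
  have htest : ∀ x ∈ K, IsTest W (fun t => (k (x - t) : ℂ)) := fun x hx =>
    ⟨hk.contDiff_sub x, hk.hasCompactSupport_sub x,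
      (closure_minimal (fun t ht => by
        by_contra hh
        exact ht (by simp [hkz x hx t hh])) hL.isClosed).trans hLW⟩
  have hgs := hk.contDiff_mollify hwi.locallyIntegrable
  refine ⟨mollify μ k (L.indicator w), hgs, fun x hx => ?_, fun x hx => ?_⟩
  · refine differentiableAt_complex_of_dbar_eq_zero (hgs.differentiable (by simp)).differentiableAt
      (dbar_eq_zero_of_span he fun j => ?_)
    rw [hk.dbar_mollify hwi.locallyIntegrable, neg_eq_zero, ← hvw _ (htest x hx) j]
    refine integral_congr_ae (Eventually.of_forall fun t => ?_)
    by_cases ht : t ∈ L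
    · simp [ht, w]
    · have : dbar (e j) (fun t => (k (x - t) : ℂ)) t = 0 :=
        image_eq_zero_of_notMem_tsupport fun hh => ht (closure_minimal (fun t ht => by
          by_contra hh
          exact ht (by simp [hkz x hx t hh])) hL.isClosed (tsupport_dbar_subset _ _ hh))
      simp [this]
  · have e1 : mollify μ k (L.indicator w) x - mollify μ k u x =
        -∫ t in L, (Real.exp (φ t / 2 - ψ t) : ℂ) * v t * (k (x - t) : ℂ) ∂μ := by
      rw [mollify, mollify, ← integral_sub (hk.integrable_mul hwi.locallyIntegrable x)
        (hk.integrable_mul hu.continuous.locallyIntegrable x),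
        ← integral_indicator hL.measurableSet, ← integral_neg]
      refine integral_congr_ae (Eventually.of_forall fun t => ?_)
      by_cases ht : t ∈ L
      · simp only [indicator_of_mem ht, w]; ring
      · simp [ht, hkz x hx t ht]
    rw [e1, norm_neg]
    have hsq : IntegrableOn (fun t => ‖v t‖ ^ 2) L μ := (integrable_sq_norm hv).integrableOn
    have hbd : ∀ t ∈ L, ‖(Real.exp (φ t / 2 - ψ t) : ℂ) * v t * (k (x - t) : ℂ)‖ ≤
        |G| * |k₁| * ((m + ‖v t‖ ^ 2 / m) / 2) := by
      intro t ht
      have h1 : ‖(Real.exp (φ t / 2 - ψ t) : ℂ)‖ ≤ |G| := (hG t ht).trans (le_abs_self _)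
      have h2 : ‖(k (x - t) : ℂ)‖ ≤ |k₁| := by
        rw [norm_real]; exact (hk₁ _).trans (le_abs_self _)
      have h3 : ‖v t‖ ≤ (m + ‖v t‖ ^ 2 / m) / 2 := by
        rw [le_div_iff₀ two_pos, ← sub_nonneg]
        have : m + ‖v t‖ ^ 2 / m - ‖v t‖ * 2 = (m - ‖v t‖) ^ 2 / m := by field_simp; ring
        rw [this]; positivity
      rw [norm_mul, norm_mul]
      calc _ ≤ |G| * ((m + ‖v t‖ ^ 2 / m) / 2) * |k₁| := by gcongr
        _ = _ := by ring
    refine (norm_integral_le_of_norm_le (g := fun t => |G| * |k₁| * ((m + ‖v t‖ ^ 2 / m) / 2)) ?_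
      ((ae_restrict_iff' hL.measurableSet).2 (Eventually.of_forall hbd))).trans ?_
    · exact (((integrableOn_const hLfin).add (hsq.div_const m)).div_const 2).const_mul _
    · rw [integral_const_mul, integral_div, integral_add
        (show Integrable (fun _ => m) (μ.restrict L) from integrableOn_const hLfin)
        (hsq.div_const m), integral_div]
      have h5 : ∫ t in L, ‖v t‖ ^ 2 ∂μ ≤ A * m ^ 2 := (setIntegral_le_integral
        (integrable_sq_norm hv) (Eventually.of_forall fun x => by positivity)).trans hvn'
      have h6 : (∫ t in L, ‖v t‖ ^ 2 ∂μ) / m ≤ A * m := by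
        rw [div_le_iff₀ hm]; linarith
      have h7 : ∫ t in L, m ∂μ = μ.real L * m := by simp
      rw [h7]
      calc _ ≤ |G| * |k₁| * ((μ.real L * m + A * m) / 2) := by gcongr
        _ = _ := by ring

end HolomorphicApproximation

section LeviCalculus

open Filter Topology
open scoped ContDiff ComplexConjugate

variable {E : Type*} [NormedAddCommGroup E] [NormedSpace ℂ E]

/-- The complex linear form whose real part is the given real form. -/
def complexForm (A : E →L[ℝ] ℝ) : E →ₗ[ℂ] ℂ where
  toFun v := (A v : ℂ) - I * (A (I • v) : ℂ)
  map_add' v w := by simp only [smul_add, map_add, ofReal_add]; ring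
  map_smul' c v := by
    obtain ⟨a, b⟩ := c
    have h1 : (⟨a, b⟩ : ℂ) • v = a • v + b • (I • v) := by
      rw [← coe_smul a v, ← coe_smul b (I • v), smul_smul, ← add_smul]
      congr 1; apply Complex.ext <;> simp
    have h2 : I • (⟨a, b⟩ : ℂ) • v = a • (I • v) - b • v := by
      rw [← coe_smul a (I • v), ← coe_smul b v, smul_smul, smul_smul, ← sub_smul]
      congr 1; apply Complex.ext <;> simp
    rw [h2, h1]
    simp only [map_add, map_sub, map_smul, smul_eq_mul, RingHom.id_apply]
    apply Complex.ext
    · simp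
    · simp; ring

theorem complexForm_apply (A : E →L[ℝ] ℝ) (v : E) :
    complexForm A v = (A v : ℂ) - I * (A (I • v) : ℂ) := rfl

theorem complexForm_re (A : E →L[ℝ] ℝ) (v : E) : (complexForm A v).re = A v := by
  simp [complexForm_apply]

theorem complexForm_sub (A B : E →L[ℝ] ℝ) (v : E) :
    complexForm (A - B) v = complexForm A v - complexForm B v := by
  simp [complexForm_apply]; ring

theorem norm_complexForm_le (A : E →L[ℝ] ℝ) (v : E) : ‖complexForm A v‖ ≤ 2 * ‖A‖ * ‖v‖ := by
  have h1 := A.le_opNorm v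
  have h2 := A.le_opNorm (I • v)
  rw [norm_smul, norm_I, one_mul] at h2
  rw [complexForm_apply]
  refine (norm_sub_le _ _).trans ?_
  rw [norm_mul, norm_I, one_mul, norm_real, norm_real]
  linarith

/-- The complex bilinear part of a real bilinear form. -/
def complexQuad (B : E →L[ℝ] E →L[ℝ] ℝ) : E →ₗ[ℂ] E →ₗ[ℂ] ℂ :=
  LinearMap.mk₂ ℂ (fun v w => (1 / 4 : ℂ) * (complexForm (B v) w - I * complexForm (B (I • v)) w))
    (fun v v' w => by
      simp only [complexForm_apply, smul_add, map_add, _root_.add_apply, ofReal_add]; ring)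
    (fun c v w => by
      have h := complexForm (B.flip w) |>.map_smul c v
      have h' := complexForm (B.flip (I • w)) |>.map_smul c v
      simp only [complexForm_apply, ContinuousLinearMap.flip_apply, smul_eq_mul] at h h' ⊢
      linear_combination (1 / 4) * h - I / 4 * h')
    (fun v w w' => by simp only [map_add]; ring)
    (fun c v w => by simp only [map_smul, smul_eq_mul]; ring)

theorem complexQuad_apply (B : E →L[ℝ] E →L[ℝ] ℝ) (v w : E) :
    complexQuad B v w = (1 / 4 : ℂ) * (complexForm (B v) w - I * complexForm (B (I • v)) w) := rfl

theorem complexQuad_comm {B : E →L[ℝ] E →L[ℝ] ℝ} (hB : ∀ v w, B v w = B w v) (v w : E) :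
    complexQuad B v w = complexQuad B w v := by
  simp only [complexQuad_apply, complexForm_apply]
  rw [hB w v, hB w (I • v), hB (I • w) v, hB (I • w) (I • v)]
  ring

theorem complexQuad_sub (A B : E →L[ℝ] E →L[ℝ] ℝ) (v w : E) :
    complexQuad (A - B) v w = complexQuad A v w - complexQuad B v w := by
  simp only [complexQuad_apply, _root_.sub_apply, complexForm_sub]; ring

theorem norm_complexQuad_le (B : E →L[ℝ] E →L[ℝ] ℝ) (v w : E) :
    ‖complexQuad B v w‖ ≤ ‖B‖ * ‖v‖ * ‖w‖ := by
  have h1 := norm_complexForm_le (B v) w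
  have h2 := norm_complexForm_le (B (I • v)) w
  have h3 := B.le_opNorm v
  have h4 := B.le_opNorm (I • v)
  rw [norm_smul, norm_I, one_mul] at h4
  have h5 : ‖complexForm (B v) w - I * complexForm (B (I • v)) w‖ ≤
      2 * ‖B v‖ * ‖w‖ + 2 * ‖B (I • v)‖ * ‖w‖ := by
    refine (norm_sub_le _ _).trans ?_
    rw [norm_mul, norm_I, one_mul]
    exact add_le_add h1 h2
  rw [complexQuad_apply, norm_mul]
  have h6 : ‖(1 / 4 : ℂ)‖ = 1 / 4 := by norm_num
  rw [h6]
  nlinarith [norm_nonneg w, mul_le_mul_of_nonneg_right h3 (norm_nonneg w),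
    mul_le_mul_of_nonneg_right h4 (norm_nonneg w)]

theorem leviForm_eq (ρ : E → ℝ) (x v : E) : leviForm ρ x v =
    (1 / 4) * (fderiv ℝ (fderiv ℝ ρ) x v v + fderiv ℝ (fderiv ℝ ρ) x (I • v) (I • v)) := by
  simp [leviForm, iteratedFDeriv_two_apply]

theorem half_fderiv_fderiv_eq (ρ : E → ℝ) {x : E} (hs : IsSymmSndFDerivAt ℝ ρ x) (v : E) :
    (1 / 2) * fderiv ℝ (fderiv ℝ ρ) x v v =
      (complexQuad (fderiv ℝ (fderiv ℝ ρ) x) v v).re + leviForm ρ x v := by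
  rw [leviForm_eq, complexQuad_apply]
  have := hs v (I • v)
  simp [complexForm_apply]
  ring

theorem abs_leviForm_le (ρ : E → ℝ) (x v : E) :
    |leviForm ρ x v| ≤ (1 / 2) * ‖fderiv ℝ (fderiv ℝ ρ) x‖ * ‖v‖ ^ 2 := by
  have h1 := (fderiv ℝ (fderiv ℝ ρ) x).le_opNorm₂ v v
  have h2 := (fderiv ℝ (fderiv ℝ ρ) x).le_opNorm₂ (I • v) (I • v)
  rw [norm_smul, norm_I, one_mul] at h2
  rw [leviForm_eq, abs_mul, abs_of_pos (by norm_num : (0 : ℝ) < 1 / 4)]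
  have := abs_add_le (fderiv ℝ (fderiv ℝ ρ) x v v) (fderiv ℝ (fderiv ℝ ρ) x (I • v) (I • v))
  simp only [Real.norm_eq_abs] at h1 h2
  nlinarith

theorem leviForm_smul (ρ : E → ℝ) (x v : E) (s : ℝ) :
    leviForm ρ x (s • v) = s ^ 2 * leviForm ρ x v := by
  rw [leviForm_eq, leviForm_eq, smul_comm I s v]
  simp; ring

/-- Second order Taylor estimate. -/
theorem abs_taylor_two_le {ρ : E → ℝ} {x : E} {δ σ : ℝ}
    (hρ : ∀ y ∈ ball x δ, ContDiffAt ℝ 2 ρ y)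
    (hσ : ∀ y ∈ ball x δ, ‖fderiv ℝ (fderiv ℝ ρ) y - fderiv ℝ (fderiv ℝ ρ) x‖ ≤ σ)
    {v : E} (hv : ‖v‖ < δ) :
    |ρ (x + v) - ρ x - fderiv ℝ ρ x v - (1 / 2) * fderiv ℝ (fderiv ℝ ρ) x v v| ≤ σ * ‖v‖ ^ 2 := by
  have hδ : 0 < δ := (norm_nonneg v).trans_lt hv
  have hx : x ∈ ball x δ := mem_ball_self hδ
  have hs : IsSymmSndFDerivAt ℝ ρ x := (hρ x hx).isSymmSndFDerivAt (by simp)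
  set H := fderiv ℝ (fderiv ℝ ρ) x with hH
  have hσ0 : 0 ≤ σ := (norm_nonneg (fderiv ℝ (fderiv ℝ ρ) x - H)).trans (hσ x hx)
  have hd1 : ∀ y ∈ ball x δ, HasFDerivAt ρ (fderiv ℝ ρ y) y := fun y hy =>
    ((hρ y hy).differentiableAt (by simp)).hasFDerivAt
  have hd2 : ∀ y ∈ ball x δ, HasFDerivAt (fderiv ℝ ρ) (fderiv ℝ (fderiv ℝ ρ) y) y := fun y hy =>
    (((hρ y hy).fderiv_right (m := 1) (by norm_num)).differentiableAt (by simp)).hasFDerivAt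
  have key : ∀ y ∈ ball x δ, ‖fderiv ℝ ρ y - fderiv ℝ ρ x - H (y - x)‖ ≤ σ * ‖y - x‖ := by
    intro y hy
    have := (convex_ball x δ).norm_image_sub_le_of_norm_hasFDerivWithin_le
      (f := fun y => fderiv ℝ ρ y - H y) (f' := fun y => fderiv ℝ (fderiv ℝ ρ) y - H)
      (fun z hz => ((hd2 z hz).sub H.hasFDerivAt).hasFDerivWithinAt) hσ hx hy
    have e : fderiv ℝ ρ y - fderiv ℝ ρ x - H (y - x) =
        fderiv ℝ ρ y - H y - (fderiv ℝ ρ x - H x) := by rw [H.map_sub]; abel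
    rw [e]
    exact this
  have hsub : ball x (‖v‖) ⊆ ball x δ := ball_subset_ball hv.le
  have hcl : closedBall x ‖v‖ ⊆ ball x δ := closedBall_subset_ball hv
  have fin := (convex_closedBall x ‖v‖).norm_image_sub_le_of_norm_hasFDerivWithin_le
    (f := fun y => ρ y - fderiv ℝ ρ x y - (1 / 2) * H (y - x) (y - x))
    (f' := fun y => fderiv ℝ ρ y - fderiv ℝ ρ x - H (y - x)) (C := σ * ‖v‖)
    (fun y hy => by
      have hq : HasFDerivAt (fun y => (1 / 2) * H (y - x) (y - x)) (H (y - x)) y := by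
        have h0 : HasFDerivAt (fun y : E => y - x) (ContinuousLinearMap.id ℝ E) y :=
          (hasFDerivAt_id y).sub_const x
        have h1 := (H.hasFDerivAt.comp y h0).clm_apply h0
        have h2 := h1.const_mul (1 / 2 : ℝ)
        refine h2.congr_fderiv ?_
        ext w
        have := hs w (y - x)
        simp only [← hH] at this
        simp only [map_sub, _root_.sub_apply] at this
        simp
        linear_combination (1 / 2) * this
      exact (((hd1 y (hcl hy)).sub (fderiv ℝ ρ x).hasFDerivAt).sub hq).hasFDerivWithinAt)
    (fun y hy => (key y (hcl hy)).trans (by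
      have : ‖y - x‖ ≤ ‖v‖ := by simpa [dist_eq_norm] using hy
      gcongr)) (mem_closedBall_self (norm_nonneg v)) (y := x + v) (by simp)
  simp only [add_sub_cancel_left, sub_self, map_zero, mul_zero, sub_zero, Real.norm_eq_abs] at fin
  refine le_trans (le_of_eq ?_) (fin.trans_eq (by ring))
  congr 1
  simp; ring

/-- Chain rule for the Levi form. -/
theorem leviForm_comp {r : E → ℝ} {Φ Φ' : ℝ → ℝ} {Φ₂ : ℝ} {x : E} (hr : ContDiffAt ℝ 2 r x)
    (h1 : ∀ᶠ s in 𝓝 (r x), HasDerivAt Φ (Φ' s) s) (h2 : HasDerivAt Φ' Φ₂ (r x)) (v : E) :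
    leviForm (fun z => Φ (r z)) x v = Φ' (r x) * leviForm r x v +
      (1 / 4) * Φ₂ * (fderiv ℝ r x v ^ 2 + fderiv ℝ r x (I • v) ^ 2) := by
  have e1 : fderiv ℝ (fun z => Φ (r z)) =ᶠ[𝓝 x] fun z => Φ' (r z) • fderiv ℝ r z := by
    filter_upwards [hr.continuousAt.eventually h1, hr.eventually (by simp)] with z hz hz'
    exact (hz.comp_hasFDerivAt z (hz'.differentiableAt (by simp)).hasFDerivAt).fderiv
  have hd : HasFDerivAt (fderiv ℝ r) (fderiv ℝ (fderiv ℝ r) x) x :=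
    ((hr.fderiv_right (m := 1) (by norm_num)).differentiableAt (by simp)).hasFDerivAt
  have e2 := ((h2.comp_hasFDerivAt x (hr.differentiableAt (by simp)).hasFDerivAt).smul hd)
  have e3 := (e2.congr_of_eventuallyEq e1).fderiv
  rw [leviForm_eq, leviForm_eq, e3]
  simp [Function.comp]
  ring

theorem leviForm_add {f g : E → ℝ} {x : E} (hf : ContDiffAt ℝ 2 f x) (hg : ContDiffAt ℝ 2 g x)
    (v : E) : leviForm (fun z => f z + g z) x v = leviForm f x v + leviForm g x v := by
  have e1 : fderiv ℝ (fun z => f z + g z) =ᶠ[𝓝 x] fun z => fderiv ℝ f z + fderiv ℝ g z := by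
    filter_upwards [hf.eventually (by simp), hg.eventually (by simp)] with z hz hz'
    exact fderiv_fun_add (hz.differentiableAt (by simp)) (hz'.differentiableAt (by simp))
  have hd : ∀ {r : E → ℝ}, ContDiffAt ℝ 2 r x → DifferentiableAt ℝ (fderiv ℝ r) x := fun hr =>
    (hr.fderiv_right (m := 1) (by norm_num)).differentiableAt (by simp)
  rw [leviForm_eq, leviForm_eq, leviForm_eq, e1.fderiv_eq, fderiv_fun_add (hd hf) (hd hg)]
  simp; ring

theorem leviForm_const_mul {f : E → ℝ} {x : E} (hf : ContDiffAt ℝ 2 f x) (c : ℝ)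
    (v : E) : leviForm (fun z => c * f z) x v = c * leviForm f x v := by
  have := leviForm_comp (Φ := fun s => c * s) (Φ' := fun _ => c) (Φ₂ := 0) hf
    (Eventually.of_forall fun s => by simpa using (hasDerivAt_id s).const_mul c)
    (hasDerivAt_const _ _) v
  simpa using this

end LeviCalculus

theorem leviForm_norm_sq {E : Type*} [NormedAddCommGroup E] [InnerProductSpace ℂ E] (x v : E) :
    leviForm (fun z : E => ‖z‖ ^ 2) x v = ‖v‖ ^ 2 := by
  let _ : InnerProductSpace ℝ E := InnerProductSpace.complexToReal
  have h1 : fderiv ℝ (fun z : E => ‖z‖ ^ 2) = fun z => ((2 : ℝ) • innerSL ℝ) z := by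
    ext z w
    rw [fderiv_norm_sq_apply]
    simp
  rw [leviForm_eq, h1, ContinuousLinearMap.fderiv]
  change (1 / 4) * (2 * inner ℝ v v + 2 * inner ℝ (I • v) (I • v)) = ‖v‖ ^ 2
  rw [real_inner_self_eq_norm_sq, real_inner_self_eq_norm_sq, norm_smul, norm_I]
  ring

section Exhaustion

open Filter Topology MeasureTheory
open scoped ContDiff ComplexConjugate

variable {E : Type*} [NormedAddCommGroup E] [InnerProductSpace ℂ E] [FiniteDimensional ℂ E]

theorem norm_del_ofReal_comp_le {f : E → ℝ} {Φ : ℝ → ℝ} {a : ℝ} {x : E}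
    (hf : DifferentiableAt ℝ f x) (hΦ : HasDerivAt Φ a (f x)) (v : E) :
    ‖del v (fun z => (Φ (f z) : ℂ)) x‖ ≤ |a| * (‖fderiv ℝ f x‖ * ‖v‖) := by
  have h1 := hΦ.comp_hasFDerivAt x hf.hasFDerivAt
  have h2 : fderiv ℝ (fun z => Φ (f z)) x = a • fderiv ℝ f x := h1.fderiv
  have h3 : DifferentiableAt ℝ (fun z => Φ (f z)) x := h1.differentiableAt
  have h4 : ∀ w : E, ‖w‖ = ‖v‖ →
      ‖((a * fderiv ℝ f x w : ℝ) : ℂ)‖ ≤ |a| * (‖fderiv ℝ f x‖ * ‖v‖) := fun w hw => by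
    rw [norm_real, Real.norm_eq_abs, abs_mul, ← hw]
    gcongr
    exact (fderiv ℝ f x).le_opNorm w
  have h5 := h4 v rfl
  have h6 := h4 (I • v) (by simp [norm_smul])
  simp only [del, fderiv_ofReal_comp h3, h2, smul_apply, smul_eq_mul]
  rw [norm_div]
  have h7 := norm_sub_le ((a * fderiv ℝ f x v : ℝ) : ℂ) (I * ((a * fderiv ℝ f x (I • v) : ℝ) : ℂ))
  rw [norm_mul I, norm_I, one_mul] at h7
  rw [div_le_iff₀ (by simp)]
  simp only [norm_ofNat]
  linarith

set_option maxHeartbeats 1000000 in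
theorem exists_hormanderData_of_exhaustion {ι : Type*} [Fintype ι] (e : OrthonormalBasis ι ℂ E)
    {W : Set E} (hW : IsOpen W) (hWb : IsBounded W)
    {R : E → ℝ} (hR : ContDiff ℝ ∞ R) (hR1 : ∀ z ∈ W, R z < 1)
    (hcomp : ∀ τ < 1, IsCompact {z ∈ W | R z ≤ τ}) {c : ℝ} (hc : 0 < c)
    (hlevi : ∀ z ∈ W, 1 / 2 ≤ R z → ∀ v, c * ‖v‖ ^ 2 ≤ leviForm R z v) :
    ∃ (φ ψ : E → ℝ) (η : ℕ → E → ℝ) (ε : ℕ → ℝ), HormanderData e W φ ψ η ε ∧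
      ∀ x ∈ W, Real.exp ((ψ x - φ x) / 2) ≤ Real.exp 2 := by
  classical
  have : FiniteDimensional ℝ E := FiniteDimensional.complexToReal E
  have : ProperSpace E := FiniteDimensional.proper ℝ E
  have hR2 : ∀ z, ContDiffAt ℝ 2 R z := fun z =>
    hR.contDiffAt.of_le (WithTop.coe_le_coe.2 le_top)
  have hRd : ∀ z, DifferentiableAt ℝ R z := fun z => (hR2 z).differentiableAt (by simp)
  have hcl : IsCompact (closure W) := hWb.isCompact_closure
  obtain ⟨G, hG⟩ := hcl.exists_bound_of_continuousOn
    (hR.continuous_fderiv (by simp)).continuousOn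
  have hf1 : ContDiff ℝ ∞ (fderiv ℝ R) := hR.fderiv_right (by simp)
  obtain ⟨H, hH⟩ := hcl.exists_bound_of_continuousOn
    (hf1.continuous_fderiv (by simp)).continuousOn
  replace hG : ∀ x ∈ W, ‖fderiv ℝ R x‖ ≤ max G 0 := fun x hx =>
    (hG x (subset_closure hx)).trans (le_max_left _ _)
  replace hH : ∀ x ∈ W, ‖fderiv ℝ (fderiv ℝ R) x‖ ≤ max H 0 := fun x hx =>
    (hH x (subset_closure hx)).trans (le_max_left _ _)
  generalize hG' : max G 0 = G' at hG
  generalize hH' : max H 0 = H' at hH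
  have hG0 : 0 ≤ G' := hG' ▸ le_max_right _ _
  have hH0 : 0 ≤ H' := hH' ▸ le_max_right _ _
  have hpos : ∀ z ∈ W, 0 < 1 - R z := fun z hz => by linarith [hR1 z hz]
  let d : ℝ := Fintype.card ι
  have hd0 : 0 ≤ d := by positivity
  -- gradient bound for a composition
  have hdel : ∀ (Φ : ℝ → ℝ) (a : ℝ) (x : E), x ∈ W → HasDerivAt Φ a (R x) →
      ∑ j, ‖del (e j) (fun z => (Φ (R z) : ℂ)) x‖ ^ 2 ≤ d * (a ^ 2 * G' ^ 2) := by
    intro Φ a x hx hΦ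
    calc _ ≤ ∑ _j : ι, a ^ 2 * G' ^ 2 := by
          refine Finset.sum_le_sum fun j _ => ?_
          have h1 := norm_del_ofReal_comp_le (hRd x) hΦ (e j)
          rw [e.norm_eq_one, mul_one] at h1
          have h2 : ‖del (e j) (fun z => (Φ (R z) : ℂ)) x‖ ≤ |a| * G' :=
            h1.trans (by gcongr; exact hG x hx)
          calc _ ≤ (|a| * G') ^ 2 := by gcongr
            _ = _ := by rw [mul_pow, sq_abs]
      _ = _ := by simp [d]
  obtain ⟨A', hA'1, hA'⟩ : ∃ A' : ℝ, 1 ≤ A' ∧ 48 * (d * G' ^ 2) + 3 ≤ 3 * A' * c := by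
    refine ⟨max 1 ((48 * (d * G' ^ 2) + 3) / (3 * c)), le_max_left _ _, ?_⟩
    have := le_max_right 1 ((48 * (d * G' ^ 2) + 3) / (3 * c))
    rw [div_le_iff₀ (by positivity)] at this
    linarith
  obtain ⟨A, hA0, hA⟩ : ∃ A : ℝ, 0 ≤ A ∧ 16 * (48 * (d * G' ^ 2) + 3) + 48 * (A' * H') ≤ A :=
    ⟨_, by positivity, le_rfl⟩
  let κ : ℝ → ℝ := fun s => Real.smoothTransition (s - 1)
  have hκ : ContDiff ℝ ∞ κ := Real.smoothTransition.contDiff.comp (contDiff_id.sub contDiff_const)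
  have hκ0 : ∀ s ≤ 1, κ s = 0 := fun s hs => Real.smoothTransition.zero_of_nonpos (by linarith)
  have hκ1 : ∀ s, 2 ≤ s → κ s = 1 := fun s hs => Real.smoothTransition.one_of_one_le (by linarith)
  have hκd : ∀ s, HasDerivAt κ (deriv κ s) s := fun s =>
    ((hκ.differentiable (by simp)) s).hasDerivAt
  obtain ⟨T, hT⟩ := (isCompact_Icc (a := (1:ℝ)) (b := 2)).exists_bound_of_continuousOn
    (hκ.continuous_deriv (by simp)).continuousOn
  have hκ' : ∀ s, s < 1 ∨ 2 < s → deriv κ s = 0 := by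
    rintro s (hs | hs)
    · have : κ =ᶠ[𝓝 s] fun _ => 0 := by
        filter_upwards [Iio_mem_nhds hs] with y hy using hκ0 y (le_of_lt hy)
      rw [this.deriv_eq]; simp
    · have : κ =ᶠ[𝓝 s] fun _ => 1 := by
        filter_upwards [Ioi_mem_nhds hs] with y hy using hκ1 y (le_of_lt hy)
      rw [this.deriv_eq]; simp
  let η : ℕ → E → ℝ := fun n z => if z ∈ W then κ ((n + 1 : ℝ) * (1 - R z)) else 0
  have hηW : ∀ n, ∀ x ∈ W, η n =ᶠ[𝓝 x] fun z => κ ((n + 1 : ℝ) * (1 - R z)) := fun n x hx => by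
    filter_upwards [hW.mem_nhds hx] with z hz
    simp only [η, if_pos hz]
  have hn0 : ∀ n : ℕ, (0:ℝ) < n + 1 := fun n => by positivity
  let L : ℕ → Set E := fun n => {z ∈ W | R z ≤ 1 - 1 / (n + 1 : ℝ)}
  have hLc : ∀ n, IsCompact (L n) := fun n => hcomp _ (by
    have : (0:ℝ) < 1 / (n + 1 : ℝ) := by positivity
    linarith)
  have hηL : ∀ n, ∀ z ∉ L n, η n z = 0 := fun n z hz => by
    simp only [η]
    split_ifs with hzW
    · apply hκ0
      have : 1 - 1 / (n + 1 : ℝ) < R z := by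
        by_contra hcon
        exact hz ⟨hzW, not_lt.1 hcon⟩
      have h1 : 1 - R z < 1 / (n + 1 : ℝ) := by linarith
      rw [lt_div_iff₀ (hn0 n)] at h1
      linarith
    · rfl
  have hηsupp : ∀ n, tsupport (η n) ⊆ L n := fun n => by
    refine closure_minimal (fun z hz => ?_) (hLc n).isClosed
    by_contra hcon
    exact hz (hηL n z hcon)
  refine ⟨fun z => A' * ((1 - R z)⁻¹) ^ 3 + A * ‖z‖ ^ 2, fun z => -4 * Real.log (1 - R z), η,
    fun n => d * (T ^ 2 * G' ^ 2) * 16 * ((1 / ((n : ℝ) + 1)) * (1 / ((n : ℝ) + 1))), ?_, ?_⟩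
  · have hexp : ∀ x ∈ W, Real.exp (-4 * Real.log (1 - R x)) = ((1 - R x)⁻¹) ^ 4 := fun x hx => by
      rw [show -4 * Real.log (1 - R x) = (4 : ℕ) * (- Real.log (1 - R x)) by push_cast; ring,
        Real.exp_nat_mul, Real.exp_neg, Real.exp_log (hpos x hx)]
    have hsub : ContDiff ℝ ∞ fun z => 1 - R z := contDiff_const.sub hR
    have hN : ContDiff ℝ ∞ fun z : E => ‖z‖ ^ 2 := by
      let _ : InnerProductSpace ℝ E := InnerProductSpace.complexToReal
      exact contDiff_norm_sq ℝ
    refine ⟨hW, ?_, ?_, ?_, ?_, ?_, ?_, ?_, ?_, ?_, ?_, ?_⟩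
    · exact (contDiffOn_const.mul ((hsub.contDiffOn.inv fun x hx => (hpos x hx).ne').pow 3)).add
        (contDiff_const.mul hN).contDiffOn
    · exact contDiffOn_const.mul (hsub.contDiffOn.log fun x hx => (hpos x hx).ne')
    · intro x hx c'
      have hx0 := hpos x hx
      have h1 : ∑ j, ‖c' j‖ ^ 2 = ‖∑ j, c' j • e j‖ ^ 2 := by
        rw [← e.sum_sq_norm_inner_right]
        refine Finset.sum_congr rfl fun j _ => ?_
        rw [e.orthonormal.inner_right_fintype]
      rw [h1, hexp x hx]
      generalize (∑ j, c' j • e j) = v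
      have hD : ∀ s : ℝ, s < 1 → HasDerivAt (fun s => -4 * Real.log (1 - s)) (4 * (1 - s)⁻¹) s := by
        intro s hs
        have := (((hasDerivAt_id s).const_sub 1).log (by simp; linarith)).const_mul (-4)
        exact this.congr_deriv (by simp; ring)
      have h2 := hdel _ _ x hx (hD _ (hR1 x hx))
      have hΦ : ∀ s : ℝ, s < 1 → HasDerivAt (fun s => ((1 - s)⁻¹) ^ 3) (3 * ((1 - s)⁻¹) ^ 4) s := by
        intro s hs
        have h0 : (1 - s) ≠ 0 := by linarith
        have := ((((hasDerivAt_id s).const_sub 1).inv h0).pow 3)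
        refine this.congr_deriv ?_
        simp [Pi.inv_apply]
        field_simp
      have hΦ' : ∀ s : ℝ, s < 1 →
          HasDerivAt (fun s => 3 * ((1 - s)⁻¹) ^ 4) (12 * ((1 - s)⁻¹) ^ 5) s := by
        intro s hs
        have h0 : (1 - s) ≠ 0 := by linarith
        have := ((((hasDerivAt_id s).const_sub 1).inv h0).pow 4).const_mul 3
        refine this.congr_deriv ?_
        simp [Pi.inv_apply]
        field_simp
        norm_num
      have h3 := leviForm_comp (hR2 x) (Φ := fun s => ((1 - s)⁻¹) ^ 3)
        (Filter.mem_of_superset (Iio_mem_nhds (hR1 x hx)) fun s hs => hΦ s hs) (hΦ' _ (hR1 x hx)) v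
      have hc1 : ContDiffAt ℝ 2 (fun z => ((1 - R z)⁻¹) ^ 3) x :=
        ((contDiffAt_const.sub (hR2 x)).inv hx0.ne').pow 3
      have hc2 : ContDiffAt ℝ 2 (fun z : E => ‖z‖ ^ 2) x :=
        hN.contDiffAt.of_le (WithTop.coe_le_coe.2 le_top)
      rw [leviForm_add (contDiffAt_const.mul hc1) (contDiffAt_const.mul hc2),
        leviForm_const_mul hc1, leviForm_const_mul hc2, leviForm_norm_sq, h3]
      have hq0 : 0 < (1 - R x)⁻¹ := by positivity
      set q := (1 - R x)⁻¹ with hq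
      have hsq : 0 ≤ 12 * q ^ 5 / 4 * (fderiv ℝ R x v ^ 2 + fderiv ℝ R x (I • v) ^ 2) := by
        positivity
      have hV : 0 ≤ ‖v‖ ^ 2 := by positivity
      have h4 : (3 * ∑ j, ‖del (e j) (fun z => ((-4 * Real.log (1 - R z) : ℝ) : ℂ)) x‖ ^ 2 +
          3 * q ^ 4) * ‖v‖ ^ 2 ≤ (48 * (d * G' ^ 2) * q ^ 2 + 3 * q ^ 4) * ‖v‖ ^ 2 := by
        refine mul_le_mul_of_nonneg_right ?_ hV
        linarith
      refine h4.trans ?_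
      have hdG : 0 ≤ 48 * (d * G' ^ 2) := by positivity
      have hA'q : 0 ≤ A' * (12 * q ^ 5 / 4 * (fderiv ℝ R x v ^ 2 + fderiv ℝ R x (I • v) ^ 2)) := by
        positivity
      by_cases hRx : 1 / 2 ≤ R x
      · have hl := hlevi x hx hRx v
        have hq1 : 1 ≤ q := by
          rw [hq]; apply (one_le_inv₀ hx0).2; linarith
        have hq24 : q ^ 2 ≤ q ^ 4 := pow_le_pow_right₀ hq1 (by norm_num)
        have h5 : A' * (3 * q ^ 4 * (c * ‖v‖ ^ 2)) ≤ A' * (3 * q ^ 4 * leviForm R x v) := by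
          gcongr
        have h6 : (48 * (d * G' ^ 2) * q ^ 2 + 3 * q ^ 4) * ‖v‖ ^ 2 ≤
            (3 * A' * c) * q ^ 4 * ‖v‖ ^ 2 := by
          gcongr
          calc _ ≤ 48 * (d * G' ^ 2) * q ^ 4 + 3 * q ^ 4 := by gcongr
            _ = (48 * (d * G' ^ 2) + 3) * q ^ 4 := by ring
            _ ≤ _ := by gcongr
        have : 0 ≤ A * ‖v‖ ^ 2 := by positivity
        linarith
      · have hq2 : q ≤ 2 := by
          rw [hq]
          apply inv_le_of_inv_le₀ (by norm_num)
          push Not at hRx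
          norm_num
          linarith
        have hl := abs_leviForm_le R x v
        have hl' : -(H' * ‖v‖ ^ 2) ≤ leviForm R x v := by
          have h5 : 1 / 2 * ‖fderiv ℝ (fderiv ℝ R) x‖ * ‖v‖ ^ 2 ≤ H' * ‖v‖ ^ 2 := by
            gcongr
            have := hH x hx
            linarith [norm_nonneg (fderiv ℝ (fderiv ℝ R) x)]
          linarith [neg_abs_le (leviForm R x v)]
        have hq2' : q ^ 2 ≤ 16 := by nlinarith
        have hq4 : q ^ 4 ≤ 16 := by
          calc q ^ 4 ≤ 2 ^ 4 := by gcongr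
            _ = 16 := by norm_num
        have h5 : A' * (3 * q ^ 4 * -(H' * ‖v‖ ^ 2)) ≤ A' * (3 * q ^ 4 * leviForm R x v) := by
          gcongr
        have h6 : A' * (3 * q ^ 4 * (H' * ‖v‖ ^ 2)) ≤ A' * (3 * 16 * (H' * ‖v‖ ^ 2)) := by
          gcongr
        have h7 : (48 * (d * G' ^ 2) * q ^ 2 + 3 * q ^ 4) * ‖v‖ ^ 2 ≤
            (16 * (48 * (d * G' ^ 2) + 3)) * ‖v‖ ^ 2 := by
          gcongr
          calc _ ≤ 48 * (d * G' ^ 2) * 16 + 3 * 16 := by gcongr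
            _ = _ := by ring
        have h8 : (16 * (48 * (d * G' ^ 2) + 3) + 48 * (A' * H')) * ‖v‖ ^ 2 ≤ A * ‖v‖ ^ 2 := by
          gcongr
        linarith
    · intro n
      rw [contDiff_iff_contDiffAt]
      intro x
      by_cases hx : x ∈ W
      · refine ContDiffAt.congr_of_eventuallyEq ?_ (hηW n x hx)
        exact (hκ.comp (contDiff_const.mul hsub)).contDiffAt
      · have hxL : x ∈ (L n)ᶜ := fun h => hx h.1
        have h1 : η n =ᶠ[𝓝 x] fun _ => 0 := by
          filter_upwards [(hLc n).isClosed.isOpen_compl.mem_nhds hxL] with z hz using hηL n z hz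
        exact contDiffAt_const.congr_of_eventuallyEq h1
    · exact fun n => HasCompactSupport.intro (hLc n) fun z hz => hηL n z hz
    · exact fun n => (hηsupp n).trans fun z hz => hz.1
    · intro n x
      simp only [η]
      split_ifs
      · exact ⟨Real.smoothTransition.nonneg _, Real.smoothTransition.le_one _⟩
      · exact ⟨le_rfl, zero_le_one⟩
    · intro x hx
      obtain ⟨n₀, hn₀⟩ := exists_nat_ge (2 / (1 - R x))
      rw [div_le_iff₀ (hpos x hx)] at hn₀
      refine tendsto_const_nhds.congr' ?_
      filter_upwards [eventually_ge_atTop n₀] with n hn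
      simp only [η, if_pos hx]
      rw [hκ1]
      have h1 : (n₀ : ℝ) ≤ n := by exact_mod_cast hn
      have := hpos x hx
      nlinarith
    · intro n; positivity
    · have := (tendsto_one_div_add_atTop_nhds_zero_nat (𝕜 := ℝ))
      simpa using (this.mul this).const_mul (d * (T ^ 2 * G' ^ 2) * 16)
    · intro n x hx
      have hx0 := hpos x hx
      have e1 : ∀ j, del (e j) (fun z => (η n z : ℂ)) x =
          del (e j) (fun z => (κ ((n + 1 : ℝ) * (1 - R z)) : ℂ)) x := fun j =>
        del_congr_of_eventuallyEq ((hηW n x hx).mono fun z hz => by simp only [hz]) _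
      simp only [e1]
      have h1 : HasDerivAt (fun s => κ ((n + 1 : ℝ) * (1 - s)))
          (deriv κ ((n + 1 : ℝ) * (1 - R x)) * ((n + 1 : ℝ) * -1)) (R x) :=
        (hκd _).comp (R x) (((hasDerivAt_id (R x)).const_sub 1).const_mul (n + 1 : ℝ))
      have h2 := hdel _ _ x hx h1
      rw [show -(-4 * Real.log (1 - R x)) = (4 : ℕ) * Real.log (1 - R x) by push_cast; ring,
        Real.exp_nat_mul, Real.exp_log hx0]
      set s := (n + 1 : ℝ) * (1 - R x) with hs
      have hsx : (1 - R x) = s * (1 / ((n : ℝ) + 1)) := by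
        rw [hs]; field_simp
      have hn1 := hn0 n
      by_cases hs12 : s < 1 ∨ 2 < s
      · rw [hκ' s hs12] at h2
        have h3 : ∑ j, ‖del (e j) (fun z => (κ ((n + 1 : ℝ) * (1 - R z)) : ℂ)) x‖ ^ 2 ≤ 0 := by
          simpa using h2
        have h4 : (∑ j, ‖del (e j) (fun z => (κ ((n + 1 : ℝ) * (1 - R z)) : ℂ)) x‖ ^ 2) *
            (1 - R x) ^ 4 ≤ 0 := mul_nonpos_of_nonpos_of_nonneg h3 (by positivity)
        exact h4.trans (by positivity)
      · push Not at hs12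
        have hT1 := hT s hs12
        have h3 : deriv κ s ^ 2 ≤ T ^ 2 := by
          rw [← sq_abs]
          exact pow_le_pow_left₀ (abs_nonneg _) hT1 2
        have h4 : s ^ 4 ≤ 16 := by
          calc s ^ 4 ≤ 2 ^ 4 := by gcongr <;> linarith [hs12.1, hs12.2]
            _ = 16 := by norm_num
        calc _ ≤ (d * ((deriv κ s * ((n + 1 : ℝ) * -1)) ^ 2 * G' ^ 2)) * (1 - R x) ^ 4 := by
              gcongr
          _ = d * (deriv κ s ^ 2 * G' ^ 2) * s ^ 4 * ((1 / ((n : ℝ) + 1)) * (1 / ((n : ℝ) + 1))) := by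
              rw [hsx]; field_simp
          _ ≤ _ := by gcongr
  · intro x hx
    have hx0 := hpos x hx
    apply Real.exp_le_exp.2
    have hq0 : 0 < (1 - R x)⁻¹ := by positivity
    have h1 : Real.log (1 - R x) = - Real.log (1 - R x)⁻¹ := by rw [Real.log_inv]; ring
    beta_reduce
    rw [h1]
    set q := (1 - R x)⁻¹
    have h2 : Real.log q ≤ q := (Real.log_le_sub_one_of_pos hq0).trans (by linarith)
    have h3 : q ^ 3 ≤ A' * q ^ 3 := le_mul_of_one_le_left (by positivity) hA'1
    have h4 : 4 * q - q ^ 3 ≤ 4 := by nlinarith [sq_nonneg (q - 1), sq_nonneg (q - 2), hq0]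
    have h5 : 0 ≤ A * ‖x‖ ^ 2 := by positivity
    linarith

/-- Smooth functions with small `∂̄` on a domain with a strictly plurisubharmonic exhaustion are
close to holomorphic ones, uniformly on compacts. -/
theorem exists_holomorphic_of_exhaustion [MeasurableSpace E] [BorelSpace E] {μ : Measure E}
    [μ.IsAddHaarMeasure] {W : Set E} (hW : IsOpen W) (hWb : IsBounded W)
    {R : E → ℝ} (hR : ContDiff ℝ ∞ R) (hR1 : ∀ z ∈ W, R z < 1)
    (hcomp : ∀ τ < 1, IsCompact {z ∈ W | R z ≤ τ}) {c : ℝ} (hc : 0 < c)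
    (hlevi : ∀ z ∈ W, 1 / 2 ≤ R z → ∀ v, c * ‖v‖ ^ 2 ≤ leviForm R z v)
    {K L : Set E} (hL : IsCompact L) (hLW : L ⊆ W)
    {δ : ℝ} {k : E → ℝ} (hk : IsMollifier μ k δ) (hKL : ∀ x ∈ K, closedBall x δ ⊆ L) :
    ∃ C : ℝ, 0 ≤ C ∧ ∀ (u : E → ℂ) (m : ℝ), ContDiff ℝ ∞ u → 0 < m →
      (∀ x ∈ W, ∀ v, ‖dbar v u x‖ ≤ m * ‖v‖) →
      ∃ g : E → ℂ, ContDiff ℝ ∞ g ∧ (∀ x ∈ K, DifferentiableAt ℂ g x) ∧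
        ∀ x ∈ K, ‖g x - mollify μ k u x‖ ≤ C * m := by
  let e := stdOrthonormalBasis ℂ E
  obtain ⟨φ, ψ, η, ε, h, hB⟩ := exists_hormanderData_of_exhaustion e hW hWb hR hR1 hcomp hc hlevi
  have he : Submodule.span ℂ (range e) = ⊤ := by
    have := e.toBasis.span_eq
    rwa [e.coe_toBasis] at this
  obtain ⟨C, hC0, hC⟩ := h.exists_holomorphic he hWb hB hL hLW hk hKL
  refine ⟨C, hC0, fun u m hu hm hd => hC u m hu hm fun x hx j => ?_⟩
  simpa using hd x hx (e j)

end Exhaustion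

section DefiningFunction

open Filter Topology MeasureTheory
open scoped ContDiff ComplexConjugate

theorem IsCompact.exists_forall_pos_add_mul {X : Type*} [TopologicalSpace X] {K : Set X}
    (hK : IsCompact K) {f p : X → ℝ} (hf : ContinuousOn f K) (hp : ContinuousOn p K)
    (hp0 : ∀ x ∈ K, 0 ≤ p x) (h : ∀ x ∈ K, p x = 0 → 0 < f x) :
    ∃ A : ℝ, 0 < A ∧ ∀ x ∈ K, 0 < f x + A * p x := by
  by_contra! hcon
  have hn : ∀ n : ℕ, ∃ x ∈ K, f x + (n + 1 : ℝ) * p x ≤ 0 := fun n =>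
    hcon (n + 1) (by positivity)
  choose u huK hu using hn
  obtain ⟨x, hxK, hx⟩ := hK.exists_mapClusterPt (f := atTop) (u := u) 
    (Filter.tendsto_principal.2 (Eventually.of_forall huK))
  have hpx : ∀ k : ℕ, f x + (k : ℝ) * p x ≤ 0 := by
    intro k
    by_contra! hk
    have hc : ContinuousWithinAt (fun y => f y + (k : ℝ) * p y) K x :=
      (hf x hxK).add (continuousWithinAt_const.mul (hp x hxK))
    have h1 : ∀ᶠ y in 𝓝 x, y ∈ K → 0 < f y + (k : ℝ) * p y :=
      eventually_nhdsWithin_iff.1 (hc.eventually (lt_mem_nhds hk))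
    obtain ⟨n, hn1, hn2⟩ := ((mapClusterPt_iff_frequently.1 hx _ h1).and_eventually
      (eventually_ge_atTop k)).exists
    have h2 := hn1 (huK n)
    have h3 := hu n
    have h4 : (k : ℝ) ≤ n + 1 := by
      have : (k : ℝ) ≤ n := by exact_mod_cast hn2
      linarith
    have := mul_le_mul_of_nonneg_right h4 (hp0 _ (huK n))
    linarith
  rcases (hp0 x hxK).eq_or_lt with h0 | h0
  · have := hpx 0
    have := h x hxK h0.symm
    simp at *
    linarith
  · obtain ⟨k, hk⟩ := exists_nat_gt (-f x / p x)
    rw [div_lt_iff₀ h0] at hk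
    linarith [hpx k]

variable {E : Type*} [NormedAddCommGroup E] [InnerProductSpace ℂ E] [FiniteDimensional ℂ E]

theorem continuousOn_leviForm {r : E → ℝ} {U : Set E} (hU : IsOpen U) (hr : ContDiffOn ℝ ∞ r U)
    {S : Set E} : ContinuousOn (fun p : E × E => leviForm r p.1 p.2) (U ×ˢ S) := by
  have h1 : ContDiffOn ℝ ∞ (fderiv ℝ r) U := hr.fderiv_of_isOpen hU (by simp)
  have h2 : ContinuousOn (fderiv ℝ (fderiv ℝ r)) U := h1.continuousOn_fderiv_of_isOpen hU (by simp)
  have h3 : ContinuousOn (fun p : E × E => fderiv ℝ (fderiv ℝ r) p.1) (U ×ˢ S) :=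
    h2.comp continuousOn_fst fun p hp => hp.1
  have h4 : ContinuousOn (fun p : E × E => I • p.2) (U ×ˢ S) :=
    continuousOn_snd.const_smul I
  simp only [leviForm_eq]
  exact continuousOn_const.mul (((h3.clm_apply continuousOn_snd).clm_apply continuousOn_snd).add
    ((h3.clm_apply h4).clm_apply h4))

theorem exists_lt_of_fderiv_ne_zero {r : E → ℝ} {x : E}
    (h : fderiv ℝ r x ≠ 0) {V : Set E} (hV : V ∈ 𝓝 x) : ∃ y ∈ V, r y < r x := by
  by_contra! hcon
  have : IsLocalMin r x := Filter.mem_of_superset hV hcon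
  exact h this.fderiv_eq_zero

/-- A strictly plurisubharmonic defining function of a strongly pseudoconvex domain. -/
structure IsDefiningFunction (D : Set E) (r : E → ℝ) (η c : ℝ) : Prop where
  contDiff : ContDiff ℝ ∞ r
  eta_pos : 0 < η
  c_pos : 0 < c
  levi : ∀ z ∈ cthickening η (frontier D), ∀ v, c * ‖v‖ ^ 2 ≤ leviForm r z v
  nonpos : ∀ z ∈ D, r z ≤ 0
  eq_zero : ∀ z ∈ frontier D, r z = 0
  pos : ∀ z ∈ cthickening η (frontier D), z ∉ closure D → 0 < r z
  fderiv_ne_zero : ∀ z ∈ frontier D, fderiv ℝ r z ≠ 0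

theorem exists_isDefiningFunction {D U : Set E} {rD : E → ℝ} (hD : IsOpen D) (hDb : IsBounded D)
    (hU : IsOpen U) (hDU : frontier D ⊆ U) (hr : ContDiffOn ℝ ∞ rD U)
    (hDr : D ∩ U = {x ∈ U | rD x < 0}) (hdr : ∀ x ∈ frontier D, fderiv ℝ rD x ≠ 0)
    (hlevi : ∀ x ∈ frontier D, ∀ v : E, v ≠ 0 →
      fderiv ℝ rD x v = 0 → fderiv ℝ rD x (I • v) = 0 → 0 < leviForm rD x v) :
    ∃ r η c, IsDefiningFunction D r η c := by
  have : FiniteDimensional ℝ E := FiniteDimensional.complexToReal E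
  have : ProperSpace E := FiniteDimensional.proper ℝ E
  have hbD : IsCompact (frontier D) :=
    hDb.isCompact_closure.of_isClosed_subset isClosed_frontier frontier_subset_closure
  have hmem : ∀ x ∈ U, (x ∈ D ↔ rD x < 0) := fun x hx => by
    have : x ∈ D ∩ U ↔ x ∈ {x ∈ U | rD x < 0} := by rw [hDr]
    simpa [hx] using this
  have hrc : ContinuousOn rD U := hr.continuousOn
  have hrA : ∀ x ∈ U, ContDiffAt ℝ ∞ rD x := fun x hx => hr.contDiffAt (hU.mem_nhds hx)
  have hr2 : ∀ x ∈ U, ContDiffAt ℝ 2 rD x := fun x hx =>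
    (hrA x hx).of_le (WithTop.coe_le_coe.2 le_top)
  have hbD0 : ∀ x ∈ frontier D, rD x = 0 := by
    intro x hx
    apply le_antisymm
    · by_contra! hcon
      have h1 := (hrA x (hDU hx)).continuousAt.eventually (lt_mem_nhds hcon)
      obtain ⟨y, ⟨hy1, hy2⟩, hy3⟩ := mem_closure_iff_nhds.1 (frontier_subset_closure hx) _
        (Filter.inter_mem h1 (hU.mem_nhds (hDU hx)))
      have := (hmem y hy2).1 hy3
      exact absurd hy1 (by simp only [mem_ofPred_eq]; linarith)
    · by_contra! hcon
      have h1 := (hmem x (hDU hx)).2 hcon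
      rw [hD.frontier_eq] at hx
      exact hx.2 h1
  -- strict plurisubharmonicity along the boundary
  have hfd : ContinuousOn (fderiv ℝ rD) U := hr.continuousOn_fderiv_of_isOpen hU (by simp)
  have hfd' : ContinuousOn (fun p : E × E => fderiv ℝ rD p.1) (frontier D ×ˢ sphere (0 : E) 1) :=
    (hfd.mono hDU).comp continuousOn_fst fun p hp => hp.1
  obtain ⟨A, hA0, hA⟩ := (hbD.prod (isCompact_sphere (0 : E) 1)).exists_forall_pos_add_mul
    ((continuousOn_leviForm hU hr (S := sphere (0 : E) 1)).mono (prod_mono_left hDU))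
    (p := fun p => (fderiv ℝ rD p.1 p.2) ^ 2 + (fderiv ℝ rD p.1 (I • p.2)) ^ 2)
    (((hfd'.clm_apply continuousOn_snd).pow 2).add
      ((hfd'.clm_apply (continuousOn_snd.const_smul I)).pow 2))
    (fun p _ => by positivity)
    (fun p hp h0 => by
      have h1 : fderiv ℝ rD p.1 p.2 = 0 := by nlinarith [sq_nonneg (fderiv ℝ rD p.1 (I • p.2))]
      have h2 : fderiv ℝ rD p.1 (I • p.2) = 0 := by nlinarith [sq_nonneg (fderiv ℝ rD p.1 p.2)]
      exact hlevi p.1 hp.1 p.2 (ne_zero_of_mem_unit_sphere ⟨p.2, hp.2⟩) h1 h2)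
  obtain ⟨χ, hχ, -, hχU, hχ1, hχI⟩ := exists_cutoff hbD hU hDU
  let r : E → ℝ := fun z => χ z * (Real.exp ((4 * A) * rD z) - 1)
  have hrs : ContDiff ℝ ∞ r := by
    rw [contDiff_iff_contDiffAt]
    intro x
    by_cases hx : x ∈ U
    · exact hχ.contDiffAt.mul ((contDiffAt_const.mul (hrA x hx)).exp.sub contDiffAt_const)
    · have hx' : x ∉ tsupport χ := fun h => hx (hχU h)
      have h1 : r =ᶠ[𝓝 x] fun _ => 0 := by
        filter_upwards [notMem_tsupport_iff_eventuallyEq.1 hx'] with z hz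
        simp only [r, hz, Pi.zero_apply, zero_mul]
      exact contDiffAt_const.congr_of_eventuallyEq h1
  obtain ⟨V, hVo, hbDV, hV⟩ : ∃ V, IsOpen V ∧ frontier D ⊆ V ∧ ∀ x ∈ V, χ x = 1 := by
    obtain ⟨V, h1, h2, h3⟩ := mem_nhdsSet_iff_exists.1 hχ1
    exact ⟨V, h1, h2, h3⟩
  have hrV : ∀ x ∈ V, r =ᶠ[𝓝 x] fun z => Real.exp ((4 * A) * rD z) - 1 := fun x hx => by
    filter_upwards [hVo.mem_nhds hx] with z hz
    simp only [r, hV z hz, one_mul]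
  have hlr : ∀ p ∈ frontier D ×ˢ sphere (0 : E) 1, 0 < leviForm r p.1 p.2 := by
    rintro ⟨x, v⟩ hp
    have h1 := hA _ hp
    have hx : x ∈ frontier D := hp.1
    rw [leviForm_congr_of_eventuallyEq (hrV x (hbDV hx))]
    have hΦ : ∀ s : ℝ, HasDerivAt (fun s => Real.exp ((4 * A) * s) - 1)
        ((4 * A) * Real.exp ((4 * A) * s)) s := fun s =>
      ((((hasDerivAt_id s).const_mul (4 * A)).exp).sub_const 1).congr_deriv (by simp; ring)
    have hΦ' : HasDerivAt (fun s => (4 * A) * Real.exp ((4 * A) * s))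
        ((4 * A) * ((4 * A) * Real.exp ((4 * A) * rD x))) (rD x) :=
      ((((hasDerivAt_id (rD x)).const_mul (4 * A)).exp).const_mul (4 * A)).congr_deriv
        (by simp only [id, mul_one]; ring)
    have h2 := leviForm_comp (hr2 x (hDU hx)) (Eventually.of_forall hΦ) hΦ' v
    simp only at h2 h1
    rw [h2, hbD0 x hx]
    simp only [mul_zero, Real.exp_zero, mul_one]
    have : 0 < 4 * A := by positivity
    nlinarith [mul_pos this h1]
  have hlc : Continuous (fun p : E × E => leviForm r p.1 p.2) := by
    have := continuousOn_leviForm isOpen_univ hrs.contDiffOn (S := univ)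
    rwa [univ_prod_univ, continuousOn_univ] at this
  obtain ⟨c, hc0, hc⟩ := (hbD.prod (isCompact_sphere (0 : E) 1)).exists_forall_le' 
    (hlc.continuousOn) hlr
  have hdU : IsOpen (U ∩ {x | fderiv ℝ rD x ≠ 0}) :=
    hfd.isOpen_inter_preimage hU isOpen_ne
  obtain ⟨u, v, hu, -, hbDu, hsv, huv⟩ := generalized_tube_lemma hbD (isCompact_sphere (0 : E) 1)
    (isOpen_lt (continuous_const (y := c / 2)) hlc)
    (fun p hp => by
      have := hc p hp
      simp only [mem_ofPred_eq]; linarith)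
  obtain ⟨η, hη0, hη⟩ := hbD.exists_cthickening_subset_open ((hu.inter hVo).inter hdU)
    (fun x hx => ⟨⟨hbDu hx, hbDV hx⟩, hDU hx, hdr x hx⟩)
  refine ⟨r, η, c / 2, hrs, hη0, half_pos hc0, ?_, ?_, ?_, ?_, ?_⟩
  · intro z hz w
    rcases eq_or_ne w 0 with rfl | hw
    · have := leviForm_smul r z (0 : E) (0 : ℝ)
      simp only [smul_zero] at this
      rw [this]; simp
    · have hw0 : 0 < ‖w‖ := norm_pos_iff.2 hw
      have h1 : (z, ‖w‖⁻¹ • w) ∈ {p : E × E | c / 2 < leviForm r p.1 p.2} := by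
        apply huv
        refine ⟨(hη hz).1.1, hsv ?_⟩
        simp [norm_smul, hw0.ne']
      have h2 := leviForm_smul r z (‖w‖⁻¹ • w) ‖w‖
      rw [smul_smul, mul_inv_cancel₀ hw0.ne', one_smul] at h2
      rw [h2]
      have h3 : c / 2 ≤ leviForm r z (‖w‖⁻¹ • w) := le_of_lt h1
      nlinarith [sq_nonneg ‖w‖]
  · intro z hz
    by_cases hzU : z ∈ U
    · have h1 := (hmem z hzU).1 hz
      have h2 : Real.exp ((4 * A) * rD z) ≤ 1 := by
        rw [Real.exp_le_one_iff]
        exact mul_nonpos_of_nonneg_of_nonpos (by positivity) h1.le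
      exact mul_nonpos_of_nonneg_of_nonpos (hχI z).1 (by linarith)
    · have : χ z = 0 := image_eq_zero_of_notMem_tsupport fun h => hzU (hχU h)
      simp [r, this]
  · intro z hz
    simp [r, hbD0 z hz]
  · intro z hz hzD
    obtain ⟨⟨-, hzV⟩, hzU, hdz⟩ := hη hz
    have h1 : 0 < rD z := by
      by_contra! hcon
      apply hzD
      rw [mem_closure_iff_nhds]
      intro t ht
      obtain ⟨y, ⟨hy1, hy2⟩, hy3⟩ := exists_lt_of_fderiv_ne_zero hdz (Filter.inter_mem ht (hU.mem_nhds hzU))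
      exact ⟨y, hy1, (hmem y hy2).2 (by linarith)⟩
    simp only [r, hV z hzV, one_mul]
    have : 1 < Real.exp ((4 * A) * rD z) := Real.one_lt_exp_iff.2 (by positivity)
    linarith
  · intro z hz
    rw [(hrV z (hbDV hz)).fderiv_eq]
    have h1 : HasFDerivAt (fun z => Real.exp ((4 * A) * rD z) - 1)
        (Real.exp ((4 * A) * rD z) • ((4 * A) • fderiv ℝ rD z)) z :=
      ((((hr2 z (hDU hz)).differentiableAt (by simp)).hasFDerivAt.const_mul (4 * A)).exp).sub_const 1
    rw [h1.fderiv]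
    exact smul_ne_zero (Real.exp_ne_zero _) (smul_ne_zero (by positivity) (hdr z hz))

/-- Small pseudoconvex neighbourhoods of a strongly pseudoconvex domain. -/
theorem IsDefiningFunction.exists_neighborhoods {D : Set E} {r : E → ℝ} {η c : ℝ}
    (h : IsDefiningFunction D r η c) (hD : IsOpen D) (hDb : IsBounded D)
    (hne : (frontier D).Nonempty) :
    ∃ s₀ > 0, ∀ s ∈ Ioc 0 s₀, ∃ W : Set E, IsOpen W ∧ IsBounded W ∧ closure D ⊆ W ∧
      (∀ z ∈ W, r z < s) ∧ (∀ τ < s, IsCompact {z ∈ W | r z ≤ τ}) ∧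
      ∀ z ∈ W, 0 < r z → ∀ v, c * ‖v‖ ^ 2 ≤ leviForm r z v := by
  have : FiniteDimensional ℝ E := FiniteDimensional.complexToReal E
  have : ProperSpace E := FiniteDimensional.proper ℝ E
  have hbD : IsCompact (frontier D) :=
    hDb.isCompact_closure.of_isClosed_subset isClosed_frontier frontier_subset_closure
  have hrc : Continuous r := h.contDiff.continuous
  have hcth : IsCompact (cthickening η (frontier D)) := hbD.cthickening
  have hth : ∀ z, infDist z (frontier D) ≤ η → z ∈ cthickening η (frontier D) := fun z hz =>
    by
      obtain ⟨y, hy, hzy⟩ := hbD.exists_infDist_eq_dist hne z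
      exact mem_cthickening_of_dist_le z y η _ hy (hzy ▸ hz)
  have hcl : ∀ z, z ∈ closure D → z ∈ D ∨ z ∈ frontier D := fun z hz => by
    by_cases hzD : z ∈ D
    · exact Or.inl hzD
    · right; rw [hD.frontier_eq]; exact ⟨hz, hzD⟩
  let S : Set E := {z | infDist z (frontier D) = η} ∩ Dᶜ
  have hS : IsCompact S := by
    refine hcth.of_isClosed_subset ?_ fun z hz => hth z (le_of_eq hz.1)
    exact (isClosed_eq (continuous_infDist_pt _) continuous_const).inter hD.isClosed_compl
  have hSpos : ∀ z ∈ S, 0 < r z := by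
    intro z hz
    refine h.pos z (hth z (le_of_eq hz.1)) fun hzc => ?_
    rcases hcl z hzc with h1 | h1
    · exact hz.2 h1
    · have h2 := hz.1
      simp only [mem_ofPred_eq, infDist_zero_of_mem h1] at h2
      exact h.eta_pos.ne h2
  obtain ⟨m, hm0, hm⟩ := hS.exists_forall_le' hrc.continuousOn hSpos
  refine ⟨m / 2, half_pos hm0, fun s hs => ?_⟩
  let W : Set E := D ∪ ({z | infDist z (frontier D) < η} ∩ {z | r z < s})
  have hWo : IsOpen W := hD.union ((isOpen_lt (continuous_infDist_pt _) continuous_const).inter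
    (isOpen_lt hrc continuous_const))
  have hWb : IsBounded W := hDb.union (hcth.isBounded.subset fun z hz => hth z (le_of_lt hz.1))
  have hclW : closure D ⊆ W := by
    intro z hz
    rcases hcl z hz with h1 | h1
    · exact Or.inl h1
    · right
      simp only [mem_inter_iff, mem_ofPred_eq, infDist_zero_of_mem h1, h.eq_zero z h1]
      exact ⟨h.eta_pos, hs.1⟩
  refine ⟨W, hWo, hWb, hclW, ?_, ?_, ?_⟩
  · rintro z (hz | hz)
    · exact (h.nonpos z hz).trans_lt hs.1
    · exact hz.2
  · intro τ hτ
    refine Metric.isCompact_of_isClosed_isBounded ?_ (hWb.subset fun z hz => hz.1)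
    rw [← isSeqClosed_iff_isClosed]
    intro x z hx hz
    have hrz : r z ≤ τ := le_of_tendsto ((hrc.tendsto z).comp hz) (.of_forall fun n => (hx n).2)
    refine ⟨?_, hrz⟩
    by_cases hzc : z ∈ closure D
    · exact hclW hzc
    · have h1 : ∀ᶠ n in atTop, x n ∉ closure D :=
        hz.eventually (isClosed_closure.isOpen_compl.mem_nhds hzc)
      have h2 : infDist z (frontier D) ≤ η := by
        refine le_of_tendsto (((continuous_infDist_pt _).tendsto z).comp hz) ?_
        filter_upwards [h1] with n hn
        rcases (hx n).1 with h3 | h3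
        · exact absurd (subset_closure h3) hn
        · exact le_of_lt h3.1
      right
      refine ⟨lt_of_le_of_ne h2 fun h3 => ?_, lt_of_le_of_lt hrz hτ⟩
      have := hm z ⟨h3, fun h4 => hzc (subset_closure h4)⟩
      linarith [hs.2]
  · rintro z (hz | hz) hr0 v
    · exact absurd (h.nonpos z hz) (by linarith)
    · exact h.levi z (hth z (le_of_lt hz.1)) v

end DefiningFunction

section LeviPolynomial

open Filter Topology MeasureTheory
open scoped ContDiff ComplexConjugate

variable {E : Type*} [NormedAddCommGroup E] [InnerProductSpace ℂ E] [FiniteDimensional ℂ E]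

/-- The negative of the Levi polynomial of `r` at `ζ`. -/
def leviPoly (r : E → ℝ) (ζ z : E) : ℂ :=
  -(complexForm (fderiv ℝ r ζ) (z - ζ) + complexQuad (fderiv ℝ (fderiv ℝ r) ζ) (z - ζ) (z - ζ))

theorem contDiff_leviPoly (𝕜 : Type*) [NontriviallyNormedField 𝕜] [NormedSpace 𝕜 E]
    [NormedAlgebra 𝕜 ℂ] [IsScalarTower 𝕜 ℂ E] (r : E → ℝ) (ζ : E) {n : WithTop ℕ∞} :
    ContDiff 𝕜 n (leviPoly r ζ) := by
  have h1 : ContDiff ℂ n (leviPoly r ζ) := by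
    have hA : ContDiff ℂ n (complexForm (fderiv ℝ r ζ)) :=
      (LinearMap.toContinuousLinearMap (complexForm (fderiv ℝ r ζ))).contDiff
    let Q : E →L[ℂ] E →L[ℂ] ℂ := LinearMap.toContinuousLinearMap
      (LinearMap.toContinuousLinearMap.toLinearMap ∘ₗ complexQuad (fderiv ℝ (fderiv ℝ r) ζ))
    have hs : ContDiff ℂ n fun z => z - ζ := contDiff_id.sub contDiff_const
    exact ((hA.comp hs).add ((Q.contDiff.comp hs).clm_apply hs)).neg
  exact h1.restrict_scalars 𝕜

theorem exists_lipschitz_bound {F : Type*} [NormedAddCommGroup F] [NormedSpace ℝ F] {f : E → F}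
    (hf : ContDiff ℝ ∞ f) (z₀ : E) (R : ℝ) : ∃ Λ : ℝ, 0 ≤ Λ ∧
      ∀ x ∈ closedBall z₀ R, ∀ y ∈ closedBall z₀ R, ‖f x - f y‖ ≤ Λ * ‖x - y‖ := by
  have : FiniteDimensional ℝ E := FiniteDimensional.complexToReal E
  have : ProperSpace E := FiniteDimensional.proper ℝ E
  obtain ⟨Λ, hΛ⟩ := (isCompact_closedBall z₀ R).exists_bound_of_continuousOn
    (hf.continuous_fderiv (by simp)).continuousOn
  refine ⟨max Λ 0, le_max_right _ _, fun x hx y hy => ?_⟩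
  exact (convex_closedBall z₀ R).norm_image_sub_le_of_norm_fderiv_le
    (fun w _ => (hf.differentiable (by simp)) w) (fun w hw => (hΛ w hw).trans (le_max_left _ _)) hy hx

theorem exists_leviPoly_four_point {r : E → ℝ} (hr : ContDiff ℝ ∞ r) (z₀ : E) :
    ∃ C : ℝ, 0 ≤ C ∧ ∀ z ∈ closedBall z₀ 1, ∀ z' ∈ closedBall z₀ 1, ∀ ζ ∈ closedBall z₀ 1,
      ∀ ζ' ∈ closedBall z₀ 1,
      ‖(leviPoly r ζ z - leviPoly r ζ' z) - (leviPoly r ζ z' - leviPoly r ζ' z')‖ ≤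
        C * ‖z - z'‖ * ‖ζ - ζ'‖ := by
  have : FiniteDimensional ℝ E := FiniteDimensional.complexToReal E
  have : ProperSpace E := FiniteDimensional.proper ℝ E
  have hA : ContDiff ℝ ∞ (fderiv ℝ r) := hr.fderiv_right (by simp)
  have hH : ContDiff ℝ ∞ (fderiv ℝ (fderiv ℝ r)) := hA.fderiv_right (by simp)
  obtain ⟨Λ₁, h1, hΛ₁⟩ := exists_lipschitz_bound hA z₀ 1
  obtain ⟨Λ₂, h2, hΛ₂⟩ := exists_lipschitz_bound hH z₀ 1
  obtain ⟨Λ₃, hΛ₃⟩ := (isCompact_closedBall z₀ 1).exists_bound_of_continuousOn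
    (hA.continuous_fderiv (by simp)).continuousOn
  have h3 : 0 ≤ Λ₃ := (norm_nonneg (fderiv ℝ (fderiv ℝ r) z₀)).trans
    (hΛ₃ z₀ (mem_closedBall_self zero_le_one))
  refine ⟨2 * Λ₁ + 4 * Λ₂ + 2 * Λ₃, by positivity, fun z hz z' hz' ζ hζ ζ' hζ' => ?_⟩
  have hsym : ∀ x v w, fderiv ℝ (fderiv ℝ r) x v w = fderiv ℝ (fderiv ℝ r) x w v := fun x v w =>
    isSymmSndFDerivAt_of_contDiffAt (hr.contDiffAt.of_le (WithTop.coe_le_coe.2 le_top)) v w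
  have hq : ∀ x, complexQuad (fderiv ℝ (fderiv ℝ r) x) (z - x) (z - x) -
      complexQuad (fderiv ℝ (fderiv ℝ r) x) (z' - x) (z' - x) =
      complexQuad (fderiv ℝ (fderiv ℝ r) x) (z - z') ((z - x) + (z' - x)) := by
    intro x
    have h1 : z - z' = (z - x) - (z' - x) := by abel
    rw [h1]
    simp only [map_sub, LinearMap.sub_apply, map_add]
    have h2 := complexQuad_comm (hsym x) z z'
    have h3 := complexQuad_comm (hsym x) x z'
    have h4 := complexQuad_comm (hsym x) x z
    linear_combination -h2 + h3 - h4
  have hl : ∀ x, complexForm (fderiv ℝ r x) (z - x) - complexForm (fderiv ℝ r x) (z' - x) =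
      complexForm (fderiv ℝ r x) (z - z') := fun x => by simp only [map_sub]; ring
  have e : (leviPoly r ζ z - leviPoly r ζ' z) - (leviPoly r ζ z' - leviPoly r ζ' z') =
      -(complexForm (fderiv ℝ r ζ - fderiv ℝ r ζ') (z - z') +
        complexQuad (fderiv ℝ (fderiv ℝ r) ζ - fderiv ℝ (fderiv ℝ r) ζ') (z - z')
          ((z - ζ) + (z' - ζ)) +
        complexQuad (fderiv ℝ (fderiv ℝ r) ζ') (z - z') ((2 : ℂ) • (ζ' - ζ))) := by
    have e1 : (2 : ℂ) • (ζ' - ζ) = ((z - ζ) + (z' - ζ)) - ((z - ζ') + (z' - ζ')) := by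
      rw [two_smul]; abel
    rw [e1, complexForm_sub, complexQuad_sub, map_sub (complexQuad _ (z - z'))]
    simp only [leviPoly]
    linear_combination -(hq ζ) + hq ζ' - (hl ζ) + hl ζ'
  rw [e, norm_neg]
  have hd : ∀ x ∈ closedBall z₀ 1, ∀ y ∈ closedBall z₀ 1, ‖x - y‖ ≤ 2 := fun x hx y hy => by
    rw [← dist_eq_norm]
    have := dist_triangle_right x y z₀
    rw [mem_closedBall] at hx hy
    linarith
  have b1 := (norm_complexForm_le (fderiv ℝ r ζ - fderiv ℝ r ζ') (z - z'))
  have b2 := (norm_complexQuad_le (fderiv ℝ (fderiv ℝ r) ζ - fderiv ℝ (fderiv ℝ r) ζ') (z - z')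
    ((z - ζ) + (z' - ζ)))
  have b3 := (norm_complexQuad_le (fderiv ℝ (fderiv ℝ r) ζ') (z - z') ((2 : ℂ) • (ζ' - ζ)))
  have c1 := hΛ₁ ζ hζ ζ' hζ'
  have c2 := hΛ₂ ζ hζ ζ' hζ'
  have c3 := hΛ₃ ζ' hζ'
  have d1 : ‖(z - ζ) + (z' - ζ)‖ ≤ 4 := (norm_add_le _ _).trans (by
    linarith [hd z hz ζ hζ, hd z' hz' ζ hζ])
  have d2 : ‖(2 : ℂ) • (ζ' - ζ)‖ = 2 * ‖ζ - ζ'‖ := by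
    rw [norm_smul, norm_sub_rev]; simp
  rw [d2] at b3
  have p1 : 2 * ‖fderiv ℝ r ζ - fderiv ℝ r ζ'‖ * ‖z - z'‖ ≤ 2 * (Λ₁ * ‖ζ - ζ'‖) * ‖z - z'‖ :=
    mul_le_mul_of_nonneg_right (by linarith) (norm_nonneg _)
  have p2 : ‖fderiv ℝ (fderiv ℝ r) ζ - fderiv ℝ (fderiv ℝ r) ζ'‖ * ‖z - z'‖ *
      ‖(z - ζ) + (z' - ζ)‖ ≤ (Λ₂ * ‖ζ - ζ'‖) * ‖z - z'‖ * 4 :=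
    mul_le_mul (mul_le_mul_of_nonneg_right c2 (norm_nonneg _)) d1 (norm_nonneg _) (by positivity)
  have p3 : ‖fderiv ℝ (fderiv ℝ r) ζ'‖ * ‖z - z'‖ * (2 * ‖ζ - ζ'‖) ≤
      Λ₃ * ‖z - z'‖ * (2 * ‖ζ - ζ'‖) :=
    mul_le_mul_of_nonneg_right (mul_le_mul_of_nonneg_right c3 (norm_nonneg _)) (by positivity)
  refine (norm_add₃_le).trans ?_
  linarith

theorem IsDefiningFunction.exists_leviPoly_re_bounds {D : Set E} {r : E → ℝ} {η c : ℝ}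
    (h : IsDefiningFunction D r η c) (z₀ : E) : ∃ a > 0, ∃ C : ℝ, 0 ≤ C ∧ a ≤ 1 ∧
      ∀ ζ ∈ frontier D, ζ ∈ closedBall z₀ a → ∀ z, ‖z - ζ‖ ≤ a →
        c / 2 * ‖z - ζ‖ ^ 2 - r z ≤ (leviPoly r ζ z).re ∧
        (leviPoly r ζ z).re ≤ C * ‖z - ζ‖ ^ 2 - r z := by
  have : FiniteDimensional ℝ E := FiniteDimensional.complexToReal E
  have : ProperSpace E := FiniteDimensional.proper ℝ E
  have hr := h.contDiff
  have hA : ContDiff ℝ ∞ (fderiv ℝ r) := hr.fderiv_right (by simp)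
  have hH : ContDiff ℝ ∞ (fderiv ℝ (fderiv ℝ r)) := hA.fderiv_right (by simp)
  obtain ⟨Λ₂, h2, hΛ₂⟩ := exists_lipschitz_bound hH z₀ 1
  obtain ⟨Λ₃, hΛ₃⟩ := (isCompact_closedBall z₀ 1).exists_bound_of_continuousOn
    (hA.continuous_fderiv (by simp)).continuousOn
  have h3 : 0 ≤ Λ₃ := (norm_nonneg (fderiv ℝ (fderiv ℝ r) z₀)).trans
    (hΛ₃ z₀ (mem_closedBall_self zero_le_one))
  have hc := h.c_pos
  let a := min (1 / 3) (c / (4 * (Λ₂ + 1)))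
  have ha0 : 0 < a := lt_min (by norm_num) (by positivity)
  have ha1 : a ≤ 1 / 3 := min_le_left _ _
  have ha2 : Λ₂ * (2 * a) ≤ c / 2 := by
    have h5 : a ≤ c / (4 * (Λ₂ + 1)) := min_le_right _ _
    rw [le_div_iff₀ (by positivity)] at h5
    nlinarith
  refine ⟨a, ha0, Λ₃ + c / 2, by positivity, by linarith, fun ζ hζ hζa z hz => ?_⟩
  have hr2 : ∀ y, ContDiffAt ℝ 2 r y := fun y => hr.contDiffAt.of_le (WithTop.coe_le_coe.2 le_top)
  have hζ1 : ζ ∈ closedBall z₀ 1 := closedBall_subset_closedBall (by linarith) hζa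
  have ht := abs_taylor_two_le (ρ := r) (x := ζ) (δ := 2 * a) (σ := c / 2) (fun y _ => hr2 y)
    (fun y hy => by
      have hy1 : y ∈ closedBall z₀ 1 := by
        rw [mem_closedBall] at hζa ⊢
        rw [mem_ball] at hy
        linarith [dist_triangle y ζ z₀]
      refine (hΛ₂ y hy1 ζ hζ1).trans (le_trans ?_ ha2)
      rw [mem_ball, dist_eq_norm] at hy
      exact mul_le_mul_of_nonneg_left hy.le h2) (v := z - ζ) (by linarith)
  rw [add_sub_cancel, h.eq_zero ζ hζ, half_fderiv_fderiv_eq r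
    (isSymmSndFDerivAt_of_contDiffAt (hr2 ζ)), abs_le] at ht
  have hl := h.levi ζ (self_subset_cthickening _ hζ) (z - ζ)
  have hl2 := (le_abs_self _).trans (abs_leviForm_le r ζ (z - ζ))
  have hl3 : (1 / 2) * ‖fderiv ℝ (fderiv ℝ r) ζ‖ * ‖z - ζ‖ ^ 2 ≤ Λ₃ * ‖z - ζ‖ ^ 2 := by
    refine mul_le_mul_of_nonneg_right ?_ (by positivity)
    linarith [hΛ₃ ζ hζ1, norm_nonneg (fderiv ℝ (fderiv ℝ r) ζ)]
  have hF : (leviPoly r ζ z).re = -(fderiv ℝ r ζ (z - ζ) +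
      (complexQuad (fderiv ℝ (fderiv ℝ r) ζ) (z - ζ) (z - ζ)).re) := by
    rw [leviPoly, neg_re, add_re, complexForm_re]
  rw [hF]
  constructor <;> linarith [ht.1, ht.2]

end LeviPolynomial

section Peak

open Filter Topology MeasureTheory
open scoped ContDiff ComplexConjugate

variable {E : Type*} [NormedAddCommGroup E] [InnerProductSpace ℂ E] [FiniteDimensional ℂ E]

theorem IsMollifier.norm_mollify_le [MeasurableSpace E] [BorelSpace E] {μ : Measure E}
    [μ.IsAddHaarMeasure] {k : E → ℝ} {δ : ℝ} (hk : IsMollifier μ k δ) {g : E → ℂ} {x : E} {B : ℝ}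
    (hB : ∀ y ∈ ball x δ, ‖g y‖ ≤ B) : ‖mollify μ k g x‖ ≤ B := by
  have : FiniteDimensional ℝ E := FiniteDimensional.complexToReal E
  rw [mollify_eq]
  have hi : Integrable k μ := integrable_of_integral_eq_one hk.integral_eq_one
  have h1 := norm_integral_le_of_norm_le (f := fun y => g (x - y) * (k y : ℂ)) (hi.const_mul B)
    (Eventually.of_forall fun y => by
      rw [norm_mul, norm_real, Real.norm_of_nonneg (hk.nonneg y)]
      by_cases hy : y ∈ ball 0 δ
      · refine mul_le_mul_of_nonneg_right (hB _ ?_) (hk.nonneg y)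
        rw [mem_ball, dist_eq_norm]
        simpa using hy
      · have : k y = 0 := by
          by_contra h0
          exact hy (hk.support_subset h0)
        simp [this])
  rwa [integral_const_mul, hk.integral_eq_one, mul_one] at h1

theorem norm_cexp_neg_mul (t : ℝ) (w : ℂ) : ‖cexp (-(t ^ 2 : ℝ) * w)‖ = Real.exp (-(t ^ 2 * w.re)) := by
  rw [Complex.norm_exp]
  rw [← ofReal_neg, re_ofReal_mul, neg_mul]

/-- Holomorphic functions concentrated near a boundary point, with Gaussian decay. -/
theorem IsDefiningFunction.exists_peak {D : Set E} {r : E → ℝ} {η c : ℝ}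
    (h : IsDefiningFunction D r η c) (hD : IsOpen D) (hDb : IsBounded D) {z₀ : E}
    (hz₀ : z₀ ∈ frontier D) :
    ∃ a c₁ C : ℝ, 0 < a ∧ a ≤ 1 ∧ 0 < c₁ ∧ 1 ≤ C ∧ ∀ ζ ∈ frontier D, ζ ∈ closedBall z₀ a →
      (∀ z ∈ frontier D, ‖z - ζ‖ ≤ a → (leviPoly r ζ z).re ≤ C * ‖z - ζ‖ ^ 2) ∧
      (∀ z ∈ closure D, ‖z - ζ‖ ≤ a → c₁ * ‖z - ζ‖ ^ 2 ≤ (leviPoly r ζ z).re) ∧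
      ∀ t : ℝ, 1 ≤ t → ∃ g : E → ℂ, ContDiff ℝ ∞ g ∧ (∀ z ∈ closure D, DifferentiableAt ℂ g z) ∧
        (∀ z ∈ closure D, ‖g z‖ ≤ C * Real.exp (-(c₁ * (t ^ 2 * ‖z - ζ‖ ^ 2)))) ∧
        ∀ z ∈ closure D, ‖z - ζ‖ ≤ a →
          ‖g z - cexp (-(t ^ 2 : ℝ) * leviPoly r ζ z)‖ ≤ C * Real.exp (-(c₁ * t ^ 2)) := by
  have : FiniteDimensional ℝ E := FiniteDimensional.complexToReal E
  have : ProperSpace E := FiniteDimensional.proper ℝ E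
  let _ : MeasurableSpace E := borel E
  have : BorelSpace E := ⟨rfl⟩
  let μ : Measure E := Measure.addHaar
  have hr := h.contDiff
  have hrcl : ∀ z ∈ closure D, r z ≤ 0 := fun z hz =>
    closure_minimal (s := D) (t := {z | r z ≤ 0}) h.nonpos (isClosed_le hr.continuous continuous_const) hz
  obtain ⟨a₀, ha₀, C₀, hC₀, ha₀1, hF⟩ := h.exists_leviPoly_re_bounds z₀
  obtain ⟨s₀, hs₀, hW⟩ := h.exists_neighborhoods hD hDb ⟨z₀, hz₀⟩
  have hc := h.c_pos
  obtain ⟨a, ha, haa⟩ : ∃ a : ℝ, 0 < a ∧ 4 * a = a₀ := ⟨a₀ / 4, by positivity, by ring⟩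
  obtain ⟨κ, hκ, hκa⟩ : ∃ κ : ℝ, 0 < κ ∧ κ = c * a ^ 2 / 16 := ⟨_, by positivity, rfl⟩
  let s := min s₀ κ
  have hs : 0 < s := lt_min hs₀ hκ
  obtain ⟨W, hWo, hWb, hDW, hWr, hWc, hWl⟩ := hW s ⟨hs, min_le_left _ _⟩
  have hcD : IsCompact (closure D) := hDb.isCompact_closure
  obtain ⟨δ₁, hδ₁, hδW⟩ := hcD.exists_cthickening_subset_open hWo hDW
  let δ := min δ₁ (a / 4)
  have hδ : 0 < δ := lt_min hδ₁ (by positivity)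
  have hδa : δ ≤ a / 4 := min_le_right _ _
  obtain ⟨k, hk, hkc⟩ := exists_circular_isMollifier μ hδ
  have hLW : cthickening δ (closure D) ⊆ W := (cthickening_mono (min_le_left _ _) _).trans hδW
  have hKL : ∀ x ∈ closure D, closedBall x δ ⊆ cthickening δ (closure D) := fun x hx =>
    closedBall_subset_cthickening hx δ
  obtain ⟨C₁, hC₁, happ⟩ := exists_holomorphic_of_exhaustion (μ := μ) hWo hWb
    (R := fun z => s⁻¹ * r z) (contDiff_const.mul hr)
    (fun z hz => by
      rw [inv_mul_lt_iff₀ hs]; simpa using hWr z hz)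
    (fun τ hτ => by
      have h1 := hWc (s * τ) (by nlinarith)
      convert h1 using 3 with z
      rw [inv_mul_le_iff₀ hs])
    (c := s⁻¹ * c) (by positivity)
    (fun z hz hz2 v => by
      have h1 : 0 < r z := by
        by_contra! hcon
        have : s⁻¹ * r z ≤ 0 := mul_nonpos_of_nonneg_of_nonpos (by positivity) hcon
        linarith
      rw [leviForm_const_mul (hr.contDiffAt.of_le (WithTop.coe_le_coe.2 le_top)), mul_assoc]
      exact mul_le_mul_of_nonneg_left (hWl z hz h1 v) (by positivity))
    hcD.cthickening hLW hk hKL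
  obtain ⟨χ, hχ, hχc, hχs, hχ1, hχI⟩ := exists_cutoff (isCompact_closedBall z₀ (2 * a))
    (isOpen_ball (x := z₀) (ε := 3 * a)) (closedBall_subset_ball (by linarith))
  have hχ1' : ∀ z ∈ closedBall z₀ (2 * a), χ =ᶠ[𝓝 z] fun _ => 1 := fun z hz =>
    (eventually_nhdsSet_iff_forall.1 hχ1) z hz
  obtain ⟨G, hG⟩ := (hχ.continuous_fderiv (by simp)).bounded_above_of_compact_support
    (hχc.fderiv ℝ)
  have hG0 : 0 ≤ G := (norm_nonneg _).trans (hG 0)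
  obtain ⟨Δ₀, hΔ₀⟩ := hDb.closure.subset_closedBall (0 : E)
  let Δ := max 1 (2 * Δ₀)
  have hΔ1 : 1 ≤ Δ := le_max_left _ _
  have hΔ : ∀ z ∈ closure D, ∀ w ∈ closure D, ‖z - w‖ ≤ Δ := fun z hz w hw => by
    have h1 := hΔ₀ hz
    have h2 := hΔ₀ hw
    rw [mem_closedBall, dist_zero_right] at h1 h2
    exact (norm_sub_le _ _).trans ((by linarith : _ ≤ 2 * Δ₀).trans (le_max_right _ _))
  let c₁ := min (c / 2) (κ / Δ ^ 2)
  have hc₁ : 0 < c₁ := lt_min (by positivity) (by positivity)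
  have hc₁c : c₁ ≤ c / 2 := min_le_left _ _
  have hc₁Δ : c₁ * Δ ^ 2 ≤ κ := by
    have := min_le_right (c / 2) (κ / Δ ^ 2)
    rwa [le_div_iff₀ (by positivity)] at this
  have hc₁κ : c₁ ≤ κ :=
    (le_mul_of_one_le_right hc₁.le (one_le_pow₀ hΔ1)).trans hc₁Δ
  let C := 2 + C₁ * (G + 1) + C₀
  have hCG : 0 ≤ C₁ * (G + 1) := by positivity
  refine ⟨a / 2, c₁, C, by positivity, by linarith, hc₁, by simp only [C]; linarith, fun ζ hζ hζa =>
    ⟨fun z hz hza => ?_, fun z hz hza => ?_, fun t ht => ?_⟩⟩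
  · have h1 := (hF ζ hζ (closedBall_subset_closedBall (by linarith) hζa) z (by linarith)).2
    rw [h.eq_zero z hz, sub_zero] at h1
    refine h1.trans (mul_le_mul_of_nonneg_right ?_ (by positivity))
    simp only [C]; linarith
  · have h1 := (hF ζ hζ (closedBall_subset_closedBall (by linarith) hζa) z (by linarith)).1
    have h2 := hrcl z hz
    have h3 := mul_le_mul_of_nonneg_right hc₁c (sq_nonneg ‖z - ζ‖)
    linarith
  have hζ0 : dist ζ z₀ ≤ a / 2 := hζa
  have hF' := hF ζ hζ (closedBall_subset_closedBall (by linarith) hζa)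
  have hζcl : ζ ∈ closure D := frontier_subset_closure hζ
  let P : E → ℂ := fun z => cexp (-(t ^ 2 : ℝ) * leviPoly r ζ z)
  have hPs : ContDiff ℝ ∞ P := (contDiff_const.mul (contDiff_leviPoly ℝ r ζ)).cexp
  have hPd : Differentiable ℂ P := ((contDiff_const.mul
    (contDiff_leviPoly ℂ r ζ (n := 1))).cexp).differentiable (by simp)
  have hPn : ∀ z, ‖P z‖ = Real.exp (-(t ^ 2 * (leviPoly r ζ z).re)) := fun z =>
    norm_cexp_neg_mul t _
  have hχs' : ContDiff ℝ ∞ fun z => (χ z : ℂ) := ofRealCLM.contDiff.comp hχ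
  let u : E → ℂ := fun z => (χ z : ℂ) * P z
  have hu : ContDiff ℝ ∞ u := hχs'.mul hPs
  have ht2 : 1 ≤ t ^ 2 := by nlinarith
  -- smallness away from the boundary point
  have hsmall : ∀ z ∈ W, a / 2 ≤ ‖z - ζ‖ → ‖z - ζ‖ ≤ 4 * a →
      ‖P z‖ ≤ Real.exp (-(κ * t ^ 2)) := by
    intro z hz h1 h2
    rw [hPn]
    apply Real.exp_le_exp.2
    have h3 := (hF' z (by linarith)).1
    have h4 := hWr z hz
    have h5 : s ≤ κ := min_le_right _ _
    have h6 : (a / 2) ^ 2 ≤ ‖z - ζ‖ ^ 2 := by gcongr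
    have h7 : κ ≤ (leviPoly r ζ z).re := by
      have h8 : c / 2 * (a / 2) ^ 2 ≤ c / 2 * ‖z - ζ‖ ^ 2 := by gcongr
      linarith
    nlinarith
  have hdist : ∀ z, ‖z - ζ‖ ≤ dist z z₀ + a / 2 ∧ dist z z₀ - a / 2 ≤ ‖z - ζ‖ := fun z => by
    rw [← dist_eq_norm]
    constructor
    · linarith [dist_triangle_right z ζ z₀]
    · linarith [dist_triangle z ζ z₀]
  have hχ0 : ∀ z, 3 * a ≤ dist z z₀ → z ∉ tsupport χ := fun z hz hzs => by
    have := hχs hzs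
    rw [mem_ball] at this
    linarith
  have hdb : ∀ x ∈ W, ∀ v, ‖dbar v u x‖ ≤ ((G + 1) * Real.exp (-(κ * t ^ 2))) * ‖v‖ := by
    intro x hx v
    have h1 : dbar v u x = dbar v (fun z => (χ z : ℂ)) x * P x := by
      rw [dbar_mul v (hχs'.differentiable (by simp) x) (hPs.differentiable (by simp) x),
        dbar_eq_zero_of_differentiableAt (hPd x), mul_zero, add_zero]
    have h2 : ‖dbar v (fun z => (χ z : ℂ)) x‖ ≤ (G + 1) * ‖v‖ := by
      rw [norm_dbar_ofReal]
      have h3 := norm_del_ofReal_comp_le (Φ := fun s => s) (hχ.differentiable (by simp) x)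
        (hasDerivAt_id (χ x)) v
      simp only [abs_one, one_mul] at h3
      refine h3.trans (mul_le_mul_of_nonneg_right ?_ (norm_nonneg v))
      linarith [hG x]
    by_cases hx2 : dist x z₀ ≤ 2 * a
    · have h3 : dbar v (fun z => (χ z : ℂ)) x = 0 := by
        rw [dbar_congr_of_eventuallyEq (g := fun _ => (1 : ℂ))
          ((hχ1' x hx2).mono fun z hz => by simp only [hz, ofReal_one])]
        exact dbar_eq_zero_of_differentiableAt (differentiableAt_const _) v
      rw [h1, h3, zero_mul, norm_zero]
      positivity
    by_cases hx3 : dist x z₀ < 3 * a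
    · have h4 := hsmall x hx (by linarith [(hdist x).2]) (by linarith [(hdist x).1])
      rw [h1, norm_mul]
      calc _ ≤ ((G + 1) * ‖v‖) * Real.exp (-(κ * t ^ 2)) := by gcongr
        _ = _ := by ring
    · have h3 : dbar v (fun z => (χ z : ℂ)) x = 0 := by
        rw [dbar_congr_of_eventuallyEq (g := fun _ => (0 : ℂ))
          ((notMem_tsupport_iff_eventuallyEq.1 (hχ0 x (not_lt.1 hx3))).mono fun z hz => by
            simp only [hz, Pi.zero_apply, ofReal_zero])]
        exact dbar_eq_zero_of_differentiableAt (differentiableAt_const _) v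
      rw [h1, h3, zero_mul, norm_zero]
      positivity
  obtain ⟨g, hg, hgd, hgu⟩ := happ u _ hu (by positivity) hdb
  have hnear : ∀ z ∈ closure D, dist z z₀ < 2 * a - δ → mollify μ k u z = P z := by
    intro z _ hz2
    rw [hk.mollify_eq_self hkc hu.continuous]
    · have : χ z = 1 := (hχ1' z (by rw [mem_closedBall]; linarith)).self_of_nhds
      simp only [u, this, ofReal_one, one_mul]
    · intro y hy
      have hy2 : y ∈ closedBall z₀ (2 * a) := by
        rw [mem_ball] at hy
        rw [mem_closedBall]
        linarith [dist_triangle y z z₀]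
      have h1 : u =ᶠ[𝓝 y] P := (hχ1' y hy2).mono fun x hx => by
        simp only [u, hx, ofReal_one, one_mul]
      exact (hPd y).congr_of_eventuallyEq h1
  have hfar : ∀ z ∈ closure D, 2 * a - δ ≤ dist z z₀ →
      ‖mollify μ k u z‖ ≤ Real.exp (-(κ * t ^ 2)) := by
    intro z hz hz2
    refine hk.norm_mollify_le fun y hy => ?_
    have hyW : y ∈ W := hLW (hKL z hz (ball_subset_closedBall hy))
    rw [mem_ball, dist_comm] at hy
    by_cases hy3 : dist y z₀ < 3 * a
    · have h4 := hsmall y hyW (by linarith [(hdist y).2, dist_triangle z y z₀])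
        (by linarith [(hdist y).1])
      simp only [u, norm_mul, norm_real]
      rw [Real.norm_of_nonneg (hχI y).1]
      calc _ ≤ 1 * ‖P y‖ := by gcongr; exact (hχI y).2
        _ ≤ _ := by rwa [one_mul]
    · have : χ y = 0 := image_eq_zero_of_notMem_tsupport (hχ0 y (not_lt.1 hy3))
      simp only [u, this, ofReal_zero, zero_mul, norm_zero]
      positivity
  have hexpκ : ∀ z ∈ closure D, Real.exp (-(κ * t ^ 2)) ≤
      Real.exp (-(c₁ * (t ^ 2 * ‖z - ζ‖ ^ 2))) := by
    intro z hz
    apply Real.exp_le_exp.2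
    have h1 : c₁ * ‖z - ζ‖ ^ 2 ≤ c₁ * Δ ^ 2 := by
      gcongr
      exact hΔ z hz ζ hζcl
    nlinarith
  refine ⟨g, hg, hgd, fun z hz => ?_, fun z hz hza => ?_⟩
  · have h1 := hgu z hz
    have h2 : ‖mollify μ k u z‖ ≤ 2 * Real.exp (-(c₁ * (t ^ 2 * ‖z - ζ‖ ^ 2))) := by
      by_cases hz2 : dist z z₀ < 2 * a - δ
      · rw [hnear z hz hz2, hPn]
        have h3 := (hF' z (by linarith [(hdist z).1])).1
        have h4 := hrcl z hz
        have h5 := mul_le_mul_of_nonneg_right hc₁c (sq_nonneg ‖z - ζ‖)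
        have h6 : Real.exp (-(t ^ 2 * (leviPoly r ζ z).re)) ≤
            Real.exp (-(c₁ * (t ^ 2 * ‖z - ζ‖ ^ 2))) := by
          apply Real.exp_le_exp.2
          nlinarith
        linarith [Real.exp_pos (-(c₁ * (t ^ 2 * ‖z - ζ‖ ^ 2)))]
      · have h3 := hfar z hz (not_lt.1 hz2)
        linarith [Real.exp_pos (-(c₁ * (t ^ 2 * ‖z - ζ‖ ^ 2))), hexpκ z hz]
    have h3 : ‖g z‖ ≤ ‖g z - mollify μ k u z‖ + ‖mollify μ k u z‖ := by
      simpa using norm_add_le (g z - mollify μ k u z) (mollify μ k u z)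
    have h4 := mul_le_mul_of_nonneg_left (hexpκ z hz) hCG
    have h5 : 0 ≤ C₀ * Real.exp (-(c₁ * (t ^ 2 * ‖z - ζ‖ ^ 2))) := by positivity
    simp only [C]
    linarith
  · have h1 := hgu z hz
    rw [hnear z hz (by linarith [(hdist z).2])] at h1
    refine h1.trans ?_
    have h2 : Real.exp (-(κ * t ^ 2)) ≤ Real.exp (-(c₁ * t ^ 2)) := by
      apply Real.exp_le_exp.2
      nlinarith
    calc _ = (C₁ * (G + 1)) * Real.exp (-(κ * t ^ 2)) := by ring
      _ ≤ C * Real.exp (-(c₁ * t ^ 2)) := by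
        gcongr
        simp only [C]; linarith

end Peak

section Packing

open Filter Topology Module

variable {E : Type*} [NormedAddCommGroup E] [NormedSpace ℝ E] [FiniteDimensional ℝ E]

/-- Separated subsets of a hypersurface satisfy a packing bound in codimension one. -/
theorem exists_hypersurface_packing {r : E → ℝ} {z₀ : E} (hr : ContDiff ℝ 1 r)
    (hd : fderiv ℝ r z₀ ≠ 0) :
    ∃ a A : ℝ, 0 < a ∧ 0 < A ∧ ∀ (s : Finset E) (y : E) (ρ δ : ℝ), 0 ≤ ρ → 0 < δ →
      (∀ x ∈ s, r x = 0 ∧ x ∈ closedBall z₀ a ∧ dist x y ≤ ρ) →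
      (∀ x ∈ s, ∀ x' ∈ s, x ≠ x' → δ ≤ dist x x') →
      (s.card : ℝ) ≤ (1 + A * ρ / δ) ^ (finrank ℝ E - 1) := by
  classical
  set ℓ := fderiv ℝ r z₀ with hℓ
  obtain ⟨u₀, hu₀⟩ : ∃ u₀, ℓ u₀ ≠ 0 := by
    by_contra! hcon
    exact hd (ContinuousLinearMap.ext hcon)
  obtain ⟨u, hu⟩ : ∃ u, ℓ u = 1 := ⟨(ℓ u₀)⁻¹ • u₀, by simp [hu₀]⟩
  have hst : HasStrictFDerivAt r ℓ z₀ := hr.contDiffAt.hasStrictFDerivAt (by simp)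
  let θ : ℝ := 1 / (2 * (‖u‖ + 1))
  have hθ : 0 < θ := by positivity
  have hθu : θ * ‖u‖ ≤ 1 / 2 := by
    simp only [θ]
    rw [div_mul_eq_mul_div, div_le_div_iff₀ (by positivity) (by positivity)]
    linarith
  have h1 := hst.isLittleO.def hθ
  obtain ⟨b, hb, hb2⟩ := Metric.eventually_nhds_iff.1 h1
  have key : ∀ x ∈ closedBall z₀ (b / 2), ∀ x' ∈ closedBall z₀ (b / 2), r x = 0 → r x' = 0 →
      |ℓ (x - x')| ≤ θ * ‖x - x'‖ := by
    intro x hx x' hx' h0 h0'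
    rw [mem_closedBall] at hx hx'
    have := @hb2 (x, x') (by
      rw [Prod.dist_eq]
      exact max_lt (by simpa using hx.trans_lt (by linarith)) (by simpa using hx'.trans_lt (by linarith)))
    simp only [h0, h0'] at this
    rw [map_sub, abs_sub_comm]
    simpa using this
  let π : E →L[ℝ] E := ContinuousLinearMap.id ℝ E - ℓ.smulRight u
  have hπ : ∀ x, π x = x - ℓ x • u := fun x => by simp [π]
  have hπk : ∀ x, π x ∈ LinearMap.ker (ℓ : E →ₗ[ℝ] ℝ) := fun x => by
    rw [LinearMap.mem_ker]; simp [hπ, hu]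
  let p : E → LinearMap.ker (ℓ : E →ₗ[ℝ] ℝ) := fun x => ⟨π x, hπk x⟩
  have hp : ∀ x y, dist (p x) (p y) = ‖π (x - y)‖ := fun x y => by
    rw [Subtype.dist_eq, dist_eq_norm, map_sub]
  have hdim : finrank ℝ (LinearMap.ker (ℓ : E →ₗ[ℝ] ℝ)) = finrank ℝ E - 1 := by
    have h2 := LinearMap.finrank_range_add_finrank_ker (ℓ : E →ₗ[ℝ] ℝ)
    have h3 : LinearMap.range (ℓ : E →ₗ[ℝ] ℝ) = ⊤ := by
      rw [LinearMap.range_eq_top]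
      intro c
      exact ⟨c • u, by simp [hu]⟩
    rw [h3, finrank_top, finrank_self] at h2
    omega
  refine ⟨b / 2, 4 * ‖π‖ + 1, by positivity, by positivity, fun s y ρ δ hρ hδ hs hsep => ?_⟩
  have hlow : ∀ x ∈ s, ∀ x' ∈ s, ‖x - x'‖ / 2 ≤ dist (p x) (p x') := by
    intro x hx x' hx'
    rw [hp, hπ]
    have h2 := key x (hs x hx).2.1 x' (hs x' hx').2.1 (hs x hx).1 (hs x' hx').1
    have h3 := norm_sub_norm_le (x - x') (ℓ (x - x') • u)
    rw [norm_smul, Real.norm_eq_abs] at h3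
    have h4 : |ℓ (x - x')| * ‖u‖ ≤ (θ * ‖x - x'‖) * ‖u‖ := by gcongr
    nlinarith [norm_nonneg (x - x')]
  have hinj : Set.InjOn p s := by
    intro x hx x' hx' hpe
    by_contra hne
    have h2 := hlow x hx x' hx'
    rw [hpe, dist_self] at h2
    have h3 := hsep x hx x' hx' hne
    rw [dist_eq_norm] at h3
    linarith
  have h5 := card_le_of_separated_of_subset_closedBall (s.image p) (c := p y) (ρ := ‖π‖ * ρ)
    (δ := δ / 2) (by positivity) (by positivity)
    (by
      intro w hw
      obtain ⟨x, hx, rfl⟩ := Finset.mem_image.1 hw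
      rw [hp]
      refine (π.le_opNorm _).trans ?_
      gcongr
      exact (dist_eq_norm x y).symm.trans_le (hs x hx).2.2)
    (by
      intro w hw w' hw' hne
      obtain ⟨x, hx, rfl⟩ := Finset.mem_image.1 hw
      obtain ⟨x', hx', rfl⟩ := Finset.mem_image.1 hw'
      have h2 := hlow x hx x' hx'
      have h3 := hsep x hx x' hx' fun h => hne (by rw [h])
      rw [dist_eq_norm] at h3
      linarith)
  rw [Finset.card_image_of_injOn hinj, hdim] at h5
  refine h5.trans ?_
  have h6 : 2 * (‖π‖ * ρ) / (δ / 2) = 4 * ‖π‖ * ρ / δ := by field_simp; ring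
  rw [h6]
  gcongr
  linarith

/-- Coefficients in the unit ball for which perturbed vectors stay away from zero. -/
theorem exists_coefficients {V : Type*} [NormedAddCommGroup V] [NormedSpace ℝ V]
    [FiniteDimensional ℝ V] {I : Type*} [Fintype I] [DecidableEq I] {X : Type*}
    [PseudoMetricSpace X] (Z : I → Set X) (Ψ : I → (I → V) → X → V) (nbr : I → Finset I) (d : ℕ)
    (hcard : ∀ i, (nbr i).card ≤ d) {L A η : ℝ} (hL : 0 < L) (hA : 0 ≤ A) (hη : 0 < η) (hη1 : η ≤ 1)
    (hself : ∀ i p v, Ψ i (Function.update p i v) = Ψ i p)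
    (hself' : ∀ i, i ∈ nbr i)
    (hinv : ∀ i j, j ∉ nbr i → ∀ p v, Ψ j (Function.update p i v) = Ψ j p)
    (hlip : ∀ i p, (∀ j, ‖p j‖ ≤ 1) → ∀ z ∈ Z i, ∀ z' ∈ Z i,
      ‖Ψ i p z - Ψ i p z'‖ ≤ L * dist z z')
    (hcov : ∀ i δ, 0 < δ → ∃ T : Finset X, ↑T ⊆ Z i ∧
      (T.card : ℝ) ≤ (1 + A / δ) ^ (finrank ℝ V - 1) ∧ ∀ z ∈ Z i, ∃ y ∈ T, dist z y < δ)
    (hdim : 1 ≤ finrank ℝ V)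
    (hsmall : 4 * (d + 1) * (5 ^ finrank ℝ V * (1 + A * L) ^ (finrank ℝ V - 1)) * η ≤ 1) :
    ∃ p : I → V, (∀ i, ‖p i‖ ≤ 1) ∧ ∀ i, ∀ z ∈ Z i, η ≤ ‖p i + Ψ i p z‖ := by
  classical
  obtain ⟨Q, hQ1, hQs, hQc⟩ := exists_finset_separated_cover
    (isBounded_closedBall (x := (0 : V)) (r := 1)) hη
  have hQcard := one_le_card_mul_pow_of_cover Q hη fun x hx => hQc x (by simpa using hx)
  have hQ1' : ∀ q : Q, ‖(q : V)‖ ≤ 1 := fun q => by simpa using hQ1 q.2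
  have : Nonempty Q := by
    obtain ⟨y, hy, -⟩ := hQc 0 (by simp)
    exact ⟨⟨y, hy⟩⟩
  let Bad : I → (I → Q) → Prop := fun i p =>
    ∃ z ∈ Z i, ‖(p i : V) + Ψ i (fun j => (p j : V)) z‖ < η
  have hupd : ∀ (i : I) (p : I → Q) (q : Q), (fun j => (Function.update p i q j : V)) =
      Function.update (fun j => (p j : V)) i (q : V) := fun i p q => by
    ext j
    by_cases hj : j = i
    · subst hj; simp
    · simp [hj]
  obtain ⟨p, hp⟩ := exists_forall_not_bad Bad nbr d hcard
    (fun i j hj p q => by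
      have hij : j ≠ i := fun h => hj (h ▸ hself' i)
      simp only [Bad, hupd, hinv i j hj, Function.update_of_ne hij])
    (fun i p => by
      simp only [Bad, hupd, hself i, Function.update_self]
      obtain ⟨T, hT1, hT2, hT3⟩ := hcov i (η / L) (by positivity)
      let Φ : X → V := Ψ i (fun j => (p j : V))
      have hcount : (Nat.card {q : Q // ∃ z ∈ Z i, ‖(q : V) + Φ z‖ < η} : ℝ) ≤
          T.card * 5 ^ finrank ℝ V := by
        let B : X → Finset V := fun y => {q ∈ Q | dist q (-Φ y) ≤ 2 * η}
        have hB : ∀ y, ((B y).card : ℝ) ≤ 5 ^ finrank ℝ V := fun y => by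
          have h1 := card_le_of_separated_of_subset_closedBall (B y) (c := -Φ y) (ρ := 2 * η)
            (δ := η) (by positivity) hη (fun x hx => (Finset.mem_filter.1 hx).2)
            (fun x hx y hy => hQs x (Finset.mem_filter.1 hx).1 y (Finset.mem_filter.1 hy).1)
          have h2 : 1 + 2 * (2 * η) / η = 5 := by field_simp; norm_num
          rwa [h2] at h1
        have h3 : Nat.card {q : Q // ∃ z ∈ Z i, ‖(q : V) + Φ z‖ < η} ≤ (T.biUnion B).card := by
          rw [← Fintype.card_coe (T.biUnion B), ← Nat.card_eq_fintype_card]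
          let φ : {q : Q // ∃ z ∈ Z i, ‖(q : V) + Φ z‖ < η} → (T.biUnion B : Finset V) := fun q =>
            ⟨q.1.1, by
              obtain ⟨z, hz, hzq⟩ := q.2
              obtain ⟨y, hy, hzy⟩ := hT3 z hz
              rw [Finset.mem_biUnion]
              refine ⟨y, hy, Finset.mem_filter.2 ⟨q.1.2, ?_⟩⟩
              have h4 := hlip i (fun j => (p j : V)) (fun j => hQ1' (p j)) z hz y (hT1 hy)
              have h5 : L * dist z y ≤ η := by
                rw [lt_div_iff₀ hL] at hzy
                linarith
              rw [dist_eq_norm, sub_neg_eq_add]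
              calc ‖(q.1.1 : V) + Φ y‖ = ‖((q.1.1 : V) + Φ z) - (Φ z - Φ y)‖ := by congr 1; abel
                _ ≤ ‖(q.1.1 : V) + Φ z‖ + ‖Φ z - Φ y‖ := norm_sub_le _ _
                _ ≤ 2 * η := by linarith⟩
          exact Nat.card_le_card_of_injective φ fun q q' h => by
            have := congrArg Subtype.val h
            exact Subtype.ext (Subtype.ext this)
        calc (Nat.card {q : Q // ∃ z ∈ Z i, ‖(q : V) + Φ z‖ < η} : ℝ)
            ≤ ((T.biUnion B).card : ℝ) := by exact_mod_cast h3
          _ ≤ ∑ y ∈ T, ((B y).card : ℝ) := by exact_mod_cast Finset.card_biUnion_le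
          _ ≤ ∑ _y ∈ T, (5 : ℝ) ^ finrank ℝ V := Finset.sum_le_sum fun y _ => hB y
          _ = _ := by simp
      have hTη : (T.card : ℝ) * η ^ (finrank ℝ V - 1) ≤ (1 + A * L) ^ (finrank ℝ V - 1) := by
        calc (T.card : ℝ) * η ^ (finrank ℝ V - 1)
            ≤ (1 + A / (η / L)) ^ (finrank ℝ V - 1) * η ^ (finrank ℝ V - 1) := by gcongr
          _ = ((1 + A / (η / L)) * η) ^ (finrank ℝ V - 1) := by rw [mul_pow]
          _ ≤ _ := by
            gcongr
            rw [div_div_eq_mul_div, add_mul, div_mul_cancel₀ _ hη.ne']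
            linarith
      have hη' : η ^ finrank ℝ V = η ^ (finrank ℝ V - 1) * η := by
        rw [← pow_succ]; congr 1; omega
      have hfin : (4 * (d + 1) * Nat.card {q : Q // ∃ z ∈ Z i, ‖(q : V) + Φ z‖ < η} : ℝ) ≤
          Fintype.card Q := by
        rw [Fintype.card_coe]
        have hηp : 0 < η ^ finrank ℝ V := by positivity
        refine le_of_mul_le_mul_right ?_ hηp
        refine le_trans ?_ hQcard
        refine le_trans ?_ hsmall
        calc (4 * (d + 1) * Nat.card {q : Q // ∃ z ∈ Z i, ‖(q : V) + Φ z‖ < η} : ℝ) *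
              η ^ finrank ℝ V ≤ 4 * (d + 1) * (T.card * 5 ^ finrank ℝ V) * η ^ finrank ℝ V := by
              gcongr
          _ = 4 * (d + 1) * (5 ^ finrank ℝ V * (T.card * η ^ (finrank ℝ V - 1))) * η := by
              rw [hη']; ring
          _ ≤ _ := by gcongr
      exact_mod_cast hfin)
  refine ⟨fun i => p i, fun i => hQ1' (p i), fun i z hz => ?_⟩
  by_contra! hcon
  exact hp i ⟨z, hz, hcon⟩

end Packing

section Nonvanishing

open Filter Topology Module
open scoped ContDiff

theorem norm_cexp_sub_cexp_le {C : ℝ} {u v : ℂ} (hu : u.re ≤ C) (hv : v.re ≤ C) :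
    ‖cexp u - cexp v‖ ≤ Real.exp C * ‖u - v‖ :=
  (convex_halfSpace_re_le C).norm_image_sub_le_of_norm_hasDerivWithin_le
    (fun z _ => (Complex.hasDerivAt_exp z).hasDerivWithinAt)
    (fun z hz => by rw [Complex.norm_exp]; exact Real.exp_le_exp.2 hz) hv hu

variable {E : Type*} [NormedAddCommGroup E] [InnerProductSpace ℂ E] [FiniteDimensional ℂ E]
variable {F : Type*} [NormedAddCommGroup F] [InnerProductSpace ℂ F] [FiniteDimensional ℂ F]

set_option maxHeartbeats 1000000 in
/-- Coefficients for which a superposition of Gaussian waves stays away from zero. -/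
theorem exists_coefficients_of_waves (Φ : E → E → ℂ) (Y : Set E) (S : Finset E) (γ : E → ℝ)
    (J : E → E →L[ℂ] F) (P : E → F →L[ℂ] E) {C C₄ A R t η : ℝ} (d : ℕ)
    (hC₄ : 0 ≤ C₄) (hA : 0 ≤ A) (hR : 0 < R) (ht : 0 < t) (hη : 0 < η) (hη1 : η ≤ 1)
    (hcardd : ∀ y, (({x ∈ S | t * dist x y ≤ R}).card : ℝ) ≤ d)
    (hpack : ∀ (T : Finset E) (y : E) (δ : ℝ), 0 < δ → (∀ x ∈ T, x ∈ Y ∧ dist x y ≤ 1 / t) →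
      (∀ x ∈ T, ∀ x' ∈ T, x ≠ x' → δ ≤ dist x x') →
      (T.card : ℝ) ≤ (1 + A * (1 / t) / δ) ^ (finrank ℝ E - 1))
    (hup : ∀ ζ ∈ S, ∀ z ∈ Y, t * dist z ζ ≤ 1 → t ^ 2 * (Φ ζ z).re ≤ C)
    (hlow : ∀ ζ ∈ S, ∀ z ∈ Y, t * dist z ζ ≤ 1 + R → 0 ≤ (Φ ζ z).re)
    (h4 : ∀ ζ ∈ S, ∀ ζ' ∈ S, ∀ z ∈ Y, ∀ z' ∈ Y,
      ‖(Φ ζ z - Φ ζ' z) - (Φ ζ z' - Φ ζ' z')‖ ≤ C₄ * ‖z - z'‖ * ‖ζ - ζ'‖)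
    (hγ : ∀ ζ ∈ S, 0 < γ ζ) (hγ2 : ∀ ζ ∈ S, ∀ ζ' ∈ S, t * dist ζ ζ' ≤ R → γ ζ ≤ 2 * γ ζ')
    (hJ : ∀ ζ v, ‖J ζ v‖ ≤ ‖v‖) (hP : ∀ ζ v, ‖P ζ v‖ ≤ ‖v‖) (hPJ : ∀ ζ v, P ζ (J ζ v) = v)
    (hdim : 1 ≤ finrank ℝ E)
    (hsmall : 4 * (d + 1) * (5 ^ finrank ℝ E *
      (1 + A * (d * (2 * (Real.exp C * (C₄ * R))) + 1)) ^ (finrank ℝ E - 1)) * η ≤ 1) :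
    ∃ p : E → E, (∀ ζ, ‖p ζ‖ ≤ 1) ∧ ∀ ζ ∈ S, ∀ z ∈ Y, t * dist z ζ ≤ 1 →
      Real.exp (-C) * η * γ ζ ≤ ‖∑ μ ∈ S with t * dist μ ζ ≤ R,
        (cexp (-((t ^ 2 : ℝ) : ℂ) * Φ μ z) * (γ μ : ℂ)) • J μ (p μ)‖ := by
  classical
  have : FiniteDimensional ℝ E := FiniteDimensional.complexToReal E
  let nbr : S → Finset S := fun i => {j | t * dist (j : E) i ≤ R}
  let W : S → S → E → ℂ := fun i j z => -((t ^ 2 : ℝ) : ℂ) * (Φ j z - Φ i z)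
  let Ψ : S → (S → E) → E → E := fun i p z => ∑ j ∈ (nbr i).erase i,
    (((γ j / γ i : ℝ) : ℂ) * cexp (W i j z)) • P i (J j (p j))
  let Z : S → Set E := fun i => {z ∈ Y | t * dist z i ≤ 1}
  have hnbr : ∀ i, ((nbr i).card : ℝ) ≤ d := fun i => by
    refine le_trans ?_ (hcardd i)
    norm_cast
    refine Finset.card_le_card_of_injOn (fun j => (j : E)) (fun j hj => ?_)
      (fun x _ y _ h => Subtype.ext h)
    simp only [nbr, Finset.coe_filter, Finset.mem_univ, true_and, mem_ofPred_eq] at hj ⊢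
    exact ⟨j.2, hj⟩
  have hW : ∀ i j, j ∈ nbr i → ∀ z ∈ Z i, (W i j z).re ≤ C := fun i j hj z hz => by
    have h1 := hup i i.2 z hz.1 hz.2
    have hj' : t * dist (j : E) i ≤ R := by simpa [nbr] using hj
    have h2 := hlow j j.2 z hz.1 (by
      have := dist_triangle_right z (j : E) i
      nlinarith [hz.2])
    have h3 : (W i j z).re = t ^ 2 * (Φ i z).re - t ^ 2 * (Φ j z).re := by
      simp only [W]
      rw [neg_mul, Complex.neg_re, Complex.re_ofReal_mul, Complex.sub_re]; ring
    rw [h3]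
    nlinarith [mul_nonneg (sq_nonneg t) h2]
  have hr2 : ∀ i j, j ∈ nbr i → γ j / γ i ≤ 2 := fun i j hj => by
    rw [div_le_iff₀ (hγ i i.2)]
    exact hγ2 j j.2 i i.2 (by simpa [nbr] using hj)
  have hr0 : ∀ i j : S, 0 ≤ γ j / γ i := fun i j => div_nonneg (hγ j j.2).le (hγ i i.2).le
  have hlip : ∀ i p, (∀ j, ‖p j‖ ≤ 1) → ∀ z ∈ Z i, ∀ z' ∈ Z i, ‖Ψ i p z - Ψ i p z'‖ ≤
      (t * (d * (2 * (Real.exp C * (C₄ * R))) + 1)) * dist z z' := fun i p hp z hz z' hz' => by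
    have h1 : ‖Ψ i p z - Ψ i p z'‖ ≤ ∑ j ∈ (nbr i).erase i,
        2 * (Real.exp C * (t * (C₄ * R) * dist z z')) := by
      simp only [Ψ]
      rw [← Finset.sum_sub_distrib]
      refine norm_sum_le_of_le _ fun j hj => ?_
      have hj' := Finset.mem_of_mem_erase hj
      rw [← sub_smul, ← mul_sub, norm_smul, norm_mul, Complex.norm_real, Real.norm_eq_abs,
        abs_of_nonneg (hr0 i j)]
      have h2 := norm_cexp_sub_cexp_le (hW i j hj' z hz) (hW i j hj' z' hz')
      have h3 : ‖W i j z - W i j z'‖ ≤ t * (C₄ * R) * dist z z' := by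
        simp only [W]
        rw [← mul_sub, norm_mul, norm_neg, Complex.norm_real, Real.norm_eq_abs,
          abs_of_nonneg (sq_nonneg t)]
        have h5 := h4 j j.2 i i.2 z hz.1 z' hz'.1
        have h6 : t * dist (j : E) i ≤ R := by simpa [nbr] using hj'
        rw [← dist_eq_norm z, ← dist_eq_norm (j : E)] at h5
        calc t ^ 2 * ‖Φ j z - Φ i z - (Φ j z' - Φ i z')‖
            ≤ t ^ 2 * (C₄ * dist z z' * dist (j : E) i) := by gcongr
          _ = t * (C₄ * (t * dist (j : E) i)) * dist z z' := by ring
          _ ≤ _ := by gcongr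
      have h7 : ‖P i (J j (p j))‖ ≤ 1 := (hP _ _).trans ((hJ _ _).trans (hp j))
      calc γ j / γ i * ‖cexp (W i j z) - cexp (W i j z')‖ * ‖P i (J j (p j))‖
          ≤ γ j / γ i * ‖cexp (W i j z) - cexp (W i j z')‖ * 1 := by
            have := hr0 i j; gcongr
        _ ≤ 2 * (Real.exp C * (t * (C₄ * R) * dist z z')) * 1 := by
            have := hr2 i j hj'
            have h8 := h2.trans (mul_le_mul_of_nonneg_left h3 (Real.exp_pos C).le)
            gcongr
        _ = _ := mul_one _
    refine h1.trans ?_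
    rw [Finset.sum_const, nsmul_eq_mul]
    have h9 : (((nbr i).erase i).card : ℝ) ≤ d :=
      le_trans (by exact_mod_cast Finset.card_erase_le) (hnbr i)
    calc (((nbr i).erase i).card : ℝ) * (2 * (Real.exp C * (t * (C₄ * R) * dist z z')))
        ≤ d * (2 * (Real.exp C * (t * (C₄ * R) * dist z z'))) := by gcongr
      _ = (t * (d * (2 * (Real.exp C * (C₄ * R))))) * dist z z' := by ring
      _ ≤ _ := by gcongr; linarith
  obtain ⟨p, hp1, hp⟩ := exists_coefficients Z Ψ nbr d
    (fun i => by exact_mod_cast hnbr i)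
    (L := t * (d * (2 * (Real.exp C * (C₄ * R))) + 1)) (A := A / t) (η := η)
    (by positivity) (by positivity) hη hη1
    (fun i p v => by
      funext z
      refine Finset.sum_congr rfl fun j hj => ?_
      rw [Function.update_of_ne (Finset.ne_of_mem_erase hj)])
    (fun i => by simp [nbr, hR.le])
    (fun i j hj p v => by
      funext z
      refine Finset.sum_congr rfl fun k hk => ?_
      rw [Function.update_of_ne]
      rintro rfl
      have hk' := Finset.mem_of_mem_erase hk
      simp only [nbr, Finset.mem_filter, Finset.mem_univ, true_and] at hk' hj
      rw [dist_comm] at hk'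
      exact hj hk')
    hlip
    (fun i δ hδ => by
      have hZb : IsBounded (Z i) := (isBounded_closedBall (x := (i : E)) (r := 1 / t)).subset
        fun z hz => by
          rw [mem_closedBall, le_div_iff₀ ht, mul_comm]; exact hz.2
      obtain ⟨T, hT1, hT2, hT3⟩ := exists_finset_separated_cover hZb hδ
      refine ⟨T, hT1, ?_, hT3⟩
      have := hpack T i δ hδ (fun x hx => ⟨(hT1 hx).1, by
        rw [le_div_iff₀ ht, mul_comm]; exact (hT1 hx).2⟩) hT2
      rwa [mul_one_div] at this)
    hdim
    (by
      have : A / t * (t * (d * (2 * (Real.exp C * (C₄ * R))) + 1)) =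
          A * (d * (2 * (Real.exp C * (C₄ * R))) + 1) := by field_simp
      rwa [this])
  refine ⟨fun x => if hx : x ∈ S then p ⟨x, hx⟩ else 0, fun x => ?_, fun ζ hζ z hz hzζ => ?_⟩
  · dsimp only
    split_ifs
    · exact hp1 _
    · simp
  · let i : S := ⟨ζ, hζ⟩
    set g := ∑ μ ∈ S with t * dist μ ζ ≤ R, (cexp (-((t ^ 2 : ℝ) : ℂ) * Φ μ z) * (γ μ : ℂ)) •
      J μ (if hx : μ ∈ S then p ⟨μ, hx⟩ else 0) with hg
    have hg2 : g = ∑ j ∈ nbr i, (cexp (-((t ^ 2 : ℝ) : ℂ) * Φ j z) * (γ j : ℂ)) • J j (p j) := by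
      rw [hg, Finset.sum_filter, ← Finset.sum_coe_sort S, Finset.sum_filter]
      refine Finset.sum_congr rfl fun j _ => ?_
      simp [i]
    have hPg : P i g = ((γ i : ℂ) * cexp (-((t ^ 2 : ℝ) : ℂ) * Φ i z)) • (p i + Ψ i p z) := by
      have hi : i ∈ nbr i := by simp [nbr, hR.le]
      rw [hg2, map_sum, ← Finset.add_sum_erase _ _ hi, smul_add]
      congr 1
      · rw [map_smul, hPJ, mul_comm]
      · simp only [Ψ]
        rw [Finset.smul_sum]
        refine Finset.sum_congr rfl fun j _ => ?_
        rw [map_smul, smul_smul]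
        congr 1
        have h0 : (γ i : ℂ) ≠ 0 := by exact_mod_cast (hγ i i.2).ne'
        have h1 : cexp (-((t ^ 2 : ℝ) : ℂ) * Φ j z) =
            cexp (-((t ^ 2 : ℝ) : ℂ) * Φ i z) * cexp (W i j z) := by
          rw [← Complex.exp_add]; congr 1; simp only [W]; ring
        rw [h1]; push_cast; field_simp
    refine le_trans ?_ (hP i g)
    rw [hPg, norm_smul, norm_mul, Complex.norm_real, Real.norm_eq_abs, abs_of_pos (hγ i i.2)]
    have h1 := hp i z ⟨hz, hzζ⟩
    have h2 : Real.exp (-C) ≤ ‖cexp (-((t ^ 2 : ℝ) : ℂ) * Φ i z)‖ := by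
      rw [norm_cexp_neg_mul]
      exact Real.exp_le_exp.2 (neg_le_neg (hup i i.2 z hz hzζ))
    have h3 := (hγ i i.2).le
    calc Real.exp (-C) * η * γ ζ = γ i * Real.exp (-C) * η := by simp only [i]; ring
      _ ≤ _ := by gcongr

end Nonvanishing

section WaveSum

open Filter Topology Module
open scoped ContDiff

/-- Choice of an interaction radius whose Gaussian tail beats the polynomial losses. -/
theorem exists_radius_threshold (n : ℕ) {c C C₄ A B : ℝ} (hc : 0 < c) (hC₄ : 0 ≤ C₄) (hA : 0 ≤ A)
    (hB : 0 ≤ B) :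
    ∃ (R η : ℝ) (d : ℕ), 1 ≤ R ∧ 0 < η ∧ η ≤ 1 ∧ (1 + 2 * R) ^ n ≤ d ∧
      4 * (d + 1) * (5 ^ n * (1 + A * (d * (2 * (Real.exp C * (C₄ * R))) + 1)) ^ (n - 1)) * η ≤ 1 ∧
      B * Real.exp (-(c * (R - 1) ^ 2)) ≤ η := by
  set B₀ : ℝ := 1 + A + 4 * (A * (Real.exp C * C₄)) with hB₀
  have hB₀1 : 1 ≤ B₀ := by
    have : 0 ≤ A * (Real.exp C * C₄) := by positivity
    linarith
  set K : ℝ := 12 * 5 ^ n * B₀ ^ (n - 1) with hK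
  have hK1 : 1 ≤ K := by
    have h1 : (1 : ℝ) ≤ 5 ^ n := one_le_pow₀ (by norm_num)
    have h2 : (1 : ℝ) ≤ B₀ ^ (n - 1) := one_le_pow₀ hB₀1
    nlinarith [mul_le_mul h1 h2 zero_le_one (by positivity)]
  set m : ℕ := n + (n + 1) * (n - 1) with hm
  have hlim := (Real.tendsto_pow_mul_exp_neg_atTop_nhds_zero m).const_mul (B * K)
  rw [mul_zero] at hlim
  obtain ⟨y, hy1, hy6, hyc⟩ := ((hlim.eventually_le_const zero_lt_one).and
    ((eventually_ge_atTop 6).and (eventually_ge_atTop (16 / c)))).exists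
  obtain ⟨R, hR⟩ : ∃ R, 1 + 2 * R = y := ⟨(y - 1) / 2, by ring⟩
  have hy0 : 0 < y := by linarith
  have hyn : (1 : ℝ) ≤ y ^ n := one_le_pow₀ (by linarith)
  have hd2 : ((⌈y ^ n⌉₊ : ℕ) : ℝ) ≤ 2 * y ^ n := by
    have := (Nat.ceil_lt_add_one (by positivity : 0 ≤ y ^ n)).le
    linarith
  refine ⟨R, 1 / (K * y ^ m), ⌈y ^ n⌉₊, by linarith, by positivity, ?_, ?_, ?_, ?_⟩
  · rw [div_le_one (by positivity)]
    exact one_le_mul_of_one_le_of_one_le hK1 (one_le_pow₀ (by linarith))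
  · rw [hR]; exact Nat.le_ceil _
  · rw [mul_one_div, div_le_one (by positivity)]
    set d : ℝ := ((⌈y ^ n⌉₊ : ℕ) : ℝ)
    have hd0 : 0 ≤ d := by positivity
    have hRy : R ≤ y := by linarith
    have hR0 : 0 ≤ R := by linarith
    have h1 : 1 + A * (d * (2 * (Real.exp C * (C₄ * R))) + 1) ≤ B₀ * y ^ (n + 1) := by
      have h2 : A * (d * (2 * (Real.exp C * (C₄ * R)))) ≤
          A * ((2 * y ^ n) * (2 * (Real.exp C * (C₄ * y)))) := by gcongr
      have h3 : (1 + A) * 1 ≤ (1 + A) * y ^ (n + 1) := by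
        gcongr
        exact one_le_pow₀ (by linarith)
      rw [hB₀, pow_succ] at *
      nlinarith
    calc 4 * (d + 1) * (5 ^ n * (1 + A * (d * (2 * (Real.exp C * (C₄ * R))) + 1)) ^ (n - 1))
        ≤ 4 * (3 * y ^ n) * (5 ^ n * (B₀ * y ^ (n + 1)) ^ (n - 1)) := by
          gcongr
          linarith
      _ = K * y ^ m := by
          rw [hK, hm, mul_pow, ← pow_mul, pow_add y n]; ring
  · have h1 : Real.exp (-(c * (R - 1) ^ 2)) ≤ Real.exp (-y) := by
      refine Real.exp_le_exp.2 (neg_le_neg ?_)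
      have h2 : 16 ≤ c * y := by
        rw [div_le_iff₀ hc] at hyc
        linarith
      have h3 : y / 4 ≤ R - 1 := by linarith
      calc y ≤ c * y * y / 16 := by nlinarith
        _ = c * (y / 4) ^ 2 := by ring
        _ ≤ _ := by gcongr
    rw [le_div_iff₀ (by positivity)]
    calc B * Real.exp (-(c * (R - 1) ^ 2)) * (K * y ^ m)
        ≤ B * Real.exp (-y) * (K * y ^ m) := by gcongr
      _ = B * K * (y ^ m * Real.exp (-y)) := by ring
      _ ≤ 1 := hy1

/-- Weighted Gaussian sums over separated sets. -/
theorem exists_weighted_gaussian_sum_le (E : Type*) [NormedAddCommGroup E] [NormedSpace ℝ E]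
    [FiniteDimensional ℝ E] {c : ℝ} (hc : 0 < c) :
    ∃ C : ℝ, 0 < C ∧ ∀ (t : ℝ), 0 < t → ∀ (S : Finset E) (z : E),
      (∀ x ∈ S, ∀ y ∈ S, x ≠ y → 1 ≤ t * dist x y) → ∀ (Δ : E → ℝ) (τ : ℝ),
      (∀ x ∈ S, Real.exp (-(c / 2 * (t ^ 2 * ‖z - x‖ ^ 2))) * Δ x ≤ τ) →
      ∑ x ∈ S, Real.exp (-(c * (t ^ 2 * ‖z - x‖ ^ 2))) * Δ x ≤ C * max τ 0 := by
  obtain ⟨C, hC, h⟩ := exists_gaussian_sum_le E (half_pos hc)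
  refine ⟨C, hC, fun t ht S z hS Δ τ hΔ => ?_⟩
  calc ∑ x ∈ S, Real.exp (-(c * (t ^ 2 * ‖z - x‖ ^ 2))) * Δ x
      ≤ ∑ x ∈ S, Real.exp (-(c / 2) * (t * dist z x) ^ 2) * max τ 0 := by
        refine Finset.sum_le_sum fun x hx => ?_
        have h1 : Real.exp (-(c * (t ^ 2 * ‖z - x‖ ^ 2))) =
            Real.exp (-(c / 2) * (t * dist z x) ^ 2) *
              Real.exp (-(c / 2 * (t ^ 2 * ‖z - x‖ ^ 2))) := by
          rw [← Real.exp_add, dist_eq_norm]; congr 1; ring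
        rw [h1, mul_assoc]
        have := (hΔ x hx).trans (le_max_left τ 0)
        gcongr
    _ = (∑ x ∈ S, Real.exp (-(c / 2) * (t * dist z x) ^ 2)) * max τ 0 := by
        rw [Finset.sum_mul]
    _ ≤ _ := by
        have := h t ht S z hS
        have := le_max_right τ 0
        gcongr

theorem tendsto_exp_neg_mul_sq {k : ℝ} (hk : 0 < k) :
    Tendsto (fun t : ℝ => Real.exp (-(k * t ^ 2))) atTop (𝓝 0) :=
  Real.tendsto_exp_neg_atTop_nhds_zero.comp
    ((tendsto_pow_atTop two_ne_zero).const_mul_atTop hk)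

variable {E : Type*} [NormedAddCommGroup E] [InnerProductSpace ℂ E] [FiniteDimensional ℂ E]
variable {F : Type*} [NormedAddCommGroup F] [InnerProductSpace ℂ F] [FiniteDimensional ℂ F]

set_option maxHeartbeats 1000000 in
/-- Near a boundary point of a strongly pseudoconvex domain there are holomorphic vector-valued
wave packets of prescribed slowly varying size whose sum does not vanish. -/
theorem IsDefiningFunction.exists_nonvanishing_sum {D : Set E} {r : E → ℝ} {η₀ c : ℝ}
    (h : IsDefiningFunction D r η₀ c) (hD : IsOpen D) (hDb : IsBounded D) {z₀ : E}
    (hz₀ : z₀ ∈ frontier D) (hdim : 1 ≤ finrank ℝ E) :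
    ∃ a c₁ C c₀ : ℝ, 0 < a ∧ 0 < c₁ ∧ 1 ≤ C ∧ 0 < c₀ ∧ ∀ ϱ m : ℝ, 0 < ϱ → 0 < m →
      ∀ᶠ t : ℝ in atTop, ∀ S : Finset E, ↑S ⊆ frontier D ∩ closedBall z₀ a →
      (∀ x ∈ S, ∀ y ∈ S, x ≠ y → 1 ≤ t * dist x y) → ∀ γ : E → ℝ,
      (∀ ζ ∈ S, m ≤ γ ζ ∧ γ ζ ≤ 1) →
      (∀ ζ ∈ S, ∀ ζ' ∈ S, dist ζ ζ' ≤ ϱ → γ ζ ≤ 2 * γ ζ') →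
      ∀ (J : E → E →L[ℂ] F) (P : E → F →L[ℂ] E), (∀ ζ v, ‖J ζ v‖ ≤ ‖v‖) →
      (∀ ζ v, ‖P ζ v‖ ≤ ‖v‖) → (∀ ζ v, P ζ (J ζ v) = v) →
      ∃ (g : E → E → ℂ) (p : E → E), (∀ ζ, ‖p ζ‖ ≤ 1) ∧
        (∀ ζ ∈ S, ContDiff ℝ ∞ (g ζ) ∧ (∀ z ∈ closure D, DifferentiableAt ℂ (g ζ) z) ∧
          ∀ z ∈ closure D, ‖g ζ z‖ ≤ C * Real.exp (-(c₁ * (t ^ 2 * ‖z - ζ‖ ^ 2)))) ∧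
        ∀ ζ ∈ S, ∀ z ∈ frontier D ∩ closedBall z₀ a, t * dist z ζ ≤ 1 →
          c₀ * γ ζ ≤ ‖∑ μ ∈ S, (g μ z * (γ μ : ℂ)) • J μ (p μ)‖ := by
  classical
  have : FiniteDimensional ℝ E := FiniteDimensional.complexToReal E
  obtain ⟨a₁, c₁, C, ha₁, ha₁1, hc₁, hC, hpeak⟩ := h.exists_peak hD hDb hz₀
  obtain ⟨a₂, A, ha₂, hA, hpack⟩ := exists_hypersurface_packing (h.contDiff.of_le (by simp))
    (h.fderiv_ne_zero z₀ hz₀)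
  obtain ⟨C₄, hC₄, h4⟩ := exists_leviPoly_four_point h.contDiff z₀
  obtain ⟨Cg, hCg, hgauss⟩ := exists_weighted_gaussian_sum_le E hc₁
  obtain ⟨R, η, d, hR, hη, hη1, hRd, hsmall, hRη⟩ := exists_radius_threshold (finrank ℝ E)
    (half_pos hc₁) (C := C) hC₄ hA.le (B := 16 * (C * Cg) * Real.exp C) (by positivity)
  have hC0 : 0 < C := by linarith
  set a := min a₁ a₂ with ha
  refine ⟨a, c₁, C, Real.exp (-C) * η / 2, lt_min ha₁ ha₂, hc₁, hC, by positivity,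
    fun ϱ m hϱ hm => ?_⟩
  have hfc : frontier D ⊆ closure D := frontier_subset_closure
  have he : 0 < Real.exp (-C) * η / 8 := by positivity
  have e1 := ((tendsto_exp_neg_mul_sq hc₁).const_mul (2 * (d * C))).eventually_le_const
    (u := Real.exp (-C) * η / 8) (by rwa [mul_zero])
  have e2 := ((tendsto_exp_neg_mul_sq (k := c₁ / 2 * (ϱ / 2) ^ 2) (by positivity)).const_mul
    (C * Cg * m⁻¹)).eventually_le_const (u := Real.exp (-C) * η / 8) (by rwa [mul_zero])
  filter_upwards [e1, e2, eventually_ge_atTop 1, eventually_ge_atTop ((1 + R) / a₁),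
    eventually_ge_atTop (R / ϱ), eventually_ge_atTop (2 / ϱ)]
    with t e1 e2 ht1 hta htR htϱ S hS hsep γ hγ hγ2 J P hJ hP hPJ
  rw [div_le_iff₀ ha₁] at hta
  rw [div_le_iff₀ hϱ] at htR htϱ
  have ht : 0 < t := by linarith
  have hSf : ∀ ζ ∈ S, ζ ∈ frontier D := fun ζ hζ => (hS hζ).1
  have hSa : ∀ ζ ∈ S, ζ ∈ closedBall z₀ a₁ := fun ζ hζ =>
    closedBall_subset_closedBall (min_le_left _ _) (hS hζ).2
  have hSγ : ∀ ζ ∈ S, 0 < γ ζ := fun ζ hζ => hm.trans_le (hγ ζ hζ).1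
  have hnear : ∀ z ζ : E, t * dist z ζ ≤ 1 + R → ‖z - ζ‖ ≤ a₁ := fun z ζ hz => by
    rw [← dist_eq_norm]
    by_contra! hcon
    nlinarith
  have hcardd : ∀ y, (({x ∈ S | t * dist x y ≤ R}).card : ℝ) ≤ d := fun y => by
    refine le_trans (card_le_of_separated_of_subset_closedBall _ (c := y) (ρ := R / t) (δ := 1 / t)
      (by positivity) (by positivity) (fun x hx => ?_) (fun x hx x' hx' hne => ?_)) ?_
    · rw [le_div_iff₀ ht, mul_comm]; exact (Finset.mem_filter.1 hx).2
    · rw [div_le_iff₀ ht, mul_comm]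
      exact hsep x (Finset.mem_filter.1 hx).1 x' (Finset.mem_filter.1 hx').1 hne
    · have : 2 * (R / t) / (1 / t) = 2 * R := by field_simp
      rwa [this]
  have hball1 : closedBall z₀ a ⊆ closedBall z₀ 1 :=
    closedBall_subset_closedBall ((min_le_left _ _).trans ha₁1)
  obtain ⟨p, hp1, hp⟩ := exists_coefficients_of_waves (F := F) (fun ζ z => leviPoly r ζ z)
    (frontier D ∩ closedBall z₀ a) S γ J P (C := C) (R := R) (t := t) (η := η) d hC₄ hA.le
    (by linarith) ht hη hη1 hcardd
    (fun T y δ hδ hT hTs => hpack T y (1 / t) δ (by positivity) hδ (fun x hx =>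
      ⟨h.eq_zero x (hT x hx).1.1,
        closedBall_subset_closedBall (min_le_right _ _) (hT x hx).1.2, (hT x hx).2⟩) hTs)
    (fun ζ hζ z hz hzζ => by
      have h1 := (hpeak ζ (hSf ζ hζ) (hSa ζ hζ)).1 z hz.1 (hnear z ζ (by linarith))
      have h2 : (t * ‖z - ζ‖) ^ 2 ≤ 1 := by
        rw [← dist_eq_norm]
        exact pow_le_one₀ (by positivity) hzζ
      calc t ^ 2 * (leviPoly r ζ z).re ≤ t ^ 2 * (C * ‖z - ζ‖ ^ 2) := by gcongr
        _ = C * (t * ‖z - ζ‖) ^ 2 := by ring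
        _ ≤ C * 1 := by gcongr
        _ = C := mul_one C)
    (fun ζ hζ z hz hzζ => le_trans (by positivity)
      ((hpeak ζ (hSf ζ hζ) (hSa ζ hζ)).2.1 z (hfc hz.1) (hnear z ζ hzζ)))
    (fun ζ hζ ζ' hζ' z hz z' hz' =>
      h4 z (hball1 hz.2) z' (hball1 hz'.2) ζ (hball1 (hS hζ).2) ζ' (hball1 (hS hζ').2))
    hSγ
    (fun ζ hζ ζ' hζ' hd => hγ2 ζ hζ ζ' hζ' (by
      by_contra! hcon
      nlinarith))
    hJ hP hPJ hdim hsmall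
  have hch : ∀ ζ, ∃ g : E → ℂ, ζ ∈ S → ContDiff ℝ ∞ g ∧
      (∀ z ∈ closure D, DifferentiableAt ℂ g z) ∧
      (∀ z ∈ closure D, ‖g z‖ ≤ C * Real.exp (-(c₁ * (t ^ 2 * ‖z - ζ‖ ^ 2)))) ∧
      ∀ z ∈ closure D, ‖z - ζ‖ ≤ a₁ →
        ‖g z - cexp (-(t ^ 2 : ℝ) * leviPoly r ζ z)‖ ≤ C * Real.exp (-(c₁ * t ^ 2)) := fun ζ => by
    by_cases hζ : ζ ∈ S
    · obtain ⟨g, hg⟩ := (hpeak ζ (hSf ζ hζ) (hSa ζ hζ)).2.2 t ht1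
      exact ⟨g, fun _ => hg⟩
    · exact ⟨0, fun h => absurd h hζ⟩
  choose g hg using hch
  refine ⟨g, p, hp1, fun ζ hζ => ⟨(hg ζ hζ).1, (hg ζ hζ).2.1, (hg ζ hζ).2.2.1⟩,
    fun ζ hζ z hz hzζ => ?_⟩
  have hmain := hp ζ hζ z hz hzζ
  have hzc := hfc hz.1
  have hJp : ∀ μ, ‖J μ (p μ)‖ ≤ 1 := fun μ => (hJ _ _).trans (hp1 μ)
  have hdz : ∀ μ, dist μ ζ - dist z ζ ≤ ‖z - μ‖ := fun μ => by
    rw [← dist_eq_norm]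
    have := dist_triangle_left μ ζ z
    linarith
  have hsplit : ∑ μ ∈ S, (g μ z * (γ μ : ℂ)) • J μ (p μ) =
      (∑ μ ∈ S with t * dist μ ζ ≤ R,
        (cexp (-((t ^ 2 : ℝ) : ℂ) * leviPoly r μ z) * (γ μ : ℂ)) • J μ (p μ)) +
      ((∑ μ ∈ S with t * dist μ ζ ≤ R,
        ((g μ z - cexp (-((t ^ 2 : ℝ) : ℂ) * leviPoly r μ z)) * (γ μ : ℂ)) • J μ (p μ)) +
      ∑ μ ∈ S with ¬ t * dist μ ζ ≤ R, (g μ z * (γ μ : ℂ)) • J μ (p μ)) := by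
    rw [← add_assoc, ← Finset.sum_add_distrib,
      ← Finset.sum_filter_add_sum_filter_not S (fun μ => t * dist μ ζ ≤ R)]
    congr 1
    refine Finset.sum_congr rfl fun μ _ => ?_
    rw [← add_smul]; congr 1; ring
  have hnorm : ∀ μ ∈ S, ∀ w : ℂ, ‖(w * (γ μ : ℂ)) • J μ (p μ)‖ ≤ ‖w‖ * γ μ := fun μ hμ w => by
    rw [norm_smul, norm_mul, Complex.norm_real, Real.norm_eq_abs, abs_of_pos (hSγ μ hμ)]
    have := (hSγ μ hμ).le
    calc ‖w‖ * γ μ * ‖J μ (p μ)‖ ≤ ‖w‖ * γ μ * 1 := by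
          gcongr
          exact hJp μ
      _ = _ := mul_one _
  have hb1 : ‖∑ μ ∈ S with t * dist μ ζ ≤ R,
      ((g μ z - cexp (-((t ^ 2 : ℝ) : ℂ) * leviPoly r μ z)) * (γ μ : ℂ)) • J μ (p μ)‖ ≤
      Real.exp (-C) * η / 8 * γ ζ := by
    have h1 : ‖∑ μ ∈ S with t * dist μ ζ ≤ R,
        ((g μ z - cexp (-((t ^ 2 : ℝ) : ℂ) * leviPoly r μ z)) * (γ μ : ℂ)) • J μ (p μ)‖ ≤
        ∑ μ ∈ S with t * dist μ ζ ≤ R, C * Real.exp (-(c₁ * t ^ 2)) * (2 * γ ζ) := by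
      refine norm_sum_le_of_le _ fun μ hμ => ?_
      obtain ⟨hμS, hμR⟩ := Finset.mem_filter.1 hμ
      refine (hnorm μ hμS _).trans ?_
      have h2 : dist μ ζ ≤ ϱ := by
        by_contra! hcon
        nlinarith
      have h3 := hγ2 μ hμS ζ hζ h2
      have h4 := (hg μ hμS).2.2.2 z hzc (hnear z μ (by
        have := dist_triangle_right z μ ζ
        nlinarith))
      have := (hSγ μ hμS).le
      gcongr
    refine h1.trans ?_
    rw [Finset.sum_const, nsmul_eq_mul]
    have := (hSγ ζ hζ).le
    calc ((({x ∈ S | t * dist x ζ ≤ R}).card : ℝ)) * (C * Real.exp (-(c₁ * t ^ 2)) * (2 * γ ζ))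
        ≤ d * (C * Real.exp (-(c₁ * t ^ 2)) * (2 * γ ζ)) := by
          exact mul_le_mul_of_nonneg_right (hcardd ζ) (by positivity)
      _ = 2 * (d * C) * Real.exp (-(c₁ * t ^ 2)) * γ ζ := by ring
      _ ≤ _ := by gcongr
  have hb2 : ‖∑ μ ∈ S with ¬ t * dist μ ζ ≤ R, (g μ z * (γ μ : ℂ)) • J μ (p μ)‖ ≤
      Real.exp (-C) * η / 4 * γ ζ := by
    set τ : ℝ := (2 * Real.exp (-(c₁ / 2 * (R - 1) ^ 2)) +
      m⁻¹ * Real.exp (-(c₁ / 2 * (ϱ / 2) ^ 2 * t ^ 2))) * γ ζ with hτ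
    have hγζ := (hSγ ζ hζ)
    have hτ0 : 0 ≤ τ := by positivity
    have h1 := hgauss t ht (S.filter fun μ => ¬ t * dist μ ζ ≤ R) z
      (fun x hx y hy => hsep x (Finset.mem_filter.1 hx).1 y (Finset.mem_filter.1 hy).1) γ τ
      (fun μ hμ => by
        obtain ⟨hμS, hμR⟩ := Finset.mem_filter.1 hμ
        rw [not_le] at hμR
        have hγμ := hSγ μ hμS
        rw [hτ, add_mul]
        by_cases h2 : dist μ ζ ≤ ϱ
        · have h3 := hγ2 μ hμS ζ hζ h2
          have h4 : R - 1 ≤ t * ‖z - μ‖ := by nlinarith [hdz μ]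
          have h5 : Real.exp (-(c₁ / 2 * (t ^ 2 * ‖z - μ‖ ^ 2))) ≤
              Real.exp (-(c₁ / 2 * (R - 1) ^ 2)) := by
            refine Real.exp_le_exp.2 (neg_le_neg ?_)
            rw [← mul_pow]
            have : 0 ≤ R - 1 := by linarith
            gcongr
          have h6 : 0 ≤ m⁻¹ * Real.exp (-(c₁ / 2 * (ϱ / 2) ^ 2 * t ^ 2)) * γ ζ := by positivity
          have h7 : Real.exp (-(c₁ / 2 * (t ^ 2 * ‖z - μ‖ ^ 2))) * γ μ ≤
              Real.exp (-(c₁ / 2 * (R - 1) ^ 2)) * (2 * γ ζ) := by gcongr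
          linarith
        · rw [not_le] at h2
          have h4 : ϱ / 2 ≤ ‖z - μ‖ := by
            have h5 : dist z ζ ≤ ϱ / 2 := by
              by_contra! hcon
              nlinarith
            linarith [hdz μ]
          have h5 : Real.exp (-(c₁ / 2 * (t ^ 2 * ‖z - μ‖ ^ 2))) ≤
              Real.exp (-(c₁ / 2 * (ϱ / 2) ^ 2 * t ^ 2)) := by
            refine Real.exp_le_exp.2 (neg_le_neg ?_)
            rw [mul_assoc, mul_comm (t ^ 2)]
            gcongr
          have h6 : γ μ ≤ m⁻¹ * γ ζ := by
            rw [inv_mul_eq_div, le_div_iff₀ hm]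
            have := (hγ μ hμS).2
            have := (hγ ζ hζ).1
            nlinarith
          have h7 : Real.exp (-(c₁ / 2 * (t ^ 2 * ‖z - μ‖ ^ 2))) * γ μ ≤
              Real.exp (-(c₁ / 2 * (ϱ / 2) ^ 2 * t ^ 2)) * (m⁻¹ * γ ζ) := by gcongr
          have h8 : 0 ≤ 2 * Real.exp (-(c₁ / 2 * (R - 1) ^ 2)) * γ ζ := by positivity
          linarith)
    rw [max_eq_left hτ0] at h1
    calc ‖∑ μ ∈ S with ¬ t * dist μ ζ ≤ R, (g μ z * (γ μ : ℂ)) • J μ (p μ)‖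
        ≤ ∑ μ ∈ S with ¬ t * dist μ ζ ≤ R,
          C * (Real.exp (-(c₁ * (t ^ 2 * ‖z - μ‖ ^ 2))) * γ μ) := by
          refine norm_sum_le_of_le _ fun μ hμ => ?_
          have hμS := (Finset.mem_filter.1 hμ).1
          refine (hnorm μ hμS _).trans ?_
          rw [← mul_assoc]
          have := (hSγ μ hμS).le
          gcongr
          exact (hg μ hμS).2.2.1 z hzc
      _ ≤ C * (Cg * τ) := by rw [← Finset.mul_sum]; gcongr
      _ ≤ (Real.exp (-C) * η / 8 + Real.exp (-C) * η / 8) * γ ζ := by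
          rw [hτ, ← mul_assoc, ← mul_assoc]
          gcongr
          rw [mul_add]
          refine add_le_add ?_ ((mul_assoc (C * Cg) _ _).symm.trans_le e2)
          have h9 : Real.exp (-C) * (16 * (C * Cg) * Real.exp C *
              Real.exp (-(c₁ / 2 * (R - 1) ^ 2))) ≤ Real.exp (-C) * η := by gcongr
          have h10 : Real.exp (-C) * Real.exp C = 1 := by rw [← Real.exp_add]; simp
          have h11 : Real.exp (-C) * (16 * (C * Cg) * Real.exp C *
              Real.exp (-(c₁ / 2 * (R - 1) ^ 2))) = (Real.exp (-C) * Real.exp C) * (16 * (C * Cg) *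
              Real.exp (-(c₁ / 2 * (R - 1) ^ 2))) := by ring
          rw [h11, h10] at h9
          linarith
      _ = _ := by ring
  rw [hsplit]
  refine le_trans ?_ (norm_sub_le_norm_add _ _)
  have h12 := norm_add_le (∑ μ ∈ S with t * dist μ ζ ≤ R,
    ((g μ z - cexp (-((t ^ 2 : ℝ) : ℂ) * leviPoly r μ z)) * (γ μ : ℂ)) • J μ (p μ))
    (∑ μ ∈ S with ¬ t * dist μ ζ ≤ R, (g μ z * (γ μ : ℂ)) • J μ (p μ))
  have h13 : 0 ≤ Real.exp (-C) * η * γ ζ := by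
    have := (hSγ ζ hζ).le
    positivity
  linarith

end WaveSum

section Normal

open Filter Topology Module
open scoped ContDiff

variable {F : Type*} [NormedAddCommGroup F] [InnerProductSpace ℂ F] [FiniteDimensional ℂ F]

/-- The rescaled gradient of a nonzero real functional `A`, normalised by
`complexForm A (unitNormal A) = 1`. -/
def unitNormal (A : F →L[ℝ] ℝ) : F :=
  let _ : InnerProductSpace ℝ F := InnerProductSpace.complexToReal
  have : FiniteDimensional ℝ F := FiniteDimensional.complexToReal F
  (‖A‖ ^ 2)⁻¹ • (InnerProductSpace.toDual ℝ F).symm A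

theorem complexForm_unitNormal {A : F →L[ℝ] ℝ} (hA : A ≠ 0) : complexForm A (unitNormal A) = 1 := by
  let _ : InnerProductSpace ℝ F := InnerProductSpace.complexToReal
  have : FiniteDimensional ℝ F := FiniteDimensional.complexToReal F
  set u := (InnerProductSpace.toDual ℝ F).symm A with hu
  have hAu : ∀ v, A v = inner ℝ u v := fun v => by
    rw [hu, InnerProductSpace.toDual_symm_apply]
  have hn : ‖u‖ = ‖A‖ := by rw [hu, LinearIsometryEquiv.norm_map]
  have h1 : A u = ‖A‖ ^ 2 := by rw [hAu, real_inner_self_eq_norm_sq, hn]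
  have h2 : A (I • u) = 0 := by
    rw [hAu]
    change (inner ℂ u (I • u)).re = 0
    rw [inner_smul_right, inner_self_eq_norm_sq_to_K]
    simp [← ofReal_pow]
  have h3 : ‖A‖ ^ 2 ≠ 0 := by simpa using hA
  change complexForm A ((‖A‖ ^ 2)⁻¹ • u) = 1
  rw [complexForm_apply, smul_comm I, map_smul, map_smul, h1, h2]
  simp [h3]

theorem continuousOn_unitNormal : ContinuousOn (unitNormal (F := F)) {0}ᶜ := by
  let _ : InnerProductSpace ℝ F := InnerProductSpace.complexToReal
  have : FiniteDimensional ℝ F := FiniteDimensional.complexToReal F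
  have h : ContinuousOn (fun A : F →L[ℝ] ℝ => (‖A‖ ^ 2)⁻¹) {0}ᶜ :=
    ContinuousOn.inv₀ (by fun_prop) fun A hA => by simpa using hA
  exact h.smul (InnerProductSpace.toDual ℝ F).symm.continuous.continuousOn

set_option maxHeartbeats 1000000 in
/-- Quadratically corrected complex tangential displacements increase a strongly
plurisubharmonic function at least quadratically. -/
theorem exists_tangential_increase {Ω : Set F} (hΩ : IsOpen Ω) {ρ : F → ℝ}
    (hρ : ContDiffOn ℝ ∞ ρ Ω) (hlevi : ∀ x ∈ Ω, ∀ v, 3 * ‖v‖ ^ 2 ≤ leviForm ρ x v)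
    {K₁ : Set F} (hK₁ : IsCompact K₁) (hK₁Ω : K₁ ⊆ Ω) (hcrit : ∀ x ∈ K₁, fderiv ℝ ρ x ≠ 0) :
    ∃ κ θ B : ℝ, 0 < κ ∧ 0 < θ ∧ θ ≤ 1 ∧ 1 ≤ B ∧ cthickening κ K₁ ⊆ Ω ∧
      (∀ x ∈ cthickening κ K₁, fderiv ℝ ρ x ≠ 0) ∧
      ∀ x ∈ cthickening κ K₁, ∀ (v e : F) (σ : ℝ), ‖v‖ ≤ θ → σ ≤ θ →
        ‖complexForm (fderiv ℝ ρ x) v‖ ≤ σ → ‖e‖ ≤ σ →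
        ∀ G : F, G = v - complexQuad (fderiv ℝ (fderiv ℝ ρ) x) v v • unitNormal (fderiv ℝ ρ x) + e →
          x + G ∈ Ω ∧ ‖G‖ ≤ 2 * ‖v‖ + σ ∧ ‖v‖ ≤ 2 * ‖G‖ + 2 * σ ∧
          2 * ‖G‖ ^ 2 - B * σ ≤ ρ (x + G) - ρ x ∧ ρ (x + G) - ρ x ≤ B * ‖G‖ ^ 2 + B * σ := by
  have : FiniteDimensional ℝ F := FiniteDimensional.complexToReal F
  have : ProperSpace F := FiniteDimensional.proper ℝ F
  have hD1 : ContDiffOn ℝ ∞ (fderiv ℝ ρ) Ω := hρ.fderiv_of_isOpen hΩ (by simp)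
  have hD2 : ContDiffOn ℝ ∞ (fderiv ℝ (fderiv ℝ ρ)) Ω := hD1.fderiv_of_isOpen hΩ (by simp)
  have hΩ' : IsOpen (Ω ∩ fderiv ℝ ρ ⁻¹' {0}ᶜ) :=
    hD1.continuousOn.isOpen_inter_preimage hΩ isOpen_compl_singleton
  obtain ⟨κ', hκ', hsub⟩ := hK₁.exists_cthickening_subset_open hΩ' fun x hx =>
    ⟨hK₁Ω hx, hcrit x hx⟩
  set K₃ := cthickening κ' K₁ with hK₃
  have hK₃c : IsCompact K₃ := hK₁.cthickening
  have hsubΩ : K₃ ⊆ Ω := fun x hx => (hsub hx).1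
  obtain ⟨B₁, hB₁⟩ := hK₃c.exists_bound_of_continuousOn (hD1.continuousOn.mono hsubΩ)
  obtain ⟨B₂, hB₂⟩ := hK₃c.exists_bound_of_continuousOn
    ((hD1.continuousOn_fderiv_of_isOpen hΩ (by simp)).mono hsubΩ)
  obtain ⟨B₃, hB₃⟩ := hK₃c.exists_bound_of_continuousOn
    (continuousOn_unitNormal.comp (hD1.continuousOn.mono hsubΩ) fun x hx => (hsub hx).2)
  have huc := Metric.uniformContinuousOn_iff.1
    (hK₃c.uniformContinuousOn_of_continuous (hD2.continuousOn.mono hsubΩ)) (1 / 2) (by norm_num)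
  obtain ⟨δ₁, hδ₁, huc⟩ := huc
  obtain ⟨B, hB, hBB₁, hBB₂, hBB₃⟩ : ∃ B : ℝ, 1 ≤ B ∧ B₁ ≤ B ∧ B₂ ≤ B ∧ B₃ ≤ B :=
    ⟨max 1 (max B₁ (max B₂ B₃)), le_max_left _ _,
      (le_max_left _ _).trans (le_max_right _ _),
      ((le_max_left _ _).trans (le_max_right _ _)).trans (le_max_right _ _),
      ((le_max_right _ _).trans (le_max_right _ _)).trans (le_max_right _ _)⟩
  obtain ⟨δ, hδ, hδδ₁, hδκ⟩ : ∃ δ : ℝ, 0 < δ ∧ δ ≤ δ₁ ∧ δ ≤ κ' / 2 :=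
    ⟨min δ₁ (κ' / 2), by positivity, min_le_left _ _, min_le_right _ _⟩
  obtain ⟨θ, hθ, hθ1, hθB, hθδ⟩ : ∃ θ : ℝ, 0 < θ ∧ θ ≤ 1 ∧ 56 * B ^ 3 * θ ≤ 1 ∧ 4 * θ ≤ δ := by
    refine ⟨min (1 / (56 * B ^ 3)) (min 1 (δ / 4)), by positivity,
      (min_le_right _ _).trans (min_le_left _ _), ?_, ?_⟩
    · calc 56 * B ^ 3 * min (1 / (56 * B ^ 3)) (min 1 (δ / 4))
          ≤ 56 * B ^ 3 * (1 / (56 * B ^ 3)) := by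
            gcongr
            exact min_le_left _ _
        _ = 1 := by field_simp
    · have := (min_le_right (1 / (56 * B ^ 3)) (min 1 (δ / 4))).trans (min_le_right _ _)
      linarith
  have hK₂₃ : cthickening (κ' / 2) K₁ ⊆ K₃ := cthickening_mono (by linarith) _
  have hnb : ∀ x ∈ cthickening (κ' / 2) K₁, ball x δ ⊆ K₃ := fun x hx y hy => by
    have h1 : y ∈ cthickening (κ' / 2) (cthickening (κ' / 2) K₁) :=
      mem_cthickening_of_dist_le y x _ _ hx ((mem_ball.1 hy).le.trans hδκ)
    have h2 := cthickening_cthickening_subset (by positivity : 0 ≤ κ' / 2)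
      (by positivity : 0 ≤ κ' / 2) K₁ h1
    rwa [add_halves] at h2
  refine ⟨κ' / 2, θ, 6 * B, by positivity, hθ, hθ1, by linarith, hK₂₃.trans hsubΩ,
    fun x hx => (hsub (hK₂₃ hx)).2, ?_⟩
  intro x hx v e σ hv hσθ hℓ he G hG
  have hσ : 0 ≤ σ := (norm_nonneg e).trans he
  have hx₃ := hK₂₃ hx
  set ℓ := complexForm (fderiv ℝ ρ x) with hℓdef
  set q := complexQuad (fderiv ℝ (fderiv ℝ ρ) x) with hq
  set n := unitNormal (fderiv ℝ ρ x) with hn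
  have hn1 : ℓ n = 1 := complexForm_unitNormal (hsub hx₃).2
  have hnB : ‖n‖ ≤ B := (hB₃ x hx₃).trans hBB₃
  have hDB : ‖fderiv ℝ ρ x‖ ≤ B := (hB₁ x hx₃).trans hBB₁
  have hHB : ‖fderiv ℝ (fderiv ℝ ρ) x‖ ≤ B := (hB₂ x hx₃).trans hBB₂
  have hqle : ∀ a b, ‖q a b‖ ≤ B * ‖a‖ * ‖b‖ := fun a b =>
    (norm_complexQuad_le _ a b).trans (by gcongr)
  set d : F := -(q v v • n) + e with hd
  have hGd : G = v + d := by rw [hG, hd]; abel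
  have hB0 : 0 ≤ B := by linarith
  have hv0 := norm_nonneg v
  have hqn : ‖q v v • n‖ ≤ B ^ 2 * ‖v‖ ^ 2 := by
    rw [norm_smul]
    calc ‖q v v‖ * ‖n‖ ≤ (B * ‖v‖ * ‖v‖) * B := by
          have := hqle v v
          gcongr
      _ = _ := by ring
  have hdle : ‖d‖ ≤ B ^ 2 * ‖v‖ ^ 2 + σ := by
    refine (norm_add_le _ _).trans ?_
    rw [norm_neg]
    linarith
  have hB23 : B ^ 2 ≤ B ^ 3 := pow_le_pow_right₀ hB (by norm_num)
  have hB2θ : B ^ 2 * θ ≤ 1 / 2 := by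
    have := mul_le_mul_of_nonneg_right hB23 hθ.le
    linarith
  have hBv : B ^ 2 * ‖v‖ ^ 2 ≤ ‖v‖ / 2 := by
    calc B ^ 2 * ‖v‖ ^ 2 = B ^ 2 * ‖v‖ * ‖v‖ := by ring
      _ ≤ B ^ 2 * θ * ‖v‖ := by gcongr
      _ ≤ 1 / 2 * ‖v‖ := by gcongr
      _ = _ := by ring
  have hd0 := norm_nonneg d
  have hGv : ‖G‖ ≤ ‖v‖ + ‖d‖ := hGd ▸ norm_add_le _ _
  have hvG : ‖v‖ ≤ ‖G‖ + ‖d‖ := by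
    have : v = G - d := by rw [hGd]; abel
    rw [this]; exact norm_sub_le _ _
  have hG0 := norm_nonneg G
  have hGδ : ‖G‖ < δ := by linarith
  have hGball : x + G ∈ ball x δ := by simpa using hGδ
  have hvG2 : ‖v‖ ≤ 2 * ‖G‖ + 2 * σ := by linarith
  have hcd : ∀ y ∈ ball x δ, ContDiffAt ℝ ∞ ρ y := fun y hy =>
    hρ.contDiffAt (hΩ.mem_nhds (hsubΩ (hnb x hx hy)))
  have htay := abs_taylor_two_le (σ := 1 / 2)
    (fun y hy => (hcd y hy).of_le (WithTop.coe_le_coe.2 le_top))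
    (fun y hy => by
      have := (huc y (hnb x hx hy) x hx₃ ((mem_ball.1 hy).trans_le hδδ₁)).le
      rwa [dist_eq_norm] at this) hGδ
  have hsymm : IsSymmSndFDerivAt ℝ ρ x :=
    ContDiffAt.isSymmSndFDerivAt (n := 2)
      ((hcd x (mem_ball_self hδ)).of_le (WithTop.coe_le_coe.2 le_top)) (by simp)
  rw [half_fderiv_fderiv_eq ρ hsymm] at htay
  have hL := hlevi x (hsubΩ hx₃) G
  have hLu : leviForm ρ x G ≤ 1 / 2 * B * ‖G‖ ^ 2 :=
    (le_abs_self _).trans ((abs_leviForm_le ρ x G).trans (by gcongr))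
  have hℓG : fderiv ℝ ρ x G = (ℓ v).re - (q v v).re + fderiv ℝ ρ x e := by
    rw [← complexForm_re, ← complexForm_re _ e, ← hℓdef, hG, map_add, map_sub, map_smul, hn1]
    simp
  have hqG : (q G G).re = (q v v).re + (q v d + q d v + q d d).re := by
    rw [hGd, map_add, map_add, LinearMap.add_apply, LinearMap.add_apply]
    simp only [Complex.add_re]; ring
  have hqd : |(q v d + q d v + q d d).re| ≤ 1 / 2 * ‖G‖ ^ 2 + 4 * B * σ := by
    refine (Complex.abs_re_le_norm _).trans ?_
    have h1 : ‖q v d + q d v + q d d‖ ≤ B * ‖d‖ * (2 * ‖v‖ + ‖d‖) := by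
      refine (norm_add₃_le).trans ?_
      have := hqle v d
      have := hqle d v
      have := hqle d d
      linarith
    refine h1.trans ?_
    have h2 : 2 * ‖v‖ + ‖d‖ ≤ 7 / 2 * θ := by linarith
    have h3 : B * ‖d‖ * (2 * ‖v‖ + ‖d‖) ≤ B * (B ^ 2 * ‖v‖ ^ 2 + σ) * (7 / 2 * θ) := by gcongr
    have h4 : ‖v‖ ^ 2 ≤ 8 * ‖G‖ ^ 2 + 8 * σ := by
      have h5 : ‖v‖ ^ 2 ≤ (2 * ‖G‖ + 2 * σ) ^ 2 := by gcongr
      have h6 : σ ^ 2 ≤ σ := by rw [sq]; exact mul_le_of_le_one_left hσ (hσθ.trans hθ1)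
      linarith [sq_nonneg (‖G‖ - σ)]
    have h6 : B ^ 3 * θ * ‖v‖ ^ 2 ≤ B ^ 3 * θ * (8 * ‖G‖ ^ 2 + 8 * σ) := by gcongr
    have h7 : (56 * B ^ 3 * θ) * (‖G‖ ^ 2 + σ) ≤ 1 * (‖G‖ ^ 2 + σ) := by gcongr
    have h8 : B * σ * θ ≤ B * σ * 1 := by gcongr
    have h9 : σ ≤ B * σ := le_mul_of_one_le_left hσ hB
    linarith
  have hℓv : |(ℓ v).re| ≤ σ := (Complex.abs_re_le_norm _).trans hℓ
  have hDe : |fderiv ℝ ρ x e| ≤ B * σ :=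
    ((fderiv ℝ ρ x).le_opNorm e).trans (by gcongr)
  have hσB : σ ≤ B * σ := le_mul_of_one_le_left hσ hB
  rw [hℓG, hqG] at htay
  rw [abs_le] at htay hqd hℓv hDe
  have hGB : ‖G‖ ^ 2 ≤ B * ‖G‖ ^ 2 := le_mul_of_one_le_left (sq_nonneg _) hB
  refine ⟨hsubΩ (hnb x hx hGball), by linarith, hvG2, ?_, ?_⟩
  · linarith
  · linarith

end Normal

section Isometry

open Module

variable {E : Type*} [NormedAddCommGroup E] [InnerProductSpace ℂ E] [FiniteDimensional ℂ E]
variable {F : Type*} [NormedAddCommGroup F] [InnerProductSpace ℂ F] [FiniteDimensional ℂ F]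

theorem exists_contraction_into_ker (ℓ : F →ₗ[ℂ] ℂ) (h : finrank ℂ E < finrank ℂ F) :
    ∃ (J : E →L[ℂ] F) (P : F →L[ℂ] E), (∀ v, ‖J v‖ ≤ ‖v‖) ∧ (∀ v, ‖P v‖ ≤ ‖v‖) ∧
      (∀ v, P (J v) = v) ∧ ∀ v, ℓ (J v) = 0 := by
  have : CompleteSpace E := FiniteDimensional.complete ℂ E
  have : CompleteSpace F := FiniteDimensional.complete ℂ F
  have hdim : finrank ℂ E ≤ finrank ℂ (LinearMap.ker ℓ) := by
    have h1 := LinearMap.finrank_range_add_finrank_ker ℓ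
    have h2 : finrank ℂ (LinearMap.range ℓ) ≤ 1 :=
      (Submodule.finrank_le _).trans (finrank_self ℂ).le
    omega
  let b := stdOrthonormalBasis ℂ E
  let b' := stdOrthonormalBasis ℂ (LinearMap.ker ℓ)
  let f : E →ₗ[ℂ] LinearMap.ker ℓ := b.toBasis.constr ℂ fun i => b' (Fin.castLE hdim i)
  have hf : f ∘ b.toBasis = fun i => b' (Fin.castLE hdim i) := by
    ext1 i
    exact b.toBasis.constr_basis ℂ _ i
  let J₀ : E →ₗᵢ[ℂ] LinearMap.ker ℓ := f.isometryOfOrthonormal (v := b.toBasis)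
    (by simp [b.orthonormal])
    (by rw [hf]; exact b'.orthonormal.comp _ (Fin.castLE_injective hdim))
  let J : E →ₗᵢ[ℂ] F := (LinearMap.ker ℓ).subtypeₗᵢ.comp J₀
  refine ⟨J.toContinuousLinearMap, ContinuousLinearMap.adjoint J.toContinuousLinearMap,
    fun v => (J.norm_map v).le, fun v => ?_, fun v => ?_, fun v => (J₀ v).2⟩
  · refine (ContinuousLinearMap.le_opNorm _ v).trans ?_
    rw [LinearIsometryEquiv.norm_map]
    exact mul_le_of_le_one_left (norm_nonneg v) J.norm_toContinuousLinearMap_le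
  · refine ext_inner_right ℂ fun w => ?_
    rw [ContinuousLinearMap.adjoint_inner_left]
    exact J.inner_map_map v w

end Isometry

section TangentialMap

open Filter Topology Module
open scoped ContDiff

variable {E : Type*} [NormedAddCommGroup E] [InnerProductSpace ℂ E] [FiniteDimensional ℂ E]
variable {F : Type*} [NormedAddCommGroup F] [InnerProductSpace ℂ F] [FiniteDimensional ℂ F]

set_option maxHeartbeats 2000000 in
/-- Almost tangential holomorphic maps of prescribed boundary size together with their quadratic
corrections. -/
theorem IsDefiningFunction.exists_tangential_map {D : Set E} {r : E → ℝ} {η₀ c : ℝ}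
    (h : IsDefiningFunction D r η₀ c) (hD : IsOpen D) (hDb : IsBounded D) {z₀ : E}
    (hz₀ : z₀ ∈ frontier D) (hE : 1 ≤ finrank ℝ E) (hdim : finrank ℂ E < finrank ℂ F) :
    ∃ a C₀ c₀ : ℝ, 0 < a ∧ 0 < C₀ ∧ 0 < c₀ ∧ ∀ (A : E → F →L[ℝ] ℝ) (H : E → F →L[ℝ] F →L[ℝ] ℝ)
      (N : E → F) (Y₁ Y₂ T : Set E) (γ : E → ℝ) (γ₀ ϱ₀ σ : ℝ),
      ContinuousOn A (closure D) → ContinuousOn H (closure D) → ContinuousOn N Y₂ →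
      IsCompact Y₂ → Y₂ ⊆ closure D → Y₁ ⊆ Y₂ → Y₁ ⊆ frontier D ∩ closedBall z₀ a →
      T ⊆ closure D → 0 < ϱ₀ → (∀ z ∈ T, ∀ ζ ∈ Y₁, ϱ₀ ≤ ‖z - ζ‖) →
      ContinuousOn γ (frontier D) → (∀ z ∈ frontier D, 0 < γ z ∧ γ z ≤ γ₀) →
      γ₀ ≤ 1 → C₀ * γ₀ ≤ 1 → 0 < σ →
      ∃ g G : E → F, ContDiff ℝ ∞ G ∧ (∀ z ∈ closure D, DifferentiableAt ℂ G z) ∧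
        (∀ z ∈ closure D, ‖g z‖ ≤ C₀ * γ₀) ∧
        (∀ z ∈ Y₂, ‖complexForm (A z) (g z)‖ ≤ σ) ∧
        (∀ z ∈ Y₂, ‖G z - (g z - complexQuad (H z) (g z) (g z) • N z)‖ ≤ σ) ∧
        (∀ z ∈ T, ‖G z‖ ≤ σ) ∧
        (∀ z ∈ frontier D, ‖g z‖ ≤ 3 * C₀ * γ z) ∧
        (∀ z ∈ Y₁, c₀ * γ z ≤ ‖g z‖) := by
  classical
  have : FiniteDimensional ℝ E := FiniteDimensional.complexToReal E
  have : ProperSpace E := FiniteDimensional.proper ℝ E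
  obtain ⟨a, c₁, C, c₀, ha, hc₁, hC, hc₀, hmain⟩ :=
    h.exists_nonvanishing_sum (F := F) hD hDb hz₀ hE
  obtain ⟨Cg, hCg, hgauss⟩ := exists_weighted_gaussian_sum_le E hc₁
  have hC0 : 0 < C := by linarith
  set C₀ := C * Cg with hC₀
  have hC₀0 : 0 < C₀ := by positivity
  refine ⟨a, C₀, c₀ / 2, ha, hC₀0, by positivity, ?_⟩
  intro A H N Y₁ Y₂ T γ γ₀ ϱ₀ σ hA hH hN hY₂c hY₂ hY₁₂ hY₁ hT hϱ₀ hTY hγc hγ hγ₀ hCγ hσ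
  have hclc : IsCompact (closure D) := hDb.isCompact_closure
  have hfc : frontier D ⊆ closure D := frontier_subset_closure
  have hbD : IsCompact (frontier D) := hclc.of_isClosed_subset isClosed_frontier hfc
  obtain ⟨m, hm, hmγ⟩ : ∃ m, 0 < m ∧ ∀ z ∈ frontier D, m ≤ γ z := by
    obtain ⟨x, hx, hxm⟩ := hbD.exists_isMinOn ⟨z₀, hz₀⟩ hγc
    exact ⟨γ x, (hγ x hx).1, fun z hz => hxm hz⟩
  obtain ⟨B₁, hB₁⟩ := hclc.exists_bound_of_continuousOn hA
  obtain ⟨B₂, hB₂⟩ : ∃ B₂, ∀ z ∈ closure D, ‖H z‖ ≤ B₂ :=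
    hclc.exists_bound_of_continuousOn (E := F →L[ℝ] F →L[ℝ] ℝ) hH
  obtain ⟨B₃, hB₃⟩ := hY₂c.exists_bound_of_continuousOn hN
  obtain ⟨B, hB, hBB₁, hBB₂, hBB₃⟩ : ∃ B : ℝ, 1 ≤ B ∧ B₁ ≤ B ∧ B₂ ≤ B ∧ B₃ ≤ B :=
    ⟨max 1 (max B₁ (max B₂ B₃)), le_max_left _ _,
      (le_max_left _ _).trans (le_max_right _ _),
      ((le_max_left _ _).trans (le_max_right _ _)).trans (le_max_right _ _),
      ((le_max_right _ _).trans (le_max_right _ _)).trans (le_max_right _ _)⟩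
  have hAB : ∀ z ∈ closure D, ‖A z‖ ≤ B := fun z hz => (hB₁ z hz).trans hBB₁
  have hHB : ∀ z ∈ closure D, ‖H z‖ ≤ B := fun z hz => (hB₂ z hz).trans hBB₂
  have hNB : ∀ z ∈ Y₂, ‖N z‖ ≤ B := fun z hz => (hB₃ z hz).trans hBB₃
  have hB0 : 0 ≤ B := by linarith
  have hBB : B ≤ B ^ 2 := by rw [sq]; exact le_mul_of_one_le_left hB0 hB
  obtain ⟨δ, hδ, hδσ⟩ : ∃ δ : ℝ, 0 < δ ∧ C₀ * (2 * B * δ) = σ / 2 :=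
    ⟨σ / (4 * B * C₀), by positivity, by field_simp; norm_num⟩
  obtain ⟨ϱ₁, hϱ₁, hu₁⟩ := Metric.uniformContinuousOn_iff.1
    (hclc.uniformContinuousOn_of_continuous hA) δ hδ
  obtain ⟨ϱ₂, hϱ₂, hu₂⟩ := (Metric.uniformContinuousOn_iff (β := F →L[ℝ] F →L[ℝ] ℝ)).1
    (IsCompact.uniformContinuousOn_of_continuous (β := F →L[ℝ] F →L[ℝ] ℝ) hclc hH) δ hδ
  obtain ⟨ϱ₃, hϱ₃, hu₃⟩ := Metric.uniformContinuousOn_iff.1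
    (hY₂c.uniformContinuousOn_of_continuous hN) δ hδ
  obtain ⟨ϱ₄, hϱ₄, hu₄⟩ := Metric.uniformContinuousOn_iff.1
    (hbD.uniformContinuousOn_of_continuous hγc) m hm
  obtain ⟨ϱ, hϱ, hr₀, hr₁, hr₂, hr₃, hr₄⟩ : ∃ ϱ : ℝ, 0 < ϱ ∧ ϱ ≤ ϱ₀ ∧ ϱ ≤ ϱ₁ ∧ ϱ ≤ ϱ₂ ∧ ϱ ≤ ϱ₃ ∧
      ϱ < ϱ₄ := by
    refine ⟨min ϱ₀ (min ϱ₁ (min ϱ₂ (min ϱ₃ (ϱ₄ / 2)))), by positivity, min_le_left _ _, ?_⟩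
    have h1 := min_le_right ϱ₀ (min ϱ₁ (min ϱ₂ (min ϱ₃ (ϱ₄ / 2))))
    have h2 := le_min_iff.1 h1
    have h3 := le_min_iff.1 h2.2
    have h4 := le_min_iff.1 h3.2
    exact ⟨h2.1, h3.1, h4.1, by linarith [h4.2]⟩
  have hγ2 : ∀ z ∈ frontier D, ∀ ζ ∈ frontier D, dist z ζ ≤ ϱ → γ z ≤ 2 * γ ζ := by
    intro z hz ζ hζ hd
    have := hu₄ z hz ζ hζ (hd.trans_lt hr₄)
    rw [Real.dist_eq, abs_lt] at this
    linarith [hmγ ζ hζ]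
  have htail := tendsto_exp_neg_mul_sq (k := c₁ / 2 * ϱ ^ 2) (by positivity)
  have ev1 := (htail.const_mul (C₀ * (4 * B ^ 2))).eventually_le_const
    (u := σ / 2) (by rw [mul_zero]; positivity)
  have ev2 := htail.eventually_le_const hm
  obtain ⟨t, hLA, ht1, ht2, ht3, ht4⟩ := ((hmain ϱ m hϱ hm).and (ev1.and (ev2.and
    ((eventually_ge_atTop 1).and (eventually_ge_atTop (1 / ϱ)))))).exists
  have ht : 0 < t := by linarith
  set τ := Real.exp (-(c₁ / 2 * ϱ ^ 2 * t ^ 2)) with hτ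
  have hτ0 : 0 < τ := Real.exp_pos _
  obtain ⟨S, hSY, hSsep, hScov⟩ := exists_finset_separated_cover
    (hDb.closure.subset (hY₁₂.trans hY₂)) (one_div_pos.2 ht)
  have hSsep' : ∀ x ∈ S, ∀ y ∈ S, x ≠ y → 1 ≤ t * dist x y := fun x hx y hy hne => by
    have := hSsep x hx y hy hne
    rwa [div_le_iff₀ ht, mul_comm] at this
  have hSf : ∀ ζ ∈ S, ζ ∈ frontier D := fun ζ hζ => (hY₁ (hSY hζ)).1
  have hS₂ : ∀ ζ ∈ S, ζ ∈ Y₂ := fun ζ hζ => hY₁₂ (hSY hζ)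
  choose J P hJ hP hPJ hJker using fun ζ : E =>
    exists_contraction_into_ker (E := E) (complexForm (A ζ)) hdim
  obtain ⟨u, p, hp1, hu, hlow⟩ := hLA S (hSY.trans hY₁) hSsep' γ
    (fun ζ hζ => ⟨hmγ ζ (hSf ζ hζ), (hγ ζ (hSf ζ hζ)).2.trans hγ₀⟩)
    (fun ζ hζ ζ' hζ' hd => hγ2 ζ (hSf ζ hζ) ζ' (hSf ζ' hζ') hd) J P hJ hP hPJ
  have hsum : ∀ z ∈ closure D, ∀ (Δ : E → ℝ) (δ' B' : ℝ), 0 ≤ δ' → 0 ≤ B' →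
      (∀ ζ ∈ S, ‖z - ζ‖ < ϱ → Δ ζ ≤ δ') → (∀ ζ ∈ S, 0 ≤ Δ ζ ∧ Δ ζ ≤ B') →
      ∑ ζ ∈ S, ‖u ζ z‖ * Δ ζ ≤ C₀ * (δ' + B' * τ) := by
    intro z hz Δ δ' B' hδ' hB' hΔ1 hΔ2
    have h1 := hgauss t ht S z hSsep' Δ (δ' + B' * τ) (fun ζ hζ => by
      obtain ⟨h0, h2⟩ := hΔ2 ζ hζ
      by_cases hd : ‖z - ζ‖ < ϱ
      · have h3 : Real.exp (-(c₁ / 2 * (t ^ 2 * ‖z - ζ‖ ^ 2))) ≤ 1 :=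
          Real.exp_le_one_iff.2 (by rw [neg_nonpos]; positivity)
        have h4 := hΔ1 ζ hζ hd
        have h5 : 0 ≤ B' * τ := by positivity
        calc _ ≤ 1 * Δ ζ := by gcongr
          _ ≤ _ := by linarith
      · rw [not_lt] at hd
        have h3 : Real.exp (-(c₁ / 2 * (t ^ 2 * ‖z - ζ‖ ^ 2))) ≤ τ := by
          refine Real.exp_le_exp.2 (neg_le_neg ?_)
          rw [mul_assoc, mul_comm (t ^ 2)]
          gcongr
        calc _ ≤ τ * B' := by gcongr
          _ ≤ _ := by linarith)
    rw [max_eq_left (by positivity)] at h1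
    calc ∑ ζ ∈ S, ‖u ζ z‖ * Δ ζ
        ≤ ∑ ζ ∈ S, C * (Real.exp (-(c₁ * (t ^ 2 * ‖z - ζ‖ ^ 2))) * Δ ζ) := by
          refine Finset.sum_le_sum fun ζ hζ => ?_
          rw [← mul_assoc]
          have := (hΔ2 ζ hζ).1
          have := (hu ζ hζ).2.2 z hz
          gcongr
      _ ≤ C * (Cg * (δ' + B' * τ)) := by rw [← Finset.mul_sum]; gcongr
      _ = _ := by ring
  let w : E → F := fun ζ => (γ ζ : ℂ) • J ζ (p ζ)
  let g : E → F := fun z => ∑ ζ ∈ S, u ζ z • w ζ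
  let Q : E → E → F := fun z ζ => complexQuad (H ζ) (w ζ) (g z) • N ζ
  let G : E → F := fun z => g z - ∑ ζ ∈ S, u ζ z • Q z ζ
  have hwγ : ∀ ζ ∈ S, ‖w ζ‖ ≤ γ ζ := fun ζ hζ => by
    simp only [w]
    have h0 := (hγ ζ (hSf ζ hζ)).1
    rw [norm_smul, Complex.norm_real, Real.norm_eq_abs, abs_of_pos h0]
    exact mul_le_of_le_one_right h0.le ((hJ _ _).trans (hp1 ζ))
  have hwγ₀ : ∀ ζ ∈ S, ‖w ζ‖ ≤ γ₀ := fun ζ hζ => (hwγ ζ hζ).trans (hγ ζ (hSf ζ hζ)).2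
  have hw1 : ∀ ζ ∈ S, ‖w ζ‖ ≤ 1 := fun ζ hζ => (hwγ₀ ζ hζ).trans hγ₀
  have hwker : ∀ ζ, complexForm (A ζ) (w ζ) = 0 := fun ζ => by
    simp only [w]
    rw [map_smul, hJker, smul_zero]
  have hγ₀0 : 0 ≤ γ₀ := (hγ z₀ hz₀).1.le.trans (hγ z₀ hz₀).2
  have hnsum : ∀ (z : E) (V : E → F) (Δ : E → ℝ), (∀ ζ ∈ S, ‖V ζ‖ ≤ Δ ζ) →
      ‖∑ ζ ∈ S, u ζ z • V ζ‖ ≤ ∑ ζ ∈ S, ‖u ζ z‖ * Δ ζ := fun z V Δ hV =>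
    norm_sum_le_of_le _ fun ζ hζ => by
      rw [norm_smul]
      have := hV ζ hζ
      gcongr
  have hg0 : ∀ z ∈ closure D, ‖g z‖ ≤ C₀ * γ₀ := fun z hz => by
    refine (hnsum z w (fun _ => γ₀) hwγ₀).trans ?_
    have h1 := hgauss t ht S z hSsep' (fun _ => γ₀) γ₀ (fun ζ hζ => by
      refine mul_le_of_le_one_left hγ₀0 (Real.exp_le_one_iff.2 ?_)
      rw [neg_nonpos]; positivity)
    rw [max_eq_left hγ₀0] at h1
    calc ∑ ζ ∈ S, ‖u ζ z‖ * γ₀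
        ≤ ∑ ζ ∈ S, C * (Real.exp (-(c₁ * (t ^ 2 * ‖z - ζ‖ ^ 2))) * γ₀) := by
          refine Finset.sum_le_sum fun ζ hζ => ?_
          rw [← mul_assoc]
          have := (hu ζ hζ).2.2 z hz
          gcongr
      _ ≤ C * (Cg * γ₀) := by rw [← Finset.mul_sum]; gcongr
      _ = _ := by ring
  have hg1 : ∀ z ∈ closure D, ‖g z‖ ≤ 1 := fun z hz => (hg0 z hz).trans hCγ
  have hqle : ∀ (b : F →L[ℝ] F →L[ℝ] ℝ) (v v' : F), ‖v‖ ≤ 1 → ‖v'‖ ≤ 1 →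
      ‖complexQuad b v v'‖ ≤ ‖b‖ := fun b v v' hv hv' => by
    refine (norm_complexQuad_le b v v').trans ?_
    calc ‖b‖ * ‖v‖ * ‖v'‖ ≤ ‖b‖ * 1 * 1 := by gcongr
      _ = _ := by ring
  have hτ1 : C₀ * (B ^ 2 * τ) ≤ σ / 8 := by
    have : C₀ * (4 * B ^ 2) * τ = 4 * (C₀ * (B ^ 2 * τ)) := by ring
    linarith
  have hB2 : (1 : ℝ) ≤ B ^ 2 := one_le_pow₀ hB
  have hgc : ContDiff ℝ ∞ g := ContDiff.sum fun ζ hζ => (hu ζ hζ).1.smul contDiff_const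
  have hgd : ∀ z ∈ closure D, DifferentiableAt ℂ g z := fun z hz =>
    DifferentiableAt.fun_sum fun ζ hζ => ((hu ζ hζ).2.1 z hz).smul_const _
  let L : E → F →L[ℂ] ℂ := fun ζ => LinearMap.toContinuousLinearMap (complexQuad (H ζ) (w ζ))
  have hQL : ∀ z ζ, Q z ζ = L ζ (g z) • N ζ := fun z ζ => rfl
  refine ⟨g, G, ?_, ?_, hg0, ?_, ?_, ?_, ?_, ?_⟩
  · refine hgc.sub (ContDiff.sum fun ζ hζ => (hu ζ hζ).1.smul ?_)
    simp only [hQL]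
    exact (((L ζ).restrictScalars ℝ).contDiff.comp hgc).smul contDiff_const
  · intro z hz
    refine (hgd z hz).sub (DifferentiableAt.fun_sum fun ζ hζ => ((hu ζ hζ).2.1 z hz).smul ?_)
    simp only [hQL]
    exact ((L ζ).differentiableAt.comp z (hgd z hz)).smul_const _
  · intro z hz
    have hz' := hY₂ hz
    have h1 : complexForm (A z) (g z) =
        ∑ ζ ∈ S, u ζ z * complexForm (A z - A ζ) (w ζ) := by
      simp only [g]
      rw [map_sum]
      refine Finset.sum_congr rfl fun ζ _ => ?_
      rw [complexForm_sub, hwker, sub_zero, map_smul, smul_eq_mul]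
    rw [h1]
    have h2 := hsum z hz' (fun ζ => 2 * ‖A z - A ζ‖) (2 * δ) (4 * B) (by positivity)
      (by positivity) (fun ζ hζ hd => by
        have := hu₁ z hz' ζ (hfc (hSf ζ hζ)) (by rw [dist_eq_norm]; linarith)
        rw [dist_eq_norm] at this
        linarith)
      (fun ζ hζ => ⟨by positivity, by
        have h3 := norm_sub_le (A z) (A ζ)
        linarith [hAB z hz', hAB ζ (hfc (hSf ζ hζ))]⟩)
    refine le_trans (norm_sum_le_of_le _ fun ζ hζ => ?_) (h2.trans ?_)
    · rw [norm_mul]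
      gcongr
      refine (norm_complexForm_le _ _).trans ?_
      exact mul_le_of_le_one_right (by positivity) (hw1 ζ hζ)
    · have h3 : C₀ * (2 * δ) ≤ C₀ * (2 * B * δ) := by
        have : 2 * δ ≤ 2 * B * δ := by nlinarith
        gcongr
      have h4 : C₀ * (B * τ) ≤ C₀ * (B ^ 2 * τ) := by gcongr
      linarith
  · intro z hz
    have hz' := hY₂ hz
    have h1 : G z - (g z - complexQuad (H z) (g z) (g z) • N z) =
        ∑ ζ ∈ S, u ζ z • (complexQuad (H z) (w ζ) (g z) • N z - Q z ζ) := by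
      have h2 : complexQuad (H z) (g z) (g z) =
          ∑ ζ ∈ S, u ζ z * complexQuad (H z) (w ζ) (g z) := by
        conv_lhs => enter [1]; rw [show g z = ∑ ζ ∈ S, u ζ z • w ζ from rfl, map_sum]
        rw [LinearMap.sum_apply]
        refine Finset.sum_congr rfl fun ζ _ => ?_
        rw [map_smul, LinearMap.smul_apply, smul_eq_mul]
      simp only [smul_sub, Finset.sum_sub_distrib, G]
      rw [h2, Finset.sum_smul]
      simp only [mul_smul]
      abel
    rw [h1]
    refine (hnsum z _ (fun ζ => ‖complexQuad (H z) (w ζ) (g z) • N z - Q z ζ‖)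
      fun ζ _ => le_rfl).trans ?_
    have hQle : ∀ ζ ∈ S, ∀ y ∈ Y₂, ‖complexQuad (H y) (w ζ) (g z) • N y‖ ≤ B ^ 2 :=
      fun ζ hζ y hy => by
        rw [norm_smul, sq]
        have := (hqle (H y) _ _ (hw1 ζ hζ) (hg1 z hz')).trans (hHB y (hY₂ hy))
        have := hNB y hy
        gcongr
    refine (hsum z hz' _ (2 * B * δ) (2 * B ^ 2) (by positivity) (by positivity)
      (fun ζ hζ hd => ?_) (fun ζ hζ => ⟨norm_nonneg _, ?_⟩)).trans ?_
    · have hd' : dist z ζ < ϱ := by rwa [dist_eq_norm]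
      have hζ₂ := hS₂ ζ hζ
      have h3 : ‖H z - H ζ‖ ≤ δ := le_of_eq_of_le (dist_eq_norm (H z) (H ζ)).symm
        (hu₂ z hz' ζ (hY₂ hζ₂) (hd'.trans_le hr₂)).le
      have h4 := (hu₃ z hz ζ hζ₂ (hd'.trans_le hr₃)).le
      rw [dist_eq_norm] at h4
      have h5 : complexQuad (H z) (w ζ) (g z) • N z - Q z ζ =
          complexQuad (H z - H ζ) (w ζ) (g z) • N z +
            complexQuad (H ζ) (w ζ) (g z) • (N z - N ζ) := by
        rw [complexQuad_sub, sub_smul, smul_sub]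
        simp only [Q]
        abel
      rw [h5]
      refine (norm_add_le _ _).trans ?_
      rw [norm_smul, norm_smul]
      have h6 := (hqle (H z - H ζ) _ _ (hw1 ζ hζ) (hg1 z hz')).trans h3
      have h7 := (hqle (H ζ) _ _ (hw1 ζ hζ) (hg1 z hz')).trans (hHB ζ (hY₂ hζ₂))
      have h8 := hNB z hz
      calc _ ≤ δ * B + B * δ := by gcongr
        _ = _ := by ring
    · refine (norm_sub_le _ _).trans ?_
      linarith [hQle ζ hζ z hz, hQle ζ hζ ζ (hS₂ ζ hζ)]
    · linarith
  · intro z hzT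
    have hz := hT hzT
    have hfar : ∀ ζ ∈ S, ¬ ‖z - ζ‖ < ϱ := fun ζ hζ hd => by
      linarith [hTY z hzT ζ (hSY hζ)]
    have h1 : ‖g z‖ ≤ C₀ * (0 + 1 * τ) :=
      (hnsum z w (fun _ => 1) hw1).trans (hsum z hz _ 0 1 le_rfl zero_le_one
        (fun ζ hζ hd => absurd hd (hfar ζ hζ)) fun _ _ => ⟨zero_le_one, le_rfl⟩)
    have h2 : ‖∑ ζ ∈ S, u ζ z • Q z ζ‖ ≤ C₀ * (0 + B ^ 2 * τ) :=
      (hnsum z (Q z) (fun _ => B ^ 2) (fun ζ hζ => by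
        simp only [Q]
        rw [norm_smul, sq]
        have := (hqle (H ζ) _ _ (hw1 ζ hζ) (hg1 z hz)).trans (hHB ζ (hY₂ (hS₂ ζ hζ)))
        have := hNB ζ (hS₂ ζ hζ)
        gcongr)).trans (hsum z hz _ 0 (B ^ 2) le_rfl (by positivity)
        (fun ζ hζ hd => absurd hd (hfar ζ hζ)) fun _ _ => ⟨by positivity, le_rfl⟩)
    have h3 : C₀ * (0 + 1 * τ) ≤ C₀ * (B ^ 2 * τ) := by
      rw [zero_add]
      gcongr
    refine (norm_sub_le _ _).trans ?_
    rw [zero_add] at h2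
    linarith
  · intro z hz
    refine (hnsum z w γ hwγ).trans ((hsum z (hfc hz) γ (2 * γ z) 1
      (by linarith [(hγ z hz).1]) zero_le_one
      (fun ζ hζ hd => hγ2 ζ (hSf ζ hζ) z hz (by rw [dist_comm, dist_eq_norm]; exact hd.le))
      fun ζ hζ => ⟨(hγ ζ (hSf ζ hζ)).1.le, (hγ ζ (hSf ζ hζ)).2.trans hγ₀⟩).trans ?_)
    have := ht2.trans (hmγ z hz)
    calc C₀ * (2 * γ z + 1 * τ) ≤ C₀ * (2 * γ z + 1 * γ z) := by gcongr
      _ = _ := by ring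
  · intro z hz
    obtain ⟨ζ, hζ, hd⟩ := hScov z hz
    have h1 := hlow ζ hζ z (hY₁ hz) (by
      rw [lt_div_iff₀ ht] at hd
      linarith)
    have h2 : ∑ μ ∈ S, (u μ z * (γ μ : ℂ)) • J μ (p μ) = g z :=
      Finset.sum_congr rfl fun μ _ => mul_smul _ _ _
    rw [h2] at h1
    have h3 := hγ2 z (hY₁ hz).1 ζ (hSf ζ hζ) (hd.le.trans (by
      rw [div_le_iff₀ hϱ] at ht4
      rw [div_le_iff₀ ht]
      linarith))
    nlinarith

end TangentialMap

section Perturbation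

open Filter Topology Module
open scoped ContDiff

variable {E : Type*} [NormedAddCommGroup E] [InnerProductSpace ℂ E] [FiniteDimensional ℂ E]
variable {F : Type*} [NormedAddCommGroup F] [InnerProductSpace ℂ F] [FiniteDimensional ℂ F]

theorem exists_forall_norm_le_abs_sub_lt {Ω : Set F} (hΩ : IsOpen Ω) {ρ : F → ℝ}
    (hρ : ContinuousOn ρ Ω) {L : Set F} (hL : IsCompact L) (hLΩ : L ⊆ Ω) {ε : ℝ} (hε : 0 < ε) :
    ∃ σ, 0 < σ ∧ ∀ x ∈ L, ∀ e : F, ‖e‖ ≤ σ → x + e ∈ Ω ∧ |ρ (x + e) - ρ x| < ε := by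
  have : FiniteDimensional ℝ F := FiniteDimensional.complexToReal F
  have : ProperSpace F := FiniteDimensional.proper ℝ F
  obtain ⟨κ, hκ, hsub⟩ := hL.exists_cthickening_subset_open hΩ hLΩ
  have hc : IsCompact (cthickening κ L) := hL.cthickening
  obtain ⟨δ, hδ, hu⟩ := Metric.uniformContinuousOn_iff.1
    (hc.uniformContinuousOn_of_continuous (hρ.mono hsub)) ε hε
  refine ⟨min κ (δ / 2), by positivity, fun x hx e he => ?_⟩
  have hd : dist (x + e) x = ‖e‖ := by rw [dist_eq_norm, add_sub_cancel_left]
  have hxe : x + e ∈ cthickening κ L :=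
    mem_cthickening_of_dist_le _ x _ _ hx (hd.trans_le (he.trans (min_le_left _ _)))
  refine ⟨hsub hxe, ?_⟩
  rw [← Real.dist_eq]
  exact hu _ hxe _ (self_subset_cthickening _ hx)
    (by rw [hd]; linarith [he.trans (min_le_right _ _)])

set_option maxHeartbeats 2000000 in
/-- Holomorphic perturbations of a map into `Ω` which increase a strictly plurisubharmonic
function `ρ`, on a domain with a global defining function. -/
theorem IsDefiningFunction.exists_perturbation {D : Set E} {r : E → ℝ} {η c : ℝ}
    (h : IsDefiningFunction D r η c) (hD : IsOpen D) (hDb : IsBounded D) {z₀ : E}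
    (hz₀ : z₀ ∈ frontier D) (hE : 1 ≤ finrank ℝ E) (hdim : finrank ℂ E < finrank ℂ F)
    {Ω : Set F} (hΩ : IsOpen Ω) {ρ : F → ℝ}
    (hρ : ContDiffOn ℝ ∞ ρ Ω) (hlevi : ∀ x ∈ Ω, ∀ v, 3 * ‖v‖ ^ 2 ≤ leviForm ρ x v)
    {K₁ : Set F} (hK₁ : IsCompact K₁) (hK₁Ω : K₁ ⊆ Ω) (hcrit : ∀ x ∈ K₁, fderiv ℝ ρ x ≠ 0) :
    ∃ ε₀ γ₀ C a : ℝ, ε₀ ∈ Ioo (0 : ℝ) 1 ∧ γ₀ ∈ Ioo (0 : ℝ) 1 ∧ 1 < C ∧ 0 < a ∧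
      ∀ f : E → F, ContinuousOn f (closure D) → MapsTo f (closure D) Ω →
        ∀ K : Set E, IsCompact K → K ⊆ D → ∀ ε : ℝ, 0 < ε →
        ∀ γ : E → ℝ, ContinuousOn γ (frontier D) → (∀ z ∈ frontier D, γ z ∈ Ioc (0 : ℝ) γ₀) →
          ∃ g : E → F, ContDiff ℝ ∞ g ∧ (∀ z ∈ closure D, DifferentiableAt ℂ g z) ∧
            (∀ z ∈ closure D, f z + g z ∈ Ω) ∧
            (∀ z ∈ closure D, ρ (f z + g z) - ρ (f z) < C * ‖g z‖ ^ 2 + ε ∧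
              ‖g z‖ ^ 2 - ε < ρ (f z + g z) - ρ (f z)) ∧
            (∀ z ∈ closedBall z₀ a ∩ frontier D, f z ∈ K₁ → ε₀ * γ z < ‖g z‖) ∧
            (∀ z ∈ frontier D, ‖g z‖ < ε₀⁻¹ * γ z) ∧
            (∀ z ∈ K, ‖g z‖ < ε) := by
  have : FiniteDimensional ℝ E := FiniteDimensional.complexToReal E
  have : ProperSpace E := FiniteDimensional.proper ℝ E
  obtain ⟨κ, θ, B, hκ, hθ, hθ1, hB, hκΩ, hκc, hinc⟩ :=
    exists_tangential_increase hΩ hρ hlevi hK₁ hK₁Ω hcrit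
  obtain ⟨a, C₀, c₀, ha, hC₀, hc₀, hmap⟩ := h.exists_tangential_map (F := F) hD hDb hz₀ hE hdim
  obtain ⟨ε₀, hε₀, hε₀1, hε₀c, hε₀C⟩ : ∃ ε₀ : ℝ, 0 < ε₀ ∧ ε₀ < 1 ∧ ε₀ ≤ c₀ / 8 ∧
      6 * C₀ + 2 ≤ ε₀⁻¹ := by
    refine ⟨min (1 / 2) (min (c₀ / 8) (6 * C₀ + 2)⁻¹), by positivity,
      (min_le_left _ _).trans_lt (by norm_num), (min_le_right _ _).trans (min_le_left _ _), ?_⟩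
    rw [le_inv_comm₀ (by positivity) (by positivity)]
    exact (min_le_right _ _).trans (min_le_right _ _)
  obtain ⟨γ₀, hγ₀, hγ₀1, hγ₀θ⟩ : ∃ γ₀ : ℝ, 0 < γ₀ ∧ γ₀ < 1 ∧ C₀ * γ₀ ≤ θ := by
    refine ⟨min (1 / 2) (θ / C₀), by positivity, (min_le_left _ _).trans_lt (by norm_num), ?_⟩
    rw [mul_comm, ← le_div_iff₀ hC₀]
    exact min_le_right _ _
  refine ⟨ε₀, γ₀, B + 1, a, ⟨hε₀, hε₀1⟩, ⟨hγ₀, hγ₀1⟩, by linarith, ha, ?_⟩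
  intro f hf hfΩ K hK hKD ε hε γ hγc hγ
  have hclc : IsCompact (closure D) := hDb.isCompact_closure
  have hfc : frontier D ⊆ closure D := frontier_subset_closure
  have hbD : IsCompact (frontier D) := hclc.of_isClosed_subset isClosed_frontier hfc
  obtain ⟨m, hm, hmγ⟩ : ∃ m, 0 < m ∧ ∀ z ∈ frontier D, m ≤ γ z := by
    obtain ⟨x, hx, hxm⟩ := hbD.exists_isMinOn ⟨z₀, hz₀⟩ hγc
    exact ⟨γ x, (hγ x hx).1, fun z hz => hxm hz⟩
  have hD1 : ContDiffOn ℝ ∞ (fderiv ℝ ρ) Ω := hρ.fderiv_of_isOpen hΩ (by simp)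
  have hD2 : ContDiffOn ℝ ∞ (fderiv ℝ (fderiv ℝ ρ)) Ω := hD1.fderiv_of_isOpen hΩ (by simp)
  have hκcl : IsClosed (cthickening κ K₁) := isClosed_cthickening
  set Y₂ := closure D ∩ f ⁻¹' cthickening κ K₁ with hY₂
  set Y₁ := frontier D ∩ closedBall z₀ a ∩ f ⁻¹' K₁ with hY₁
  set T := {z ∈ closure D | f z ∉ cthickening κ K₁ ∨ z ∈ K} with hT
  have hY₂c : IsCompact Y₂ := hclc.of_isClosed_subset
    (hf.preimage_isClosed_of_isClosed isClosed_closure hκcl) inter_subset_left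
  obtain ⟨ϱ₀, hϱ₀, hTY⟩ : ∃ ϱ₀, 0 < ϱ₀ ∧ ∀ z ∈ T, ∀ ζ ∈ Y₁, ϱ₀ ≤ ‖z - ζ‖ := by
    obtain ⟨δ₁, hδ₁, hu⟩ := Metric.uniformContinuousOn_iff.1
      (hclc.uniformContinuousOn_of_continuous hf) κ hκ
    obtain ⟨δ₂, hδ₂, hKδ⟩ := hK.exists_thickening_subset_open hD hKD
    refine ⟨min δ₁ δ₂, by positivity, fun z hz ζ hζ => ?_⟩
    by_contra! hlt
    rw [← dist_eq_norm, lt_min_iff] at hlt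
    rcases hz.2 with hz' | hz'
    · refine hz' (mem_cthickening_of_dist_le _ (f ζ) _ _ hζ.2 ?_)
      exact (hu z hz.1 ζ (hfc hζ.1.1) hlt.1).le
    · have hmem : ζ ∈ D := hKδ (mem_thickening_iff.2 ⟨z, hz', by rw [dist_comm]; exact hlt.2⟩)
      have := hζ.1.1
      rw [hD.frontier_eq] at this
      exact this.2 hmem
  obtain ⟨σ₀, hσ₀, hsmall⟩ := exists_forall_norm_le_abs_sub_lt hΩ hρ.continuousOn
    (hclc.image_of_continuousOn hf) (image_subset_iff.2 hfΩ) (half_pos hε)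
  obtain ⟨σ, hσ, hσ₀', hσ1, hσθ, hσB, hσε, hσm, hσc⟩ : ∃ σ : ℝ, 0 < σ ∧ σ ≤ σ₀ ∧ σ ≤ 1 ∧ σ ≤ θ ∧
      B * σ ≤ ε / 2 ∧ σ ≤ ε / 2 ∧ σ ≤ m ∧ σ ≤ c₀ * m / 8 := by
    have hev : ∀ᶠ σ : ℝ in 𝓝[>] 0, ∀ b : ℝ, b ∈ ({σ₀, 1, θ, ε / 2 / B, ε / 2, m, c₀ * m / 8} :
        Set ℝ) → σ ≤ b := by
      have hfin : ({σ₀, 1, θ, ε / 2 / B, ε / 2, m, c₀ * m / 8} : Set ℝ).Finite := by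
        simp
      refine (eventually_all_finite hfin).2 fun b hb => ?_
      have hb0 : 0 < b := by
        simp only [mem_insert_iff, mem_singleton_iff] at hb
        rcases hb with rfl | rfl | rfl | rfl | rfl | rfl | rfl <;> positivity
      exact (eventually_le_nhds hb0).filter_mono nhdsWithin_le_nhds
    obtain ⟨σ, hσ, hσ0⟩ := (hev.and self_mem_nhdsWithin).exists
    refine ⟨σ, hσ0, hσ _ (by simp), hσ _ (by simp), hσ _ (by simp), ?_, hσ _ (by simp),
      hσ _ (by simp), hσ _ (by simp)⟩
    have := hσ (ε / 2 / B) (by simp)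
    rwa [le_div_iff₀ (by positivity), mul_comm] at this
  obtain ⟨g, G, hGc, hGd, hg0, hgA, hGg, hGT, hgγ, hgY⟩ := hmap (fun z => fderiv ℝ ρ (f z))
    (fun z => fderiv ℝ (fderiv ℝ ρ) (f z)) (fun z => unitNormal (fderiv ℝ ρ (f z))) Y₁ Y₂ T γ γ₀ ϱ₀ σ
    (hD1.continuousOn.comp hf hfΩ) (hD2.continuousOn.comp hf hfΩ)
    (continuousOn_unitNormal.comp (hD1.continuousOn.comp (hf.mono inter_subset_left)
      fun z hz => hfΩ hz.1) fun z hz => hκc _ hz.2)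
    hY₂c inter_subset_left
    (fun z hz => ⟨hfc hz.1.1, self_subset_cthickening _ hz.2⟩) inter_subset_left
    (sep_subset _ _) hϱ₀ hTY hγc (fun z hz => hγ z hz) hγ₀1.le (hγ₀θ.trans hθ1) hσ
  have hY : ∀ z ∈ Y₂, _ := fun z (hz : z ∈ Y₂) => hinc (f z) hz.2 (g z) _ σ
    ((hg0 z hz.1).trans hγ₀θ) hσθ (hgA z hz) (hGg z hz) (G z) (by abel)
  have hcases : ∀ z ∈ closure D, z ∈ Y₂ ∨ z ∈ T := fun z hz => by
    by_cases hz' : f z ∈ cthickening κ K₁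
    · exact Or.inl ⟨hz, hz'⟩
    · exact Or.inr ⟨hz, Or.inl hz'⟩
  refine ⟨G, hGc, hGd, fun z hz => ?_, fun z hz => ?_, fun z hz hzK => ?_, fun z hz => ?_,
    fun z hz => ?_⟩
  · rcases hcases z hz with hz' | hz'
    · exact (hY z hz').1
    · exact (hsmall _ (mem_image_of_mem f hz) _ ((hGT z hz').trans hσ₀')).1
  · have hsq : 0 ≤ ‖G z‖ ^ 2 := by positivity
    rcases hcases z hz with hz' | hz'
    · obtain ⟨-, -, -, h1, h2⟩ := hY z hz'
      constructor <;> linarith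
    · have h1 := (hsmall _ (mem_image_of_mem f hz) _ ((hGT z hz').trans hσ₀')).2
      have h2 : ‖G z‖ ^ 2 ≤ ε / 2 := by
        have h3 := hGT z hz'
        nlinarith [norm_nonneg (G z)]
      rw [abs_lt] at h1
      have h4 : 0 ≤ (B + 1) * ‖G z‖ ^ 2 := by positivity
      constructor <;> linarith
  · have hz₁ : z ∈ Y₁ := ⟨⟨hz.2, hz.1⟩, hzK⟩
    obtain ⟨-, -, h1, -⟩ := hY z ⟨hfc hz.2, self_subset_cthickening _ hzK⟩
    have h2 := hgY z hz₁
    have h3 := hmγ z hz.2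
    have h4 : ε₀ * γ z ≤ c₀ / 8 * γ z := by have := (hγ z hz.2).1; gcongr
    have h5 : c₀ * m ≤ c₀ * γ z := by gcongr
    have h6 : 0 < c₀ * γ z := mul_pos hc₀ (hγ z hz.2).1
    linarith
  · have h3 := hmγ z hz
    have h0 := (hγ z hz).1
    have h4 : (6 * C₀ + 2) * γ z ≤ ε₀⁻¹ * γ z := by gcongr
    have h6 : 0 < C₀ * γ z := mul_pos hC₀ h0
    rcases hcases z (hfc hz) with hz' | hz'
    · obtain ⟨-, h1, -⟩ := hY z hz'
      linarith [hgγ z hz]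
    · linarith [hGT z hz']
  · linarith [hGT z ⟨subset_closure (hKD hz), Or.inr hz⟩]

end Perturbation

/-- Lemma 5.1 (A. Dor): pushing the boundary image to higher levels of a strongly
plurisubharmonic (normalized-3) function. -/
theorem dor_lemma
    {N M : ℕ} (hN : 2 ≤ N) (hM : N + 1 ≤ M)
    {Ω : Set (EuclideanSpace ℂ (Fin M))} (hΩopen : IsOpen Ω) (hΩconn : IsConnected Ω)
    {ρ : EuclideanSpace ℂ (Fin M) → ℝ} (hρ : ContDiffOn ℝ (⊤ : ℕ∞) ρ Ω)
    (hρlevi : ∀ x ∈ Ω, ∀ v : EuclideanSpace ℂ (Fin M), 3 * ‖v‖ ^ 2 ≤ leviForm ρ x v)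
    {D : Set (EuclideanSpace ℂ (Fin N))} (hD : IsSPCDomain D ⊤)
    {z₀ : EuclideanSpace ℂ (Fin N)} (hz₀ : z₀ ∈ frontier D)
    {K₁ : Set (EuclideanSpace ℂ (Fin M))} (hK₁comp : IsCompact K₁) (hK₁Ω : K₁ ⊆ Ω)
    (hK₁noncrit : ∀ x ∈ K₁, fderiv ℝ ρ x ≠ 0) :
    ∃ (ε₀ γ₀ C : ℝ) (U : Set (EuclideanSpace ℂ (Fin N))),
      ε₀ ∈ Set.Ioo (0 : ℝ) 1 ∧ γ₀ ∈ Set.Ioo (0 : ℝ) 1 ∧ 1 < C ∧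
      z₀ ∈ U ∧ U ⊆ frontier D ∧
      (∃ V : Set (EuclideanSpace ℂ (Fin N)), IsOpen V ∧ U = V ∩ frontier D) ∧
      ∀ f : EuclideanSpace ℂ (Fin N) → EuclideanSpace ℂ (Fin M),
        ContDiffOn ℝ (⊤ : ℕ∞) f (closure D) → DifferentiableOn ℂ f D →
        MapsTo f (closure D) Ω →
        ∀ K : Set (EuclideanSpace ℂ (Fin N)), IsCompact K → K ⊆ D →
        ∀ ε : ℝ, 0 < ε →
        ∀ γ : EuclideanSpace ℂ (Fin N) → ℝ, ContinuousOn γ (frontier D) →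
          (∀ z ∈ frontier D, γ z ∈ Set.Ioc (0 : ℝ) γ₀) →
          ∃ g : EuclideanSpace ℂ (Fin N) → EuclideanSpace ℂ (Fin M),
            ContDiffOn ℝ (⊤ : ℕ∞) g (closure D) ∧ DifferentiableOn ℂ g D ∧
            -- (i)
            (∀ z ∈ closure D, f z + g z ∈ Ω) ∧
            -- (ii)
            (∀ z ∈ closure D,
              ρ (f z + g z) - ρ (f z) < C * ‖g z‖ ^ 2 + ε ∧
              ‖g z‖ ^ 2 - ε < ρ (f z + g z) - ρ (f z)) ∧
            -- (iii)
            (∀ z ∈ U, f z ∈ K₁ → ε₀ * γ z < ‖g z‖) ∧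
            -- (iv)
            (∀ z ∈ frontier D, ‖g z‖ < ε₀⁻¹ * γ z) ∧
            -- (v)
            (∀ z ∈ K, ‖g z‖ < ε) := by
  obtain ⟨hDo, -, hDb, U, rD, hU, hDU, hr, hDr, hdr, hlevi⟩ := hD
  obtain ⟨r, η, c, h⟩ := exists_isDefiningFunction hDo hDb hU hDU hr hDr hdr hlevi
  have hdimE : Module.finrank ℂ (EuclideanSpace ℂ (Fin N)) = N := finrank_euclideanSpace_fin
  have hdimF : Module.finrank ℂ (EuclideanSpace ℂ (Fin M)) = M := finrank_euclideanSpace_fin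
  have hdimR : 1 ≤ Module.finrank ℝ (EuclideanSpace ℂ (Fin N)) := by
    have := finrank_real_of_complex (EuclideanSpace ℂ (Fin N))
    omega
  obtain ⟨ε₀, γ₀, C, a, hε₀, hγ₀, hC, ha, hmain⟩ := h.exists_perturbation hDo hDb hz₀
    hdimR (by omega) hΩopen hρ hρlevi hK₁comp hK₁Ω hK₁noncrit
  refine ⟨ε₀, γ₀, C, ball z₀ a ∩ frontier D, hε₀, hγ₀, hC, ⟨mem_ball_self ha, hz₀⟩,
    inter_subset_right, ⟨ball z₀ a, isOpen_ball, rfl⟩, ?_⟩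
  intro f hf _ hfΩ K hK hKD ε hε γ hγc hγ
  obtain ⟨g, hg, hgd, h1, h2, h3, h4, h5⟩ := hmain f hf.continuousOn hfΩ K hK hKD ε hε γ hγc hγ
  exact ⟨g, hg.contDiffOn, fun z hz => (hgd z (subset_closure hz)).differentiableWithinAt, h1, h2,
    fun z hz => h3 z ⟨ball_subset_closedBall hz.1, hz.2⟩, h4, h5⟩

end
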